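/- Let A₁, A₂, A₃ be subsets of the prime numbers with δ̲(A₁) + δ̲(A₂) + δ̲(A₃) > 2. Then there exists N₀ such that every odd positive integer N ≥ N₀ can be written as N = a₁ + a₂ + a₃ with aᵢ ∈ Aᵢ for i = 1, 2, 3. -/

import Mathlib

/-- The lower density of a set `A` of natural numbers in the primes:
`liminf_{N → ∞} |A ∩ [1,N]| / |P ∩ [1,N]|`. -/
noncomputable def lowerDensityInPrimes (A : Set ℕ) : ℝ :=
  Filter.liminf
    (fun N : ℕ => ((A ∩ Set.Icc 1 N).ncard : ℝ) / (({p : ℕ | p.Prime} ∩ Set.Icc 1 N).ncard : ℝ))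
    Filter.atTop

section
noncomputable def ee (x : ℝ) : ℂ := Complex.exp (2 * Real.pi * Complex.I * x)
noncomputable def dn (x : ℝ) : ℝ := ‖(x : UnitAddCircle)‖

lemma ee_add (x y : ℝ) : ee (x + y) = ee x * ee y := by
  unfold ee; rw [← Complex.exp_add]; push_cast; ring_nf
lemma ee_zero : ee 0 = 1 := by simp [ee]
lemma ee_int (n : ℤ) : ee n = 1 := by
  unfold ee; rw [Complex.exp_eq_one_iff]; exact ⟨n, by push_cast; ring⟩
lemma ee_nat (n : ℕ) : ee n = 1 := by exact_mod_cast ee_int n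
lemma ee_norm (x : ℝ) : ‖ee x‖ = 1 := by
  unfold ee; rw [show (2 * Real.pi * Complex.I * x : ℂ) = ((2 * Real.pi * x : ℝ) : ℂ) * Complex.I by push_cast; ring]
  exact Complex.norm_exp_ofReal_mul_I _
lemma ee_ne (x : ℝ) : ee x ≠ 0 := Complex.exp_ne_zero _
lemma ee_neg (x : ℝ) : ee (-x) = (ee x)⁻¹ := by
  unfold ee; rw [← Complex.exp_neg]; push_cast; ring_nf
lemma ee_conj (x : ℝ) : (starRingEnd ℂ) (ee x) = ee (-x) := by
  rw [ee_neg]; exact (Complex.inv_eq_conj (ee_norm x)).symm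
lemma ee_sub (x y : ℝ) : ee (x - y) = ee x * (ee y)⁻¹ := by rw [sub_eq_add_neg, ee_add, ee_neg]
lemma ee_nat_mul (n : ℕ) (x : ℝ) : ee (n * x) = ee x ^ n := by
  unfold ee; rw [← Complex.exp_nat_mul]; push_cast; ring_nf
lemma ee_add_int (x : ℝ) (n : ℤ) : ee (x + n) = ee x := by rw [ee_add, ee_int, mul_one]
lemma ee_add_nat (x : ℝ) (n : ℕ) : ee (x + n) = ee x := by rw [ee_add, ee_nat, mul_one]

lemma dn_eq (x : ℝ) : dn x = |x - round x| := UnitAddCircle.norm_eq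
lemma dn_nonneg (x : ℝ) : 0 ≤ dn x := norm_nonneg _
lemma dn_neg (x : ℝ) : dn (-x) = dn x := by exact norm_neg (x : UnitAddCircle)
lemma dn_add (x y : ℝ) : dn (x + y) ≤ dn x + dn y := by exact norm_add_le (x : UnitAddCircle) y
lemma dn_sub (x y : ℝ) : dn (x - y) ≤ dn x + dn y := by exact norm_sub_le (x : UnitAddCircle) y
lemma dn_add_int (x : ℝ) (n : ℤ) : dn (x + n) = dn x := by
  rw [dn_eq, dn_eq, round_add_intCast]; push_cast; ring_nf
lemma dn_le (x : ℝ) (n : ℤ) : dn x ≤ |x - n| := by rw [dn_eq]; exact round_le x n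
lemma dn_le_half (x : ℝ) : dn x ≤ 1 / 2 := by rw [dn_eq]; exact abs_sub_round x
lemma dn_le_abs (x : ℝ) : dn x ≤ |x| := by simpa using dn_le x 0
lemma dn_exists (x : ℝ) : ∃ n : ℤ, |x - n| = dn x := ⟨round x, (dn_eq x).symm⟩
lemma dn_nsmul (n : ℕ) (x : ℝ) : dn (n * x) ≤ n * dn x := by
  have := norm_nsmul_le (n := n) (a := (x : UnitAddCircle))
  unfold dn; rw [← nsmul_eq_mul]; simpa using this
lemma dn_zero_iff (x : ℝ) : dn x = 0 ↔ ∃ n : ℤ, x = n := by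
  constructor
  · intro h; rw [dn_eq, abs_eq_zero, sub_eq_zero] at h; exact ⟨_, h⟩
  · rintro ⟨n, rfl⟩; exact le_antisymm (by simpa using dn_le n n) (dn_nonneg _)
lemma dn_sub_comm (x y : ℝ) : dn (x - y) = dn (y - x) := by rw [← dn_neg]; ring_nf

/-- a fraction not an integer has `dn ≥ 1/q`. -/
lemma dn_frac (a : ℤ) (q : ℕ) (hq : 0 < q) (h : ¬ (q : ℤ) ∣ a) : 1 / (q : ℝ) ≤ dn (a / q) := by
  obtain ⟨n, hn⟩ := dn_exists (a / q)
  rw [← hn]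
  have hq' : (0 : ℝ) < q := by exact_mod_cast hq
  have : (a : ℝ) / q - n = ((a - n * q : ℤ) : ℝ) / q := by push_cast; field_simp
  rw [this, abs_div, abs_of_pos hq', ← Int.cast_abs]
  gcongr
  have : a - n * q ≠ 0 := fun h0 => h ⟨n, by linarith⟩
  exact_mod_cast Int.one_le_abs this

lemma ee_sub_one (x : ℝ) : 4 * dn x ≤ ‖ee x - 1‖ := by
  have h : ee x = ee (x - round x) := by
    rw [ee_sub, ee_int]; simp
  rw [h, dn_eq]
  set y := x - round x
  have hy : |y| ≤ 1 / 2 := abs_sub_round x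
  have e1 : ‖ee y - 1‖ = ‖2 * Real.sin (Real.pi * y)‖ := by
    have := Complex.norm_exp_I_mul_ofReal_sub_one (2 * Real.pi * y)
    rw [show 2 * Real.pi * y / 2 = Real.pi * y by ring] at this
    rw [← this]; unfold ee; push_cast; ring_nf
  rw [e1, norm_mul, Real.norm_eq_abs, Real.norm_eq_abs, abs_two]
  have h3 := Real.mul_abs_le_abs_sin (x := Real.pi * y) (by
    rw [abs_mul, abs_of_pos Real.pi_pos]; nlinarith [Real.pi_pos])
  rw [abs_mul, abs_of_pos Real.pi_pos] at h3
  have : 2 / Real.pi * (Real.pi * |y|) = 2 * |y| := by field_simp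
  linarith

lemma ee_sub_one_le (x : ℝ) : ‖ee x - 1‖ ≤ 7 * |x| := by
  have := Real.norm_exp_I_mul_ofReal_sub_one_le (x := 2 * Real.pi * x)
  rw [show Complex.I * ((2 * Real.pi * x : ℝ) : ℂ) = 2 * Real.pi * Complex.I * x by push_cast; ring] at this
  refine this.trans ?_
  rw [Real.norm_eq_abs, abs_mul, abs_of_pos (by positivity)]
  gcongr
  linarith [Real.pi_lt_d2]

lemma ee_dist (x y : ℝ) : ‖ee x - ee y‖ ≤ 7 * |x - y| := by
  have : ee x - ee y = ee y * (ee (x - y) - 1) := by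
    rw [mul_sub, ← ee_add]; simp
  rw [this, norm_mul, ee_norm, one_mul]; exact ee_sub_one_le _

lemma geom_ee (n : ℕ) (x : ℝ) : dn x * ‖∑ j ∈ Finset.range n, ee (j * x)‖ ≤ 1 / 2 := by
  have h : (∑ j ∈ Finset.range n, ee (j * x)) * (ee x - 1) = ee x ^ n - 1 := by
    rw [← geom_sum_mul]; simp [ee_nat_mul]
  have h2 : ‖∑ j ∈ Finset.range n, ee (j * x)‖ * ‖ee x - 1‖ ≤ 2 := by
    rw [← norm_mul, h]
    refine (norm_sub_le _ _).trans ?_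
    rw [norm_pow, ee_norm]; norm_num
  nlinarith [ee_sub_one x, norm_nonneg (∑ j ∈ Finset.range n, ee (j * x)), dn_nonneg x]

lemma sum_ee_le {ι : Type*} (s : Finset ι) (f : ι → ℝ) : ‖∑ j ∈ s, ee (f j)‖ ≤ s.card := by
  refine (norm_sum_le _ _).trans ?_
  simp [ee_norm]

/-- orthogonality -/
lemma sum_ee_frac (q : ℕ) (hq : 0 < q) (a : ℤ) :
    ∑ j ∈ Finset.range q, ee (j * (a / q)) = if (q : ℤ) ∣ a then (q : ℂ) else 0 := by
  have hq' : (q : ℝ) ≠ 0 := by positivity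
  split_ifs with h
  · obtain ⟨c, rfl⟩ := h
    rw [Finset.sum_congr rfl (g := fun _ => 1)]
    · simp
    · intro j _
      rw [show (j : ℝ) * ((q * c : ℤ) / q) = ((j * c : ℤ) : ℝ) by push_cast; field_simp, ee_int]
  · have h1 : (∑ j ∈ Finset.range q, ee (j * ((a : ℝ) / q))) * (ee (a / q) - 1) = 0 := by
      have := geom_sum_mul (ee (a / q)) q
      simp only [← ee_nat_mul] at this
      rw [this, show (q : ℝ) * (a / q) = (a : ℤ) by field_simp, ee_int, sub_self]
    rcases mul_eq_zero.1 h1 with h1 | h1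
    · exact h1
    · have := ee_sub_one (a / q)
      have h2 := dn_frac a q hq h
      rw [h1, norm_zero] at this
      have : 0 < 1 / (q : ℝ) := by positivity
      linarith
end

section
open Finset

lemma sum_int_sq (s : Finset ℤ) : ∑ n ∈ s, 1 / (|(n : ℝ)| + 1) ^ 2 ≤ 4 := by
  have key : ∀ N : ℕ, ∑ n ∈ range N, 1 / ((n : ℝ) + 1) ^ 2 ≤ 2 - 2 / ((N : ℝ) + 1) := by
    intro N
    induction N with
    | zero => norm_num
    | succ k ih =>
      rw [sum_range_succ]
      have : (1 : ℝ) / (k + 1) ^ 2 ≤ 2 / (k + 1) - 2 / (k + 1 + 1) := by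
        rw [div_sub_div _ _ (by positivity) (by positivity), div_le_div_iff₀ (by positivity) (by positivity)]
        have : (0 : ℝ) ≤ k := by positivity
        nlinarith
      push_cast; linarith
  have k2 : ∀ t : Finset ℕ, ∑ n ∈ t, 1 / ((n : ℝ) + 1) ^ 2 ≤ 2 := fun t => by
    obtain ⟨N, hN⟩ := t.exists_nat_subset_range
    refine (sum_le_sum_of_subset_of_nonneg hN (fun _ _ _ => by positivity)).trans ((key N).trans ?_)
    have : (0 : ℝ) < 2 / (N + 1) := by positivity
    linarith
  have k3 : ∀ t : Finset ℤ, Set.InjOn Int.natAbs t → ∑ n ∈ t, 1 / (|(n : ℝ)| + 1) ^ 2 ≤ 2 := fun t ht => by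
    have := k2 (t.image Int.natAbs)
    rw [sum_image ht] at this
    refine le_trans (le_of_eq (sum_congr rfl fun n _ => ?_)) this
    rw [Nat.cast_natAbs, Int.cast_abs]
  rw [← sum_filter_add_sum_filter_not s (fun n => 0 ≤ n)]
  have a := k3 (s.filter fun n => 0 ≤ n) (by intro x hx y hy h; simp at hx hy h; omega)
  have b := k3 (s.filter fun n => ¬ 0 ≤ n) (by intro x hx y hy h; simp at hx hy h; omega)
  linarith

lemma row_sum {ι : Type*} [DecidableEq ι] (s : Finset ι) (θ : ι → ℝ) (M : ℕ) (hM : 0 < M)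
    (hsep : ∀ i ∈ s, ∀ j ∈ s, i ≠ j → 1 / (2 * M : ℝ) ≤ dn (θ i - θ j)) (i : ι) (hi : i ∈ s) :
    ∑ j ∈ s, ‖∑ a ∈ range (2 * M), ee (a * (θ i - θ j))‖ ^ 2 ≤ 40 * (M : ℝ) ^ 2 := by
  have hM' : (0 : ℝ) < M := by exact_mod_cast hM
  rw [← add_sum_erase s _ hi]
  have h0 : ‖∑ a ∈ range (2 * M), ee (a * (θ i - θ i))‖ ^ 2 ≤ 4 * (M : ℝ) ^ 2 := by
    have := sum_ee_le (range (2 * M)) (fun a => a * (θ i - θ i))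
    rw [card_range] at this; push_cast at this
    nlinarith [norm_nonneg (∑ a ∈ range (2 * M), ee (a * (θ i - θ i)))]
  let y : ι → ℝ := fun j => (θ i - θ j) - round (θ i - θ j)
  let n : ι → ℤ := fun j => ⌊y j * (2 * M)⌋
  have inj : Set.InjOn n (s.erase i : Finset ι) := by
    intro j hj k hk h
    by_contra hjk
    have h1 := hsep j (mem_of_mem_erase hj) k (mem_of_mem_erase hk) hjk
    have h2 : dn (θ j - θ k) ≤ |y j - y k| := by
      have := dn_le (θ k - θ j) (round (θ i - θ j) - round (θ i - θ k))
      rw [dn_sub_comm]; refine this.trans (le_of_eq ?_)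
      congr 1; simp only [y]; push_cast; ring
    have h3 := Int.abs_sub_lt_one_of_floor_eq_floor h
    rw [← sub_mul, abs_mul, abs_of_pos (by positivity : (0 : ℝ) < 2 * M)] at h3
    have h4 := h1.trans h2
    rw [div_le_iff₀ (by positivity)] at h4
    linarith
  have each : ∀ j ∈ s.erase i, ‖∑ a ∈ range (2 * M), ee (a * (θ i - θ j))‖ ^ 2 ≤
      9 * (M : ℝ) ^ 2 * (1 / (|(n j : ℝ)| + 1) ^ 2) := by
    intro j hj
    have hd : dn (θ i - θ j) = |y j| := dn_eq _
    have h1 := hsep i hi j (mem_of_mem_erase hj) (ne_of_mem_erase hj).symm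
    have h2 := geom_ee (2 * M) (θ i - θ j)
    rw [hd] at h1 h2
    have h3 : (|(n j : ℝ)| + 1) ≤ 3 * (|y j| * (2 * M)) := by
      rw [div_le_iff₀ (by positivity)] at h1
      have f1 : (n j : ℝ) ≤ y j * (2 * M) := Int.floor_le _
      have f2 : y j * (2 * M) < n j + 1 := Int.lt_floor_add_one _
      have f3 : |y j| * (2 * M) = |y j * (2 * M)| := by rw [abs_mul, abs_of_pos (by positivity : (0 : ℝ) < 2 * M)]
      rw [f3] at h1 ⊢
      rcases abs_cases (n j : ℝ) with h | h <;> rcases abs_cases (y j * (2 * M)) with h' | h' <;> linarith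
    rw [mul_one_div, le_div_iff₀ (by positivity), ← mul_pow, show 9 * (M : ℝ) ^ 2 = (3 * M) ^ 2 by ring]
    apply pow_le_pow_left₀ (by positivity)
    have := norm_nonneg (∑ a ∈ range (2 * M), ee (a * (θ i - θ j)))
    nlinarith [mul_le_mul_of_nonneg_left h3 this]
  have h5 := sum_le_sum each
  rw [← mul_sum] at h5
  have h6 := sum_int_sq ((s.erase i).image n)
  rw [sum_image inj] at h6
  nlinarith [sq_nonneg (M : ℝ)]

/-- Dual large sieve. -/
lemma dual_ls {ι : Type*} [DecidableEq ι] (s : Finset ι) (θ : ι → ℝ) (M : ℕ) (hM : 0 < M)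
    (hsep : ∀ i ∈ s, ∀ j ∈ s, i ≠ j → 1 / (2 * M : ℝ) ≤ dn (θ i - θ j)) (c : ι → ℂ) :
    ∑ k ∈ range M, ‖∑ i ∈ s, c i * ee (k * θ i)‖ ^ 2 ≤ 40 * M * ∑ i ∈ s, ‖c i‖ ^ 2 := by
  have hM' : (0 : ℝ) < M := by exact_mod_cast hM
  let g : ℝ → ℂ := fun x => ∑ i ∈ s, c i * ee (x * θ i)
  let D : ℝ → ℂ := fun x => ∑ a ∈ range (2 * M), ee (a * x)
  have h1 : (M : ℝ) * ∑ k ∈ range M, ‖g k‖ ^ 2 ≤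
      ∑ x ∈ range (2 * M) ×ˢ range (2 * M), ‖g (x.1 - x.2)‖ ^ 2 := by
    have : (M : ℝ) * ∑ k ∈ range M, ‖g k‖ ^ 2 = ∑ x ∈ (range M ×ˢ range M).image (fun z : ℕ × ℕ => (z.1 + z.2, z.2)), ‖g (x.1 - x.2)‖ ^ 2 := by
      rw [sum_image (by rintro ⟨a, b⟩ _ ⟨c, d⟩ _ h; simp at h ⊢; omega), sum_product_right]
      simp
    rw [this]
    apply sum_le_sum_of_subset_of_nonneg
    · intro x hx; simp at hx ⊢; obtain ⟨a, b, ⟨h, h'⟩, rfl⟩ := hx; simp; omega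
    · intros; positivity
  have h2 : ((∑ x ∈ range (2 * M) ×ˢ range (2 * M), ‖g (x.1 - x.2)‖ ^ 2 : ℝ) : ℂ) =
      ∑ i ∈ s, ∑ j ∈ s, c i * (starRingEnd ℂ) (c j) * (‖D (θ i - θ j)‖ ^ 2 : ℝ) := by
    have e1 : ∀ z : ℂ, ((‖z‖ ^ 2 : ℝ) : ℂ) = z * (starRingEnd ℂ) z := fun z => by
      rw [Complex.mul_conj, Complex.normSq_eq_norm_sq]
    rw [Complex.ofReal_sum]
    simp_rw [e1]
    have e2 : ∀ x : ℕ × ℕ, g (x.1 - x.2) * (starRingEnd ℂ) (g (x.1 - x.2)) = ∑ i ∈ s, ∑ j ∈ s,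
        c i * (starRingEnd ℂ) (c j) * (ee (x.1 * (θ i - θ j)) * ee (-(x.2 * (θ i - θ j)))) := fun x => by
      simp only [g, map_sum, map_mul, ee_conj]
      rw [sum_mul_sum]
      refine sum_congr rfl fun i _ => sum_congr rfl fun j _ => ?_
      have : ee (((x.1 : ℝ) - x.2) * θ i) * ee (-(((x.1 : ℝ) - x.2) * θ j)) =
          ee (x.1 * (θ i - θ j)) * ee (-(x.2 * (θ i - θ j))) := by
        rw [← ee_add, ← ee_add]; ring_nf
      linear_combination (c i * (starRingEnd ℂ) (c j)) * this
    rw [sum_congr rfl fun x _ => e2 x, sum_comm]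
    refine sum_congr rfl fun i _ => ?_
    rw [sum_comm]
    refine sum_congr rfl fun j _ => ?_
    simp only [D, map_sum, ee_conj]
    rw [sum_mul_sum, ← sum_product', mul_sum]
  have h3 : ∑ x ∈ range (2 * M) ×ˢ range (2 * M), ‖g (x.1 - x.2)‖ ^ 2 ≤ 40 * (M : ℝ) ^ 2 * ∑ i ∈ s, ‖c i‖ ^ 2 := by
    have : ∑ x ∈ range (2 * M) ×ˢ range (2 * M), ‖g (x.1 - x.2)‖ ^ 2 =
        ‖((∑ x ∈ range (2 * M) ×ˢ range (2 * M), ‖g (x.1 - x.2)‖ ^ 2 : ℝ) : ℂ)‖ := by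
      rw [Complex.norm_real, Real.norm_of_nonneg (by positivity)]
    rw [this, h2]
    have hsymm : ∀ x, ‖D (-x)‖ = ‖D x‖ := fun x => by
      rw [← Complex.norm_conj (D x)]; simp only [D, map_sum, ee_conj, mul_neg]
    calc _ ≤ ∑ i ∈ s, ∑ j ∈ s, (‖c i‖ ^ 2 / 2 * ‖D (θ i - θ j)‖ ^ 2 + ‖c j‖ ^ 2 / 2 * ‖D (θ j - θ i)‖ ^ 2) := by
          refine (norm_sum_le _ _).trans (sum_le_sum fun i _ => (norm_sum_le _ _).trans (sum_le_sum fun j _ => ?_))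
          rw [norm_mul, norm_mul, Complex.norm_conj, Complex.norm_real, Real.norm_of_nonneg (by positivity),
            ← hsymm (θ j - θ i), neg_sub]
          nlinarith [sq_nonneg (‖c i‖ - ‖c j‖), sq_nonneg (‖D (θ i - θ j)‖)]
      _ = ∑ i ∈ s, ‖c i‖ ^ 2 * ∑ j ∈ s, ‖D (θ i - θ j)‖ ^ 2 := by
          simp_rw [sum_add_distrib]
          rw [sum_comm (f := fun i j => ‖c j‖ ^ 2 / 2 * ‖D (θ j - θ i)‖ ^ 2), ← sum_add_distrib]
          refine sum_congr rfl fun i _ => ?_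
          rw [← mul_sum]; ring
      _ ≤ ∑ i ∈ s, ‖c i‖ ^ 2 * (40 * (M : ℝ) ^ 2) := by
          refine sum_le_sum fun i hi => ?_
          gcongr
          exact row_sum s θ M hM hsep i hi
      _ = _ := by rw [← sum_mul]; ring
  have h4 := h1.trans h3
  have : (M : ℝ) * ∑ k ∈ range M, ‖g k‖ ^ 2 ≤ M * (40 * M * ∑ i ∈ s, ‖c i‖ ^ 2) := by linarith
  exact le_of_mul_le_mul_left this hM'

lemma large_sieve {ι : Type*} [DecidableEq ι] (s : Finset ι) (θ : ι → ℝ) (M : ℕ) (hM : 0 < M)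
    (hsep : ∀ i ∈ s, ∀ j ∈ s, i ≠ j → 1 / (2 * M : ℝ) ≤ dn (θ i - θ j)) (f : ℕ → ℂ) :
    ∑ i ∈ s, ‖∑ k ∈ range M, f k * ee (k * θ i)‖ ^ 2 ≤ 40 * M * ∑ k ∈ range M, ‖f k‖ ^ 2 := by
  let S : ι → ℂ := fun i => ∑ k ∈ range M, f k * ee (k * θ i)
  set T := ∑ i ∈ s, ‖S i‖ ^ 2 with hT
  have h1 : (T : ℂ) = ∑ k ∈ range M, f k * ∑ i ∈ s, (starRingEnd ℂ) (S i) * ee (k * θ i) := by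
    rw [hT, Complex.ofReal_sum]
    simp_rw [mul_sum]
    rw [sum_comm]
    refine sum_congr rfl fun i _ => ?_
    rw [← Complex.normSq_eq_norm_sq, ← Complex.mul_conj]
    simp only [S]; rw [sum_mul]
    exact sum_congr rfl fun k _ => by ring
  have h2 : T ≤ ∑ k ∈ range M, ‖f k‖ * ‖∑ i ∈ s, (starRingEnd ℂ) (S i) * ee (k * θ i)‖ := by
    have : T = ‖(T : ℂ)‖ := by rw [Complex.norm_real, Real.norm_of_nonneg (by positivity)]
    rw [this, h1]
    refine (norm_sum_le _ _).trans (le_of_eq (sum_congr rfl fun k _ => norm_mul _ _))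
  have h3 := sum_mul_sq_le_sq_mul_sq (range M) (fun k => ‖f k‖) (fun k => ‖∑ i ∈ s, (starRingEnd ℂ) (S i) * ee (k * θ i)‖)
  have h4 := dual_ls s θ M hM hsep (fun i => (starRingEnd ℂ) (S i))
  simp_rw [Complex.norm_conj] at h4
  have hT0 : 0 ≤ T := by positivity
  have hF : 0 ≤ ∑ k ∈ range M, ‖f k‖ ^ 2 := by positivity
  have h5 : T ^ 2 ≤ (∑ k ∈ range M, ‖f k‖ ^ 2) * (40 * M * T) :=
    (pow_le_pow_left₀ hT0 h2 2).trans (h3.trans (by gcongr))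
  rcases hT0.eq_or_lt with h | h
  · change T ≤ _; rw [← h]; positivity
  · exact le_of_mul_le_mul_left (by nlinarith : T * T ≤ T * _) h
end

section
open Finset

lemma mu_sum (n : ℕ) : ∑ d ∈ n.divisors, ArithmeticFunction.moebius d = if n = 1 then 1 else 0 := by
  rw [← ArithmeticFunction.coe_mul_zeta_apply, ArithmeticFunction.moebius_mul_coe_zeta, ArithmeticFunction.one_apply]

lemma mu_coprime (a q : ℕ) (hq : 0 < q) :
    (if Nat.Coprime a q then (1 : ℤ) else 0) = ∑ d ∈ q.divisors, if d ∣ a then ArithmeticFunction.moebius d else 0 := by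
  rw [← sum_filter]
  have : q.divisors.filter (· ∣ a) = (Nat.gcd a q).divisors := by
    ext d; simp [Nat.dvd_gcd_iff, hq.ne']; tauto
  rw [this, mu_sum]

lemma sum_mult_range (q d : ℕ) (hq : 0 < q) (hd : d ∣ q) (f : ℕ → ℂ) :
    ∑ a ∈ range q, (if d ∣ a then f a else 0) = ∑ c ∈ range (q / d), f (d * c) := by
  obtain ⟨e, rfl⟩ := hd
  have hd : 0 < d := Nat.pos_of_mul_pos_right hq
  rw [Nat.mul_div_cancel_left _ hd, ← sum_filter]
  have : (range (d * e)).filter (d ∣ ·) = (range e).image (d * ·) := by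
    ext a; simp only [mem_filter, mem_range, mem_image]
    constructor
    · rintro ⟨h, c, rfl⟩; exact ⟨c, lt_of_mul_lt_mul_left h hd.le, rfl⟩
    · rintro ⟨c, hc, rfl⟩; exact ⟨by gcongr, dvd_mul_right _ _⟩
  rw [this, sum_image (by intro x _ y _ h; exact Nat.eq_of_mul_eq_mul_left hd h)]

/-- Ramanujan sum at a coprime argument. -/
lemma ramanujan (q : ℕ) (hq : 0 < q) (n : ℤ) (h : IsCoprime n q) :
    ∑ a ∈ (range q).filter (Nat.Coprime · q), ee (a * (n / q)) = ArithmeticFunction.moebius q := by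
  have h1 : ∑ a ∈ (range q).filter (Nat.Coprime · q), ee (a * (n / q)) =
      ∑ d ∈ q.divisors, (ArithmeticFunction.moebius d : ℂ) * ∑ a ∈ range q, if d ∣ a then ee (a * (n / q)) else 0 := by
    simp_rw [mul_sum]
    rw [sum_comm, sum_filter]
    refine sum_congr rfl fun a _ => ?_
    have := congrArg (fun z : ℤ => (z : ℂ) * ee (a * (n / q))) (mu_coprime a q hq)
    simp only [Int.cast_sum, sum_mul] at this
    convert this using 1
    · split_ifs <;> simp
    · refine sum_congr rfl fun d _ => ?_
      split_ifs <;> simp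
  rw [h1, sum_eq_single q]
  · rw [sum_mult_range q q hq dvd_rfl, Nat.div_self hq]; simp [ee_zero]
  · intro d hd hdq
    have hd' := Nat.dvd_of_mem_divisors hd
    obtain ⟨e, he⟩ := hd'
    have hd0 : 0 < d := Nat.pos_of_mem_divisors hd
    have he0 : 0 < e := by rcases Nat.eq_zero_or_pos e with h | h; · simp [h] at he; omega
                           · exact h
    rw [sum_mult_range q d hq (Nat.dvd_of_mem_divisors hd)]
    have hc : q / d = e := by rw [he, Nat.mul_div_cancel_left _ hd0]
    rw [hc]
    have : ∀ c ∈ range e, ee ((d * c : ℕ) * (n / q)) = ee (c * (n / e)) := by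
      intro c _; congr 1; rw [he]; push_cast
      have : (d : ℝ) ≠ 0 := by positivity
      field_simp
    rw [sum_congr rfl this, sum_ee_frac e he0, if_neg, mul_zero]
    intro hdv
    have he1 : e ≠ 1 := fun h => hdq (by simp [he, h])
    have : IsCoprime (e : ℤ) e := (h.of_isCoprime_of_dvd_left hdv).of_isCoprime_of_dvd_right ⟨d, by rw [he]; push_cast; ring⟩
    rw [isCoprime_self, Int.isUnit_iff] at this
    omega
  · intro h; exact absurd (Nat.mem_divisors_self q hq.ne') h

/-- sum of reciprocals of integers composed of primes dividing `N`. -/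
lemma factored_sum (N : ℕ) (hN : 0 < N) (T : Finset ℕ)
    (hT : ∀ n ∈ T, n ≠ 0 ∧ ∀ p, p.Prime → p ∣ n → p ∣ N) :
    ∑ n ∈ T, 1 / (n : ℝ) ≤ N / N.totient := by
  let f : ℕ →* ℝ := ⟨⟨fun n => (n : ℝ)⁻¹, by simp⟩, fun a b => by simp [mul_comm]⟩
  have h := (EulerProduct.summable_and_hasSum_factoredNumbers_prod_filter_prime_geometric (f := f)
    (fun {p} hp => by
      change ‖(p : ℝ)⁻¹‖ < 1
      rw [norm_inv, Real.norm_natCast]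
      exact inv_lt_one_of_one_lt₀ (by exact_mod_cast hp.one_lt)) N.primeFactors).2
  have e : ∏ p ∈ N.primeFactors with p.Prime, (1 - f p)⁻¹ = N / N.totient := by
    rw [filter_true_of_mem (fun p hp => Nat.prime_of_mem_primeFactors hp), prod_inv_distrib]
    have := Nat.totient_eq_mul_prod_factors N
    have h2 : (N.totient : ℝ) = N * ∏ p ∈ N.primeFactors, (1 - (p : ℝ)⁻¹) := by
      have := congrArg (fun x : ℚ => (x : ℝ)) this
      push_cast at this; exact this
    rw [h2]
    have : (N : ℝ) ≠ 0 := by positivity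
    change (∏ p ∈ N.primeFactors, (1 - (p : ℝ)⁻¹))⁻¹ = _
    rw [div_mul_eq_div_div, div_self this, one_div]
  rw [← e, ← h.tsum_eq]
  have hT' : ∀ n ∈ T, n ∈ Nat.factoredNumbers N.primeFactors := fun n hn =>
    Nat.mem_factoredNumbers.2 ⟨(hT n hn).1, fun p hp => Nat.mem_primeFactors.2
      ⟨Nat.prime_of_mem_primeFactorsList hp, (hT n hn).2 p (Nat.prime_of_mem_primeFactorsList hp) (Nat.dvd_of_mem_primeFactorsList hp), hN.ne'⟩⟩
  have h3 := h.summable.sum_le_tsum (T.subtype (· ∈ Nat.factoredNumbers N.primeFactors)) (fun i _ => by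
    change 0 ≤ ((i : ℕ) : ℝ)⁻¹; positivity)
  refine le_trans (le_of_eq ?_) h3
  rw [sum_subtype_of_mem (f := fun n => f n) hT']
  exact sum_congr rfl fun n _ => one_div _

lemma sum_phi_ge (Q d : ℕ) (hd : 0 < d) : (d.totient : ℝ) / d * Real.log Q ≤
    ∑ q ∈ (Icc 1 Q).filter (fun q => Squarefree q ∧ q.Coprime d), 1 / (q.totient : ℝ) := by
  set A := (Icc 1 Q).filter (fun q => Squarefree q ∧ q.Coprime d)
  let g : ℕ → ℕ := fun n => ∏ p ∈ n.primeFactors.filter (fun p => ¬ p ∣ d), p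
  have hg : ∀ n ∈ Icc 1 Q, g n ∈ A ∧ g n ∣ n ∧ ∀ p, p.Prime → p ∣ n → p ∣ g n * d := by
    intro n hn
    have hn' := mem_Icc.1 hn
    have hdvd : g n ∣ n := (prod_dvd_prod_of_subset _ _ _ (filter_subset _ _)).trans (Nat.prod_primeFactors_dvd n)
    have hpr : ∀ p ∈ n.primeFactors.filter (fun p => ¬ p ∣ d), p.Prime := fun p hp => Nat.prime_of_mem_primeFactors (mem_filter.1 hp).1
    refine ⟨?_, hdvd, ?_⟩
    · rw [mem_filter, mem_Icc]
      refine ⟨⟨Nat.pos_of_dvd_of_pos hdvd (by omega), (Nat.le_of_dvd (by omega) hdvd).trans hn'.2⟩, ?_, ?_⟩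
      · refine squarefree_prod_of_pairwise_isCoprime (fun p hp q hq hpq => ?_) (fun p hp => (hpr p hp).prime.squarefree)
        exact Nat.coprime_iff_isRelPrime.1 ((Nat.coprime_primes (hpr p hp) (hpr q hq)).2 hpq)
      · apply Nat.Coprime.prod_left
        intro p hp
        exact (hpr p hp).coprime_iff_not_dvd.2 (mem_filter.1 hp).2
    · intro p hp hpn
      by_cases h : p ∣ d
      · exact h.mul_left _
      · exact (dvd_prod_of_mem _ (mem_filter.2 ⟨Nat.mem_primeFactors.2 ⟨hp, hpn, by omega⟩, h⟩)).mul_right _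
  have h1 : ∑ n ∈ Icc 1 Q, 1 / (n : ℝ) ≤ ∑ q ∈ A, (d : ℝ) / d.totient * (1 / (q.totient : ℝ)) := by
    rw [← sum_fiberwise_of_maps_to (fun n hn => (hg n hn).1)]
    refine sum_le_sum fun q hq => ?_
    have hq' := mem_filter.1 hq
    have hq0 : 0 < q := (mem_Icc.1 hq'.1).1
    have h2 := factored_sum (q * d) (by positivity) (((Icc 1 Q).filter (fun n => g n = q)).image (· / q)) (by
      intro m hm
      obtain ⟨n, hn, rfl⟩ := mem_image.1 hm
      obtain ⟨hn, hgq⟩ := mem_filter.1 hn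
      obtain ⟨_, h2, h3⟩ := hg n hn
      rw [hgq] at h2 h3
      have : 0 < n := (mem_Icc.1 hn).1
      exact ⟨(Nat.div_pos (Nat.le_of_dvd this h2) hq0).ne', fun p hp hpn => h3 p hp (hpn.trans (Nat.div_dvd_of_dvd h2))⟩)
    rw [sum_image (by
      intro x hx y hy h
      have hx := (mem_filter.1 hx); have hy := (mem_filter.1 hy)
      have a := (hg x hx.1).2.1; have b := (hg y hy.1).2.1
      rw [hx.2] at a; rw [hy.2] at b
      exact (Nat.div_left_inj a b).1 h)] at h2
    have h3 : ∑ n ∈ (Icc 1 Q).filter (fun n => g n = q), 1 / (n : ℝ) =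
        (1 / q) * ∑ n ∈ (Icc 1 Q).filter (fun n => g n = q), 1 / ((n / q : ℕ) : ℝ) := by
      rw [mul_sum]
      refine sum_congr rfl fun n hn => ?_
      have hn := mem_filter.1 hn
      have a := (hg n hn.1).2.1; rw [hn.2] at a
      rw [Nat.cast_div a (by positivity)]
      have : (q : ℝ) ≠ 0 := by positivity
      field_simp
    rw [h3]
    calc _ ≤ (1 / (q : ℝ)) * ((q * d : ℕ) / (q * d).totient) := by gcongr
      _ = _ := by
        rw [Nat.totient_mul hq'.2.2]; push_cast
        have : (q.totient : ℝ) ≠ 0 := by have := Nat.totient_pos.2 hq0; positivity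
        have : (d.totient : ℝ) ≠ 0 := by have := Nat.totient_pos.2 hd; positivity
        field_simp
  have h4 : Real.log Q ≤ ∑ n ∈ Icc 1 Q, 1 / (n : ℝ) := by
    have := log_add_one_le_harmonic Q
    rw [harmonic_eq_sum_Icc] at this
    push_cast at this
    simp_rw [one_div]
    refine le_trans ?_ this
    rcases Nat.eq_zero_or_pos Q with h | h
    · simp [h]
    · exact Real.log_le_log (by exact_mod_cast h) (by linarith)
  rw [← mul_sum] at h1
  have hdt : (0 : ℝ) < d.totient := by exact_mod_cast Nat.totient_pos.2 hd
  have hd' : (0 : ℝ) < d := by exact_mod_cast hd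
  rw [div_mul_eq_mul_div, div_le_iff₀ hd']
  have := h4.trans h1
  rw [div_mul_eq_mul_div, le_div_iff₀ hdt] at this
  linarith
end

section
open Finset

lemma montgomery (f : ℕ → ℂ) (M D b q : ℕ) (hq : Squarefree q) (hD : D.Coprime q)
    (hf : ∀ k < M, f k ≠ 0 → (D * k + b).Coprime q) (α : ℝ) :
    ‖∑ k ∈ range M, f k * ee (k * α)‖ ^ 2 ≤ q.totient *
      ∑ a ∈ (range q).filter (Nat.Coprime · q), ‖∑ k ∈ range M, f k * ee (k * (α + a / q))‖ ^ 2 := by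
  have hq0 : 0 < q := Nat.pos_of_ne_zero hq.ne_zero
  have hqr : (q : ℝ) ≠ 0 := by positivity
  obtain ⟨u, v, huv⟩ := Nat.isCoprime_iff_coprime.2 hD
  set A := (range q).filter (Nat.Coprime · q)
  have h1 : ∑ a ∈ A, ee (a * ((b * u : ℤ) / q)) * ∑ k ∈ range M, f k * ee (k * (α + a / q)) =
      ArithmeticFunction.moebius q * ∑ k ∈ range M, f k * ee (k * α) := by
    simp_rw [mul_sum]
    rw [sum_comm]
    refine sum_congr rfl fun k hk => ?_
    by_cases h0 : f k = 0
    · simp [h0]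
    have hc := Nat.isCoprime_iff_coprime.2 (hf k (mem_range.1 hk) h0)
    have hc2 : IsCoprime ((k : ℤ) + b * u) q := by
      have : IsCoprime ((D : ℤ) * (k + b * u)) q := by
        have := hc.add_mul_right_left (-(b * v))
        have e : (D : ℤ) * (k + b * u) = ((D * k + b : ℕ) : ℤ) + -(b * v) * q := by
          push_cast; linear_combination (b : ℤ) * huv
        rw [e]; exact this
      exact this.of_mul_left_right
    rw [← ramanujan q hq0 _ hc2, sum_mul]
    refine sum_congr rfl fun a _ => ?_
    have : ee (a * ((b * u : ℤ) / q)) * ee (k * (α + a / q)) = ee (a * (((k + b * u : ℤ) : ℝ) / q)) * ee (k * α) := by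
      rw [← ee_add, ← ee_add]; congr 1; push_cast; field_simp; ring
    linear_combination (f k) * this
  have h2 := congrArg norm h1
  have hmu : ‖(ArithmeticFunction.moebius q : ℂ)‖ = 1 := by
    rcases ArithmeticFunction.moebius_ne_zero_iff_eq_or.1 (ArithmeticFunction.moebius_ne_zero_iff_squarefree.2 hq) with h | h <;> simp [h]
  rw [norm_mul, hmu, one_mul] at h2
  rw [← h2]
  have h3 : ‖∑ a ∈ A, ee (a * ((b * u : ℤ) / q)) * ∑ k ∈ range M, f k * ee (k * (α + a / q))‖ ≤
      ∑ a ∈ A, ‖∑ k ∈ range M, f k * ee (k * (α + a / q))‖ := by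
    refine (norm_sum_le _ _).trans (le_of_eq (sum_congr rfl fun a _ => ?_))
    rw [norm_mul, ee_norm, one_mul]
  refine (pow_le_pow_left₀ (norm_nonneg _) h3 2).trans ?_
  have h4 := sq_sum_le_card_mul_sum_sq (s := A) (f := fun a => ‖∑ k ∈ range M, f k * ee (k * (α + a / q))‖)
  have : A.card = q.totient := by
    rw [Nat.totient_eq_card_coprime]; congr 1; ext a; simp [A, Nat.coprime_comm]
  rw [this] at h4
  exact h4

lemma tot_ratio_mul_prime (d p : ℕ) (hd : 0 < d) (hp : p.Prime) :
    (d.totient : ℝ) / d * (1 - 1 / p) ≤ ((p * d).totient : ℝ) / (p * d : ℕ) := by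
  have hp0 : (0 : ℝ) < p := by exact_mod_cast hp.pos
  have hd0 : (0 : ℝ) < d := by exact_mod_cast hd
  have ht : (0 : ℝ) ≤ d.totient := by positivity
  by_cases h : p ∣ d
  · rw [Nat.totient_mul_of_prime_of_dvd hp h]
    push_cast
    rw [mul_div_mul_left _ _ hp0.ne']
    have : 0 ≤ (d.totient : ℝ) / d := by positivity
    have h2 : 0 ≤ 1 / (p : ℝ) := by positivity
    nlinarith
  · rw [Nat.totient_mul_of_prime_of_not_dvd hp h]
    push_cast [Nat.cast_sub hp.one_le]
    apply le_of_eq; field_simp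

lemma tot_ratio_prod (d : ℕ) (hd : 0 < d) (P : Finset ℕ) (hP : ∀ p ∈ P, p.Prime) :
    (d.totient : ℝ) / d * (1 - ∑ p ∈ P, 1 / (p : ℝ)) ≤ ((d * ∏ p ∈ P, p).totient : ℝ) / (d * ∏ p ∈ P, p : ℕ) := by
  induction P using Finset.induction_on with
  | empty => simp
  | insert p P hp ih =>
    have hpp := hP p (mem_insert_self _ _)
    have ih := ih fun q hq => hP q (mem_insert_of_mem hq)
    have hpos : 0 < d * ∏ p ∈ P, p := Nat.mul_pos hd (prod_pos fun q hq => (hP q (mem_insert_of_mem hq)).pos)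
    rw [prod_insert hp, sum_insert hp, mul_left_comm]
    refine le_trans ?_ (tot_ratio_mul_prime _ p hpos hpp)
    have h1 : (0 : ℝ) ≤ 1 - 1 / p := by
      have : (1 : ℝ) ≤ p := by exact_mod_cast hpp.one_le
      rw [sub_nonneg, div_le_one (by linarith)]; exact this
    refine le_trans ?_ (mul_le_mul_of_nonneg_right ih h1)
    have h2 : 0 ≤ (d.totient : ℝ) / d := by positivity
    have h3 : 0 ≤ 1 / (p : ℝ) := by positivity
    have h4 : 0 ≤ ∑ p ∈ P, 1 / (p : ℝ) := sum_nonneg fun _ _ => by positivity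
    nlinarith [mul_nonneg h2 (mul_nonneg h3 h4)]

/-- If two fractions-differences conflict they must agree mod 1. -/
lemma frac_aux (x y : ℝ) (m n M : ℕ) (hm : 0 < m) (hn : 0 < n) (c c' : ℤ) (hx : x = c / m) (hy : y = c' / n)
    (hM : m * n ≤ M) (h : dn (x - y) < 1 / M) : ∃ z : ℤ, x = y + z := by
  have hm' : (m : ℝ) ≠ 0 := by positivity
  have hn' : (n : ℝ) ≠ 0 := by positivity
  have e : x - y = ((c * n - c' * m : ℤ) : ℝ) / (m * n : ℕ) := by rw [hx, hy]; push_cast; field_simp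
  by_cases hd : ((m * n : ℕ) : ℤ) ∣ c * n - c' * m
  · obtain ⟨z, hz⟩ := hd
    refine ⟨z, ?_⟩
    rw [hz] at e; push_cast at e
    have : x - y = z := by rw [e]; field_simp
    linarith
  · have := dn_frac _ (m * n) (by positivity) hd
    rw [← e] at this
    have h3 : (1 : ℝ) / M ≤ 1 / (m * n : ℕ) := by
      apply one_div_le_one_div_of_le (by positivity); exact_mod_cast hM
    linarith

theorem sieve_ls {ι : Type*} [DecidableEq ι] (s : Finset ι) (α : ι → ℝ) (M Q D b d : ℕ) (hQ : 0 < Q)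
    (hQM : Q ^ 4 ≤ M) (hd : 0 < d) (hDd : D ∣ d) (hds : ∀ p, p.Prime → p ≤ 4 * s.card → p ∣ d)
    (hsep : ∀ i ∈ s, ∀ j ∈ s, i ≠ j → 1 / (M : ℝ) ≤ dn (α i - α j))
    (f : ℕ → ℂ) (hf : ∀ k < M, f k ≠ 0 → (D * k + b).Prime ∧ Q < D * k + b) :
    (d.totient : ℝ) / d * Real.log Q * ∑ i ∈ s, ‖∑ k ∈ range M, f k * ee (k * α i)‖ ^ 2 ≤
      80 * M * ∑ k ∈ range M, ‖f k‖ ^ 2 := by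
  have hM : 0 < M := lt_of_lt_of_le (by positivity) hQM
  have hMr : (0 : ℝ) < M := by exact_mod_cast hM
  let B : ℕ → Prop := fun q => 0 < q ∧ q ≤ Q ∧ q.Coprime d
  let conf : ι → ι → ℕ → ℕ → ℝ → Prop := fun i j q q' x => B q ∧ B q' ∧ (∃ c : ℤ, x = c / (q * q' : ℕ)) ∧
    dn (α i - α j + x) < 1 / (2 * M)
  -- the distinguished prime of a pair
  have hpi : ∀ i j, ∃ p : ℕ, p.Prime ∧ (i ∈ s → j ∈ s → i ≠ j → 4 * s.card < p ∧
      ∀ q q' x, conf i j q q' x → p ∣ q * q') := by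
    intro i j
    by_cases hij : ∃ q q' x, conf i j q q' x
    swap
    · obtain ⟨p, hp, hp2⟩ := Nat.exists_infinite_primes (4 * s.card + 1)
      refine ⟨p, hp2, fun _ _ _ => ⟨by omega, fun q q' x h => absurd ⟨q, q', x, h⟩ hij⟩⟩
    by_cases hs : i ∈ s ∧ j ∈ s ∧ i ≠ j
    swap
    · exact ⟨2, Nat.prime_two, fun a b c => absurd ⟨a, b, c⟩ hs⟩
    obtain ⟨hi, hj, hne⟩ := hs
    obtain ⟨q, q', x, h⟩ := hij
    obtain ⟨hB, hB', ⟨c, hc⟩, hx⟩ := h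
    have hm : 0 < q * q' := Nat.mul_pos hB.1 hB'.1
    have hmr : ((q * q' : ℕ) : ℝ) ≠ 0 := by positivity
    -- the reduced denominator
    let r : ℚ := c / (q * q' : ℕ)
    have hxr : x = r := by rw [hc]; simp [r]
    have hr1 : r.den ≠ 1 := by
      intro h1
      have h2 : x = (r.num : ℤ) := by rw [hxr]; exact_mod_cast (Rat.coe_int_num_of_den_eq_one h1).symm
      have h3 := hsep i hi j hj hne
      rw [h2, dn_add_int] at hx
      have : (1 : ℝ) / (2 * M) ≤ 1 / M := by
        apply one_div_le_one_div_of_le hMr; linarith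
      linarith
    have hden : ∀ q1 q1' x1, conf i j q1 q1' x1 → r.den ∣ q1 * q1' := by
      rintro q1 q1' x1 ⟨hC, hC', ⟨c1, hc1⟩, hx1⟩
      have hm1 : 0 < q1 * q1' := Nat.mul_pos hC.1 hC'.1
      obtain ⟨z, hz⟩ := frac_aux x1 x (q1 * q1') (q * q') M hm1 hm c1 c hc1 hc (by
        calc q1 * q1' * (q * q') ≤ Q * Q * (Q * Q) := by
              gcongr; exacts [hC.2.1, hC'.2.1, hB.2.1, hB'.2.1]
          _ = Q ^ 4 := by ring
          _ ≤ M := hQM) (by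
        have := dn_sub (α i - α j + x1) (α i - α j + x)
        rw [show α i - α j + x1 - (α i - α j + x) = x1 - x by ring] at this
        have e : (1 : ℝ) / M = 1 / (2 * M) + 1 / (2 * M) := by field_simp; norm_num
        linarith)
      have hr : r = (c1 - z * (q1 * q1' : ℕ) : ℤ) / (q1 * q1' : ℕ) := by
        have : (r : ℝ) = (((c1 - z * (q1 * q1' : ℕ) : ℤ) / (q1 * q1' : ℕ) : ℚ) : ℝ) := by
          rw [← hxr, show x = x1 - z by linarith, hc1]; push_cast
          have : (q1 : ℝ) ≠ 0 := by have := hC.1; positivity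
          have : (q1' : ℝ) ≠ 0 := by have := hC'.1; positivity
          field_simp
        exact_mod_cast this
      have h4 := Rat.den_dvd (c1 - z * (q1 * q1' : ℕ)) (q1 * q1' : ℕ)
      rw [Rat.divInt_eq_div] at h4
      have h5 : ((c1 - z * (q1 * q1' : ℕ) : ℤ) : ℚ) / (((q1 * q1' : ℕ) : ℤ) : ℚ) = r := by rw [hr]; push_cast; ring
      rw [h5] at h4
      exact_mod_cast h4
    refine ⟨r.den.minFac, Nat.minFac_prime hr1, fun _ _ _ => ⟨?_, fun q1 q1' x1 h => (Nat.minFac_dvd _).trans (hden q1 q1' x1 h)⟩⟩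
    by_contra hle
    have hpd := hds _ (Nat.minFac_prime hr1) (not_lt.1 hle)
    have hpq := (Nat.minFac_dvd _).trans (hden q q' x ⟨hB, hB', ⟨c, hc⟩, hx⟩)
    have hcop : (q * q').Coprime d := Nat.Coprime.mul_left hB.2.2 hB'.2.2
    exact Nat.not_coprime_of_dvd_of_dvd (Nat.minFac_prime hr1).one_lt hpq hpd hcop
  choose π hπ hπ' using hpi
  let P : ι → Finset ℕ := fun i => (s.erase i).image (fun j => π i j) ∪ (s.erase i).image (fun j => π j i)
  let Qs : ι → Finset ℕ := fun i => (Icc 1 Q).filter (fun q => Squarefree q ∧ q.Coprime (d * ∏ p ∈ P i, p))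
  have hPpr : ∀ i, ∀ p ∈ P i, p.Prime := by
    intro i p hp
    rcases mem_union.1 hp with h | h <;> obtain ⟨j, _, rfl⟩ := mem_image.1 h
    exacts [hπ i j, hπ j i]
  have hPbig : ∀ i ∈ s, ∀ p ∈ P i, 4 * s.card < p := by
    intro i hi p hp
    rcases mem_union.1 hp with h | h <;> obtain ⟨j, hj, rfl⟩ := mem_image.1 h
    · exact (hπ' i j hi (mem_of_mem_erase hj) (ne_of_mem_erase hj).symm).1
    · exact (hπ' j i (mem_of_mem_erase hj) hi (ne_of_mem_erase hj)).1
  have hweight : ∀ i ∈ s, (d.totient : ℝ) / d * Real.log Q / 2 ≤ ∑ q ∈ Qs i, 1 / (q.totient : ℝ) := by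
    intro i hi
    have hdP : 0 < d * ∏ p ∈ P i, p := Nat.mul_pos hd (prod_pos fun q hq => (hPpr i q hq).pos)
    refine le_trans ?_ (sum_phi_ge Q (d * ∏ p ∈ P i, p) hdP)
    have hs0 : (0 : ℝ) < s.card := by exact_mod_cast card_pos.2 ⟨i, hi⟩
    have h1 : ∑ p ∈ P i, 1 / (p : ℝ) ≤ 1 / 2 := by
      have h2 : ∑ p ∈ P i, 1 / (p : ℝ) ≤ ∑ p ∈ P i, 1 / (4 * s.card : ℝ) := by
        refine sum_le_sum fun p hp => one_div_le_one_div_of_le (by positivity) ?_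
        exact_mod_cast (hPbig i hi p hp).le
      have h3 : ((P i).card : ℝ) ≤ 2 * s.card := by
        have a1 := card_union_le ((s.erase i).image (fun j => π i j)) ((s.erase i).image (fun j => π j i))
        have a2 := card_image_le (s := s.erase i) (f := fun j => π i j)
        have a3 := card_image_le (s := s.erase i) (f := fun j => π j i)
        have a4 := card_erase_le (s := s) (a := i)
        have : (P i).card ≤ 2 * s.card := by simp only [P]; omega
        exact_mod_cast this
      rw [sum_const, nsmul_eq_mul, mul_one_div] at h2
      refine h2.trans ?_
      rw [div_le_div_iff₀ (by positivity) (by positivity)]; linarith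
    have h2 := tot_ratio_prod d hd (P i) (hPpr i)
    have h3 : (d.totient : ℝ) / d * (1 / 2) ≤ (d.totient : ℝ) / d * (1 - ∑ p ∈ P i, 1 / (p : ℝ)) := by
      gcongr; linarith
    have hl : 0 ≤ Real.log Q := Real.log_nonneg (by exact_mod_cast hQ)
    have := mul_le_mul_of_nonneg_right (h3.trans h2) hl
    linarith
  -- the points
  let T : Finset ((_ : ι) × ((_ : ℕ) × ℕ)) := s.sigma fun i => (Qs i).sigma fun q => (range q).filter (Nat.Coprime · q)
  let θ : ((_ : ι) × ((_ : ℕ) × ℕ)) → ℝ := fun z => α z.1 + z.2.2 / z.2.1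
  have hT : ∀ z ∈ T, z.1 ∈ s ∧ B z.2.1 ∧ z.2.1.Coprime (∏ p ∈ P z.1, p) ∧ z.2.2 < z.2.1 ∧ z.2.2.Coprime z.2.1 := by
    rintro ⟨i, q, a⟩ hz
    simp only [T, Qs, mem_sigma, mem_filter, mem_Icc, mem_range] at hz
    obtain ⟨h1, ⟨⟨h2, h3⟩, h4, h5⟩, h6, h7⟩ := hz
    exact ⟨h1, ⟨h2, h3, Nat.Coprime.coprime_mul_right_right h5⟩, Nat.Coprime.coprime_mul_left_right h5, h6, h7⟩
  have hsepT : ∀ z ∈ T, ∀ z' ∈ T, z ≠ z' → 1 / (2 * M : ℝ) ≤ dn (θ z - θ z') := by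
    rintro ⟨i, q, a⟩ hz ⟨j, q', a'⟩ hz' hne
    obtain ⟨hi, hB, hc, ha, hac⟩ := hT _ hz
    obtain ⟨hj, hB', hc', ha', hac'⟩ := hT _ hz'
    simp only at hi hB hc ha hac hj hB' hc' ha' hac'
    have hq0 : (q : ℝ) ≠ 0 := by have := hB.1; positivity
    have hq0' : (q' : ℝ) ≠ 0 := by have := hB'.1; positivity
    have hx : (a : ℝ) / q - a' / q' = ((a * q' - a' * q : ℤ) : ℝ) / (q * q' : ℕ) := by
      push_cast; field_simp
    by_contra hlt
    push Not at hlt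
    have e : θ ⟨i, q, a⟩ - θ ⟨j, q', a'⟩ = α i - α j + ((a : ℝ) / q - a' / q') := by simp only [θ]; ring
    rw [e] at hlt
    by_cases hij : i = j
    · subst hij
      rw [sub_self, zero_add] at hlt
      obtain ⟨z, hz⟩ := frac_aux ((a : ℝ) / q - a' / q') 0 (q * q') 1 M (Nat.mul_pos hB.1 hB'.1) one_pos _ 0 hx (by simp) (by
        calc q * q' * 1 ≤ Q * Q * 1 := by gcongr; exacts [hB.2.1, hB'.2.1]
          _ ≤ Q ^ 4 := by nlinarith [Nat.pow_le_pow_right hQ (show 2 ≤ 4 by norm_num)]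
          _ ≤ M := hQM) (by
          rw [sub_zero]; refine hlt.trans_le (one_div_le_one_div_of_le hMr (by linarith)))
      -- difference an integer, so equal
      have hlt1 : (a : ℝ) / q < 1 := by rw [div_lt_one (by have := hB.1; positivity)]; exact_mod_cast ha
      have hlt2 : (a' : ℝ) / q' < 1 := by rw [div_lt_one (by have := hB'.1; positivity)]; exact_mod_cast ha'
      have hge1 : 0 ≤ (a : ℝ) / q := by positivity
      have hge2 : 0 ≤ (a' : ℝ) / q' := by positivity
      have hz0 : z = 0 := by
        have h1 : (z : ℝ) < 1 := by linarith
        have h2 : (-1 : ℝ) < z := by linarith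
        have h1' : z < 1 := by exact_mod_cast h1
        have h2' : -1 < z := by exact_mod_cast h2
        omega
      rw [hz0, Int.cast_zero, add_zero, sub_eq_zero, div_eq_div_iff hq0 hq0'] at hz
      have hz' : a * q' = a' * q := by exact_mod_cast hz
      have d1 : q ∣ q' := hac.symm.dvd_of_dvd_mul_left ⟨a', by rw [hz', mul_comm]⟩
      have d2 : q' ∣ q := hac'.symm.dvd_of_dvd_mul_left ⟨a, by rw [← hz', mul_comm]⟩
      have hqq : q = q' := Nat.dvd_antisymm d1 d2
      subst hqq
      have : a = a' := Nat.eq_of_mul_eq_mul_right hB.1 hz'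
      subst this
      exact hne rfl
    · have hdv := (hπ' i j hi hj hij).2 q q' _ ⟨hB, hB', ⟨_, hx⟩, hlt⟩
      rcases (hπ i j).dvd_mul.1 hdv with h | h
      · have : π i j ∈ P i := mem_union_left _ (mem_image.2 ⟨j, mem_erase.2 ⟨Ne.symm hij, hj⟩, rfl⟩)
        exact Nat.not_coprime_of_dvd_of_dvd (hπ i j).one_lt h (dvd_prod_of_mem (fun p => p) this) hc
      · have : π i j ∈ P j := mem_union_right _ (mem_image.2 ⟨i, mem_erase.2 ⟨hij, hi⟩, rfl⟩)
        exact Nat.not_coprime_of_dvd_of_dvd (hπ i j).one_lt h (dvd_prod_of_mem (fun p => p) this) hc'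
  have hLS := large_sieve T θ M hM hsepT f
  have hlow : (d.totient : ℝ) / d * Real.log Q / 2 * ∑ i ∈ s, ‖∑ k ∈ range M, f k * ee (k * α i)‖ ^ 2 ≤
      ∑ z ∈ T, ‖∑ k ∈ range M, f k * ee (k * θ z)‖ ^ 2 := by
    rw [mul_sum, sum_sigma]
    refine sum_le_sum fun i hi => ?_
    refine (mul_le_mul_of_nonneg_right (hweight i hi) (by positivity)).trans ?_
    rw [sum_sigma, sum_mul]
    refine sum_le_sum fun q hq => ?_
    simp only [Qs, mem_filter, mem_Icc] at hq
    obtain ⟨⟨h2, h3⟩, h4, h5⟩ := hq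
    have h6 : q.Coprime d := Nat.Coprime.coprime_mul_right_right h5
    have hm := montgomery f M D b q h4 (h6.symm.coprime_dvd_left hDd) (fun k hk h0 => by
      obtain ⟨g1, g2⟩ := hf k hk h0
      exact Nat.coprime_of_lt_prime (by omega) (h3.trans_lt g2) g1) (α i)
    have ht : (0 : ℝ) < q.totient := by exact_mod_cast Nat.totient_pos.2 h2
    rw [one_div, inv_mul_le_iff₀ ht]
    exact hm
  linarith
end

section
open Finset

lemma mertens (N : ℕ) (hN : 0 < N) : ∑ n ∈ Ioc 0 N, ArithmeticFunction.vonMangoldt n / n ≤ Real.log N + 6 := by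
  have h1 := ArithmeticFunction.sum_Ioc_mul_zeta_eq_sum ArithmeticFunction.vonMangoldt N
  rw [ArithmeticFunction.vonMangoldt_mul_zeta] at h1
  have hNr : (0 : ℝ) < N := by exact_mod_cast hN
  have h2 : ∑ n ∈ Ioc 0 N, ArithmeticFunction.log n ≤ N * Real.log N := by
    refine (sum_le_card_nsmul _ _ (Real.log N) fun n hn => ?_).trans (by simp)
    have := mem_Ioc.1 hn
    rw [ArithmeticFunction.log_apply]
    exact Real.log_le_log (by exact_mod_cast this.1) (by exact_mod_cast this.2)
  have h3 : ∑ n ∈ Ioc 0 N, ArithmeticFunction.vonMangoldt n * (N / n - 1) ≤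
      ∑ n ∈ Ioc 0 N, ArithmeticFunction.vonMangoldt n * (N / n : ℕ) := by
    refine sum_le_sum fun n hn => mul_le_mul_of_nonneg_left ?_ ArithmeticFunction.vonMangoldt_nonneg
    have h0 := (mem_Ioc.1 hn).1
    have := Nat.lt_div_mul_add (a := N) h0
    have h' : (N : ℝ) < (N / n : ℕ) * n + n := by exact_mod_cast this
    have hn0 : (0 : ℝ) < n := by exact_mod_cast h0
    rw [sub_le_iff_le_add, div_le_iff₀ hn0]; linarith
  have h4 := Chebyshev.psi_le_const_mul_self (x := N) hNr.le
  have h5 : Chebyshev.psi N = ∑ n ∈ Ioc 0 N, ArithmeticFunction.vonMangoldt n := by simp [Chebyshev.psi]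
  have h6 : ∑ n ∈ Ioc 0 N, ArithmeticFunction.vonMangoldt n * (N / n - 1 : ℝ) =
      N * ∑ n ∈ Ioc 0 N, ArithmeticFunction.vonMangoldt n / n - Chebyshev.psi N := by
    rw [h5, mul_sum, ← sum_sub_distrib]; exact sum_congr rfl fun n _ => by ring
  have h7 : Real.log 4 ≤ 2 := by
    rw [show (4 : ℝ) = 2 ^ 2 by norm_num, Real.log_pow]; have := Real.log_two_lt_d9; norm_num; linarith
  have : (N : ℝ) * ∑ n ∈ Ioc 0 N, ArithmeticFunction.vonMangoldt n / n ≤ N * (Real.log N + 6) := by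
    nlinarith
  exact le_of_mul_le_mul_left this hNr

lemma primorial_ratio : ∃ C : ℝ, 0 < C ∧ ∀ t : ℕ, 0 < t →
    1 ≤ C * (t : ℝ) ^ (1 / 4 : ℝ) * ((primorial t).totient / (primorial t : ℕ)) := by
  refine ⟨Real.exp (2 * (Real.exp 8 + 1) + 2), Real.exp_pos _, fun t ht => ?_⟩
  have htr : (0 : ℝ) < t := by exact_mod_cast ht
  have hP0 : ((primorial t : ℕ) : ℝ) ≠ 0 := by exact_mod_cast (primorial_pos t).ne'
  have e1 : ((primorial t).totient : ℝ) / (primorial t : ℕ) = ∏ p ∈ (primorial t).primeFactors, (1 - (p : ℝ)⁻¹) := by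
    have := congrArg (fun x : ℚ => (x : ℝ)) (Nat.totient_eq_mul_prod_factors (primorial t))
    push_cast at this
    rw [this]; field_simp
  set A := (primorial t).primeFactors
  have hA : ∀ p ∈ A, p.Prime ∧ p ∈ Ioc 0 t := fun p hp => by
    have h := Nat.mem_primeFactors.1 hp
    have := (h.1.dvd_primorial_iff).1 h.2.1
    exact ⟨h.1, mem_Ioc.2 ⟨h.1.pos, this⟩⟩
  have h1 : ∏ p ∈ A, Real.exp (-(2 / (p : ℝ))) ≤ ∏ p ∈ A, (1 - (p : ℝ)⁻¹) := by
    refine prod_le_prod (fun _ _ => (Real.exp_pos _).le) fun p hp => ?_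
    have h2 : (2 : ℝ) ≤ p := by exact_mod_cast (hA p hp).1.two_le
    have hi : (p : ℝ)⁻¹ ≤ 1 / 2 := by rw [one_div]; exact inv_anti₀ (by norm_num) h2
    have hi0 : 0 < (p : ℝ)⁻¹ := by positivity
    rw [Real.exp_neg, inv_le_comm₀ (Real.exp_pos _) (by linarith)]
    refine le_trans ?_ (Real.add_one_le_exp _)
    rw [inv_le_comm₀ (by linarith) (by positivity), div_eq_mul_inv]
    rw [inv_le_iff_one_le_mul₀ (by positivity)]
    nlinarith
  rw [← Real.exp_sum] at h1
  have h2 : ∑ p ∈ A, 1 / (p : ℝ) ≤ (Real.exp 8 + 1) + (Real.log t + 6) / 8 := by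
    rw [← sum_filter_add_sum_filter_not A (fun p : ℕ => (p : ℝ) ≤ Real.exp 8)]
    apply add_le_add
    · refine (sum_le_card_nsmul _ _ 1 fun p hp => ?_).trans ?_
      · have := (hA p (mem_filter.1 hp).1).1.one_le
        rw [div_le_one (by exact_mod_cast this)]; exact_mod_cast this
      · have : (A.filter (fun p : ℕ => (p : ℝ) ≤ Real.exp 8)) ⊆ Ioc 0 ⌊Real.exp 8⌋₊ := fun p hp => by
          have h := mem_filter.1 hp
          exact mem_Ioc.2 ⟨(hA p h.1).1.pos, Nat.le_floor h.2⟩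
        have := card_le_card this
        rw [Nat.card_Ioc] at this
        have h' : ((A.filter (fun p : ℕ => (p : ℝ) ≤ Real.exp 8)).card : ℝ) ≤ ⌊Real.exp 8⌋₊ := by exact_mod_cast this
        have := Nat.floor_le (Real.exp_pos 8).le
        simp; linarith
    · rw [le_div_iff₀ (by norm_num), sum_mul]
      refine le_trans ?_ (mertens t ht)
      refine le_trans (sum_le_sum (g := fun p : ℕ => ArithmeticFunction.vonMangoldt p / p) fun p hp => ?_) ?_
      · have h := mem_filter.1 hp
        have hp := (hA p h.1).1
        rw [ArithmeticFunction.vonMangoldt_apply_prime hp, div_mul_eq_mul_div, one_mul]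
        gcongr
        rw [Real.le_log_iff_exp_le (by exact_mod_cast hp.pos)]
        exact (not_le.1 h.2).le
      · exact sum_le_sum_of_subset_of_nonneg (fun p hp => (hA p (mem_filter.1 hp).1).2)
          (fun _ _ _ => div_nonneg ArithmeticFunction.vonMangoldt_nonneg (by positivity))
  rw [e1]
  refine le_trans ?_ (mul_le_mul_of_nonneg_left h1 (by positivity))
  rw [Real.rpow_def_of_pos htr, ← Real.exp_add, ← Real.exp_add]
  apply Real.one_le_exp
  have : ∑ p ∈ A, -(2 / (p : ℝ)) = -2 * ∑ p ∈ A, 1 / (p : ℝ) := by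
    rw [mul_sum]; exact sum_congr rfl fun p _ => by ring
  rw [this]; linarith

theorem sieve_ls' : ∃ C : ℝ, 0 < C ∧ ∀ (ι : Type) (_ : DecidableEq ι) (s : Finset ι) (α : ι → ℝ) (M D b : ℕ),
    256 ≤ M → 0 < D → (∀ i ∈ s, ∀ j ∈ s, i ≠ j → 1 / (M : ℝ) ≤ dn (α i - α j)) →
    ∀ (f : ℕ → ℂ), (∀ k < M, f k ≠ 0 → (D * k + b).Prime ∧ M < (D * k + b) ^ 4) →
    (D.totient : ℝ) / D * Real.log M * ∑ i ∈ s, ‖∑ k ∈ range M, f k * ee (k * α i)‖ ^ 2 ≤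
      C * (s.card : ℝ) ^ (1 / 4 : ℝ) * M * ∑ k ∈ range M, ‖f k‖ ^ 2 := by
  obtain ⟨C, hC, h⟩ := primorial_ratio
  refine ⟨1280 * C, by positivity, fun ι _ s α M D b hM hD hsep f hf => ?_⟩
  rcases s.eq_empty_or_nonempty with rfl | hs
  · simp
  have hK : 0 < s.card := card_pos.2 hs
  have hMr : (256 : ℝ) ≤ M := by exact_mod_cast hM
  set x : ℝ := (M : ℝ) ^ (1 / 4 : ℝ)
  have hx0 : 0 ≤ x := by positivity
  have hx4 : x ^ 4 = M := by
    simp only [x]; rw [← Real.rpow_natCast, ← Real.rpow_mul (by positivity)]; norm_num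
  have hx2 : 2 ≤ x := by
    by_contra hlt; push Not at hlt
    have : x ^ 4 < 2 ^ 4 := pow_lt_pow_left₀ hlt hx0 (by norm_num)
    rw [hx4] at this; linarith
  set Q := ⌊x⌋₊
  have hQ1 : (Q : ℝ) ≤ x := Nat.floor_le hx0
  have hQ2 : x < Q + 1 := Nat.lt_floor_add_one x
  have hQM : Q ^ 4 ≤ M := by
    have : (Q : ℝ) ^ 4 ≤ M := by rw [← hx4]; gcongr
    exact_mod_cast this
  have hQ0 : 0 < Q := Nat.floor_pos.2 (by linarith)
  have hlogQ : Real.log M / 8 ≤ Real.log Q := by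
    have h1 : x / 2 ≤ Q := by linarith
    have h2 := Real.log_le_log (by linarith) h1
    rw [Real.log_div (by linarith) (by norm_num)] at h2
    have h3 : Real.log M = 4 * Real.log x := by rw [← hx4, Real.log_pow]; norm_num
    have h4 : Real.log 256 ≤ Real.log M := Real.log_le_log (by norm_num) hMr
    rw [show (256 : ℝ) = 2 ^ 8 by norm_num, Real.log_pow] at h4
    norm_num at h4
    linarith
  have key := sieve_ls s α M Q D b (D * primorial (4 * s.card)) hQ0 hQM (Nat.mul_pos hD (primorial_pos _))
    (dvd_mul_right _ _) (fun p hp hle => ((hp.dvd_primorial_iff).2 hle).mul_left _) hsep f (fun k hk h0 => by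
      obtain ⟨h1, h2⟩ := hf k hk h0
      refine ⟨h1, ?_⟩
      by_contra hle
      have := (Nat.pow_le_pow_left (not_lt.1 hle) 4).trans hQM
      omega)
  set S := ∑ i ∈ s, ‖∑ k ∈ range M, f k * ee (k * α i)‖ ^ 2
  have hS : 0 ≤ S := by positivity
  have h4K := h (4 * s.card) (by omega)
  have hp0 : (0 : ℝ) < (primorial (4 * s.card) : ℕ) := by exact_mod_cast primorial_pos _
  have hD0 : (0 : ℝ) < D := by exact_mod_cast hD
  have hsm : (D.totient : ℝ) / D * ((primorial (4 * s.card)).totient / (primorial (4 * s.card) : ℕ)) ≤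
      ((D * primorial (4 * s.card)).totient : ℝ) / (D * primorial (4 * s.card) : ℕ) := by
    rw [div_mul_div_comm]; push_cast; gcongr
    exact_mod_cast Nat.totient_super_multiplicative _ _
  set u := (D.totient : ℝ) / D
  set v := ((primorial (4 * s.card)).totient : ℝ) / (primorial (4 * s.card) : ℕ)
  have hu : 0 ≤ u := by positivity
  have hv : 0 ≤ v := by positivity
  have hK4 : ((4 * s.card : ℕ) : ℝ) ^ (1 / 4 : ℝ) ≤ 2 * (s.card : ℝ) ^ (1 / 4 : ℝ) := by
    push_cast
    rw [Real.mul_rpow (by norm_num) (by positivity)]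
    gcongr
    calc (4 : ℝ) ^ (1 / 4 : ℝ) ≤ 4 ^ (1 / 2 : ℝ) := Real.rpow_le_rpow_of_exponent_le (by norm_num) (by norm_num)
      _ = 2 := by rw [show (4 : ℝ) = 2 ^ (2 : ℝ) by norm_num, ← Real.rpow_mul (by norm_num)]; norm_num
  set κ := (s.card : ℝ) ^ (1 / 4 : ℝ)
  have hκ : 0 ≤ κ := by positivity
  have hl : 0 ≤ Real.log M := Real.log_nonneg (by linarith)
  have h5 : 1 ≤ C * (2 * κ) * v := h4K.trans (by gcongr)
  calc u * Real.log M * S ≤ u * Real.log M * S * (C * (2 * κ) * v) :=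
        le_mul_of_one_le_right (by positivity) h5
    _ = 16 * C * κ * (u * v * (Real.log M / 8) * S) := by ring
    _ ≤ 16 * C * κ * (((D * primorial (4 * s.card)).totient : ℝ) / (D * primorial (4 * s.card) : ℕ) * Real.log Q * S) := by
        gcongr
    _ ≤ 16 * C * κ * (80 * M * ∑ k ∈ range M, ‖f k‖ ^ 2) := by gcongr
    _ = _ := by ring
end

section
open Finset

open MeasureTheory Filter Topology in
lemma wi_kernel (u : ℝ) (hu : u ≠ 0) :
    ∫ t in (0:ℝ)..1, (1 - t) * Real.cos (t * u) = (1 - Real.cos u) / u ^ 2 := by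
  have h := intervalIntegral.integral_eq_sub_of_hasDerivAt (a := 0) (b := 1)
    (f := fun t => (1 - t) * (Real.sin (t * u) / u) - Real.cos (t * u) / u ^ 2)
    (f' := fun t => (1 - t) * Real.cos (t * u)) ?_ ?_
  · rw [h]; simp; field_simp; ring
  · intro t _
    have h1 : HasDerivAt (fun t => t * u) u t := by simpa using (hasDerivAt_id t).mul_const u
    have h2 := ((hasDerivAt_id t).const_sub 1).mul (h1.sin.div_const u)
    have h3 := h2.sub (h1.cos.div_const (u ^ 2))
    refine (h3.congr_deriv ?_)
    simp only [id]; field_simp; ring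
  · apply Continuous.intervalIntegrable; fun_prop

noncomputable def wK (u : ℝ) : ℝ := (1 - Real.cos u) / u ^ 2

lemma wK_nonneg (u : ℝ) : 0 ≤ wK u := by
  unfold wK; have := Real.cos_le_one u; positivity [sub_nonneg.2 this]

lemma wK_le (u : ℝ) : wK u ≤ 4 * (1 + u ^ 2)⁻¹ := by
  unfold wK
  rcases eq_or_ne u 0 with rfl | hu
  · simp
  have h1 := Real.one_sub_sq_div_two_le_cos (x := u)
  have h2 := Real.neg_one_le_cos u
  have hu2 : 0 < u ^ 2 := by positivity
  rw [← div_eq_mul_inv, div_le_div_iff₀ hu2 (by positivity)]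
  rcases le_total (u ^ 2) 1 with h | h <;> nlinarith

lemma wK_meas : Measurable wK := by unfold wK; fun_prop

open MeasureTheory in
lemma wK_int : Integrable wK := by
  refine (integrable_inv_one_add_sq.const_mul 4).mono' wK_meas.aestronglyMeasurable ?_
  filter_upwards with u
  rw [Real.norm_of_nonneg (wK_nonneg u)]; exact wK_le u

open MeasureTheory in
lemma wK_pos : 0 < ∫ u, wK u := by
  rw [integral_pos_iff_support_of_nonneg wK_nonneg wK_int]
  refine lt_of_lt_of_le ?_ (measure_mono (?_ : Set.Ioo (0:ℝ) 1 ⊆ _))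
  · simp
  · intro x hx
    have : Real.cos x < 1 := by
      have := Real.cos_lt_cos_of_nonneg_of_le_pi_div_two le_rfl (by linarith [Real.pi_gt_three, hx.2]) hx.1
      simpa using this
    simp only [Function.mem_support, wK]
    have h0 := hx.1
    have : 0 < 1 - Real.cos x := by linarith
    positivity

open MeasureTheory Filter Topology in
lemma wi_fub (b : ℝ → ℝ) (hb : Measurable b) (C : ℝ) (hC : ∀ u, |b u| ≤ C) (H : ℂ → ℂ)
    (hH : ∀ e : ℝ, 0 < e → ∀ t : ℝ, ∫ u in Set.Ioi (0:ℝ), (b u : ℂ) * Complex.exp (-((e + t * Complex.I) * u)) = H (e + t * Complex.I))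
    (e : ℝ) (he : 0 < e) (l y : ℝ) (hl : 0 < l) :
    ∫ u in Set.Ioi (0:ℝ), b u * Real.exp (-(e * u)) * wK (l * (u - y)) =
      ∫ t in Set.Ioc (0:ℝ) 1, (1 - t) * (Complex.exp (t * l * y * Complex.I) * H (e + (t * l : ℝ) * Complex.I)).re := by
  have hexp : IntegrableOn (fun u : ℝ => Real.exp (-(e * u))) (Set.Ioi 0) := by
    simpa using exp_neg_integrableOn_Ioi 0 he
  have hC0 : 0 ≤ C := (abs_nonneg _).trans (hC 0)
  have h1 : ∀ t : ℝ, (Complex.exp (t * l * y * Complex.I) * H (e + (t * l : ℝ) * Complex.I)).re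
      = ∫ u in Set.Ioi (0:ℝ), b u * Real.exp (-(e * u)) * Real.cos (t * (l * (u - y))) := by
    intro t
    rw [← hH e he, ← integral_const_mul, ← RCLike.re_eq_complex_re, ← integral_re]
    · refine integral_congr_ae (Eventually.of_forall fun u => ?_)
      have : Complex.exp (t * l * y * Complex.I) * ((b u : ℂ) * Complex.exp (-((e + (t * l : ℝ) * Complex.I) * u)))
          = (b u : ℂ) * Complex.exp ((-(e * u) : ℝ) + ((-(t * (l * (u - y))) : ℝ) : ℂ) * Complex.I) := by
        rw [mul_left_comm, ← Complex.exp_add]; congr 2; push_cast; ring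
      simp only [this, RCLike.re_eq_complex_re]
      rw [Complex.re_ofReal_mul, Complex.exp_re]
      simp [mul_assoc]
    · refine Integrable.const_mul ?_ _
      refine (hexp.const_mul C).mono' ?_ ?_
      · exact (by fun_prop : Measurable _).aestronglyMeasurable
      · filter_upwards with u
        rw [norm_mul, Complex.norm_exp]
        simp only [Complex.norm_real, Real.norm_eq_abs]
        have : (-((e + (t * l : ℝ) * Complex.I) * u)).re = -(e * u) := by simp
        rw [this]; exact mul_le_mul_of_nonneg_right (hC u) (Real.exp_nonneg _)
  simp_rw [h1, ← integral_const_mul]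
  rw [integral_integral_swap]
  · refine integral_congr_ae ?_
    have : ∀ᵐ u ∂(volume.restrict (Set.Ioi (0:ℝ))), u ≠ y := by
      refine ae_restrict_of_ae ?_
      simp [ae_iff]
    filter_upwards [this] with u hu
    have hne : l * (u - y) ≠ 0 := mul_ne_zero hl.ne' (sub_ne_zero.2 hu)
    rw [wK, ← wi_kernel _ hne, intervalIntegral.integral_of_le zero_le_one, ← integral_const_mul]
    refine integral_congr_ae (Eventually.of_forall fun t => ?_)
    simp only; ring
  · have hp : Integrable (fun p : ℝ × ℝ => (1:ℝ) * (C * Real.exp (-(e * p.2))))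
        ((volume.restrict (Set.Ioc (0:ℝ) 1)).prod (volume.restrict (Set.Ioi (0:ℝ)))) :=
      Integrable.mul_prod (f := fun _ : ℝ => (1:ℝ)) (integrable_const 1) (hexp.const_mul C)
    refine hp.mono' (by unfold Function.uncurry; exact (by fun_prop : Measurable _).aestronglyMeasurable) ?_
    rw [Measure.prod_restrict]
    filter_upwards [ae_restrict_mem (measurableSet_Ioc.prod measurableSet_Ioi)] with p hp
    have h0 := hp.1.1
    have h1 := hp.1.2
    simp only [Function.uncurry, norm_mul, Real.norm_eq_abs]
    have ha : |1 - p.1| ≤ 1 := by rw [abs_le]; constructor <;> linarith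
    have hc := Real.abs_cos_le_one (p.1 * (l * (p.2 - y)))
    rw [abs_of_pos (Real.exp_pos _)]
    refine mul_le_mul ha ?_ (by positivity) zero_le_one
    calc _ ≤ C * Real.exp (-(e * p.2)) * 1 := by
          refine mul_le_mul (mul_le_mul_of_nonneg_right (hC _) (Real.exp_nonneg _)) hc (abs_nonneg _) (by positivity)
      _ = _ := mul_one _

open MeasureTheory Filter Topology in
lemma wi_lim (b : ℝ → ℝ) (hb : Measurable b) (C : ℝ) (hC : ∀ u, |b u| ≤ C) (H : ℂ → ℂ)
    (hc : ContinuousOn H {s | 0 ≤ s.re})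
    (hH : ∀ e : ℝ, 0 < e → ∀ t : ℝ, ∫ u in Set.Ioi (0:ℝ), (b u : ℂ) * Complex.exp (-((e + t * Complex.I) * u)) = H (e + t * Complex.I))
    (l : ℝ) (hl : 0 < l) :
    Tendsto (fun y => ∫ u in Set.Ioi (0:ℝ), b u * wK (l * (u - y))) atTop (𝓝 0) := by
  have hC0 : 0 ≤ C := (abs_nonneg _).trans (hC 0)
  have key : ∀ y, ∫ u in Set.Ioi (0:ℝ), b u * wK (l * (u - y)) =
      ∫ t in Set.Ioc (0:ℝ) 1, (1 - t) * (Complex.exp (t * l * y * Complex.I) * H ((t * l : ℝ) * Complex.I)).re := by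
    intro y
    have L1 : Tendsto (fun e : ℝ => ∫ u in Set.Ioi (0:ℝ), b u * Real.exp (-(e * u)) * wK (l * (u - y))) (𝓝[>] 0)
        (𝓝 (∫ u in Set.Ioi (0:ℝ), b u * wK (l * (u - y)))) := by
      refine tendsto_integral_filter_of_dominated_convergence (fun u => C * wK (l * (u - y))) ?_ ?_ ?_ ?_
      · filter_upwards with e
        exact ((hb.mul (by fun_prop)).mul (wK_meas.comp (by fun_prop))).aestronglyMeasurable
      · filter_upwards [self_mem_nhdsWithin] with e he
        filter_upwards [ae_restrict_mem measurableSet_Ioi] with u hu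
        rw [norm_mul, norm_mul, Real.norm_of_nonneg (wK_nonneg _)]
        have : ‖Real.exp (-(e * u))‖ ≤ 1 := by
          rw [Real.norm_of_nonneg (Real.exp_nonneg _)]; apply Real.exp_le_one_iff.2
          have := mul_pos (Set.mem_Ioi.1 he) (Set.mem_Ioi.1 hu); linarith
        have h2 := wK_nonneg (l * (u - y))
        gcongr
        calc _ ≤ C * 1 := by gcongr; exact hC u
          _ = C := mul_one _
      · refine Integrable.const_mul ?_ _
        exact ((wK_int.comp_mul_left' hl.ne').comp_sub_right y).integrableOn
      · filter_upwards with u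
        have : Tendsto (fun e : ℝ => b u * Real.exp (-(e * u)) * wK (l * (u - y))) (𝓝 0) (𝓝 (b u * Real.exp (-(0 * u)) * wK (l * (u - y)))) := by
          apply Continuous.tendsto; fun_prop
        simp only [zero_mul, neg_zero, Real.exp_zero, mul_one] at this
        exact this.mono_left nhdsWithin_le_nhds
    have L2 : Tendsto (fun e : ℝ => ∫ t in Set.Ioc (0:ℝ) 1, (1 - t) * (Complex.exp (t * l * y * Complex.I) * H (e + (t * l : ℝ) * Complex.I)).re) (𝓝[>] 0)
        (𝓝 (∫ t in Set.Ioc (0:ℝ) 1, (1 - t) * (Complex.exp (t * l * y * Complex.I) * H ((t * l : ℝ) * Complex.I)).re)) := by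
      have hcomp : IsCompact ((fun p : ℝ × ℝ => (p.1 : ℂ) + (p.2 : ℂ) * Complex.I) '' (Set.Icc 0 1 ×ˢ Set.Icc 0 l)) :=
        (isCompact_Icc.prod isCompact_Icc).image (by fun_prop)
      obtain ⟨B, hB⟩ := hcomp.exists_bound_of_continuousOn (hc.mono (by
        rintro _ ⟨p, hp, rfl⟩; simpa using hp.1.1))
      have hcont : ∀ e : ℝ, 0 ≤ e → Continuous (fun t : ℝ => H (e + (t * l : ℝ) * Complex.I)) := by
        intro e he
        refine hc.comp_continuous (by fun_prop) ?_
        intro t; simpa using he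
      refine tendsto_integral_filter_of_dominated_convergence (fun u => B) ?_ ?_ ?_ ?_
      · filter_upwards [self_mem_nhdsWithin] with e he
        have := hcont e (le_of_lt he)
        exact ((continuous_const.sub continuous_id).mul (Complex.continuous_re.comp ((by fun_prop : Continuous fun t : ℝ => Complex.exp (t * l * y * Complex.I)).mul this))).aestronglyMeasurable
      · filter_upwards [Ioo_mem_nhdsGT (zero_lt_one)] with e he
        filter_upwards [ae_restrict_mem measurableSet_Ioc] with t ht
        have h1 := hB (e + (t * l : ℝ) * Complex.I) ⟨(e, t * l), ⟨⟨he.1.le, he.2.le⟩, ⟨by have := ht.1; positivity, by have := ht.2; nlinarith⟩⟩, rfl⟩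
        have h2 : ‖Complex.exp (t * l * y * Complex.I)‖ = 1 := by
          have := Complex.norm_exp_ofReal_mul_I (t * l * y); simpa using this
        rw [norm_mul]
        have h3 : ‖1 - t‖ ≤ 1 := by rw [Real.norm_eq_abs, abs_le]; constructor <;> linarith [ht.1, ht.2]
        calc _ ≤ 1 * ‖Complex.exp (t * l * y * Complex.I) * H (e + (t * l : ℝ) * Complex.I)‖ := by
              gcongr; exact Complex.abs_re_le_norm _
          _ ≤ B := by rw [norm_mul, h2]; simpa using h1
      · exact integrable_const B
      · filter_upwards with t
        have h0 : Tendsto (fun e : ℝ => H (e + (t * l : ℝ) * Complex.I)) (𝓝[>] 0) (𝓝 (H ((t * l : ℝ) * Complex.I))) := by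
          have : ContinuousWithinAt (fun e : ℝ => H (e + (t * l : ℝ) * Complex.I)) (Set.Ici 0) 0 := by
            have := hc ((0:ℝ) + (t * l : ℝ) * Complex.I) (by simp)
            refine ContinuousWithinAt.comp (g := H) this (by fun_prop) ?_
            intro e he; simpa using he
          have := this.tendsto.mono_left (nhdsWithin_mono 0 Set.Ioi_subset_Ici_self)
          simpa using this
        exact ((Complex.continuous_re.tendsto _).comp (h0.const_mul _)).const_mul _
    refine tendsto_nhds_unique (L1.congr' ?_) L2
    filter_upwards [self_mem_nhdsWithin] with e he
    exact wi_fub b hb C hC H hH e he l y hl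
  simp_rw [key]
  have R := Real.tendsto_integral_exp_smul_cocompact (fun t : ℝ => Set.indicator (Set.Ioc (0:ℝ) 1) (fun t : ℝ => ((1 - t : ℝ) : ℂ) * H ((t * l : ℝ) * Complex.I)) t)
  have hT : Tendsto (fun y : ℝ => y * (-(l / (2 * Real.pi)))) atTop (cocompact ℝ) :=
    Tendsto.mono_right (tendsto_id.atTop_mul_const_of_neg (by have := Real.pi_pos; simp; positivity)) atBot_le_cocompact
  have R2 := (Complex.continuous_re.tendsto _).comp (R.comp hT)
  simp only [Complex.zero_re] at R2
  refine R2.congr fun y => ?_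
  have hcont : Continuous (fun t : ℝ => H ((t * l : ℝ) * Complex.I)) := by
    refine hc.comp_continuous (by fun_prop) ?_
    intro t; simp
  have e1 : ∀ v : ℝ, (Real.fourierChar (-(v * (y * (-(l / (2 * Real.pi)))))) • Set.indicator (Set.Ioc (0:ℝ) 1) (fun t : ℝ => ((1 - t : ℝ) : ℂ) * H ((t * l : ℝ) * Complex.I)) v : ℂ)
      = Set.indicator (Set.Ioc (0:ℝ) 1) (fun t : ℝ => ((1 - t : ℝ) : ℂ) * (Complex.exp (t * l * y * Complex.I) * H ((t * l : ℝ) * Complex.I))) v := by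
    intro v
    by_cases hv : v ∈ Set.Ioc (0:ℝ) 1
    · rw [Set.indicator_of_mem hv, Set.indicator_of_mem hv, Circle.smul_def, Real.fourierChar_apply, smul_eq_mul, mul_left_comm]
      congr 3
      have := Real.pi_ne_zero
      push_cast
      have : (Real.pi : ℂ) ≠ 0 := by exact_mod_cast this
      field_simp
    · simp [Set.indicator_of_notMem hv]
  simp only [Function.comp_apply]
  simp_rw [e1]
  rw [integral_indicator measurableSet_Ioc, ← RCLike.re_eq_complex_re, ← integral_re]
  · refine integral_congr_ae (Eventually.of_forall fun t => ?_)
    simp only [RCLike.re_eq_complex_re, Complex.re_ofReal_mul]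
  · exact Continuous.integrableOn_Ioc ((by fun_prop : Continuous fun t : ℝ => ((1 - t : ℝ) : ℂ)).mul ((by fun_prop : Continuous fun t : ℝ => Complex.exp (t * l * y * Complex.I)).mul hcont))
end

section
open Finset

open MeasureTheory Filter Topology in
lemma wi_ratio (η : ℝ) (hη : 0 < η) : ∃ l : ℝ, 0 < l ∧
    (1 - η) * (∫ v, wK (l * v)) ≤ ∫ v in Set.Icc (-η) η, wK (l * v) := by
  have h := MeasureTheory.intervalIntegral_tendsto_integral wK_int (tendsto_neg_atTop_atBot.comp (tendsto_id.atTop_mul_const hη)) (tendsto_id.atTop_mul_const hη)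
  have hp := wK_pos
  have h2 := h.eventually (lt_mem_nhds (show (1 - η) * ∫ u, wK u < ∫ u, wK u by nlinarith))
  obtain ⟨l, hl, hl0⟩ := (h2.and (eventually_gt_atTop 0)).exists
  refine ⟨l, hl0, ?_⟩
  rw [integral_Icc_eq_integral_Ioc, ← intervalIntegral.integral_of_le (by linarith),
    intervalIntegral.integral_comp_mul_left _ hl0.ne', Measure.integral_comp_mul_left, smul_eq_mul, smul_eq_mul,
    abs_of_pos (by positivity)]
  have : l * (-η) = -(l * η) := by ring
  rw [this, mul_left_comm]
  exact mul_le_mul_of_nonneg_left hl.le (by positivity)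

open MeasureTheory Filter Topology in
lemma wi_taub (B : ℝ → ℝ) (hB : Measurable B) (A C : ℝ) (hA : 0 ≤ A) (hB0 : ∀ u, 0 ≤ B u) (hC : ∀ u, B u ≤ C)
    (hm : Monotone fun u => Real.exp u * B u)
    (hlim : ∀ l : ℝ, 0 < l → Tendsto (fun y => ∫ u in Set.Ioi (0:ℝ), (B u - A) * wK (l * (u - y))) atTop (𝓝 0)) :
    Tendsto B atTop (𝓝 A) := by
  have hgrow : ∀ u v, u ≤ v → B u * Real.exp (-(v - u)) ≤ B v := by
    intro u v huv
    have h := hm huv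
    simp only at h
    have e : Real.exp (-(v - u)) = Real.exp u * (Real.exp v)⁻¹ := by
      rw [← Real.exp_neg, ← Real.exp_add]; congr 1; ring
    rw [e]
    have := Real.exp_pos v
    rw [← mul_assoc, ← div_eq_mul_inv, div_le_iff₀ this]; linarith
  have hint : ∀ l : ℝ, 0 < l → ∀ y, Integrable (fun u => wK (l * (u - y))) := fun l hl y =>
    (wK_int.comp_mul_left' hl.ne').comp_sub_right y
  have hBint : ∀ l : ℝ, 0 < l → ∀ y, Integrable (fun u => B u * wK (l * (u - y))) := fun l hl y => by
    refine ((hint l hl y).const_mul C).mono' (hB.mul (wK_meas.comp (by fun_prop))).aestronglyMeasurable ?_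
    filter_upwards with u
    rw [norm_mul, Real.norm_of_nonneg (hB0 u), Real.norm_of_nonneg (wK_nonneg _)]
    exact mul_le_mul_of_nonneg_right (hC u) (wK_nonneg _)
  have htot : ∀ l y : ℝ, ∫ u, wK (l * (u - y)) = ∫ v, wK (l * v) := fun l y =>
    integral_sub_right_eq_self (fun v => wK (l * v)) y
  have hloc : ∀ l y η : ℝ, ∫ u in Set.Icc (y - η) (y + η), wK (l * (u - y)) = ∫ v in Set.Icc (-η) η, wK (l * v) := by
    intro l y η
    rw [← integral_indicator measurableSet_Icc, ← integral_indicator measurableSet_Icc,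
      ← integral_sub_right_eq_self (fun v => Set.indicator (Set.Icc (-η) η) (fun v => wK (l * v)) v) y]
    congr 1; ext u
    simp only [Set.indicator, Set.mem_Icc]
    congr 1
    apply propext; constructor <;> rintro ⟨h1, h2⟩ <;> constructor <;> linarith
  have main : ∀ η : ℝ, 0 < η → η < 1 → ∀ᶠ y in atTop,
      B y ≤ Real.exp (2 * η) * (A + η) / (1 - η) ∧ Real.exp (-(2 * η)) * (A * (1 - η) - C * η - η) ≤ B y := by
    intro η hη hη1
    obtain ⟨l, hl, hr⟩ := wi_ratio η hη
    set k := ∫ v, wK (l * v) with hk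
    set kη := ∫ v in Set.Icc (-η) η, wK (l * v) with hkη
    have hkpos : 0 < k := by
      rw [hk, Measure.integral_comp_mul_left, smul_eq_mul, abs_of_pos (by positivity)]
      exact mul_pos (by positivity) wK_pos
    have hCn : 0 ≤ C := (hB0 0).trans (hC 0)
    have L := (hlim l hl)
    have Lu := (tendsto_atTop_add_const_right atTop η tendsto_id |> L.comp).eventually (Metric.ball_mem_nhds 0 (show 0 < η * k by positivity))
    have Ll := (tendsto_atTop_add_const_right atTop (-η) tendsto_id |> L.comp).eventually (Metric.ball_mem_nhds 0 (show 0 < η * k by positivity))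
    filter_upwards [Lu, Ll, eventually_gt_atTop (2 * η)] with y h1 h2 hy
    simp only [Function.comp, id, Metric.mem_ball, Real.dist_eq, sub_zero] at h1 h2
    have hsplit : ∀ z, ∫ u in Set.Ioi (0:ℝ), (B u - A) * wK (l * (u - z)) =
        (∫ u in Set.Ioi (0:ℝ), B u * wK (l * (u - z))) - A * ∫ u in Set.Ioi (0:ℝ), wK (l * (u - z)) := by
      intro z
      rw [← integral_const_mul, ← integral_sub (hBint l hl z).integrableOn ((hint l hl z).integrableOn.const_mul A)]
      congr 1; ext u; ring
    rw [hsplit] at h1 h2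
    constructor
    · have a1 : ∫ u in Set.Ioi (0:ℝ), wK (l * (u - (y + η))) ≤ k := by
        rw [hk, ← htot l (y + η)]
        exact setIntegral_le_integral (hint l hl _) (Eventually.of_forall fun u => wK_nonneg _)
      have a2 : B y * Real.exp (-(2 * η)) * kη ≤ ∫ u in Set.Ioi (0:ℝ), B u * wK (l * (u - (y + η))) := by
        rw [hkη, ← hloc l (y + η) η, ← integral_const_mul]
        refine le_trans ?_ (setIntegral_mono_set (s := Set.Icc (y + η - η) (y + η + η)) (hBint l hl _).integrableOn (Eventually.of_forall fun u => mul_nonneg (hB0 u) (wK_nonneg _)) (Eventually.of_forall fun u hu => ?_))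
        · refine setIntegral_mono_on ((hint l hl _).integrableOn.const_mul _) (hBint l hl _).integrableOn measurableSet_Icc fun u hu => ?_
          refine mul_le_mul_of_nonneg_right ?_ (wK_nonneg _)
          have := hgrow y u (by linarith [hu.1])
          refine le_trans (mul_le_mul_of_nonneg_left (Real.exp_le_exp.2 ?_) (hB0 y)) this
          linarith [hu.2]
        · have : u ∈ Set.Icc (y + η - η) (y + η + η) := hu
          exact lt_of_lt_of_le (by linarith) this.1
      have a3 := (abs_lt.1 h1).2
      have a4 : B y * Real.exp (-(2 * η)) * ((1 - η) * k) ≤ (A + η) * k := by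
        have : B y * Real.exp (-(2 * η)) * ((1 - η) * k) ≤ B y * Real.exp (-(2 * η)) * kη :=
          mul_le_mul_of_nonneg_left hr (mul_nonneg (hB0 y) (Real.exp_nonneg _))
        nlinarith [mul_le_mul_of_nonneg_left a1 hA]
      rw [le_div_iff₀ (by linarith)]
      have a5 : B y * Real.exp (-(2 * η)) * (1 - η) ≤ A + η := by
        by_contra hcon; push Not at hcon; nlinarith
      rw [Real.exp_neg] at a5
      have := Real.exp_pos (2 * η)
      field_simp at a5
      linarith
    · have hsub : Set.Icc (y + -η - η) (y + -η + η) ⊆ Set.Ioi 0 := fun u hu => lt_of_lt_of_le (by linarith) hu.1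
      have a1 : kη ≤ ∫ u in Set.Ioi (0:ℝ), wK (l * (u - (y + -η))) := by
        rw [hkη, ← hloc l (y + -η) η]
        exact setIntegral_mono_set (hint l hl _).integrableOn (Eventually.of_forall fun u => wK_nonneg _) (LE.le.eventuallyLE hsub)
      have a2 : ∫ u in Set.Ioi (0:ℝ), B u * wK (l * (u - (y + -η))) ≤ B y * Real.exp (2 * η) * k + C * (k - kη) := by
        have b1 : ∫ u in Set.Ioi (0:ℝ), B u * wK (l * (u - (y + -η))) ≤ ∫ u, B u * wK (l * (u - (y + -η))) :=
          setIntegral_le_integral (hBint l hl _) (Eventually.of_forall fun u => mul_nonneg (hB0 u) (wK_nonneg _))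
        have b2 := integral_add_compl (s := Set.Icc (y + -η - η) (y + -η + η)) measurableSet_Icc (hBint l hl (y + -η))
        have b3 := integral_add_compl (s := Set.Icc (y + -η - η) (y + -η + η)) measurableSet_Icc (hint l hl (y + -η))
        rw [hloc, htot] at b3
        have b4 : ∫ u in (Set.Icc (y + -η - η) (y + -η + η))ᶜ, B u * wK (l * (u - (y + -η))) ≤ C * ∫ u in (Set.Icc (y + -η - η) (y + -η + η))ᶜ, wK (l * (u - (y + -η))) := by
          rw [← integral_const_mul]
          exact integral_mono (hBint l hl _).integrableOn ((hint l hl _).integrableOn.const_mul _) fun u => mul_le_mul_of_nonneg_right (hC u) (wK_nonneg _)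
        have b5 : ∫ u in Set.Icc (y + -η - η) (y + -η + η), B u * wK (l * (u - (y + -η))) ≤ B y * Real.exp (2 * η) * kη := by
          rw [hkη, ← hloc l (y + -η) η, ← integral_const_mul]
          refine setIntegral_mono_on (hBint l hl _).integrableOn ((hint l hl _).integrableOn.const_mul _) measurableSet_Icc fun u hu => ?_
          refine mul_le_mul_of_nonneg_right ?_ (wK_nonneg _)
          have := hgrow u y (by linarith [hu.2])
          rw [Real.exp_neg] at this
          have h3 := Real.exp_pos (y - u)
          rw [← div_eq_mul_inv, div_le_iff₀ h3] at this
          refine this.trans (mul_le_mul_of_nonneg_left (Real.exp_le_exp.2 ?_) (hB0 y))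
          linarith [hu.1]
        have b6 : kη ≤ k := by
          rw [hkη, hk]; exact setIntegral_le_integral (by simpa using hint l hl 0) (Eventually.of_forall fun u => wK_nonneg _)
        have b7 : B y * Real.exp (2 * η) * kη ≤ B y * Real.exp (2 * η) * k :=
          mul_le_mul_of_nonneg_left b6 (mul_nonneg (hB0 y) (Real.exp_nonneg _))
        have b8 : ∫ u in (Set.Icc (y + -η - η) (y + -η + η))ᶜ, wK (l * (u - (y + -η))) = k - kη := by linarith
        rw [b8] at b4
        linarith
      have a3 := (abs_lt.1 h2).1
      have a4 : (A * (1 - η) - C * η - η) * k ≤ B y * Real.exp (2 * η) * k := by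
        have c1 : A * ((1 - η) * k) ≤ A * kη := mul_le_mul_of_nonneg_left hr hA
        have c2 := mul_le_mul_of_nonneg_left a1 hA
        have c3 : C * (k - kη) ≤ C * (η * k) := mul_le_mul_of_nonneg_left (by linarith) hCn
        linarith
      have a5 := le_of_mul_le_mul_right a4 hkpos
      have h3 := Real.exp_pos (2 * η)
      rw [Real.exp_neg, inv_mul_le_iff₀ h3]; linarith
  have t1 : Tendsto (fun η : ℝ => Real.exp (2 * η) * (A + η) / (1 - η)) (𝓝[>] 0) (𝓝 A) := by
    have : ContinuousAt (fun η : ℝ => Real.exp (2 * η) * (A + η) / (1 - η)) 0 := by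
      apply ContinuousAt.div <;> first | fun_prop | simp
    simpa using this.tendsto.mono_left nhdsWithin_le_nhds
  have t2 : Tendsto (fun η : ℝ => Real.exp (-(2 * η)) * (A * (1 - η) - C * η - η)) (𝓝[>] 0) (𝓝 A) := by
    have : ContinuousAt (fun η : ℝ => Real.exp (-(2 * η)) * (A * (1 - η) - C * η - η)) 0 := by fun_prop
    simpa using this.tendsto.mono_left nhdsWithin_le_nhds
  rw [Metric.tendsto_nhds]
  intro ε hε
  obtain ⟨η, ⟨⟨h1, h2⟩, h3⟩⟩ := (((t1.eventually (gt_mem_nhds (show A < A + ε by linarith))).and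
    (t2.eventually (lt_mem_nhds (show A - ε < A by linarith)))).and (Ioo_mem_nhdsGT (zero_lt_one' ℝ))).exists
  filter_upwards [main η h3.1 h3.2] with y hy
  rw [Real.dist_eq, abs_lt]; constructor <;> linarith [hy.1, hy.2]
end

section
open Finset

open MeasureTheory Filter Topology ArithmeticFunction in
lemma psi_ap (q : ℕ) [NeZero q] (a : ZMod q) (ha : IsUnit a) :
    Tendsto (fun x : ℕ => (∑ k ∈ Icc 1 x, vonMangoldt.residueClass a k) / x) atTop (𝓝 ((q.totient : ℝ)⁻¹)) := by
  set f := vonMangoldt.residueClass a with hf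
  have hf0 : ∀ n, 0 ≤ f n := vonMangoldt.residueClass_nonneg a
  set Ψ : ℝ → ℝ := fun t => ∑ k ∈ Icc 1 ⌊t⌋₊, f k with hΨ
  have hΨm : Monotone Ψ := fun s t hst => sum_le_sum_of_subset_of_nonneg
    (Icc_subset_Icc le_rfl (Nat.floor_le_floor hst)) fun k _ _ => hf0 k
  have hΨ0 : ∀ t, 0 ≤ Ψ t := fun t => sum_nonneg fun k _ => hf0 k
  have hΨC : ∀ t : ℝ, 0 ≤ t → Ψ t ≤ (Real.log 4 + 4) * t := by
    intro t ht
    refine le_trans ?_ (Chebyshev.psi_le_const_mul_self ht)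
    exact sum_le_sum fun k _ => vonMangoldt.residueClass_le a k
  set A : ℝ := (q.totient : ℝ)⁻¹ with hA
  set B : ℝ → ℝ := fun u => Real.exp (-u) * Ψ (Real.exp u) with hB
  have hBm : Measurable B := (by fun_prop : Measurable fun u : ℝ => Real.exp (-u)).mul (hΨm.measurable.comp Real.measurable_exp)
  have hB0 : ∀ u, 0 ≤ B u := fun u => mul_nonneg (Real.exp_nonneg _) (hΨ0 _)
  have hBC : ∀ u, B u ≤ Real.log 4 + 4 := by
    intro u
    have := hΨC (Real.exp u) (Real.exp_nonneg _)
    simp only [hB, Real.exp_neg]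
    rw [inv_mul_le_iff₀ (Real.exp_pos u)]; linarith
  have hA0 : 0 ≤ A := by positivity
  set G := vonMangoldt.LFunctionResidueClassAux a with hG
  have hO : (fun n : ℕ => ∑ k ∈ Icc 1 n, f k) =O[atTop] fun n : ℕ => (n : ℝ) ^ (1:ℝ) := by
    refine Asymptotics.IsBigO.of_bound (Real.log 4 + 4) (Eventually.of_forall fun n => ?_)
    rw [Real.norm_of_nonneg (sum_nonneg fun k _ => hf0 k), Real.rpow_one, Real.norm_of_nonneg (Nat.cast_nonneg n)]
    simpa [hΨ] using hΨC n (Nat.cast_nonneg n)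
  have hBt : Tendsto B atTop (𝓝 A) := by
    refine wi_taub B hBm A (Real.log 4 + 4) hA0 hB0 hBC ?_ ?_
    · intro u v huv
      simp only [hB]
      rw [← mul_assoc, ← mul_assoc, ← Real.exp_add, ← Real.exp_add]
      simpa using hΨm (Real.exp_le_exp.2 huv)
    · refine fun l hl => wi_lim (fun u => B u - A) (hBm.sub_const A) (Real.log 4 + 4 + A) ?_ (fun z => (G (1 + z) - A) / (1 + z)) ?_ ?_ l hl
      · intro u
        have h1 := hB0 u
        have h2 := hBC u
        rw [abs_le]; constructor <;> linarith
      · refine ContinuousOn.div ?_ (by fun_prop) ?_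
        · refine ContinuousOn.sub ?_ continuousOn_const
          refine (vonMangoldt.continuousOn_LFunctionResidueClassAux a).comp (by fun_prop) ?_
          intro z hz; simpa using hz
        · intro z hz h0
          have := congrArg Complex.re h0
          simp at this hz; linarith
      · intro e he t
        set z : ℂ := e + t * Complex.I with hz
        have hzre : z.re = e := by simp [hz]
        have hz0 : z ≠ 0 := fun h => by rw [h] at hzre; simp at hzre; linarith
        have hz1 : 1 + z ≠ 0 := fun h => by have := congrArg Complex.re h; simp [hzre] at this; linarith
        have hre : 1 < (1 + z).re := by simp [hzre, he]
        have h1 := vonMangoldt.eqOn_LFunctionResidueClassAux ha (x := 1 + z) hre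
        have h2 := LSeries_eq_mul_integral_of_nonneg f zero_le_one hre hO hf0
        have himg : Set.Ioi (1:ℝ) = Real.exp '' Set.Ioi 0 := by
          ext x; constructor
          · intro hx; exact ⟨Real.log x, Real.log_pos hx, Real.exp_log (by linarith [Set.mem_Ioi.1 hx])⟩
          · rintro ⟨u, hu, rfl⟩; exact Real.one_lt_exp_iff.2 hu
        have h3 : ∫ x in Set.Ioi (1:ℝ), (∑ k ∈ Icc 1 ⌊x⌋₊, (f k : ℂ)) * (x:ℂ) ^ (-(1 + z + 1)) =
            ∫ u in Set.Ioi (0:ℝ), (B u : ℂ) * Complex.exp (-(z * u)) := by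
          rw [himg, integral_image_eq_integral_abs_deriv_smul measurableSet_Ioi (fun x _ => (Real.hasDerivAt_exp x).hasDerivWithinAt) Real.exp_injective.injOn]
          refine integral_congr_ae (Eventually.of_forall fun u => ?_)
          simp only [hB, hΨ]
          rw [abs_of_pos (Real.exp_pos u), Complex.cpow_def_of_ne_zero (by exact_mod_cast (Real.exp_pos u).ne'),
            ← Complex.ofReal_log (Real.exp_nonneg u), Real.log_exp, Complex.real_smul]
          push_cast
          rw [mul_left_comm, ← Complex.exp_add, mul_right_comm, ← Complex.exp_add, mul_comm]
          congr 2; ring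
        have h4 := integral_exp_mul_complex_Ioi (a := -z) (by simp [hzre, he]) 0
        simp only [Complex.ofReal_zero, mul_zero, Complex.exp_zero] at h4
        have hi : IntegrableOn (fun u : ℝ => Complex.exp (-(z * u))) (Set.Ioi 0) := by
          simpa using integrableOn_exp_mul_complex_Ioi (a := -z) (by simp [hzre, he]) 0
        have h5 : ∫ u in Set.Ioi (0:ℝ), ((B u - A : ℝ) : ℂ) * Complex.exp (-(z * u)) =
            (∫ u in Set.Ioi (0:ℝ), (B u : ℂ) * Complex.exp (-(z * u))) - A * (-1 / -z) := by
          rw [← h4]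
          simp only [neg_mul]
          rw [← integral_const_mul, ← integral_sub]
          · congr 1; ext u; push_cast; ring
          · refine (hi.norm.const_mul (Real.log 4 + 4)).mono' (((Complex.measurable_ofReal.comp hBm).mul (by fun_prop)).aestronglyMeasurable) ?_
            filter_upwards with u
            rw [norm_mul, Complex.norm_real, Real.norm_of_nonneg (hB0 u)]
            exact mul_le_mul_of_nonneg_right (hBC u) (norm_nonneg _)
          · exact hi.const_mul _
        rw [h5, ← h3]
        have h6 : G (1 + z) = (1 + z) * (∫ x in Set.Ioi (1:ℝ), (∑ k ∈ Icc 1 ⌊x⌋₊, (f k : ℂ)) * (x:ℂ) ^ (-(1 + z + 1))) - A / z := by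
          rw [hG, h1, ← h2]; simp [hA]; rfl
        rw [h6]; field_simp; ring
  have := hBt.comp (Real.tendsto_log_atTop.comp tendsto_natCast_atTop_atTop)
  refine this.congr' ?_
  filter_upwards [eventually_gt_atTop 0] with n hn
  have : (0:ℝ) < n := by exact_mod_cast hn
  simp only [Function.comp, hB, hΨ, Real.exp_neg, Real.exp_log this, Nat.floor_natCast]
  field_simp

def pc (q a x : ℕ) : ℕ := #((Ioc 0 x).filter fun p => p.Prime ∧ p % q = a % q)

open Filter Topology ArithmeticFunction in
lemma pnt_ap (q a : ℕ) (hq : 0 < q) (ha : a.Coprime q) :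
    Tendsto (fun x : ℕ => (pc q a x : ℝ) * Real.log x / x) atTop (𝓝 ((q.totient : ℝ)⁻¹)) := by
  haveI : NeZero q := ⟨hq.ne'⟩
  have hP := psi_ap q (a : ZMod q) ((ZMod.isUnit_iff_coprime a q).2 ha)
  set f := vonMangoldt.residueClass (a : ZMod q) with hf
  have hf0 : ∀ n, 0 ≤ f n := vonMangoldt.residueClass_nonneg _
  have hfp : ∀ n, n.Prime → n % q = a % q → f n = Real.log n := by
    intro n hn h
    have : (n : ZMod q) = a := (ZMod.natCast_eq_natCast_iff' n a q).2 h
    simp [hf, vonMangoldt.residueClass, Set.indicator, this, vonMangoldt_apply_prime hn]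
  have hfn : ∀ n, n % q ≠ a % q → f n = 0 := by
    intro n h
    have : ¬ (n : ZMod q) = a := fun h' => h ((ZMod.natCast_eq_natCast_iff' n a q).1 h')
    simp [hf, vonMangoldt.residueClass, Set.indicator, this]
  have hlog : Tendsto (fun x : ℕ => Real.log x) atTop atTop := Real.tendsto_log_atTop.comp tendsto_natCast_atTop_atTop
  have hIcc : ∀ x, Icc 1 x = Ioc 0 x := fun x => by ext; simp; omega
  -- lower
  have hlow : ∀ᶠ x : ℕ in atTop, (∑ k ∈ Icc 1 x, f k) / x - 2 * Real.log x / Real.sqrt x ≤ (pc q a x : ℝ) * Real.log x / x := by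
    filter_upwards [eventually_gt_atTop 0] with x hx
    have hx' : (0:ℝ) < x := by exact_mod_cast hx
    have hx1 : (1:ℝ) ≤ x := by exact_mod_cast hx
    have h1 : (∑ k ∈ Icc 1 x, f k) ≤ pc q a x * Real.log x + (Chebyshev.psi x - Chebyshev.theta x) := by
      rw [Chebyshev.psi_sub_theta_eq_sum_not_prime, hIcc, pc, ← nsmul_eq_mul, ← sum_const, Nat.floor_natCast, sum_filter, sum_filter, ← sum_add_distrib]
      refine sum_le_sum fun n hn => ?_
      have hn' := mem_Ioc.1 hn
      have hL : Real.log n ≤ Real.log x := Real.log_le_log (by exact_mod_cast hn'.1) (by exact_mod_cast hn'.2)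
      have hL0 : 0 ≤ Real.log n := Real.log_natCast_nonneg n
      by_cases hp : n.Prime
      · by_cases hc : n % q = a % q
        · simp [hp, hc, hfp n hp hc, hL]
        · simp [hp, hc, hfn n hc]
      · simp [hp]; exact vonMangoldt.residueClass_le _ n
    have h2 := (abs_le.1 (Chebyshev.abs_psi_sub_theta_le_sqrt_mul_log hx1)).2
    have h3 : 2 * Real.log x / Real.sqrt x = 2 * Real.sqrt x * Real.log x / x := by
      have := Real.sq_sqrt hx'.le
      have h0 := Real.sqrt_pos.2 hx'
      rw [div_eq_div_iff h0.ne' hx'.ne']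
      linear_combination (-2 * Real.log x) * this
    rw [h3, div_sub_div_same]
    gcongr; linarith
  have hup : ∀ᶠ x : ℕ in atTop, (pc q a x : ℝ) * Real.log x / x ≤ 1 / Real.log x + (∑ k ∈ Icc 1 x, f k) / x * (Real.log x / (Real.log x - 2 * Real.log (Real.log x))) := by
    have hd : ∀ᶠ x : ℕ in atTop, 0 < Real.log x - 2 * Real.log (Real.log x) := by
      have : ∀ᶠ y : ℝ in atTop, 0 < y - 2 * Real.log y := by
        have := Real.isLittleO_log_id_atTop.bound (show (0:ℝ) < 1/4 by norm_num)
        filter_upwards [this, eventually_gt_atTop 1] with y hy hy1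
        rw [Real.norm_of_nonneg (Real.log_nonneg hy1.le), id, Real.norm_of_nonneg (by linarith)] at hy
        linarith
      exact hlog.eventually this
    filter_upwards [eventually_gt_atTop 0, hd, hlog.eventually_gt_atTop 1] with x hx hd hl
    have hx' : (0:ℝ) < x := by exact_mod_cast hx
    set L := Real.log x with hL
    have hL2 : 0 < Real.log L := Real.log_pos hl
    set d := L - 2 * Real.log L with hdd
    have h1 : (pc q a x : ℝ) ≤ x / L ^ 2 + (∑ k ∈ Icc 1 x, f k) / d := by
      have hs : (Ioc 0 x).filter (fun p => p.Prime ∧ p % q = a % q) ⊆ Ioc 0 ⌊x / L ^ 2⌋₊ ∪ (Ioc 0 x).filter (fun p : ℕ => (p.Prime ∧ p % q = a % q) ∧ x / L ^ 2 < p) := by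
        intro p hp
        rw [mem_filter] at hp
        rw [mem_union]
        by_cases h : (p:ℝ) ≤ x / L ^ 2
        · left; rw [mem_Ioc]; exact ⟨(mem_Ioc.1 hp.1).1, Nat.le_floor h⟩
        · right; rw [mem_filter]; exact ⟨hp.1, hp.2, not_le.1 h⟩
      have h2 : (pc q a x : ℝ) ≤ (⌊x / L ^ 2⌋₊ : ℝ) + #((Ioc 0 x).filter (fun p : ℕ => (p.Prime ∧ p % q = a % q) ∧ x / L ^ 2 < p)) := by
        have := (card_le_card hs).trans (card_union_le _ _)
        rw [Nat.card_Ioc, Nat.sub_zero] at this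
        unfold pc
        exact_mod_cast this
      refine h2.trans (add_le_add (Nat.floor_le (by positivity)) ?_)
      rw [le_div_iff₀ hd, ← nsmul_eq_mul, ← sum_const, sum_filter, hIcc]
      refine sum_le_sum fun n hn => ?_
      split_ifs with h
      · rw [hfp n h.1.1 h.1.2, hdd]
        have : Real.log (x / L ^ 2) ≤ Real.log n := Real.log_le_log (by positivity) h.2.le
        rw [Real.log_div hx'.ne' (by positivity), Real.log_pow] at this
        push_cast at this; linarith
      · exact hf0 n
    have h3 : (pc q a x : ℝ) * L / x ≤ (x / L ^ 2 + (∑ k ∈ Icc 1 x, f k) / d) * L / x := by gcongr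
    refine h3.trans (le_of_eq ?_)
    have : L ≠ 0 := by positivity
    field_simp
  have t1 : Tendsto (fun x : ℕ => 2 * Real.log x / Real.sqrt x) atTop (𝓝 0) := by
    have h := (isLittleO_log_rpow_atTop (show (0:ℝ) < 1/2 by norm_num)).tendsto_div_nhds_zero
    have h2 := (h.comp tendsto_natCast_atTop_atTop).const_mul 2
    simp only [mul_zero] at h2
    refine h2.congr fun x => ?_
    simp [Real.sqrt_eq_rpow, mul_div_assoc]
  have t2 : Tendsto (fun x : ℕ => 1 / Real.log x) atTop (𝓝 0) := by
    simp only [one_div]; exact hlog.inv_tendsto_atTop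
  have t3 : Tendsto (fun x : ℕ => (Real.log x / (Real.log x - 2 * Real.log (Real.log x)))) atTop (𝓝 1) := by
    have : Tendsto (fun y : ℝ => y / (y - 2 * Real.log y)) atTop (𝓝 1) := by
      have h := Real.isLittleO_log_id_atTop.tendsto_div_nhds_zero
      have h2 := ((h.const_mul 2).const_sub 1).inv₀ (by norm_num)
      simp only [mul_zero, sub_zero, inv_one] at h2
      refine h2.congr' ?_
      filter_upwards [eventually_gt_atTop 0] with y hy
      simp only [id]
      rw [← one_div, ← div_div_div_cancel_right₀ hy.ne' y, div_self hy.ne']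
      congr 1; field_simp
    exact this.comp hlog
  have T1 := hP.sub t1
  have T2 := t2.add (hP.mul t3)
  simp only [sub_zero, zero_add, mul_one] at T1 T2
  exact tendsto_of_tendsto_of_tendsto_of_le_of_le' T1 T2 hlow hup
end

section
open Finset

section pol
variable {p : ℕ} [hp : Fact p.Prime]

def rp (A B : Finset (ZMod p)) (s : ZMod p) : ℕ := #(B.filter fun b => s - b ∈ A)

lemma rp_sum (A B : Finset (ZMod p)) : ∑ s, rp A B s = #A * #B := by
  unfold rp
  simp_rw [card_filter]
  rw [sum_comm]
  have : ∀ b ∈ B, ∑ s, (if s - b ∈ A then 1 else 0) = #A := by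
    intro b _
    rw [← Equiv.sum_comp (Equiv.addRight b)]
    simp
  rw [sum_congr rfl this]; simp [mul_comm]

lemma rp_le (A B : Finset (ZMod p)) (s : ZMod p) : rp A B s ≤ #B := card_filter_le _ _

lemma rp_union_right (A B C : Finset (ZMod p)) (h : Disjoint B C) (s : ZMod p) :
    rp A (B ∪ C) s = rp A B s + rp A C s := by
  unfold rp; rw [filter_union, card_union_of_disjoint (disjoint_filter_filter h)]

lemma rp_comm (A B : Finset (ZMod p)) (s : ZMod p) : rp A B s = rp B A s := by
  unfold rp
  refine card_bij (fun b _ => s - b) ?_ ?_ ?_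
  · intro b hb; simp only [mem_filter] at *; simp [hb.1, hb.2]
  · intro a _ b _ h; simpa using h
  · intro a ha; simp only [mem_filter] at *; exact ⟨s - a, by simp [ha.1, ha.2], by simp⟩

lemma rp_dyson (A B : Finset (ZMod p)) (s : ZMod p) :
    rp A B s = rp (A \ B) (B \ A) s + rp (A ∪ B) (A ∩ B) s := by
  have h1 : rp A B s = rp A (A ∩ B) s + rp A (B \ A) s := by
    rw [← rp_union_right]
    · congr 1; ext x; simp; tauto
    · rw [disjoint_left]; intro x; simp; tauto
  have h2 : rp A (B \ A) s = rp (A \ B) (B \ A) s + rp (A ∩ B) (B \ A) s := by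
    rw [rp_comm A, rp_comm (A \ B), rp_comm (A ∩ B), ← rp_union_right]
    · congr 1; ext x; simp; tauto
    · rw [disjoint_left]; intro x; simp; tauto
  have h3 : rp (A ∪ B) (A ∩ B) s = rp A (A ∩ B) s + rp (A ∩ B) (B \ A) s := by
    rw [rp_comm (A ∪ B), rp_comm A, ← rp_union_right]
    · congr 1; ext x; simp
    · rw [disjoint_left]; intro x; simp; tauto
  omega

lemma exists_shift (A B : Finset (ZMod p)) (hA : A.Nonempty) (hA' : A ≠ univ) (hB : 1 < #B) :
    ∃ e : ZMod p, (A ∩ B.image (· + e)).Nonempty ∧ ¬ B.image (· + e) ⊆ A := by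
  by_contra hcon
  push Not at hcon
  obtain ⟨b, hb, c, hc, hbc⟩ := one_lt_card.1 hB
  have step : ∀ a ∈ A, a + (c - b) ∈ A := by
    intro a ha
    have := hcon (a - b) ⟨a, by rw [mem_inter]; exact ⟨ha, mem_image.2 ⟨b, hb, by ring⟩⟩⟩
    have h2 := this (mem_image.2 ⟨c, hc, rfl⟩)
    convert h2 using 1; ring
  obtain ⟨a, ha⟩ := hA
  have all : ∀ n : ℕ, a + n * (c - b) ∈ A := by
    intro n
    induction n with
    | zero => simpa using ha
    | succ n ih => have := step _ ih; push_cast; convert this using 1; ring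
  apply hA'
  ext x
  simp only [mem_univ, iff_true]
  have hne : c - b ≠ 0 := sub_ne_zero.2 (Ne.symm hbc)
  have := all ((x - a) / (c - b)).val
  rw [ZMod.natCast_val, ZMod.cast_id, div_mul_cancel₀ _ hne] at this
  simpa using this

lemma pollard_aux (n : ℕ) : ∀ (A B : Finset (ZMod p)) (t : ℕ), #B ≤ n → t ≤ #A → t ≤ #B → #A + #B ≤ p + t →
    t * (#A + #B) ≤ (∑ s, min t (rp A B s)) + t * t := by
  induction n using Nat.strong_induction_on with
  | _ n ih =>
  intro A B t hn htA htB hs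
  rcases eq_or_lt_of_le htB with h | h
  · have : ∀ s ∈ (univ : Finset (ZMod p)), min t (rp A B s) = rp A B s := fun s _ => min_eq_right (by rw [h]; exact rp_le A B s)
    rw [sum_congr rfl this, rp_sum, h]; nlinarith
  rcases Nat.eq_zero_or_pos t with h0 | h0
  · simp [h0]
  have hA : A.Nonempty := card_pos.1 (by omega)
  have hA' : A ≠ univ := by
    rintro rfl
    rw [card_univ, ZMod.card] at hs; omega
  obtain ⟨e, he1, he2⟩ := exists_shift A B hA hA' (by omega)
  set B' := B.image (· + e) with hB'
  have hc : #B' = #B := card_image_of_injective _ (add_left_injective e)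
  have hN : ∑ s, min t (rp A B s) = ∑ s, min t (rp A B' s) := by
    rw [← Equiv.sum_comp (Equiv.addRight e) (fun s => min t (rp A B' s))]
    refine sum_congr rfl fun s _ => ?_
    congr 1
    unfold rp
    rw [hB', filter_image, card_image_of_injective _ (add_left_injective e)]
    simp
  rw [hN, ← hc]
  rw [← hc] at hs h
  have hun := card_union_add_card_inter A B'
  have hk : 0 < #(A ∩ B') := he1.card_pos
  have hk2 : #(A ∩ B') < #B' := by
    refine card_lt_card (ssubset_of_subset_of_ne inter_subset_right fun h => he2 ?_)
    rw [← h]; exact inter_subset_left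
  rcases le_or_gt t #(A ∩ B') with h1 | h1
  · have := ih #(A ∩ B') (by omega) (A ∪ B') (A ∩ B') t le_rfl (by omega) h1 (by omega)
    rw [hun] at this
    refine this.trans (Nat.add_le_add_right (sum_le_sum fun s _ => min_le_min_left _ ?_) _)
    rw [rp_dyson A B' s]; omega
  · have hd1 : #(A \ B') + #(A ∩ B') = #A := card_sdiff_add_card_inter A B'
    have hd2 : #(B' \ A) + #(A ∩ B') = #B' := by rw [inter_comm]; exact card_sdiff_add_card_inter B' A
    obtain ⟨d, hd⟩ := Nat.exists_eq_add_of_lt h1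
    have := ih #(B' \ A) (by omega) (A \ B') (B' \ A) (d + 1) le_rfl (by omega) (by omega) (by omega)
    have h3 : (∑ s, min (d + 1) (rp (A \ B') (B' \ A) s)) + #(A ∪ B') * #(A ∩ B') ≤ ∑ s, min t (rp A B' s) := by
      rw [← rp_sum, ← sum_add_distrib]
      refine sum_le_sum fun s _ => ?_
      have := rp_dyson A B' s
      have := rp_le (A ∪ B') (A ∩ B') s
      omega
    set k := #(A ∩ B')
    subst hd
    have e1 : #(A ∪ B') = #(A \ B') + #(B' \ A) + k := by omega
    rw [e1] at h3
    rw [← hd1, ← hd2]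
    nlinarith

lemma rp_mono (A A' B : Finset (ZMod p)) (h : A ⊆ A') (s : ZMod p) : rp A B s ≤ rp A' B s :=
  card_le_card fun x hx => by rw [mem_filter] at *; exact ⟨hx.1, h hx.2⟩

lemma pollard (A B : Finset (ZMod p)) (t : ℕ) (htA : t ≤ #A) (htB : t ≤ #B) :
    t * min (p + t) (#A + #B) ≤ (∑ s, min t (rp A B s)) + t * t := by
  rcases le_total (#A + #B) (p + t) with h | h
  · rw [min_eq_right h]; exact pollard_aux _ A B t le_rfl htA htB h
  · have hB : #B ≤ p := by simpa [ZMod.card] using card_le_univ B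
    obtain ⟨A', hA', hc⟩ := exists_subset_card_eq (show p + t - #B ≤ #A by omega)
    have := pollard_aux _ A' B t le_rfl (by omega) htB (by omega)
    rw [hc, Nat.sub_add_cancel (by omega)] at this
    rw [min_eq_left h]
    exact this.trans (Nat.add_le_add_right (sum_le_sum fun s _ => min_le_min_left _ (rp_mono _ _ _ hA' s)) _)

lemma pollard3 (A B C : Finset (ZMod p)) (n : ZMod p) (t : ℕ) (htA : t ≤ #A) (htB : t ≤ #B) (htC : t ≤ #C)
    (h : p + 2 * t ≤ #A + #B + #C) :
    t * t ≤ ∑ s, if n - s ∈ C then rp A B s else 0 := by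
  have h1 := pollard A B t htA htB
  have hC : #(univ.filter fun s : ZMod p => n - s ∈ C) = #C := by
    refine card_bij (fun b _ => n - b) ?_ ?_ ?_
    · intro b hb; simpa using hb
    · intro a _ b _ h; simpa using h
    · intro a ha; exact ⟨n - a, by simpa using ha, by simp⟩
  have h2 : ∑ s, min t (rp A B s) ≤ (∑ s, if n - s ∈ C then rp A B s else 0) + t * (p - #C) := by
    have : t * (p - #C) = ∑ s : ZMod p, if n - s ∈ C then 0 else t := by
      rw [sum_ite, sum_const_zero, zero_add, sum_const, smul_eq_mul, mul_comm]
      congr 1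
      have := card_filter_add_card_filter_not (s := (univ : Finset (ZMod p))) (fun s : ZMod p => n - s ∈ C)
      rw [card_univ, ZMod.card, hC] at this; omega
    rw [this, ← sum_add_distrib]
    refine sum_le_sum fun s _ => ?_
    split_ifs <;> simp
  have hCp : #C ≤ p := by simpa [ZMod.card] using card_le_univ C
  obtain ⟨d, hd⟩ := Nat.exists_eq_add_of_le hCp
  have e : p - #C = d := by omega
  rw [e] at h2
  have h3 : d + 2 * t ≤ min (p + t) (#A + #B) := by
    rw [le_min_iff]; constructor <;> omega
  have h4 := Nat.mul_le_mul_left t h3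
  nlinarith
end pol
end

section
open Finset

def LGood (R : Type) [CommRing R] [Fintype Rˣ] (n : R) : Prop := ∀ f g h : R → ℝ, ∃ x y z : Rˣ,
  (x + y + z : R) = n ∧ ∑ u : Rˣ, (f u + g u + h u) ≤ Fintype.card Rˣ * (f x + g y + h z)

lemma LGood.equiv {R S : Type} [CommRing R] [Fintype Rˣ] [CommRing S] [Fintype Sˣ] (e : R ≃+* S) (n : R)
    (hg : LGood S (e n)) : LGood R n := by
  intro f g h
  obtain ⟨x, y, z, h1, h2⟩ := hg (f ∘ e.symm) (g ∘ e.symm) (h ∘ e.symm)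
  refine ⟨Units.mapEquiv e.symm.toMulEquiv x, Units.mapEquiv e.symm.toMulEquiv y, Units.mapEquiv e.symm.toMulEquiv z, ?_, ?_⟩
  · have := congrArg e.symm h1
    simpa using this
  · rw [Fintype.card_congr (Units.mapEquiv e.toMulEquiv).toEquiv,
      ← Equiv.sum_comp (Units.mapEquiv e.symm.toMulEquiv).toEquiv]
    simpa using h2

lemma LGood.prod {R S : Type} [CommRing R] [Fintype Rˣ] [CommRing S] [Fintype Sˣ] [Fintype (R × S)ˣ] (n : R × S)
    (h1 : LGood R n.1) (h2 : LGood S n.2) : LGood (R × S) n := by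
  intro f g h
  obtain ⟨x, y, z, a1, a2⟩ := h1 (fun r => ∑ s : Sˣ, f (r, s)) (fun r => ∑ s : Sˣ, g (r, s)) (fun r => ∑ s : Sˣ, h (r, s))
  obtain ⟨x', y', z', b1, b2⟩ := h2 (fun s => f (x, s)) (fun s => g (y, s)) (fun s => h (z, s))
  refine ⟨MulEquiv.prodUnits.symm (x, x'), MulEquiv.prodUnits.symm (y, y'), MulEquiv.prodUnits.symm (z, z'), ?_, ?_⟩
  · have e : ∀ (u : Rˣ) (v : Sˣ), ((MulEquiv.prodUnits.symm (u, v) : (R × S)ˣ) : R × S) = (↑u, ↑v) := fun _ _ => rfl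
    ext <;> simp [e, a1, b1]
  · rw [Fintype.card_congr MulEquiv.prodUnits.toEquiv, Fintype.card_prod,
      ← Equiv.sum_comp MulEquiv.prodUnits.symm.toEquiv, Fintype.sum_prod_type]
    simp only [← sum_add_distrib] at a2
    push_cast
    have := mul_le_mul_of_nonneg_left b2 (Nat.cast_nonneg (α := ℝ) (Fintype.card Rˣ))
    have e : ∀ (u : Rˣ) (v : Sˣ), ((MulEquiv.prodUnits.symm (u, v) : (R × S)ˣ) : R × S) = (↑u, ↑v) := fun _ _ => rfl
    simp only [MulEquiv.coe_toEquiv, MulEquiv.toEquiv_eq_coe, EquivLike.coe_coe, e]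
    linarith

lemma LGood_two : LGood (ZMod 2) 1 := by
  intro f g h
  refine ⟨1, 1, 1, by decide, ?_⟩
  simp [Subsingleton.elim _ (1 : (ZMod 2)ˣ)]

lemma sum_units_eq {p : ℕ} [Fact p.Prime] (f : ZMod p → ℝ) :
    ∑ u : (ZMod p)ˣ, f u = ∑ x : ZMod p, if x ≠ 0 then f x else 0 := by
  rw [← sum_filter]
  refine sum_bij (fun u _ => (u : ZMod p)) ?_ ?_ ?_ ?_
  · intro u _; simp
  · intro u _ v _ h; exact Units.ext h
  · intro x hx; exact ⟨Units.mk0 x (mem_filter.1 hx).2, mem_univ _, rfl⟩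
  · intro u _; rfl

lemma marg {p : ℕ} [Fact p.Prime] (n x : ZMod p) (hx : x ≠ 0) (a : ℝ) (ha : (n = 0 ∧ a = 0) ∨ (n ≠ 0 ∧ a * (p - 1) = 1)) :
    ∑ y : ZMod p, (if y ≠ 0 ∧ n - x - y ≠ 0 then
      (1 - a * ((if x = n then 1 else 0) + (if y = n then 1 else 0) + (if n - x - y = n then 1 else 0))) else 0) = p - 2 - 2 * a := by
  have e : ∀ y : ZMod p, (if y ≠ 0 ∧ n - x - y ≠ 0 then
      (1 - a * ((if x = n then 1 else 0) + (if y = n then 1 else 0) + (if n - x - y = n then 1 else 0))) else 0)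
      = (1 - a * (if x = n then 1 else 0)) * (1 - (if y = 0 then 1 else 0) - (if y = n - x then (if x = n then 0 else 1) else 0))
        - a * (if y = n then (if n = 0 then 0 else 1) else 0) - a * (if y = -x then (if n = 0 then 0 else 1) else 0) := by
    intro y
    have h1 : n - x - y = 0 ↔ y = n - x := ⟨fun h => by linear_combination -h, fun h => by rw [h]; ring⟩
    have h2 : n - x - y = n ↔ y = -x := ⟨fun h => by linear_combination -h, fun h => by rw [h]; ring⟩
    have h3 : -x = n - x ↔ n = 0 := ⟨fun h => by linear_combination -h, fun h => by rw [h]; ring⟩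
    have h4 : n - x = 0 ↔ x = n := ⟨fun h => by linear_combination -h, fun h => by rw [h]; ring⟩
    have h5 : n - x = n ↔ x = 0 := by simp
    simp only [ne_eq, h1, h2]
    by_cases y0 : y = 0
    · subst y0
      have h6 : (0 = -x) ↔ False := by simp [eq_comm, hx]
      have h7 : (0 = n - x) ↔ x = n := by rw [eq_comm, h4]
      simp only [h6, h7, not_true_eq_false, false_and, if_false, if_true]
      by_cases hn : n = 0
      · subst hn; simp [hx]
      · by_cases hxn : x = n <;> simp [hxn, hn, Ne.symm hn]
    · by_cases y1 : y = n - x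
      · subst y1
        simp only [h5, h4, hx] at *
        simp [y0, eq_comm (a := n - x), h3]; tauto
      · by_cases y2 : y = n
        · subst y2; simp [y0, y1]
          by_cases h : y = -x
          · rw [← h]; simp; try split_ifs <;> ring
          · simp [h]; try split_ifs <;> ring
        · by_cases y3 : y = -x
          · subst y3; rw [h3] at y1; simp [h3, y1, y2, hx]; try split_ifs <;> ring
          · simp [y0, y1, y2, y3]
  rw [sum_congr rfl fun y _ => e y]
  simp only [sum_sub_distrib, ← mul_sum, sum_ite_eq', mem_univ, if_true, sum_const, card_univ, ZMod.card, nsmul_eq_mul, mul_one]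
  by_cases hxn : x = n
  · subst hxn; simp [hx]
    rcases ha with ⟨h, _⟩ | ⟨_, h⟩
    · exact absurd h hx
    · linarith
  · simp [hxn]
    by_cases hn : n = 0
    · have : a = 0 := by tauto
      simp [hn, this]; ring
    · simp [hn]; ring

lemma LGood_prime (p : ℕ) [hp : Fact p.Prime] (h5 : 5 ≤ p) (n : ZMod p) : LGood (ZMod p) n := by
  intro f g h
  obtain ⟨a, ha⟩ : ∃ a : ℝ, (n = 0 ∧ a = 0) ∨ (n ≠ 0 ∧ a * (p - 1) = 1) := by
    by_cases hn : n = 0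
    · exact ⟨0, by tauto⟩
    · refine ⟨1 / (p - 1), Or.inr ⟨hn, ?_⟩⟩
      have : (5:ℝ) ≤ p := by exact_mod_cast h5
      have : (p - 1 : ℝ) ≠ 0 := by linarith
      field_simp
  have h5' : (5:ℝ) ≤ p := by exact_mod_cast h5
  have ha0 : 0 ≤ a ∧ a ≤ 1/4 := by
    rcases ha with ⟨_, h⟩ | ⟨_, h⟩
    · rw [h]; norm_num
    · constructor <;> nlinarith
  set w : ZMod p → ZMod p → ℝ := fun x y => if x ≠ 0 then (if y ≠ 0 ∧ n - x - y ≠ 0 then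
      (1 - a * ((if x = n then 1 else 0) + (if y = n then 1 else 0) + (if n - x - y = n then 1 else 0))) else 0) else 0 with hw
  have hw0 : ∀ x y, 0 ≤ w x y := by
    intro x y; simp only [hw]
    have h1 : ∀ q : Prop, [Decidable q] → (if q then (1:ℝ) else 0) ≤ 1 := fun q _ => by split_ifs <;> norm_num
    split_ifs <;> norm_num <;> linarith [ha0.1, ha0.2]
  have hsym1 : ∀ x y, w x y = w y x := by
    intro x y; simp only [hw]
    rw [show n - y - x = n - x - y by ring]
    by_cases hx : x = 0 <;> by_cases hy : y = 0 <;> simp [hx, hy]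
    split_ifs <;> ring
  have hsym2 : ∀ x z, w x (n - x - z) = w x z := by
    intro x z; simp only [hw]
    rw [show n - x - (n - x - z) = z by ring]
    by_cases hx : x = 0 <;> by_cases hz : z = 0 <;> simp [hx, hz]
    split_ifs <;> ring
  set T : ℝ := p - 2 - 2 * a with hT
  have m1 : ∀ x, ∑ y, w x y = if x ≠ 0 then T else 0 := by
    intro x; simp only [hw]
    by_cases hx : x = 0
    · simp [hx]
    · simp only [ne_eq, hx, not_false_eq_true, if_true]; exact marg n x hx a ha
  have s1 : ∀ f : ZMod p → ℝ, ∑ x, ∑ y, w x y * f x = T * ∑ u : (ZMod p)ˣ, f u := by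
    intro f
    rw [sum_units_eq, mul_sum]
    refine sum_congr rfl fun x _ => ?_
    rw [← sum_mul, m1]; split_ifs <;> ring
  have s2 : ∀ f : ZMod p → ℝ, ∑ x, ∑ y, w x y * f y = T * ∑ u : (ZMod p)ˣ, f u := by
    intro f
    rw [sum_comm, ← s1]
    exact sum_congr rfl fun x _ => sum_congr rfl fun y _ => by rw [hsym1]
  have s3 : ∀ f : ZMod p → ℝ, ∑ x, ∑ y, w x y * f (n - x - y) = T * ∑ u : (ZMod p)ˣ, f u := by
    intro f
    rw [← s2]
    refine sum_congr rfl fun x _ => ?_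
    rw [← Equiv.sum_comp (Equiv.subLeft (n - x))]
    refine sum_congr rfl fun y _ => ?_
    simp only [Equiv.subLeft_apply]
    rw [hsym2]; congr 2; ring
  have hcard : (Fintype.card (ZMod p)ˣ : ℝ) = p - 1 := by
    rw [ZMod.card_units, Nat.cast_sub hp.out.one_lt.le]; simp
  have s0 := s1 (fun _ => 1)
  simp only [mul_one, sum_const, card_univ, nsmul_eq_mul, hcard] at s0
  set D := ∑ u : (ZMod p)ˣ, (f u + g u + h u) with hD
  by_contra hcon
  push Not at hcon
  have hlt : ∀ x y, w x y ≠ 0 → (p - 1) * (f x + g y + h (n - x - y)) < D := by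
    intro x y hxy
    have hx : x ≠ 0 := fun h0 => hxy (by simp [hw, h0])
    have hy : y ≠ 0 := fun h0 => hxy (by simp [hw, h0])
    have hz : n - x - y ≠ 0 := fun h0 => hxy (by simp [hw, h0])
    have := hcon (Units.mk0 x hx) (Units.mk0 y hy) (Units.mk0 _ hz) (by simp)
    rw [hcard] at this
    simpa only [Units.val_mk0] using this
  have hz : ∑ x, ∑ y, w x y * (D - (p - 1) * (f x + g y + h (n - x - y))) = 0 := by
    have e : ∀ x y, w x y * (D - (p - 1) * (f x + g y + h (n - x - y))) =
      w x y * D - (p - 1) * (w x y * f x + w x y * g y + w x y * h (n - x - y)) := fun x y => by ring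
    have hD' : D = ∑ u : (ZMod p)ˣ, f u + ∑ u : (ZMod p)ˣ, g u + ∑ u : (ZMod p)ˣ, h u := by
      rw [hD, sum_add_distrib, sum_add_distrib]
    simp only [e, sum_sub_distrib, ← mul_sum, sum_add_distrib, s1, s2, s3]
    rw [sum_const, card_univ, nsmul_eq_mul, hcard, hD']; ring
  have hnn : ∀ x y, 0 ≤ w x y * (D - (p - 1) * (f x + g y + h (n - x - y))) := by
    intro x y
    by_cases h0 : w x y = 0
    · simp [h0]
    · exact mul_nonneg (hw0 x y) (by linarith [hlt x y h0])
  have hall : ∀ x y, w x y = 0 := by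
    intro x y
    by_contra h0
    have h1 := (sum_eq_zero_iff_of_nonneg (fun x _ => sum_nonneg fun y _ => hnn x y)).1 hz x (mem_univ _)
    have h2 := (sum_eq_zero_iff_of_nonneg (fun y _ => hnn x y)).1 h1 y (mem_univ _)
    rcases mul_eq_zero.1 h2 with h3 | h3
    · exact h0 h3
    · linarith [hlt x y h0]
  simp only [hall, sum_const_zero] at s0
  have : 0 < T * (p - 1) := mul_pos (by linarith [ha0.2]) (by linarith)
  linarith

lemma LGood_set (s : Finset ℕ) (hs : ∀ p ∈ s, p.Prime ∧ p ≠ 3) (n : ℕ) (hn : n % 2 = 1) [Fintype (ZMod (∏ p ∈ s, p))ˣ] :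
    LGood (ZMod (∏ p ∈ s, p)) n := by
  revert hs
  rename_i inst
  revert inst
  induction s using Finset.induction_on with
  | empty =>
    have key : ∀ M : ℕ, ∀ i : Fintype (ZMod M)ˣ, M = 1 → LGood (ZMod M) n := by
      rintro M i rfl f g h
      refine ⟨1, 1, 1, Subsingleton.elim _ _, ?_⟩
      rw [sum_congr rfl (fun (u : (ZMod 1)ˣ) _ => show f u + g u + h u = f (1 : (ZMod 1)ˣ) + g (1 : (ZMod 1)ˣ) + h (1 : (ZMod 1)ˣ) by
        rw [Subsingleton.elim u (1 : (ZMod 1)ˣ)]), sum_const, nsmul_eq_mul, card_univ]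
    intro inst _
    exact key _ inst prod_empty
  | insert q s hq ih =>
    intro inst hs
    have hqp := (hs q (mem_insert_self _ _)).1
    haveI : Fact q.Prime := ⟨hqp⟩
    have hcop : Nat.Coprime q (∏ p ∈ s, p) := by
      refine Nat.Coprime.prod_right fun p hp => (Nat.coprime_primes hqp (hs p (mem_insert_of_mem hp)).1).2 ?_
      rintro rfl; exact hq hp
    have hne : NeZero (∏ p ∈ s, p) := ⟨prod_ne_zero_iff.2 fun p hp => (hs p (mem_insert_of_mem hp)).1.ne_zero⟩
    have hg : LGood (ZMod q × ZMod (∏ p ∈ s, p)) ((n : ℕ) : ZMod q × ZMod (∏ p ∈ s, p)) := by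
      refine LGood.prod _ ?_ ?_
      · simp only [Prod.fst_natCast]
        by_cases h2 : q = 2
        · subst h2
          rw [show ((n : ℕ) : ZMod 2) = 1 by rw [← Nat.div_add_mod n 2, hn]; push_cast; rw [show (2 : ZMod 2) = 0 from rfl]; ring]
          convert LGood_two
        · refine LGood_prime q ?_ _
          have h3 := (hs q (mem_insert_self _ _)).2
          have := hqp.two_le
          by_contra h5
          have : q = 4 := by omega
          rw [this] at hqp; norm_num at hqp
      · simp only [Prod.snd_natCast]
        exact ih (fun p hp => hs p (mem_insert_of_mem hp))
    have key : ∀ M : ℕ, ∀ i : Fintype (ZMod M)ˣ, M = q * ∏ p ∈ s, p → LGood (ZMod M) n := by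
      rintro M i rfl
      refine LGood.equiv (ZMod.chineseRemainder hcop) _ ?_
      rw [map_natCast]; exact hg
    exact key _ inst (prod_insert hq)

lemma three_aux (a b : Fin 3 → ℝ) (c : ℝ) (hc : 0 < c) (ha : ∀ i, a i ≤ 1 + c / 10) (hb : ∀ i, b i ≤ 1 + c / 10)
    (hs : 4 + 2 * c ≤ a 0 + a 1 + a 2 + (b 0 + b 1 + b 2)) :
    (5/3 ≤ b 0 + a 1 + a 2 ∧ c / 10 ≤ b 0 ∧ c / 10 ≤ a 1 ∧ c / 10 ≤ a 2) ∨
    (5/3 ≤ a 0 + b 1 + a 2 ∧ c / 10 ≤ a 0 ∧ c / 10 ≤ b 1 ∧ c / 10 ≤ a 2) ∨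
    (5/3 ≤ a 0 + a 1 + b 2 ∧ c / 10 ≤ a 0 ∧ c / 10 ≤ a 1 ∧ c / 10 ≤ b 2) := by
  have h0 := ha 0; have h1 := ha 1; have h2 := ha 2
  have g0 := hb 0; have g1 := hb 1; have g2 := hb 2
  by_cases a0 : a 0 < c / 10
  · left; refine ⟨?_, ?_, ?_, ?_⟩ <;> linarith
  by_cases a1 : a 1 < c / 10
  · right; left; refine ⟨?_, ?_, ?_, ?_⟩ <;> linarith
  by_cases a2 : a 2 < c / 10
  · right; right; refine ⟨?_, ?_, ?_, ?_⟩ <;> linarith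
  by_cases b0 : b 0 < c / 10
  · right; left; refine ⟨?_, ?_, ?_, ?_⟩ <;> linarith
  by_cases b1 : b 1 < c / 10
  · left; refine ⟨?_, ?_, ?_, ?_⟩ <;> linarith
  by_cases b2 : b 2 < c / 10
  · left; refine ⟨?_, ?_, ?_, ?_⟩ <;> linarith
  push Not at *
  by_contra hcon
  push Not at hcon
  obtain ⟨c1, c2, c3⟩ := hcon
  have k1 : b 0 + a 1 + a 2 < 5/3 := by by_contra h; push Not at h; linarith [c1 h b0 a1]
  have k2 : a 0 + b 1 + a 2 < 5/3 := by by_contra h; push Not at h; linarith [c2 h a0 b1]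
  have k3 : a 0 + a 1 + b 2 < 5/3 := by by_contra h; push Not at h; linarith [c3 h a0 a1]
  linarith

lemma local_three (f : Fin 3 → ZMod 3 → ℝ) (c : ℝ) (hc : 0 < c) (hf : ∀ i x, f i x ≤ 1 + c / 10)
    (hs : 4 + 2 * c ≤ ∑ i, (f i 1 + f i 2)) (n : ZMod 3) :
    ∃ x : Fin 3 → ZMod 3, (∀ i, x i = 1 ∨ x i = 2) ∧ x 0 + x 1 + x 2 = n ∧ 5/3 ≤ ∑ i, f i (x i) ∧ ∀ i, c / 10 ≤ f i (x i) := by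
  rw [Fin.sum_univ_three] at hs
  simp only [Fin.sum_univ_three, Fin.forall_fin_succ, Fin.succ_zero_eq_one, Fin.succ_one_eq_two, IsEmpty.forall_iff, and_true]
  have A := fun i => hf i 1
  have B := fun i => hf i 2
  have h0 := A 0; have h1 := A 1; have h2 := A 2
  have g0 := B 0; have g1 := B 1; have g2 := B 2
  have hn : n = 0 ∨ n = 1 ∨ n = 2 := by revert n; decide
  rcases hn with rfl | rfl | rfl
  · rcases le_total (2 + c) (f 0 1 + f 1 1 + f 2 1) with h | h
    · refine ⟨![1, 1, 1], by simp, by decide, ?_⟩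
      simp; refine ⟨?_, ?_, ?_, ?_⟩ <;> linarith
    · refine ⟨![2, 2, 2], by simp, by decide, ?_⟩
      simp; refine ⟨?_, ?_, ?_, ?_⟩ <;> linarith
  · rcases three_aux (fun i => f i 1) (fun i => f i 2) c hc A B (by linarith) with h | h | h
    · exact ⟨![2, 1, 1], by simp, by decide, by simpa using h⟩
    · exact ⟨![1, 2, 1], by simp, by decide, by simpa using h⟩
    · exact ⟨![1, 1, 2], by simp, by decide, by simpa using h⟩
  · rcases three_aux (fun i => f i 2) (fun i => f i 1) c hc B A (by linarith) with h | h | h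
    · exact ⟨![1, 2, 2], by simp, by decide, by simpa using h⟩
    · exact ⟨![2, 1, 2], by simp, by decide, by simpa using h⟩
    · exact ⟨![2, 2, 1], by simp, by decide, by simpa using h⟩

lemma sum_units_three (f : ZMod 3 → ℝ) : ∑ u : (ZMod 3)ˣ, f u = f 1 + f 2 := by
  haveI : Fact (Nat.Prime 3) := ⟨Nat.prime_three⟩
  rw [sum_units_eq]
  have : ∀ g : ZMod 3 → ℝ, ∑ x, g x = g 0 + g 1 + g 2 := fun g => Fin.sum_univ_three g
  have h2 : (2 : ZMod 3) ≠ 0 := by intro h; exact absurd h (by clear this; decide +revert)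
  rw [this, if_neg (by simp), if_pos one_ne_zero, if_pos h2, zero_add]

lemma local_main (M : ℕ) [NeZero (3 * M)] [NeZero M] (hM : Nat.Coprime 3 M) (n : ℕ) (hg : LGood (ZMod M) (n : ZMod M))
    (f : Fin 3 → ZMod (3 * M) → ℝ) (c : ℝ) (hc : 0 < c) (hf : ∀ i x, f i x ≤ 1 + c / 10)
    (hs : (2 + c) * Nat.totient (3 * M) ≤ ∑ i, ∑ u : (ZMod (3 * M))ˣ, f i u) :
    ∃ x : Fin 3 → (ZMod (3 * M))ˣ, (x 0 + x 1 + x 2 : ZMod (3 * M)) = n ∧ 5/3 ≤ ∑ i, f i (x i) ∧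
      ∀ i, c / 10 ≤ f i (x i) := by
  set e := ZMod.chineseRemainder hM with he
  set F : Fin 3 → ZMod 3 → ZMod M → ℝ := fun i u v => f i (e.symm (u, v)) with hF
  obtain ⟨x, y, z, h1, h2⟩ := hg (fun v => F 0 1 v + F 0 2 v) (fun v => F 1 1 v + F 1 2 v) (fun v => F 2 1 v + F 2 2 v)
  have hsum : ∀ i, ∑ u : (ZMod (3 * M))ˣ, f i u = ∑ v : (ZMod M)ˣ, (F i 1 v + F i 2 v) := by
    intro i
    rw [← Equiv.sum_comp (Units.mapEquiv e.symm.toMulEquiv).toEquiv, ← Equiv.sum_comp MulEquiv.prodUnits.symm.toEquiv,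
      Fintype.sum_prod_type, sum_comm]
    refine sum_congr rfl fun v _ => ?_
    rw [← sum_units_three (fun u => F i u v)]
    rfl
  have hphi : ((Nat.totient (3 * M) : ℕ) : ℝ) = 2 * Nat.totient M := by
    rw [Nat.totient_mul hM, Nat.totient_prime Nat.prime_three]; push_cast; norm_num
  rw [ZMod.card_units_eq_totient] at h2
  rw [Fin.sum_univ_three, hsum, hsum, hsum, hphi, ← sum_add_distrib, ← sum_add_distrib] at hs
  have hpos : (0:ℝ) < Nat.totient M := by exact_mod_cast Nat.totient_pos.2 (Nat.pos_of_ne_zero (NeZero.ne M))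
  have h3 := hs.trans h2
  have h4 : 4 + 2 * c ≤ F 0 1 x + F 0 2 x + (F 1 1 y + F 1 2 y) + (F 2 1 z + F 2 2 z) := by
    refine le_of_mul_le_mul_left ?_ hpos
    calc _ = (2 + c) * (2 * Nat.totient M) := by ring
      _ ≤ _ := h3
  set X : Fin 3 → (ZMod M)ˣ := ![x, y, z] with hX
  obtain ⟨t, t1, t2, t3, t4⟩ := local_three (fun i u => F i u (X i)) c hc (fun i u => hf _ _)
    (by rw [Fin.sum_univ_three]; simpa [hX] using h4) n
  have tu : ∀ i, IsUnit (t i) := by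
    intro i
    rcases t1 i with h | h <;> rw [h]
    · exact isUnit_one
    · exact ⟨⟨2, 2, by decide, by decide⟩, rfl⟩
  choose T hT using tu
  refine ⟨fun i => Units.mapEquiv e.symm.toMulEquiv (MulEquiv.prodUnits.symm (T i, X i)), ?_, ?_, ?_⟩
  · apply e.injective
    have : ∀ i, e (((Units.mapEquiv e.symm.toMulEquiv (MulEquiv.prodUnits.symm (T i, X i)) : (ZMod (3 * M))ˣ)) : ZMod (3 * M)) =
      (t i, (X i : ZMod M)) := fun i => by rw [← hT]; exact e.apply_symm_apply _
    rw [map_add, map_add, this, this, this, map_natCast]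
    ext
    · simpa using t2
    · simpa [hX] using h1
  · have : ∀ i, f i (((Units.mapEquiv e.symm.toMulEquiv (MulEquiv.prodUnits.symm (T i, X i)) : (ZMod (3 * M))ˣ)) : ZMod (3 * M)) =
      F i (t i) (X i) := fun i => by rw [← hT]; rfl
    simpa only [this] using t3
  · have : ∀ i, f i (((Units.mapEquiv e.symm.toMulEquiv (MulEquiv.prodUnits.symm (T i, X i)) : (ZMod (3 * M))ˣ)) : ZMod (3 * M)) =
      F i (t i) (X i) := fun i => by rw [← hT]; rfl
    simpa only [this] using t4
end

section
open Finset

lemma log_succ_bd (n : ℕ) (hn : 0 < n) : 1 / ((n : ℝ) + 1) ≤ Real.log (n + 1) - Real.log n ∧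
    Real.log (n + 1) - Real.log n ≤ 1 / (n : ℝ) := by
  have h : (0:ℝ) < n := by exact_mod_cast hn
  rw [← Real.log_div (by positivity) (by positivity)]
  constructor
  · have := Real.one_sub_inv_le_log_of_pos (show 0 < ((n:ℝ) + 1) / n by positivity)
    refine le_trans (le_of_eq ?_) this
    field_simp; ring
  · refine (Real.log_le_sub_one_of_pos (by positivity)).trans (le_of_eq ?_)
    field_simp; ring

lemma logsum (n : ℕ) (hn : 0 < n) : |∑ m ∈ Ioc 0 n, Real.log m / m - 1 / 2 * Real.log n ^ 2| ≤ 2 := by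
  have key : ∑ m ∈ Ioc 0 n, Real.log m / m ≤ 1 / 2 * Real.log n ^ 2 + 1 / 2 * (1 - 1 / n) ∧
      1 / 2 * Real.log n ^ 2 - 2 + (2 + Real.log n) / n ≤ ∑ m ∈ Ioc 0 n, Real.log m / m := by
    induction n, hn using Nat.le_induction with
    | base => simp
    | succ n hn ih =>
      obtain ⟨i1, i2⟩ := ih
      obtain ⟨b1, b2⟩ := log_succ_bd n hn
      have h : (1:ℝ) ≤ n := by exact_mod_cast hn
      have hl : 0 ≤ Real.log n := Real.log_nonneg h
      rw [sum_Ioc_succ_top (Nat.zero_le n), add_comm]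
      push_cast
      set a := Real.log ((n:ℝ) + 1) with ha
      set b := Real.log (n:ℝ) with hb
      have hr : (n:ℝ) * (1 / n) = 1 := by field_simp
      have hs : ((n:ℝ) + 1) * (1 / (n + 1)) = 1 := by field_simp
      have hrs : 1 / (n:ℝ) - 1 / (n + 1) = 1 / n * (1 / (n + 1)) := by field_simp; ring
      rw [div_eq_mul_one_div a, div_eq_mul_one_div (2 + a)]
      rw [div_eq_mul_one_div (2 + b)] at i2
      set r := 1 / (n:ℝ) with hrr
      set s := 1 / ((n:ℝ) + 1) with hss
      have hs0 : 0 < s := by positivity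
      have hr0 : 0 < r := by positivity
      have hr1 : r ≤ 1 := by rw [hrr, div_le_one (by positivity)]; exact h
      have hsr : s ≤ r := b1.trans b2
      constructor
      · have : 0 ≤ (a - b - s) * (a - ((a - b) + s) / 2) := mul_nonneg (by linarith) (by nlinarith)
        nlinarith [mul_le_mul_of_nonneg_right hsr hs0.le]
      · have h1 : a ^ 2 / 2 - b ^ 2 / 2 ≤ r * a := by nlinarith [mul_nonneg (sub_nonneg.2 b2) (show 0 ≤ a by linarith)]
        have h2 : (2 + b) * r - (2 + a) * s = 2 * (r * s) + b * (r * s) - (a - b) * s := by linear_combination (2+b) * hrs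
        have h3 : r * a = s * a + r * s * a := by linear_combination a * hrs
        have h4 : (a - b) * s ≤ r * s := mul_le_mul_of_nonneg_right b2 hs0.le
        have h5 : r * s * a ≤ r * s * (b + 1) := mul_le_mul_of_nonneg_left (by linarith) (by positivity)
        linarith
  have h : (1:ℝ) ≤ n := by exact_mod_cast hn
  have : 0 ≤ 1 / (n:ℝ) := by positivity
  have : 0 ≤ (2 + Real.log n) / n := by have := Real.log_nonneg h; positivity
  rw [abs_le]; constructor <;> linarith

noncomputable def eg : ℝ := Real.eulerMascheroniConstant

lemma eg_bd : 0 ≤ eg ∧ eg ≤ 1 :=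
  ⟨by have := Real.one_half_lt_eulerMascheroniConstant; unfold eg; linarith,
   by have := Real.eulerMascheroniConstant_lt_two_thirds; unfold eg; linarith⟩

lemma floor_bd (y : ℝ) (hy : 1 ≤ y) : 0 < ⌊y⌋₊ ∧ (⌊y⌋₊ : ℝ) ≤ y ∧ y ≤ ⌊y⌋₊ + 1 ∧ 1 / (⌊y⌋₊ : ℝ) ≤ 2 / y := by
  have h1 : 0 < ⌊y⌋₊ := Nat.floor_pos.2 hy
  have h2 : (⌊y⌋₊ : ℝ) ≤ y := Nat.floor_le (by linarith)
  have h3 := (Nat.lt_floor_add_one y).le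
  have h4 : (1:ℝ) ≤ ⌊y⌋₊ := by exact_mod_cast h1
  refine ⟨h1, h2, h3, ?_⟩
  rw [div_le_div_iff₀ (by linarith) (by linarith)]; linarith

lemma harm_bd (y : ℝ) (hy : 1 ≤ y) : |∑ m ∈ Ioc 0 ⌊y⌋₊, 1 / (m:ℝ) - Real.log y - eg| ≤ 2 / y := by
  obtain ⟨h1, h2, h3, h4⟩ := floor_bd y hy
  set n := ⌊y⌋₊
  have e : ∑ m ∈ Ioc 0 n, 1 / (m:ℝ) = harmonic n := by
    rw [harmonic_eq_sum_Icc]; push_cast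
    exact sum_congr (by ext; simp; omega) (fun i _ => by rw [one_div])
  have hn : (1:ℝ) ≤ n := by exact_mod_cast h1
  have g1 := Real.eulerMascheroniSeq_lt_eulerMascheroniConstant n
  have g2 := Real.eulerMascheroniConstant_lt_eulerMascheroniSeq' n
  rw [Real.eulerMascheroniSeq] at g1
  rw [Real.eulerMascheroniSeq', if_neg h1.ne'] at g2
  obtain ⟨b1, b2⟩ := log_succ_bd n h1
  have l1 := Real.log_le_log (by linarith) h2
  have l2 := Real.log_le_log (by linarith) h3
  rw [e, eg, abs_le]; constructor <;> linarith

lemma log_sq_bd (y : ℝ) (hy : 1 ≤ y) :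
    |Real.log y ^ 2 - 2 * ∑ m ∈ Ioc 0 ⌊y⌋₊, 1 / (m:ℝ) * Real.log (y / m) + 2 * eg * Real.log y| ≤ 12 := by
  obtain ⟨h1, h2, h3, h4⟩ := floor_bd y hy
  have hH := harm_bd y hy
  have hL := logsum _ h1
  have e : ∑ m ∈ Ioc 0 ⌊y⌋₊, 1 / (m:ℝ) * Real.log (y / m) =
      Real.log y * ∑ m ∈ Ioc 0 ⌊y⌋₊, 1 / (m:ℝ) - ∑ m ∈ Ioc 0 ⌊y⌋₊, Real.log m / m := by
    rw [mul_sum, ← sum_sub_distrib]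
    refine sum_congr rfl fun m hm => ?_
    have : (m:ℝ) ≠ 0 := by have := (mem_Ioc.1 hm).1; positivity
    rw [Real.log_div (by linarith) this]; ring
  rw [e]
  set n := ⌊y⌋₊
  have hn : (1:ℝ) ≤ n := by exact_mod_cast h1
  set H := ∑ m ∈ Ioc 0 n, 1 / (m:ℝ)
  set G := ∑ m ∈ Ioc 0 n, Real.log m / m
  obtain ⟨b1, b2⟩ := log_succ_bd n h1
  have l0 := Real.log_nonneg hn
  have l1 := Real.log_le_log (by linarith) h2
  have l2 := Real.log_le_log (by linarith) h3
  set a := Real.log y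
  set b := Real.log n
  have hay : a * (2 / y) ≤ 2 := by
    have := Real.log_le_sub_one_of_pos (show 0 < y by linarith)
    rw [← mul_div_assoc, div_le_iff₀ (by linarith)]; linarith
  have hd : a - b ≤ 2 / y := by linarith
  have k1 : |a * (H - a - eg)| ≤ 2 := by
    rw [abs_mul, abs_of_nonneg (by linarith : 0 ≤ a)]
    exact (mul_le_mul_of_nonneg_left hH (by linarith)).trans hay
  have k2 : a ^ 2 - b ^ 2 ≤ 4 := by nlinarith [mul_le_mul_of_nonneg_left hd (show 0 ≤ a by linarith), mul_le_mul_of_nonneg_left hd l0]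
  have k3 : 0 ≤ a ^ 2 - b ^ 2 := by nlinarith
  rw [abs_le] at *
  constructor <;> nlinarith

lemma cop_part (q n : ℕ) (hn : 0 < n) : ∃ n', 0 < n' ∧ (∀ k, (k ∣ n ∧ k.Coprime q) ↔ k ∣ n') ∧
    (n' = 1 → ∀ p, p.Prime → p ∣ n → p ∣ q) := by
  induction n using Nat.strong_induction_on with
  | _ n ih =>
    by_cases hc : n.Coprime q
    · refine ⟨n, hn, fun k => ⟨fun h => h.1, fun h => ⟨h, hc.coprime_dvd_left h⟩⟩, ?_⟩
      rintro rfl p hp h; exact absurd (Nat.dvd_one.1 h) hp.ne_one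
    · obtain ⟨p, hp, h1, h2⟩ := Nat.Prime.not_coprime_iff_dvd.1 hc
      obtain ⟨m, rfl⟩ := h1
      have hm : 0 < m := Nat.pos_of_mul_pos_left hn
      obtain ⟨n', h0, h3, h4⟩ := ih m (by nlinarith [hp.two_le]) hm
      refine ⟨n', h0, fun k => ⟨fun h => (h3 k).1 ⟨?_, h.2⟩, fun h => ?_⟩, fun h r hr hd => ?_⟩
      · exact (h.2.coprime_dvd_right h2).dvd_of_dvd_mul_left h.1
      · have := (h3 k).2 h; exact ⟨this.1.mul_left _, this.2⟩
      · rcases (Nat.Prime.dvd_mul hr).1 hd with h' | h'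
        · rwa [(Nat.prime_dvd_prime_iff_eq hr hp).1 h']
        · exact h4 h r hr h'

noncomputable def uq (q k : ℕ) : ℝ := if k.Coprime q then (ArithmeticFunction.moebius k : ℝ) else 0

lemma uq_abs (q k : ℕ) : |uq q k| ≤ 1 := by
  unfold uq; split_ifs
  · exact_mod_cast ArithmeticFunction.abs_moebius_le_one
  · simp

lemma uq_sum (q n : ℕ) (hn : 0 < n) : ∑ k ∈ n.divisors, uq q k = 0 ∨
    (∑ k ∈ n.divisors, uq q k = 1 ∧ ∀ p, p.Prime → p ∣ n → p ∣ q) := by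
  obtain ⟨n', h0, h1, h2⟩ := cop_part q n hn
  have : ∑ k ∈ n.divisors, uq q k = if n' = 1 then 1 else 0 := by
    unfold uq
    rw [← sum_filter]
    have : n.divisors.filter (fun k => k.Coprime q) = n'.divisors := by
      ext k; simp only [mem_filter, Nat.mem_divisors]; rw [← h1]
      constructor
      · rintro ⟨⟨a, b⟩, c⟩; exact ⟨⟨a, c⟩, h0.ne'⟩
      · rintro ⟨⟨a, c⟩, _⟩; exact ⟨⟨a, hn.ne'⟩, c⟩
    rw [this]; exact_mod_cast mu_sum n'
  rw [this]
  split_ifs with h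
  · exact Or.inr ⟨rfl, h2 h⟩
  · exact Or.inl rfl

lemma dsum_swap {R : Type*} [AddCommMonoid R] (F : ℕ → ℕ → R) (N : ℕ) :
    ∑ k ∈ Ioc 0 N, ∑ m ∈ Ioc 0 (N / k), F k (k * m) = ∑ n ∈ Ioc 0 N, ∑ k ∈ n.divisors, F k n := by
  rw [sum_sigma', sum_sigma']
  refine sum_bij' (fun x _ => ⟨x.1 * x.2, x.1⟩) (fun x _ => ⟨x.2, x.1 / x.2⟩) ?_ ?_ ?_ ?_ ?_
  · rintro ⟨k, m⟩ h
    simp only [mem_sigma, mem_Ioc, Nat.mem_divisors] at h ⊢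
    have := (Nat.le_div_iff_mul_le h.1.1).1 h.2.2
    have h3 := Nat.mul_pos h.1.1 h.2.1
    exact ⟨⟨h3, by rw [mul_comm]; exact this⟩, dvd_mul_right _ _, h3.ne'⟩
  · rintro ⟨n, k⟩ h
    simp only [mem_sigma, mem_Ioc, Nat.mem_divisors] at h ⊢
    have hk := Nat.pos_of_dvd_of_pos h.2.1 h.1.1
    exact ⟨⟨hk, (Nat.le_of_dvd h.1.1 h.2.1).trans h.1.2⟩, Nat.div_pos (Nat.le_of_dvd h.1.1 h.2.1) hk, Nat.div_le_div_right h.1.2⟩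
  · rintro ⟨k, m⟩ h
    simp only [mem_sigma, mem_Ioc] at h
    simp [Nat.mul_div_cancel_left _ h.1.1]
  · rintro ⟨n, k⟩ h
    simp only [mem_sigma, Nat.mem_divisors] at h
    simp [Nat.mul_div_cancel' h.2.1]
  · rintro ⟨k, m⟩ h; rfl

lemma uq_dsum (q N : ℕ) (hq : 0 < q) (w : ℕ → ℝ) (B : ℝ) (hB0 : 0 ≤ B) (hw : ∀ n ∈ Ioc 0 N, 0 ≤ w n ∧ w n ≤ B) :
    |∑ k ∈ Ioc 0 N, uq q k / k * ∑ m ∈ Ioc 0 (N / k), 1 / (m:ℝ) * w (k * m)| ≤ B * (q / q.totient) := by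
  have e : ∑ k ∈ Ioc 0 N, uq q k / k * ∑ m ∈ Ioc 0 (N / k), 1 / (m:ℝ) * w (k * m) =
      ∑ n ∈ Ioc 0 N, 1 / (n:ℝ) * w n * ∑ k ∈ n.divisors, uq q k := by
    have := dsum_swap (fun k n => 1 / (n:ℝ) * w n * uq q k) N
    simp only [← mul_sum] at this
    rw [← this]
    refine sum_congr rfl fun k _ => ?_
    rw [mul_sum]
    refine sum_congr rfl fun m _ => ?_
    push_cast; rw [one_div_mul_eq_div, one_div_mul_eq_div, div_mul_div_comm, div_mul_eq_mul_div]; ring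
  rw [e]
  classical
  have hB : ∀ n ∈ Ioc 0 N, |1 / (n:ℝ) * w n * ∑ k ∈ n.divisors, uq q k| ≤
      if (∀ p : ℕ, p.Prime → p ∣ n → p ∣ q) then B * (1 / (n:ℝ)) else 0 := by
    intro n hn
    obtain ⟨w0, w1⟩ := hw n hn
    rcases uq_sum q n (mem_Ioc.1 hn).1 with h | ⟨h, h'⟩
    · rw [h, mul_zero, abs_zero]; positivity
    · rw [h, if_pos h', mul_one, abs_of_nonneg (by positivity), mul_comm]
      gcongr
  refine (abs_sum_le_sum_abs _ _).trans ((sum_le_sum hB).trans ?_)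
  rw [← sum_filter, ← mul_sum]

  refine mul_le_mul_of_nonneg_left (factored_sum q hq _ ?_) hB0
  intro n hn
  have := mem_filter.1 hn
  exact ⟨((mem_Ioc.1 this.1).1).ne', this.2⟩

lemma mob2 (q : ℕ) (hq : 0 < q) (x : ℝ) (hx : 1 ≤ x) :
    |∑ k ∈ Ioc 0 ⌊x⌋₊, uq q k / k * Real.log (x / k) ^ 2| ≤ 60 * (q / q.totient) * (1 + Real.log x) := by
  set N := ⌊x⌋₊ with hN
  obtain ⟨f1, f2, f3, f4⟩ := floor_bd x hx
  have hl := Real.log_nonneg hx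
  have hr : 1 ≤ (q:ℝ) / q.totient := by
    rw [one_le_div (by exact_mod_cast Nat.totient_pos.2 hq)]; exact_mod_cast Nat.totient_le q
  set r := (q:ℝ) / q.totient
  have hy : ∀ k ∈ Ioc 0 N, 1 ≤ x / k ∧ ⌊x / k⌋₊ = N / k := by
    intro k hk
    obtain ⟨a, b⟩ := mem_Ioc.1 hk
    have : (k:ℝ) ≤ x := (by exact_mod_cast b : (k:ℝ) ≤ N).trans f2
    exact ⟨by rw [one_le_div (by exact_mod_cast a)]; exact this, Nat.floor_div_natCast x k⟩
  have hH : ∑ k ∈ Ioc 0 N, 1 / (k:ℝ) ≤ 3 + Real.log x := by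
    have := harm_bd x hx
    rw [abs_le] at this
    have h2 : 2 / x ≤ 2 := by rw [div_le_iff₀ (by linarith)]; linarith
    linarith [this.2, eg_bd.2]
  have htriv : ∀ (G : ℕ → ℝ) (B : ℝ), 0 ≤ B → (∀ k ∈ Ioc 0 N, |G k| ≤ B) →
      |∑ k ∈ Ioc 0 N, uq q k / k * G k| ≤ B * (3 + Real.log x) := by
    intro G B hB hG
    refine (abs_sum_le_sum_abs _ _).trans (le_trans (sum_le_sum (g := fun k : ℕ => B * (1 / (k:ℝ))) fun k hk => ?_) ?_)
    · rw [abs_mul, abs_div, Nat.abs_cast, mul_comm]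
      refine mul_le_mul (hG k hk) ?_ (by positivity) hB
      gcongr; exact uq_abs q k
    · rw [← mul_sum]; exact mul_le_mul_of_nonneg_left hH hB
  have s1 : |∑ k ∈ Ioc 0 N, uq q k / k * Real.log (x / k)| ≤ r + 3 * (3 + Real.log x) := by
    have t1 := uq_dsum q N hq (fun _ => 1) 1 zero_le_one (fun _ _ => by norm_num)
    have t2 := htriv (fun k => Real.log (x / k) - ∑ m ∈ Ioc 0 (N / k), 1 / (m:ℝ) * 1) 3 (by norm_num) (by
      intro k hk
      obtain ⟨a, b⟩ := hy k hk
      have := harm_bd _ a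
      have h2 : 2 / (x / k) ≤ 2 := by rw [div_le_iff₀ (by linarith)]; linarith
      rw [b] at this
      simp only [mul_one]
      rw [abs_le] at *
      constructor <;> linarith [this.1, this.2, eg_bd.1, eg_bd.2])
    simp only [mul_sub, sum_sub_distrib] at t2
    rw [abs_le] at *
    constructor <;> linarith [t1.1, t1.2, t2.1, t2.2]
  have t1 := uq_dsum q N hq (fun n => Real.log (x / n)) (Real.log x) hl (by
    intro n hn
    obtain ⟨a, b⟩ := hy n hn
    have hn' : (1:ℝ) ≤ n := by exact_mod_cast (mem_Ioc.1 hn).1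
    exact ⟨Real.log_nonneg a, Real.log_le_log (by linarith) (div_le_self (by linarith) hn')⟩)
  have t2 := htriv (fun k => Real.log (x / k) ^ 2 - 2 * ∑ m ∈ Ioc 0 (N / k), 1 / (m:ℝ) * Real.log (x / ↑(k * m)) + 2 * eg * Real.log (x / k))
    12 (by norm_num) (by
      intro k hk
      obtain ⟨a, b⟩ := hy k hk
      have := log_sq_bd _ a
      rw [b] at this
      simpa only [Nat.cast_mul, div_div] using this)
  have e : ∀ k : ℕ, uq q k / k * (Real.log (x / k) ^ 2 - 2 * ∑ m ∈ Ioc 0 (N / k), 1 / (m:ℝ) * Real.log (x / ↑(k * m)) + 2 * eg * Real.log (x / k))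
     = uq q k / k * Real.log (x / k) ^ 2 - 2 * (uq q k / k * ∑ m ∈ Ioc 0 (N / k), 1 / (m:ℝ) * Real.log (x / ↑(k * m))) + 2 * eg * (uq q k / k * Real.log (x / k)) :=
     fun k => by ring
  simp only [e, sum_add_distrib, sum_sub_distrib, ← mul_sum] at t2
  set S1 := ∑ k ∈ Ioc 0 N, uq q k / k * Real.log (x / k)
  have k1 : |2 * eg * S1| ≤ 2 * (r + 3 * (3 + Real.log x)) := by
    rw [abs_mul, abs_of_nonneg (by linarith [eg_bd.1])]
    have := abs_nonneg S1
    nlinarith [eg_bd.1, eg_bd.2]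
  have k2 : 1 + Real.log x ≤ r * (1 + Real.log x) := by nlinarith
  have k3 : r ≤ r * (1 + Real.log x) := by nlinarith
  have k4 : Real.log x * r ≤ r * (1 + Real.log x) := by nlinarith
  rw [abs_le] at *
  constructor <;> linarith [t1.1, t1.2, t2.1, t2.2, k1.1, k1.2]
end

section
open Finset

noncomputable def EE (n : ℕ) (θ : ℝ) : ℂ := ∑ m ∈ Ioc 0 n, ee (m * θ)

lemma EE_triv (n : ℕ) (θ : ℝ) : ‖EE n θ‖ ≤ n := by
  unfold EE
  refine (norm_sum_le _ _).trans ?_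
  simp [ee_norm]

lemma EE_range (n : ℕ) (θ : ℝ) : EE n θ = ∑ i ∈ range n, ee ((i + 1 : ℕ) * θ) := by
  unfold EE
  induction n with
  | zero => simp
  | succ n ih => rw [sum_Ioc_succ_top (Nat.zero_le n), sum_range_succ, ih]

lemma EE_geom (n : ℕ) (θ : ℝ) : dn θ * ‖EE n θ‖ ≤ 1 / 2 := by
  have : EE n θ = ee θ * ∑ j ∈ range n, ee (j * θ) := by
    rw [EE_range, mul_sum]
    refine sum_congr rfl fun i _ => ?_
    rw [← ee_add]; congr 1; push_cast; ring
  rw [this, norm_mul, ee_norm, one_mul]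
  exact geom_ee n θ

lemma EE_add_int (n : ℕ) (θ : ℝ) (k : ℤ) : EE n (θ + k) = EE n θ := by
  unfold EE
  refine sum_congr rfl fun m _ => ?_
  rw [show (m:ℝ) * (θ + k) = m * θ + ((m * k : ℤ) : ℝ) by push_cast; ring, ee_add_int]

lemma EE_mult (X D : ℕ) (hD : 0 < D) (β : ℝ) :
    ‖EE X β - D * EE (X / D) (D * β)‖ ≤ D * (7 * |β| * X + 1) := by
  have key : ∀ T : ℕ, ‖EE (D * T) β - D * EE T (D * β)‖ ≤ 7 * |β| * D * (D * T : ℕ) := by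
    intro T
    induction T with
    | zero => simp [EE]
    | succ T ih =>
      have e1 : EE (D * (T + 1)) β = EE (D * T) β + ∑ j ∈ range D, ee ((D * T + j + 1 : ℕ) * β) := by
        rw [EE_range, EE_range, mul_add, mul_one, sum_range_add]
      have e2 : EE (T + 1) (D * β) = EE T (D * β) + ee ((T + 1 : ℕ) * (D * β)) := by
        unfold EE; rw [sum_Ioc_succ_top (Nat.zero_le T)]
      have h3 : ‖∑ j ∈ range D, ee ((D * T + j + 1 : ℕ) * β) - D * ee ((T + 1 : ℕ) * (D * β))‖ ≤ D * (7 * |β| * D) := by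
        have : (D:ℂ) * ee ((T + 1 : ℕ) * (D * β)) = ∑ j ∈ range D, ee ((T + 1 : ℕ) * (D * β)) := by simp
        rw [this, ← sum_sub_distrib]
        have hc : (D:ℝ) * (7 * |β| * D) = ∑ j ∈ range D, 7 * |β| * D := by simp
        rw [hc]
        refine (norm_sum_le _ _).trans (sum_le_sum fun j hj => ?_)
        have hb : |(((D * T + j + 1 : ℕ):ℝ) * β) - ((T + 1 : ℕ) * (D * β))| ≤ D * |β| := by
          rw [show (((D * T + j + 1 : ℕ):ℝ) * β) - ((T + 1 : ℕ) * (D * β)) = ((j + 1 : ℝ) - D) * β by push_cast; ring, abs_mul]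
          gcongr
          have : (j:ℝ) + 1 ≤ D := by exact_mod_cast (mem_range.1 hj)
          rw [abs_le]; constructor <;> linarith [(Nat.cast_nonneg j : (0:ℝ) ≤ j)]
        refine (ee_dist _ _).trans ?_
        nlinarith
      rw [e1, e2]
      calc _ = ‖(EE (D * T) β - D * EE T (D * β)) + (∑ j ∈ range D, ee ((D * T + j + 1 : ℕ) * β) - D * ee ((T + 1 : ℕ) * (D * β)))‖ := by
            congr 1; ring
        _ ≤ _ := (norm_add_le _ _).trans (add_le_add ih h3)
        _ = _ := by push_cast; ring
  have hX : X = D * (X / D) + X % D := (Nat.div_add_mod X D).symm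
  have e1 : EE X β = EE (D * (X / D)) β + ∑ j ∈ range (X % D), ee ((D * (X / D) + j + 1 : ℕ) * β) := by
    conv_lhs => rw [hX]
    rw [EE_range, EE_range, sum_range_add]
  have h2 : ‖∑ j ∈ range (X % D), ee ((D * (X / D) + j + 1 : ℕ) * β)‖ ≤ D := by
    refine (norm_sum_le _ _).trans ?_
    simp only [ee_norm, sum_const, card_range, nsmul_eq_mul, mul_one]
    exact_mod_cast (Nat.mod_lt X hD).le
  have h3 := key (X / D)
  have h4 : ((D * (X / D) : ℕ) : ℝ) ≤ X := by exact_mod_cast Nat.mul_div_le X D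
  rw [e1]
  calc _ = ‖(EE (D * (X / D)) β - D * EE (X / D) (D * β)) + ∑ j ∈ range (X % D), ee ((D * (X / D) + j + 1 : ℕ) * β)‖ := by
        congr 1; ring
    _ ≤ 7 * |β| * D * X + D := (norm_add_le _ _).trans (add_le_add (h3.trans (by gcongr)) h2)
    _ = _ := by ring

lemma sum_inv_Ioc (u v : ℕ) (huv : u < v) : ∑ k ∈ Ioc u v, 1 / (k:ℝ) ≤ 1 + Real.log v - Real.log (u + 1) := by
  induction v, huv using Nat.le_induction with
  | base =>
    rw [sum_Ioc_succ_top le_rfl]; simp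
    rw [inv_le_one₀ (by positivity)]; linarith [(Nat.cast_nonneg u : (0:ℝ) ≤ u)]
  | succ v hv ih =>
    rw [sum_Ioc_succ_top (by omega)]
    have := (log_succ_bd v (by omega)).1
    push_cast at *; linarith

lemma dn_unit (i q : ℕ) (h0 : 0 < i) (h1 : i < q) : 1 / dn (i / q) ≤ q * (1 / i) + q * (1 / ((q - i : ℕ) : ℝ)) := by
  have hq : (0:ℝ) < q := by exact_mod_cast h0.trans h1
  have hi : (0:ℝ) < i := by exact_mod_cast h0
  have hqi : (0:ℝ) < ((q - i : ℕ) : ℝ) := by exact_mod_cast Nat.sub_pos_of_lt h1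
  obtain ⟨n, hn⟩ := dn_exists (i / q : ℝ)
  have : (i / q : ℝ) ≤ dn (i / q) ∨ ((q - i : ℕ) : ℝ) / q ≤ dn (i / q) := by
    rw [← hn]
    rcases le_or_gt n 0 with h | h
    · left
      have : (n:ℝ) ≤ 0 := by exact_mod_cast h
      exact le_trans (by linarith) (le_abs_self _)
    · right
      have : (1:ℝ) ≤ n := by exact_mod_cast h
      rw [abs_sub_comm]
      refine le_trans ?_ (le_abs_self _)
      rw [Nat.cast_sub h1.le, sub_div, div_self hq.ne']; linarith
  have p1 : 0 < (q:ℝ) * (1 / i) := by positivity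
  have p2 : 0 < q * (1 / ((q - i : ℕ) : ℝ)) := by positivity
  rcases this with h | h
  · have := one_div_le_one_div_of_le (by positivity) h
    rw [one_div_div, div_eq_mul_one_div (q:ℝ)] at this; linarith
  · have := one_div_le_one_div_of_le (by positivity) h
    rw [one_div_div, div_eq_mul_one_div (q:ℝ)] at this; linarith

lemma dn_block (q : ℕ) (hq : 0 < q) (a : ℤ) (ha : IsCoprime a (q:ℤ)) (T : ℕ) :
    ∑ d ∈ range (T * q), (if q ∣ d then 0 else 1 / dn (d * (a / q))) ≤ T * (2 * q * (1 + Real.log q)) := by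
  set g : ℕ → ℝ := fun d => if q ∣ d then 0 else 1 / dn (d * (a / q)) with hg
  set h : ℕ → ℝ := fun i => if q ∣ i then 0 else 1 / dn (i / q) with hh
  have hq' : (q:ℝ) ≠ 0 := by positivity
  set σ : ℕ → ℕ := fun j => ((a * j) % (q:ℤ)).toNat with hσ
  have hσc : ∀ j, ((σ j : ℕ) : ℤ) = (a * j) % (q:ℤ) := fun j => Int.toNat_of_nonneg (Int.emod_nonneg _ (by exact_mod_cast hq.ne'))
  have hσd : ∀ j, (q:ℤ) ∣ a * j - σ j := fun j => by rw [hσc]; exact Int.dvd_self_sub_emod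
  have hdvd : ∀ j, q ∣ j ↔ q ∣ σ j := by
    intro j
    have : (q:ℤ) ∣ ((σ j : ℕ) : ℤ) ↔ (q:ℤ) ∣ a * j := (dvd_iff_dvd_of_dvd_sub (hσd j)).symm
    rw [← Int.natCast_dvd_natCast, ← Int.natCast_dvd_natCast, this]
    exact ⟨fun h => h.mul_left _, fun h => ha.symm.dvd_of_dvd_mul_left h⟩
  have hgh : ∀ j, g j = h (σ j) := by
    intro j
    simp only [hg, hh, hdvd j]
    congr 2
    obtain ⟨c, hc⟩ := hσd j
    have : (j:ℝ) * (a / q) = σ j / q + c := by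
      have : (a:ℝ) * j - σ j = q * c := by exact_mod_cast hc
      field_simp; linarith
    rw [this, dn_add_int]
  have hinj : Set.InjOn σ (range q) := by
    intro i hi j hj hij
    simp only [coe_range, Set.mem_Iio] at hi hj
    have h1 : (q:ℤ) ∣ a * (i - j) := by
      have := dvd_sub (hσd i) (hσd j)
      rw [hij] at this
      rwa [show a * (i:ℤ) - (σ j : ℕ) - (a * j - (σ j : ℕ)) = a * (i - j) by ring] at this
    have h2 := ha.symm.dvd_of_dvd_mul_left h1
    have h3 := Int.eq_zero_of_abs_lt_dvd h2 (by rw [abs_lt]; constructor <;> omega)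
    omega
  have him : (range q).image σ = range q := by
    refine eq_of_subset_of_card_le ?_ (by rw [card_image_of_injOn hinj])
    intro i hi
    obtain ⟨j, _, rfl⟩ := mem_image.1 hi
    rw [mem_range]
    have := Int.emod_lt_of_pos (a * j) (by exact_mod_cast hq : (0:ℤ) < q)
    rw [← hσc] at this; exact_mod_cast this
  have hblock : ∑ d ∈ range q, g d ≤ 2 * q * (1 + Real.log q) := by
    rw [sum_congr rfl fun j _ => hgh j, ← sum_image hinj (f := h), him]
    obtain ⟨r, rfl⟩ : ∃ r, q = r + 1 := ⟨q - 1, by omega⟩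
    rw [sum_range_succ']
    simp only [hh, dvd_zero, if_true, add_zero]
    have hH : ∑ i ∈ range r, 1 / ((i + 1 : ℕ) : ℝ) ≤ 1 + Real.log ((r + 1 : ℕ) : ℝ) := by
      have := harmonic_le_one_add_log r
      have e : ∑ i ∈ range r, 1 / ((i + 1 : ℕ) : ℝ) = harmonic r := by
        unfold harmonic; push_cast; simp
      rw [e]
      refine this.trans ?_
      rcases Nat.eq_zero_or_pos r with h | h
      · subst h; simp
      · gcongr; omega
    calc _ ≤ ∑ i ∈ range r, (((r + 1 : ℕ):ℝ) * (1 / ((i + 1 : ℕ) : ℝ)) + ((r + 1 : ℕ):ℝ) * (1 / ((r - 1 - i + 1 : ℕ) : ℝ))) := by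
          refine sum_le_sum fun i hi => ?_
          rw [mem_range] at hi
          rw [if_neg (fun h => by have := Nat.le_of_dvd (by omega) h; omega)]
          have := dn_unit (i + 1) (r + 1) (by omega) (by omega)
          rwa [show r + 1 - (i + 1) = r - 1 - i + 1 by omega] at this
      _ = 2 * ((r + 1 : ℕ):ℝ) * ∑ i ∈ range r, 1 / ((i + 1 : ℕ) : ℝ) := by
          rw [sum_add_distrib, ← mul_sum, ← mul_sum, sum_range_reflect (fun i => 1 / ((i + 1 : ℕ) : ℝ)) r]; ring
      _ ≤ _ := by gcongr
  have hper : ∀ t j, g (t * q + j) = g j := by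
    intro t j
    simp only [hg]
    simp only [Nat.dvd_add_right (dvd_mul_left q t)]
    congr 2
    rw [show ((t * q + j : ℕ) : ℝ) * (a / q) = j * (a / q) + ((t * a : ℤ) : ℝ) by push_cast; field_simp; ring, dn_add_int]
  induction T with
  | zero => simp
  | succ T ih =>
    rw [add_mul, one_mul, sum_range_add, sum_congr rfl fun j _ => hper T j]
    push_cast; linarith
end

section
open Finset

noncomputable def tyI (X : ℕ) (α : ℝ) : ℂ :=
  ∑ d ∈ Ioc 0 X, ((ArithmeticFunction.moebius d * Real.log (X / d) ^ 2 : ℝ) : ℂ) * EE (X / d) (d * α)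

lemma mu_mul_uq (q k : ℕ) : (ArithmeticFunction.moebius (q * k) : ℝ) = ArithmeticFunction.moebius q * uq q k := by
  unfold uq
  split_ifs with h
  · rw [ArithmeticFunction.isMultiplicative_moebius.map_mul_of_coprime h.symm]; push_cast; rfl
  · rw [ArithmeticFunction.moebius_eq_zero_of_not_squarefree]
    · simp
    · intro hs; exact h (Nat.coprime_of_squarefree_mul hs).symm

lemma mu_abs (d : ℕ) : |(ArithmeticFunction.moebius d : ℝ)| ≤ 1 := by
  exact_mod_cast ArithmeticFunction.abs_moebius_le_one

lemma sum_mult_Ioc (q Z : ℕ) (hq : 0 < q) (f : ℕ → ℂ) :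
    ∑ d ∈ (Ioc 0 Z).filter (q ∣ ·), f d = ∑ k ∈ Ioc 0 (Z / q), f (q * k) := by
  have : (Ioc 0 Z).filter (q ∣ ·) = (Ioc 0 (Z / q)).image (q * ·) := by
    ext d; simp only [mem_filter, mem_Ioc, mem_image]
    constructor
    · rintro ⟨⟨h1, h2⟩, k, rfl⟩
      exact ⟨k, ⟨Nat.pos_of_mul_pos_left h1, by rw [Nat.le_div_iff_mul_le hq, mul_comm]; exact h2⟩, rfl⟩
    · rintro ⟨k, ⟨h1, h2⟩, rfl⟩
      rw [Nat.le_div_iff_mul_le hq, mul_comm] at h2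
      exact ⟨⟨Nat.mul_pos hq h1, h2⟩, dvd_mul_right _ _⟩
  rw [this, sum_image (fun a _ b _ h => Nat.eq_of_mul_eq_mul_left hq h)]

set_option maxHeartbeats 1600000 in
lemma type1_bd (X q : ℕ) (a : ℤ) (α : ℝ) (hq : 0 < q) (ha : IsCoprime a (q:ℤ)) (hL : 3 ≤ Real.log X)
    (hX : Real.log X ^ 10 ≤ X) (hq2 : (q:ℝ) * Real.log X ^ 5 ≤ X)
    (hb : |α - a / q| * (X * q) ≤ Real.log X ^ 5) :
    ‖tyI X α‖ ≤ 3000 * X * Real.log (Real.log X) ^ 3 + 120 * Real.log X * ‖EE X (α - a / q)‖ / q.totient := by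
  set L := Real.log X with hLd
  set ℓ := Real.log L with hl
  set β := α - a / q with hβ
  have hℓ : 1 ≤ ℓ := by
    rw [hl, Real.le_log_iff_exp_le (by linarith)]; linarith [Real.exp_one_lt_d9]
  have hX0 : (0:ℝ) < X := lt_of_lt_of_le (by positivity) hX
  have hX1 : (1:ℝ) ≤ X := by
    have : 0 < X := by exact_mod_cast hX0
    exact_mod_cast this
  have hq1 : (1:ℝ) ≤ q := by exact_mod_cast hq
  have hq0 : (0:ℝ) < q := by linarith
  have hphi : (0:ℝ) < q.totient := by exact_mod_cast Nat.totient_pos.2 hq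
  set Z := ⌊(X:ℝ) / L ^ 10⌋₊ with hZ
  have hy : 1 ≤ (X:ℝ) / L ^ 10 := by rw [one_le_div (by positivity)]; exact hX
  obtain ⟨z1, z2, z3, z4⟩ := floor_bd _ hy
  rw [← hZ] at z1 z2 z3 z4
  have z1' : (0:ℝ) < Z := by exact_mod_cast z1
  have hZL : (Z:ℝ) * L ^ 10 ≤ X := by rwa [le_div_iff₀ (by positivity)] at z2
  have hZX : Z ≤ X := by
    have : (Z:ℝ) ≤ X := z2.trans (div_le_self hX0.le (one_le_pow₀ (by linarith)))
    exact_mod_cast this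
  have hXZ : Real.log X - Real.log Z ≤ 1 + 10 * ℓ := by
    rw [← Real.log_div hX0.ne' z1'.ne']
    have : (X:ℝ) / Z ≤ 2 * L ^ 10 := by
      rw [div_le_div_iff₀ z1' (by positivity)] at z4
      rw [div_le_iff₀ z1']
      have : (X:ℝ) = X / L ^ 10 * L ^ 10 := by field_simp
      rw [this]
      nlinarith [show 0 < L ^ 10 by positivity]
    refine (Real.log_le_log (by positivity) this).trans ?_
    rw [Real.log_mul (by norm_num) (by positivity), Real.log_pow]
    push_cast
    linarith [Real.log_two_lt_d9]
  -- log bound beyond Z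
  have hlogZ : ∀ d : ℕ, Z < d → d ≤ X → 0 ≤ Real.log (X / d) ∧ Real.log (X / d) ^ 2 ≤ 100 * ℓ ^ 2 := by
    intro d h1 h2
    have hd : (X:ℝ) / L ^ 10 ≤ d := z3.trans (by exact_mod_cast h1)
    have hd0 : (0:ℝ) < d := by linarith
    have g0 : 0 ≤ Real.log (X / d) := Real.log_nonneg (by rw [one_le_div hd0]; exact_mod_cast h2)
    have g1 : Real.log (X / d) ≤ 10 * ℓ := by
      have : (X:ℝ) / d ≤ L ^ 10 := by rw [div_le_iff₀ hd0]; rw [div_le_iff₀ (by positivity)] at hd; linarith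
      refine (Real.log_le_log (by positivity) this).trans ?_
      rw [Real.log_pow]; push_cast; exact le_rfl
    exact ⟨g0, by nlinarith⟩
  have hlogL : ∀ d : ℕ, 0 < d → d ≤ X → 0 ≤ Real.log (X / d) ∧ Real.log (X / d) ^ 2 ≤ L ^ 2 := by
    intro d h1 h2
    have hd0 : (1:ℝ) ≤ d := by exact_mod_cast h1
    have g0 : 0 ≤ Real.log (X / d) := Real.log_nonneg (by rw [one_le_div (by linarith)]; exact_mod_cast h2)
    have g1 : Real.log (X / d) ≤ L := Real.log_le_log (by positivity) (div_le_self hX0.le hd0)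
    exact ⟨g0, by nlinarith⟩
  set t : ℕ → ℂ := fun d => ((ArithmeticFunction.moebius d * Real.log (X / d) ^ 2 : ℝ) : ℂ) * EE (X / d) (d * α) with ht
  have htn : ∀ d, ‖t d‖ ≤ Real.log (X / d) ^ 2 * ‖EE (X / d) (d * α)‖ := by
    intro d
    simp only [ht]
    rw [norm_mul, Complex.norm_real, Real.norm_eq_abs, abs_mul, abs_of_nonneg (sq_nonneg (Real.log (X / d)))]
    gcongr
    exact mul_le_of_le_one_left (sq_nonneg _) (mu_abs d)
  have hsplit : tyI X α = ∑ d ∈ Ioc Z X, t d + (∑ d ∈ (Ioc 0 Z).filter (q ∣ ·), t d + ∑ d ∈ (Ioc 0 Z).filter (¬ q ∣ ·), t d) := by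
    rw [sum_filter_add_sum_filter_not, add_comm, sum_Ioc_consecutive _ (Nat.zero_le _) hZX]; rfl
  -- part (i)
  have hsumZ : ∀ q u v : ℕ, Z < q * (u + 1) → q * v ≤ X → 0 < q → ∑ k ∈ Ioc u v, 1 / (k:ℝ) ≤ 2 + 10 * ℓ := by
    intro q u v h1 h2 hq
    have hq0 : (0:ℝ) < q := by exact_mod_cast hq
    by_cases huv : u < v
    · refine (sum_inv_Ioc u v huv).trans ?_
      have hv : (0:ℝ) < v := by exact_mod_cast (by omega : 0 < v)
      have k1 : Real.log (q * v) ≤ Real.log X := Real.log_le_log (by positivity) (by exact_mod_cast h2)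
      have k2 : Real.log Z ≤ Real.log (q * (u + 1)) := Real.log_le_log z1' (by exact_mod_cast h1.le)
      rw [Real.log_mul hq0.ne' hv.ne'] at k1
      rw [Real.log_mul hq0.ne' (by positivity)] at k2
      linarith
    · rw [Ioc_eq_empty huv, sum_empty]; linarith
  have hsumZ1 : ∑ k ∈ Ioc Z X, 1 / (k:ℝ) ≤ 2 + 10 * ℓ :=
    hsumZ 1 Z X (by omega) (by omega) one_pos
  have hi : ‖∑ d ∈ Ioc Z X, t d‖ ≤ 100 * ℓ ^ 2 * X * (2 + 10 * ℓ) := by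
    refine (norm_sum_le _ _).trans ?_
    calc _ ≤ ∑ d ∈ Ioc Z X, 100 * ℓ ^ 2 * X * (1 / (d:ℝ)) := by
          refine sum_le_sum fun d hd => (htn d).trans ?_
          obtain ⟨h1, h2⟩ := mem_Ioc.1 hd
          have : ‖EE (X / d) (d * α)‖ ≤ X * (1 / (d:ℝ)) := by
            refine (EE_triv _ _).trans ?_
            rw [mul_one_div]; exact Nat.cast_div_le
          calc _ ≤ (100 * ℓ ^ 2) * (X * (1 / (d:ℝ))) := mul_le_mul (hlogZ d h1 h2).2 this (norm_nonneg _) (by positivity)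
            _ = _ := by ring
      _ ≤ _ := by rw [← mul_sum]; gcongr
  -- part (ii)
  have hii : ‖∑ d ∈ (Ioc 0 Z).filter (¬ q ∣ ·), t d‖ ≤ X := by
    have step : ∀ d ∈ Ioc 0 Z, ¬ q ∣ d → ‖t d‖ ≤ L ^ 2 * (1 / dn (d * (a / q))) := by
      intro d hd hqd
      obtain ⟨h1, h2⟩ := mem_Ioc.1 hd
      refine (htn d).trans (mul_le_mul (hlogL d h1 (h2.trans hZX)).2 ?_ (norm_nonneg _) (by positivity))
      have k1 : 1 / (q:ℝ) ≤ dn (d * (a / q)) := by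
        have := dn_frac (d * a) q hq (fun h => hqd (by
          have := ha.symm.dvd_of_dvd_mul_right h; exact_mod_cast this))
        rwa [show (((d * a : ℤ) : ℝ) / q) = d * (a / q) by push_cast; ring] at this
      have hdp : 0 < dn (d * (a / q)) := lt_of_lt_of_le (by positivity) k1
      have k2 : (d:ℝ) * |β| ≤ 1 / (2 * q) := by
        rw [le_div_iff₀ (by positivity)]
        have hdZ : (d:ℝ) ≤ Z := by exact_mod_cast h2
        have e1 : (d:ℝ) * L ^ 10 * (|β| * q) ≤ L ^ 5 := by
          refine le_trans ?_ hb
          calc _ ≤ X * (|β| * q) := mul_le_mul_of_nonneg_right (le_trans (by gcongr) hZL) (by positivity)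
            _ = _ := by ring
        have hL5 : 243 ≤ L ^ 5 := by
          calc (243:ℝ) = 3 ^ 5 := by norm_num
            _ ≤ L ^ 5 := by gcongr
        have e2 : (d:ℝ) * (|β| * q) * L ^ 5 ≤ 1 := by
          have : ((d:ℝ) * (|β| * q) * L ^ 5) * L ^ 5 ≤ 1 * L ^ 5 := by
            calc _ = (d:ℝ) * L ^ 10 * (|β| * q) := by ring
              _ ≤ _ := by linarith
          exact le_of_mul_le_mul_right this (by positivity)
        have e3 : 0 ≤ (d:ℝ) * (|β| * q) := by positivity
        nlinarith
      have k3 : dn (d * (a / q)) ≤ 2 * dn (d * α) := by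
        have e : (d:ℝ) * (a / q) = d * α - d * β := by rw [hβ]; ring
        have k4 : dn (d * (a / q)) ≤ dn (d * α) + d * |β| := by
          rw [e]
          refine (dn_sub _ _).trans ?_
          gcongr
          refine (dn_le_abs _).trans (le_of_eq ?_)
          rw [abs_mul, Nat.abs_cast]
        have k5 : 1 / (2 * (q:ℝ)) = 1 / 2 * (1 / q) := by ring
        linarith
      have k6 := EE_geom (X / d) (d * α)
      rw [le_div_iff₀ hdp]
      nlinarith [norm_nonneg (EE (X / d) (d * α))]
    calc _ ≤ ∑ d ∈ (Ioc 0 Z).filter (¬ q ∣ ·), L ^ 2 * (1 / dn (d * (a / q))) :=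
          (norm_sum_le _ _).trans (sum_le_sum fun d hd => step d (mem_filter.1 hd).1 (mem_filter.1 hd).2)
      _ = ∑ d ∈ Ioc 0 Z, L ^ 2 * (if q ∣ d then 0 else 1 / dn (d * (a / q))) := by
          rw [sum_filter]; refine sum_congr rfl fun d _ => ?_; split_ifs <;> simp
      _ ≤ ∑ d ∈ range ((Z / q + 1) * q), L ^ 2 * (if q ∣ d then 0 else 1 / dn (d * (a / q))) := by
          refine sum_le_sum_of_subset_of_nonneg ?_ ?_
          · intro d hd
            have := (mem_Ioc.1 hd).2
            have := Nat.lt_div_mul_add hq (a := Z)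
            rw [mem_range, add_mul, one_mul]; omega
          · intro d _ _; have := dn_nonneg (d * (a / q : ℝ)); positivity
      _ ≤ L ^ 2 * (((Z / q + 1 : ℕ) : ℝ) * (2 * q * (1 + Real.log q))) := by
          rw [← mul_sum]; gcongr; exact dn_block q hq a ha _
      _ ≤ X := by
          have hqX : (q:ℝ) ≤ X := by
            refine le_trans ?_ hq2
            have : 1 ≤ L ^ 5 := one_le_pow₀ (by linarith)
            nlinarith
          have g1 : Real.log q ≤ L := Real.log_le_log hq0 hqX
          have g0 : 0 ≤ Real.log q := Real.log_nonneg hq1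
          have g2 : ((Z / q + 1 : ℕ) : ℝ) * q ≤ Z + q := by
            have := Nat.div_mul_le_self Z q
            have : ((Z / q * q : ℕ) : ℝ) ≤ Z := by exact_mod_cast this
            push_cast at this ⊢; linarith
          have g3 : ((Z:ℝ) + q) * L ^ 5 ≤ 2 * X := by
            have : (Z:ℝ) * L ^ 5 ≤ X := by
              refine le_trans ?_ hZL
              gcongr
              · linarith
              · norm_num
            linarith
          have g4 : 2 * L ^ 2 * (1 + L) * 2 ≤ L ^ 5 := by nlinarith [show 0 < L ^ 2 by positivity, show 0 < L ^ 3 by positivity, show 9 ≤ L^2 by nlinarith]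
          have g5 : (2 * L ^ 2 * (1 + L)) * ((Z:ℝ) + q) ≤ X := by
            have : 0 ≤ (Z:ℝ) + q := by positivity
            nlinarith
          calc _ = 2 * L ^ 2 * (1 + Real.log q) * (((Z / q + 1 : ℕ) : ℝ) * q) := by ring
            _ ≤ 2 * L ^ 2 * (1 + L) * ((Z:ℝ) + q) := by gcongr
            _ ≤ X := g5
  -- part (iii)
  have hiii : ‖∑ d ∈ (Ioc 0 Z).filter (q ∣ ·), t d‖ ≤ X + X * (100 * ℓ ^ 2 * (2 + 10 * ℓ)) + 120 * L * ‖EE X β‖ / q.totient := by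
    rw [sum_mult_Ioc q Z hq]
    set I := EE X β with hI
    have hIX : ‖I‖ ≤ X := EE_triv _ _
    set v : ℕ → ℝ := fun k => uq q k / k * Real.log (X / q / k) ^ 2 with hv
    have hkX : ∀ k, k ∈ Ioc 0 (Z / q) → 0 < q * k ∧ q * k ≤ X := by
      intro k hk
      obtain ⟨h1, h2⟩ := mem_Ioc.1 hk
      rw [Nat.le_div_iff_mul_le hq] at h2
      exact ⟨Nat.mul_pos hq h1, by rw [mul_comm]; omega⟩
    have herr : ∀ k ∈ Ioc 0 (Z / q), ‖t (q * k) - (ArithmeticFunction.moebius q * v k / q : ℝ) * I‖ ≤ L ^ 2 * (7 * |β| * X + 1) := by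
      intro k hk
      obtain ⟨h1, h2⟩ := hkX k hk
      have hk0 : (0:ℝ) < k := by exact_mod_cast (mem_Ioc.1 hk).1
      have e1 : EE (X / (q * k)) ((q * k : ℕ) * α) = EE (X / (q * k)) ((q * k : ℕ) * β) := by
        rw [← EE_add_int _ ((q * k : ℕ) * β) (k * a)]
        congr 1; rw [hβ]; push_cast; field_simp; ring
      have e2 := EE_mult X (q * k) h1 β
      have e3 : t (q * k) - (ArithmeticFunction.moebius q * v k / q : ℝ) * I =
          ((-(ArithmeticFunction.moebius (q * k) * Real.log (X / (q * k : ℕ)) ^ 2 / (q * k : ℕ)) : ℝ) : ℂ) *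
            (I - (q * k : ℕ) * EE (X / (q * k)) ((q * k : ℕ) * β)) := by
        simp only [ht, hv, e1]
        rw [mu_mul_uq, div_div]
        push_cast
        have : (q:ℂ) ≠ 0 := by exact_mod_cast hq.ne'
        have : (k:ℂ) ≠ 0 := by exact_mod_cast hk0.ne'
        field_simp; ring
      have hqk : (0:ℝ) < (q * k : ℕ) := by exact_mod_cast h1
      rw [e3, norm_mul, Complex.norm_real, Real.norm_eq_abs, abs_neg, abs_div, Nat.abs_cast, div_mul_eq_mul_div, div_le_iff₀ hqk]
      have e4 : |(ArithmeticFunction.moebius (q * k) : ℝ) * Real.log (X / (q * k : ℕ)) ^ 2| ≤ L ^ 2 := by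
        rw [abs_mul, abs_of_nonneg (sq_nonneg (Real.log _))]
        exact (mul_le_of_le_one_left (sq_nonneg _) (mu_abs _)).trans (hlogL _ h1 h2).2
      calc _ ≤ L ^ 2 * ((q * k : ℕ) * (7 * |β| * X + 1)) := mul_le_mul e4 e2 (norm_nonneg _) (by positivity)
        _ = _ := by ring
    have herr2 : ‖∑ k ∈ Ioc 0 (Z / q), t (q * k) - (ArithmeticFunction.moebius q * (∑ k ∈ Ioc 0 (Z / q), v k) / q : ℝ) * I‖ ≤ X := by
      have e : ((ArithmeticFunction.moebius q * (∑ k ∈ Ioc 0 (Z / q), v k) / q : ℝ) : ℂ) * I = ∑ k ∈ Ioc 0 (Z / q), (ArithmeticFunction.moebius q * v k / q : ℝ) * I := by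
        rw [← sum_mul, ← Complex.ofReal_sum, ← sum_div, ← mul_sum]
      rw [e, ← sum_sub_distrib]
      refine (norm_sum_le _ _).trans ((sum_le_sum herr).trans ?_)
      rw [sum_const, Nat.card_Ioc, nsmul_eq_mul, Nat.sub_zero]
      have f1 : ((Z / q : ℕ):ℝ) * L ^ 10 ≤ X / q := by
        refine le_trans ?_ (div_le_div_of_nonneg_right hZL hq0.le)
        rw [mul_div_right_comm]; gcongr; exact Nat.cast_div_le
      have f2 : |β| * X ≤ L ^ 5 := by
        refine le_trans ?_ hb
        calc _ ≤ |β| * X * q := le_mul_of_one_le_right (by positivity) hq1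
          _ = _ := by ring
      have f3 : (X:ℝ) / q ≤ X := div_le_self hX0.le hq1
      have f4 : L ^ 2 * (7 * |β| * X + 1) ≤ L ^ 10 := by
        have : 1 ≤ L ^ 5 := one_le_pow₀ (by linarith)
        have h8 : 8 ≤ L ^ 3 := by
          calc (8:ℝ) ≤ 3 ^ 3 := by norm_num
            _ ≤ L ^ 3 := by gcongr
        calc L ^ 2 * (7 * |β| * X + 1) ≤ L ^ 2 * (8 * L ^ 5) := by gcongr; linarith
          _ ≤ L ^ 2 * (L ^ 3 * L ^ 5) := by gcongr
          _ = L ^ 10 := by ring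
      calc _ ≤ ((Z / q : ℕ):ℝ) * L ^ 10 := by gcongr
        _ ≤ X := f1.trans f3
    have hqX : (1:ℝ) ≤ X / q := by
      rw [one_le_div hq0]
      refine le_trans ?_ hq2
      have : 1 ≤ L ^ 5 := one_le_pow₀ (by linarith)
      nlinarith
    have hfl : ⌊(X:ℝ) / q⌋₊ = X / q := Nat.floor_div_eq_div X q
    have hm := mob2 q hq (X / q) hqX
    rw [hfl, ← sum_Ioc_consecutive _ (Nat.zero_le (Z / q)) (Nat.div_le_div_right hZX)] at hm
    have htail : |∑ k ∈ Ioc (Z / q) (X / q), v k| ≤ 100 * ℓ ^ 2 * (2 + 10 * ℓ) := by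
      refine (abs_sum_le_sum_abs _ _).trans ?_
      calc _ ≤ ∑ k ∈ Ioc (Z / q) (X / q), 100 * ℓ ^ 2 * (1 / (k:ℝ)) := by
            refine sum_le_sum fun k hk => ?_
            obtain ⟨h1, h2⟩ := mem_Ioc.1 hk
            simp only [hv]
            rw [abs_mul, abs_div, Nat.abs_cast, abs_of_nonneg (sq_nonneg (Real.log _)), mul_comm, div_div]
            have := (hlogZ (q * k) (by rw [Nat.div_lt_iff_lt_mul hq] at h1; linarith) (by rw [Nat.le_div_iff_mul_le hq] at h2; linarith)).2
            push_cast at this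
            gcongr
            exact uq_abs q k
        _ ≤ _ := by
            rw [← mul_sum]; gcongr
            refine hsumZ q _ _ ?_ ?_ hq
            · have := Nat.lt_mul_div_succ Z hq; exact this
            · exact Nat.mul_div_le X q
    have hmain : |∑ k ∈ Ioc 0 (Z / q), v k| ≤ 120 * (q / q.totient) * L + 100 * ℓ ^ 2 * (2 + 10 * ℓ) := by
      have h1 : Real.log (X / q) ≤ L := Real.log_le_log (by positivity) (div_le_self hX0.le hq1)
      have h2 : 60 * ((q:ℝ) / q.totient) * (1 + Real.log (X / q)) ≤ 120 * (q / q.totient) * L := by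
        have : 0 ≤ (q:ℝ) / q.totient := by positivity
        nlinarith
      have h3 := hm.trans h2
      change |∑ k ∈ Ioc 0 (Z / q), v k + ∑ k ∈ Ioc (Z / q) (X / q), v k| ≤ _ at h3
      rw [abs_le] at *
      constructor <;> linarith [h3.1, h3.2, htail.1, htail.2]
    have hfin : ‖((ArithmeticFunction.moebius q * (∑ k ∈ Ioc 0 (Z / q), v k) / q : ℝ) : ℂ) * I‖ ≤
        120 * L * ‖I‖ / q.totient + X * (100 * ℓ ^ 2 * (2 + 10 * ℓ)) := by
      rw [norm_mul, Complex.norm_real, Real.norm_eq_abs, abs_div, Nat.abs_cast, abs_mul]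
      have h1 : |(ArithmeticFunction.moebius q : ℝ)| * |∑ k ∈ Ioc 0 (Z / q), v k| ≤ 120 * (q / q.totient) * L + 100 * ℓ ^ 2 * (2 + 10 * ℓ) :=
        (mul_le_of_le_one_left (abs_nonneg _) (mu_abs q)).trans hmain
      calc _ ≤ (120 * (q / q.totient) * L + 100 * ℓ ^ 2 * (2 + 10 * ℓ)) / q * ‖I‖ := by gcongr
        _ = 120 * L * ‖I‖ / q.totient + (100 * ℓ ^ 2 * (2 + 10 * ℓ)) / q * ‖I‖ := by field_simp
        _ ≤ 120 * L * ‖I‖ / q.totient + (100 * ℓ ^ 2 * (2 + 10 * ℓ)) * X := by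
            gcongr
            exact div_le_self (by positivity) hq1
        _ = _ := by ring
    have := norm_sub_norm_le (∑ k ∈ Ioc 0 (Z / q), t (q * k)) ((ArithmeticFunction.moebius q * (∑ k ∈ Ioc 0 (Z / q), v k) / q : ℝ) * I)
    linarith
  rw [hsplit]
  refine (norm_add_le _ _).trans (le_trans (add_le_add_right (norm_add_le _ _) _) ?_)
  have p2 : 1 ≤ ℓ ^ 2 := one_le_pow₀ hℓ
  have p3 : ℓ ^ 2 ≤ ℓ ^ 3 := pow_le_pow_right₀ hℓ (by norm_num)
  have : 2 + 2 * (100 * ℓ ^ 2 * (2 + 10 * ℓ)) ≤ 3000 * ℓ ^ 3 := by nlinarith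
  have := mul_le_mul_of_nonneg_left this hX0.le
  linarith
end

section
open Finset

def Maj (Q X : ℕ) (α : ℝ) : Prop := ∃ q : ℕ, 0 < q ∧ q ≤ Q ∧ dn (q * α) * X ≤ Q

lemma Maj.mono {Q Q' X : ℕ} {α : ℝ} (h : Q ≤ Q') (hm : Maj Q X α) : Maj Q' X α := by
  obtain ⟨q, h0, h1, h2⟩ := hm
  exact ⟨q, h0, h1.trans h, h2.trans (by exact_mod_cast h)⟩

lemma phi_fin (q : ℕ) (hq : 0 < q) : q ≤ 2 * q.totient ^ 2 := by
  suffices h : (q % 2 = 1 → q ≤ q.totient ^ 2) ∧ q ≤ 2 * q.totient ^ 2 from h.2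
  induction q using Nat.recOnPosPrimePosCoprime with
  | zero => omega
  | one => simp
  | prime_pow p n hp hn =>
    obtain ⟨k, rfl⟩ : ∃ k, n = k + 1 := ⟨n - 1, by omega⟩
    rw [Nat.totient_prime_pow_succ hp]
    have h1 : 1 ≤ p ^ k := Nat.one_le_pow _ _ hp.pos
    obtain ⟨r, rfl⟩ : ∃ r, p = r + 2 := ⟨p - 2, by have := hp.two_le; omega⟩
    have e : (r + 2) - 1 = r + 1 := rfl
    rw [e, pow_succ]
    constructor
    · intro h
      have : r ≠ 0 := by rintro rfl; simp at h
      have h3 : 1 ≤ r := by omega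
      calc (r+2)^k * (r+2) ≤ (r+2)^k * (r+1)^2 := by gcongr; nlinarith
        _ ≤ ((r+2)^k * (r+1))^2 := by rw [mul_pow]; exact Nat.mul_le_mul_right _ (Nat.le_self_pow two_ne_zero _)
    · calc (r+2)^k * (r+2) ≤ (r+2)^k * (2*(r+1)^2) := by gcongr; nlinarith
        _ ≤ 2*((r+2)^k * (r+1))^2 := by rw [mul_pow]; nlinarith [sq_nonneg (r+1), Nat.zero_le ((r+1)^2 * ((r+2)^k)), mul_le_mul_left h1 ((r+1)^2 * (r+2)^k)]
  | coprime a b ha hb hab iha ihb =>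
    have A := iha (by omega)
    have B := ihb (by omega)
    rw [Nat.totient_mul hab, mul_pow]
    constructor
    · intro h
      have : a % 2 = 1 ∧ b % 2 = 1 := by
        rcases Nat.mod_two_eq_zero_or_one a with h1 | h1 <;> rcases Nat.mod_two_eq_zero_or_one b with h2 | h2 <;> simp [Nat.mul_mod, h1, h2] at h ⊢
      exact Nat.mul_le_mul (A.1 this.1) (B.1 this.2)
    · rcases Nat.mod_two_eq_zero_or_one a with h1 | h1
      · rcases Nat.mod_two_eq_zero_or_one b with h2 | h2
        · have := Nat.dvd_gcd (Nat.dvd_of_mod_eq_zero h1) (Nat.dvd_of_mod_eq_zero h2)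
          rw [hab] at this; omega
        · rw [← mul_assoc]; exact Nat.mul_le_mul A.2 (B.1 h2)
      · calc a * b ≤ a.totient^2 * (2 * b.totient^2) := Nat.mul_le_mul (A.1 h1) B.2
          _ = _ := by ring

lemma log_small (k : ℕ) (ε : ℝ) (hε : 0 < ε) : ∀ᶠ x : ℝ in Filter.atTop, Real.log x ^ k ≤ ε * x := by
  have h := (Real.isLittleO_pow_log_id_atTop (n := k)).bound hε
  filter_upwards [h, Filter.eventually_ge_atTop 1] with x hx h1
  rw [Real.norm_of_nonneg (pow_nonneg (Real.log_nonneg h1) _)] at hx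
  simpa [abs_of_pos (lt_of_lt_of_le one_pos h1)] using hx

lemma dirich (α : ℝ) (n : ℕ) (hn : 0 < n) : ∃ q : ℕ, ∃ a : ℤ, 0 < q ∧ q ≤ n ∧ IsCoprime a (q:ℤ) ∧
    |α - a / q| * ((n + 1) * q) ≤ 1 := by
  obtain ⟨r, h1, h2⟩ := Real.exists_rat_abs_sub_le_and_den_le α hn
  refine ⟨r.den, r.num, r.den_pos, h2, ?_, ?_⟩
  · rw [Int.isCoprime_iff_nat_coprime]; simpa using r.reduced
  · have e : ((r.num:ℝ) / r.den) = (r:ℝ) := by exact_mod_cast r.num_div_den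
    rw [e]
    have : (0:ℝ) < r.den := by exact_mod_cast r.den_pos
    rwa [le_div_iff₀ (by positivity)] at h1

lemma maj_of (q Q X : ℕ) (a : ℤ) (α : ℝ) (hq : 0 < q) (hQ : q ≤ Q) (h : |α - a/q| * q * X ≤ Q) : Maj Q X α := by
  refine ⟨q, hq, hQ, le_trans ?_ h⟩
  have hq' : (0:ℝ) < q := by exact_mod_cast hq
  gcongr
  refine (dn_le _ a).trans (le_of_eq ?_)
  rw [← abs_of_pos hq', ← abs_mul, abs_of_pos hq']
  congr 1; field_simp

lemma dn_small (x : ℝ) (h : |x| < 1/2) : dn x = |x| := by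
  rw [dn_eq, (round_eq_zero_iff).2, Int.cast_zero, sub_zero]
  rw [abs_lt] at h
  exact ⟨by linarith [h.1], h.2⟩

lemma type1_min (ε : ℝ) (hε : 0 < ε) : ∃ Q X0 : ℕ, ∀ X ≥ X0, ∀ α : ℝ, Maj Q X α ∨ ‖tyI X α‖ ≤ ε * X * Real.log X := by
  obtain ⟨K, hK⟩ := exists_nat_ge (240 / ε)
  have E : ∀ᶠ X : ℕ in Filter.atTop, 3 ≤ Real.log X ∧ Real.log X ^ 10 ≤ 1 * X ∧ Real.log (Real.log X) ^ 3 ≤ ε / 6000 * Real.log X := by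
    have hl : Filter.Tendsto (fun n : ℕ => Real.log n) Filter.atTop Filter.atTop := Real.tendsto_log_atTop.comp tendsto_natCast_atTop_atTop
    filter_upwards [hl.eventually_ge_atTop 3, tendsto_natCast_atTop_atTop.eventually (log_small 10 1 one_pos), hl.eventually (log_small 3 (ε/6000) (by positivity))] with X h1 h2 h3 using ⟨h1, h2, h3⟩
  obtain ⟨X0, hX0⟩ := Filter.eventually_atTop.1 E
  refine ⟨2 * K^2 + 2 * K^2 * K, X0, fun X hX α => ?_⟩
  obtain ⟨h1, h2, h3⟩ := hX0 X hX
  rw [one_mul] at h2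
  set L := Real.log X with hL
  have hXp : (0:ℝ) < X := lt_of_lt_of_le (by positivity) h2
  have h5 : L^5 ≤ X := le_trans (pow_le_pow_right₀ (by linarith) (by norm_num)) h2
  obtain ⟨f1, f2, f3, -⟩ := floor_bd (X / L^5) (by rw [le_div_iff₀ (by positivity)]; linarith)
  obtain ⟨q, a, hq, hqn, hc, hb⟩ := dirich α _ f1
  have hq' : (0:ℝ) < q := by exact_mod_cast hq
  have hqn' : (q:ℝ) ≤ X / L^5 := le_trans (by exact_mod_cast hqn) f2
  rw [le_div_iff₀ (by positivity)] at hqn'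
  set β := α - a/q
  have hb2 : |β| * (X * q) ≤ L^5 := by
    rw [div_le_iff₀ (by positivity)] at f3
    calc |β| * (X*q) ≤ |β| * (((⌊X / L^5⌋₊+1) * L^5) * q) := by gcongr
      _ = (|β| * ((⌊X / L^5⌋₊+1) * q)) * L^5 := by ring
      _ ≤ 1 * L^5 := by gcongr
      _ = _ := by ring
  have hT := type1_bd X q a α hq hc h1 h2 hqn' hb2
  have hph : (0:ℝ) < q.totient := by exact_mod_cast Nat.totient_pos.2 hq
  rw [← hL] at hT
  by_cases hE : 120 * ‖EE X β‖ ≤ ε / 2 * X * q.totient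
  · right
    have : 120 * L * ‖EE X β‖ / q.totient ≤ ε / 2 * X * L := by
      rw [div_le_iff₀ hph]; nlinarith
    nlinarith
  left
  push Not at hE
  have hφ : (q.totient:ℝ) ≤ 240 / ε := by
    rw [le_div_iff₀ hε]
    have := EE_triv X β
    nlinarith
  have hφ2 : q.totient ≤ K := by exact_mod_cast hφ.trans hK
  have hqK : q ≤ 2 * K^2 := (phi_fin q hq).trans (by gcongr)
  refine maj_of q _ X a α hq (hqK.trans (by omega)) ?_
  have hβ : |β| * X ≤ K := by
    have hb3 : |β| < 1/2 := by
      have : X * q * (3^5 * |β|) ≤ X * q * 1 := by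
        have h6 : (1:ℝ) ≤ q := by exact_mod_cast hq
        have h7 : (0:ℝ) ≤ L^5 - 3^5 := sub_nonneg.2 (by gcongr)
        calc X * q * (3^5*|β|) = 3^5 * (|β| * (X*q)) := by ring
          _ ≤ L^5 * L^5 := by gcongr
          _ = L^10 := by ring
          _ ≤ X * 1 := by linarith
          _ ≤ X * q * 1 := by nlinarith
      have := le_of_mul_le_mul_left this (by positivity)
      linarith
    have h8 := EE_geom X β
    rw [dn_small β hb3] at h8
    have h9 : (1:ℝ) ≤ q.totient := by exact_mod_cast Nat.totient_pos.2 hq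
    have h10 : ε / 2 * X ≤ 120 * ‖EE X β‖ := le_trans (le_mul_of_one_le_right (by positivity) h9) hE.le
    refine le_trans ?_ hK
    rw [le_div_iff₀ hε]
    nlinarith [abs_nonneg β, mul_le_mul_of_nonneg_left h10 (abs_nonneg β)]
  have : (q:ℝ) ≤ 2 * K^2 := by exact_mod_cast hqK
  push_cast
  calc |β| * q * X = q * (|β| * X) := by ring
    _ ≤ 2 * K^2 * K := by gcongr
    _ ≤ _ := by have : (0:ℝ) ≤ 2 * K^2 := by positivity
                linarith
end

section
open Finset
open ArithmeticFunction ArithmeticFunction.Moebius ArithmeticFunction.zeta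

noncomputable def Dl (f : ArithmeticFunction ℝ) : ArithmeticFunction ℝ := pmul log f

lemma Dl_app (f : ArithmeticFunction ℝ) (n : ℕ) : Dl f n = Real.log n * f n := by simp [Dl, pmul_apply, log_apply]

lemma Dl_mul (f g : ArithmeticFunction ℝ) : Dl (f * g) = Dl f * g + f * Dl g := by
  ext n
  rw [ArithmeticFunction.add_apply, Dl_app, mul_apply, mul_apply, mul_apply, mul_sum, ← sum_add_distrib]
  refine sum_congr rfl fun x hx => ?_
  obtain ⟨h1, h2⟩ := Nat.mem_divisorsAntidiagonal.1 hx
  rw [Dl_app, Dl_app, ← h1, Nat.cast_mul, Real.log_mul (by rintro h; simp_all) (by rintro h; simp_all)]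
  ring

lemma selberg_af : Dl (Dl (μ : ArithmeticFunction ℝ)) * (ζ : ArithmeticFunction ℝ) + Dl vonMangoldt = vonMangoldt * vonMangoldt := by
  have h1 : Dl (μ : ArithmeticFunction ℝ) = - (vonMangoldt * (μ : ArithmeticFunction ℝ)) := by
    have h : Dl (μ : ArithmeticFunction ℝ) * (ζ : ArithmeticFunction ℝ) = - vonMangoldt := by
      ext n
      rw [coe_mul_zeta_apply, ArithmeticFunction.neg_apply, ← sum_moebius_mul_log_eq]
      refine sum_congr rfl fun d _ => ?_
      rw [Dl_app]; simp [mul_comm]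
    calc Dl (μ : ArithmeticFunction ℝ) = Dl (μ : ArithmeticFunction ℝ) * (ζ * μ : ArithmeticFunction ℝ) := by rw [coe_zeta_mul_coe_moebius, mul_one]
      _ = _ := by rw [← mul_assoc, h]; ring
  have h2 : ∀ f, Dl (-f) = - Dl f := fun f => by ext n; simp [Dl_app]
  have h3 : (μ * ζ : ArithmeticFunction ℝ) = 1 := coe_moebius_mul_coe_zeta
  rw [h1, h2, Dl_mul, h1]
  linear_combination (- Dl vonMangoldt + vonMangoldt * vonMangoldt) * h3

lemma selberg_id (n : ℕ) (hn : 0 < n) (L : ℝ) : ∑ d ∈ n.divisors, (μ d : ℝ) * (L - Real.log d)^2 =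
    (if n = 1 then L^2 else 0) + vonMangoldt n * (2 * L - Real.log n) + (vonMangoldt * vonMangoldt) n := by
  have h1 := congrArg (fun f : ArithmeticFunction ℝ => f n) selberg_af
  simp only [coe_mul_zeta_apply, Dl_app, ArithmeticFunction.add_apply, intCoe_apply] at h1
  rw [← eq_sub_iff_add_eq] at h1
  have h2 := sum_moebius_mul_log_eq (n := n)
  have h3 : ∑ d ∈ n.divisors, (μ d : ℝ) = if n = 1 then 1 else 0 := by
    have := congrArg (fun f : ArithmeticFunction ℝ => f n) (coe_moebius_mul_coe_zeta (R := ℝ))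
    simpa only [coe_mul_zeta_apply, ArithmeticFunction.one_apply, intCoe_apply] using this
  have : ∑ d ∈ n.divisors, (μ d : ℝ) * (L - Real.log d)^2 = L^2 * ∑ d ∈ n.divisors, (μ d : ℝ) - 2 * L * ∑ d ∈ n.divisors, (μ d : ℝ) * log d
      + ∑ d ∈ n.divisors, Real.log d * (Real.log d * μ d) := by
    simp only [mul_sum, ← sum_add_distrib, ← sum_sub_distrib]
    refine sum_congr rfl fun d _ => ?_
    rw [log_apply]; ring
  rw [this, h1, h2, h3]
  split_ifs <;> ring

lemma tyI_eq (X : ℕ) (α : ℝ) : tyI X α = ∑ n ∈ Ioc 0 X, ((∑ d ∈ n.divisors, (μ d : ℝ) * (Real.log X - Real.log d)^2 : ℝ) : ℂ) * ee (n * α) := by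
  have := dsum_swap (fun d n => (((μ d : ℝ) * (Real.log X - Real.log d)^2 : ℝ) : ℂ) * ee (n * α)) X
  simp only [← sum_mul, ← Complex.ofReal_sum] at this
  rw [← this, tyI]
  refine sum_congr rfl fun d hd => ?_
  rw [mem_Ioc] at hd
  rw [EE, mul_sum]
  refine sum_congr rfl fun m _ => ?_
  rw [Real.log_div (by norm_cast; omega) (by norm_cast; omega)]
  congr 2; push_cast; ring

lemma selberg_ex (X : ℕ) (hX : 0 < X) (α : ℝ) : tyI X α = Real.log X ^ 2 * ee α + ∑ n ∈ Ioc 0 X, (vonMangoldt n * (2 * Real.log X - Real.log n) : ℝ) * ee (n * α)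
    + ∑ n ∈ Ioc 0 X, ((vonMangoldt * vonMangoldt) n : ℝ) * ee (n * α) := by
  have : (Real.log X ^ 2 * ee α : ℂ) = ∑ n ∈ Ioc 0 X, ((if n = 1 then Real.log X ^ 2 else 0 : ℝ) : ℂ) * ee (n * α) := by
    rw [sum_eq_single_of_mem 1 (by simp; omega)]
    · simp
    · intro b _ hb; simp [hb]
  rw [tyI_eq, this, ← sum_add_distrib, ← sum_add_distrib]
  refine sum_congr rfl fun n hn => ?_
  rw [selberg_id n (mem_Ioc.1 hn).1]
  push_cast; ring
end

section
open Finset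

lemma bt : ∃ C : ℝ, 0 < C ∧ ∀ M D b : ℕ, 256 ≤ M → 0 < D → ∀ S : Finset ℕ, (∀ k ∈ S, k < M ∧ (D*k+b).Prime ∧ M < (D*k+b)^4) →
    (D.totient : ℝ) * Real.log M * #S ≤ C * M * D := by
  obtain ⟨C, hC, h⟩ := sieve_ls'
  refine ⟨C, hC, fun M D b hM hD S hS => ?_⟩
  have h1 := h Unit inferInstance {()} (fun _ => 0) M D b hM hD (by simp) (fun k => if k ∈ S then 1 else 0) (by
    intro k _ hk
    have : k ∈ S := by by_contra hh; simp [hh] at hk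
    exact (hS k this).2)
  have hsub : (range M).filter (· ∈ S) = S := by
    ext k; simp only [mem_filter, mem_range, and_iff_right_iff_imp]; exact fun hk => (hS k hk).1
  have e1 : ∑ k ∈ range M, (if k ∈ S then (1:ℂ) else 0) * ee (k * 0) = #S := by
    simp only [mul_zero, ee_zero, mul_one, ← sum_filter, hsub]; simp
  have e2 : ∑ k ∈ range M, ‖(if k ∈ S then (1:ℂ) else 0)‖^2 = #S := by
    have : ∀ k, ‖(if k ∈ S then (1:ℂ) else 0)‖^2 = if k ∈ S then (1:ℝ) else 0 := fun k => by split_ifs <;> simp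
    simp only [this, ← sum_filter, hsub]; simp
  simp only [sum_singleton, card_singleton, e1, e2, Nat.cast_one, Real.one_rpow, mul_one, Complex.norm_natCast] at h1
  rcases S.eq_empty_or_nonempty with rfl | hne
  · simp; positivity
  have hc : (0:ℝ) < #S := by exact_mod_cast card_pos.2 hne
  have hD' : (0:ℝ) < D := by exact_mod_cast hD
  refine le_of_mul_le_mul_right ?_ hc
  calc (D.totient : ℝ) * Real.log M * #S * #S = (D.totient / D * Real.log M * (#S:ℝ)^2) * D := by field_simp
    _ ≤ (C * M * #S) * D := by gcongr
    _ = _ := by ring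

set_option maxHeartbeats 800000 in
lemma occup (ε : ℝ) (hε : 0 < ε) : ∃ Q N1 : ℕ, ∀ X N M : ℕ, N1 ≤ N → 32 * N ≤ M → X ≤ 2 * M * N → ∀ α γ : ℝ, Maj Q X α ∨
    ∀ Z : Finset ℕ, (∀ p ∈ Z, p.Prime ∧ N ≤ p ∧ p ≤ 2 * N ∧ dn (p * α - γ) < 1 / M) → #Z * Real.log N ≤ ε * N := by
  obtain ⟨C, hC, hbt⟩ := bt
  obtain ⟨K, hK⟩ := exists_nat_ge (16 * C / ε)
  have E : ∀ᶠ N : ℕ in Filter.atTop, 1 ≤ Real.log N ∧ 256 * Real.log N ≤ ε * N ∧ Real.log N ^ 2 ≤ ε^2 * N := by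
    filter_upwards [(Real.tendsto_log_atTop.comp tendsto_natCast_atTop_atTop).eventually_ge_atTop 1, tendsto_natCast_atTop_atTop.eventually (log_small 1 (ε/256) (by positivity)),
     tendsto_natCast_atTop_atTop.eventually (log_small 2 (ε^2) (by positivity))] with N h1 h2 h3
    exact ⟨h1, by linarith, h3⟩
  obtain ⟨N1, hN1⟩ := Filter.eventually_atTop.1 E
  refine ⟨2 * K^2 + 2 * K^2 * K, N1 + 2, fun X N M hN hM hX α γ => or_iff_not_imp_right.2 fun hZ => ?_⟩
  push Not at hZ
  obtain ⟨Z, hZ, hlt⟩ := hZ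
  obtain ⟨l1, l2, l3⟩ := hN1 N (by omega)
  have hN0 : (0:ℝ) < N := by norm_cast; omega
  have hM0 : (0:ℝ) < M := by norm_cast; omega
  have hMN : (32:ℝ) * N ≤ M := by exact_mod_cast hM
  have hne : Z.Nonempty := by
    rw [nonempty_iff_ne_empty]; rintro rfl; simp at hlt; nlinarith
  obtain ⟨q, a, hq, hqn, hc, hb⟩ := dirich α (M/8) (by omega)
  have hq' : (0:ℝ) < q := by exact_mod_cast hq
  have hq1 : (1:ℝ) ≤ q := by exact_mod_cast hq
  have hqM : (8:ℝ) * q ≤ M := by have : 8 * q ≤ M := by omega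
                                 exact_mod_cast this
  set β := α - a/q with hβ
  have hbM : |β| * q * M ≤ 8 := by
    have : (M:ℝ) ≤ 8 * ((M/8:ℕ) + 1) := by norm_cast; omega
    calc |β| * q * M ≤ |β| * q * (8 * ((M/8:ℕ) + 1)) := by gcongr
      _ ≤ _ := by linarith
  set n0 := Z.min' hne
  have key : ∀ p ∈ Z, n0 ≤ p ∧ q ∣ (p - n0) ∧ ((p - n0 : ℕ):ℝ) * |β| * M < 2 := by
    intro p hp
    have h0 : n0 ≤ p := min'_le _ _ hp
    obtain ⟨-, hp1, hp2, hp3⟩ := hZ p hp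
    obtain ⟨-, hn1, hn2, hn3⟩ := hZ n0 (min'_mem _ _)
    obtain ⟨t, ht⟩ : ∃ t, p = n0 + t := ⟨p - n0, by omega⟩
    have ht' : p - n0 = t := by omega
    rw [ht']
    have htN : (t:ℝ) ≤ N := by norm_cast; omega
    have d1 : dn (t * α) * M < 2 := by
      have := dn_sub (p * α - γ) (n0 * α - γ)
      have e : p * α - γ - (n0 * α - γ) = t * α := by rw [ht]; push_cast; ring
      rw [e] at this
      rw [lt_div_iff₀ hM0] at hp3 hn3
      nlinarith
    have e2 : t * α = t * β + (t * a : ℤ) / q := by rw [hβ]; push_cast; ring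
    have tb : 4 * q * (t * |β|) ≤ 1 := by
      have : 4 * q * (t * |β|) * M ≤ 1 * M := by
        calc 4 * q * (t * |β|) * M = 4 * t * (|β| * q * M) := by ring
          _ ≤ 4 * N * 8 := by gcongr
          _ ≤ _ := by linarith
      exact le_of_mul_le_mul_right this hM0
    have hqt : q ∣ t := by
      by_contra hnd
      have h1 := dn_frac (t * a) q hq (by
        intro hd
        exact hnd (Int.natCast_dvd_natCast.1 (hc.symm.dvd_of_dvd_mul_right hd)))
      have h2 := dn_sub (t * α) (t * β)
      rw [show t * α - t * β = ((t * a : ℤ):ℝ) / q by rw [e2]; ring] at h2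
      have h3 := dn_le_abs (t * β)
      rw [abs_mul, Nat.abs_cast] at h3
      have h4 : 1 / (q:ℝ) ≤ dn (t*α) + t * |β| := by linarith
      rw [div_le_iff₀ hq'] at h4
      have : 2 ≤ dn (t * α) * M := by nlinarith [dn_nonneg (t*α)]
      linarith
    refine ⟨h0, hqt, ?_⟩
    obtain ⟨k, rfl⟩ := hqt
    have : dn ((q * k : ℕ) * α) = ((q * k : ℕ):ℝ) * |β| := by
      rw [e2, show (((q * k : ℕ) * a : ℤ):ℝ) / q = ((k * a : ℤ) : ℝ) by push_cast; field_simp, dn_add_int, dn_small, abs_mul, Nat.abs_cast]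
      rw [abs_mul, Nat.abs_cast]; nlinarith [mul_nonneg (Nat.cast_nonneg (α := ℝ) (q*k)) (abs_nonneg β)]
    rwa [this] at d1
  set f : ℕ → ℕ := fun p => (p - n0) / q
  have hf : ∀ p ∈ Z, q * f p + n0 = p := fun p hp => by
    obtain ⟨h1, h2, -⟩ := key p hp
    simp only [f]; rw [Nat.mul_div_cancel' h2]; omega
  have hinj : Set.InjOn f Z := fun x hx y hy hxy => by rw [← hf x hx, ← hf y hy, hxy]
  set m := Z.max' hne
  have hmZ : m ∈ Z := max'_mem _ _
  set Lk := f m + 1 with hLk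
  have hfl : ∀ p ∈ Z, f p < Lk := fun p hp => by
    have h1 : p ≤ m := le_max' _ _ hp
    exact Nat.lt_succ_of_le (Nat.div_le_div_right (by omega))
  have hcard : #Z ≤ Lk := by
    rw [← card_image_of_injOn hinj, ← card_range Lk]
    exact card_le_card fun x hx => by
      obtain ⟨p, hp, rfl⟩ := mem_image.1 hx
      exact mem_range.2 (hfl p hp)
  have hcard' : (#Z:ℝ) ≤ Lk := by exact_mod_cast hcard
  have hl0 : 0 < Real.log N := by linarith
  have hZ256 : (256:ℝ) < #Z := by nlinarith
  have hL256 : (256:ℝ) < Lk := by linarith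
  have hqf : q * f m ≤ N := by
    have := hf m hmZ
    have h1 := (hZ m hmZ).2.2.1
    have h2 := (hZ n0 (min'_mem _ _)).2.1
    omega
  have hqL : (q:ℝ) * Lk ≤ 2 * N := by
    have h1 : (q:ℝ) * f m ≤ N := by exact_mod_cast hqf
    have h2 : (Lk:ℝ) = f m + 1 := by rw [hLk]; push_cast; rfl
    nlinarith
  have hB := hbt Lk q n0 (by exact_mod_cast hL256.le) hq (Z.image f) (by
    intro k hk
    obtain ⟨p, hp, rfl⟩ := mem_image.1 hk
    rw [hf p hp]
    refine ⟨hfl p hp, (hZ p hp).1, ?_⟩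
    have h1 := (hZ p hp).2.1
    have h2 : Lk ≤ N + 1 := by
      have : f m ≤ q * f m := Nat.le_mul_of_pos_left _ hq
      omega
    calc Lk < 2^2 * N := by omega
      _ ≤ N^2 * N := by gcongr; omega
      _ = N^3 := by ring
      _ ≤ N^4 := Nat.pow_le_pow_right (by omega) (by norm_num)
      _ ≤ p^4 := by gcongr)
  rw [card_image_of_injOn hinj] at hB
  have hlog : Real.log N ≤ 2 * Real.log Lk := by
    rw [← Real.log_rpow (by linarith), Real.rpow_two]
    apply Real.log_le_log hN0
    have h1 : ε * N ≤ Lk * Real.log N := hlt.le.trans (by gcongr)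
    have h2 : (ε * N)^2 ≤ Lk^2 * (ε^2 * N) := by
      calc (ε * N)^2 ≤ (Lk * Real.log N)^2 := by gcongr
        _ = Lk^2 * Real.log N^2 := by ring
        _ ≤ _ := by gcongr
    have : N * (ε^2 * N) ≤ Lk^2 * (ε^2 * N) := by linarith
    exact le_of_mul_le_mul_right this (by positivity)
  have hφ0 : (1:ℝ) ≤ q.totient := by exact_mod_cast Nat.totient_pos.2 hq
  have hB2 : q.totient * (ε * N) ≤ 2 * C * (Lk * q) := by
    calc (q.totient:ℝ) * (ε * N) ≤ q.totient * (#Z * Real.log N) := by gcongr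
      _ ≤ q.totient * (#Z * (2 * Real.log Lk)) := by gcongr
      _ ≤ _ := by linarith
  have hφ : (q.totient:ℝ) ≤ 16 * C / ε := by
    rw [le_div_iff₀ hε]
    have h1 := mul_le_mul_of_nonneg_left hqL hC.le
    have h2 := mul_pos hC hN0
    have : q.totient * ε * N ≤ (16 * C) * N := by linarith
    exact le_of_mul_le_mul_right this hN0
  have hφ2 : q.totient ≤ K := by exact_mod_cast hφ.trans hK
  have hqK : q ≤ 2 * K^2 := (phi_fin q hq).trans (by gcongr)
  refine maj_of q _ X a α hq (hqK.trans (by omega)) ?_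
  have hbL : (Lk * q) * |β| * M ≤ 4 := by
    have h1 := (key m hmZ).2.2
    have e : m - n0 = q * f m := by have := hf m hmZ; omega
    have h2 : (Lk:ℝ) = f m + 1 := by rw [hLk]; push_cast; rfl
    rw [e] at h1; push_cast at h1
    have : (Lk:ℝ) ≤ 2 * f m := by linarith
    calc (Lk * q) * |β| * M ≤ (2 * f m * q) * |β| * M := by gcongr
      _ ≤ 4 := by linarith
  have hβ2 : |β| * X ≤ K := by
    refine le_trans ?_ hK
    rw [le_div_iff₀ hε]
    have hX' : (X:ℝ) ≤ 2 * M * N := by exact_mod_cast hX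
    have h3 : ε * N ≤ 2 * C * (Lk * q) := le_trans (le_mul_of_one_le_left (by positivity) hφ0) hB2
    calc |β| * X * ε ≤ |β| * (2 * M * N) * ε := by gcongr
      _ = 2 * |β| * M * (ε * N) := by ring
      _ ≤ 2 * |β| * M * (2 * C * (Lk * q)) := by gcongr
      _ = 4 * C * ((Lk * q) * |β| * M) := by ring
      _ ≤ 4 * C * 4 := by gcongr
      _ = _ := by ring
  have : (q:ℝ) ≤ 2 * K^2 := by exact_mod_cast hqK
  push_cast
  calc |β| * q * X = q * (|β| * X) := by ring
    _ ≤ 2 * K^2 * K := by gcongr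
    _ ≤ _ := by have : (0:ℝ) ≤ 2 * K^2 := by positivity
                linarith
end

section
open Finset

noncomputable def lgp (n : ℕ) : ℝ := if n.Prime then Real.log n else 0
noncomputable def TT (M : ℕ) (θ : ℝ) : ℂ := ∑ k ∈ range M, (lgp k : ℂ) * ee (k * θ)

lemma lgp_nonneg (n : ℕ) : 0 ≤ lgp n := by
  unfold lgp; split_ifs
  · exact Real.log_natCast_nonneg n
  · rfl

lemma lgp_le (n : ℕ) : lgp n ≤ Real.log n := by
  unfold lgp; split_ifs
  · rfl
  · exact Real.log_natCast_nonneg n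

lemma lgp_le_vm (n : ℕ) : lgp n ≤ ArithmeticFunction.vonMangoldt n := by
  unfold lgp; split_ifs with h
  · rw [ArithmeticFunction.vonMangoldt_apply_prime h]
  · exact ArithmeticFunction.vonMangoldt_nonneg

lemma theta_eq' (n : ℕ) : ∑ k ∈ range (n+1), lgp k = Chebyshev.theta n := by
  rw [Chebyshev.theta, Nat.floor_natCast, sum_filter, range_eq_Ico, sum_eq_sum_Ico_succ_bot (by omega)]
  simp only [lgp, Nat.not_prime_zero, if_false, zero_add]
  exact sum_congr (by ext; simp; omega) fun _ _ => rfl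

lemma lgp_sum (M : ℕ) : ∑ k ∈ range (M+1), lgp k ≤ 2 * M := by
  have h := Chebyshev.theta_le_log4_mul_x (x := M) (by positivity)
  rw [theta_eq']
  refine h.trans (mul_le_mul_of_nonneg_right ?_ (by positivity))
  rw [show (4:ℝ) = 2^2 by norm_num, Real.log_pow]; have := Real.log_two_lt_d9; push_cast; linarith

lemma lgp_sum' (M : ℕ) : ∑ k ∈ range M, lgp k ≤ 2 * M :=
  le_trans (sum_le_sum_of_subset_of_nonneg (range_subset_range.2 M.le_succ) fun i _ _ => lgp_nonneg i) (lgp_sum M)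

lemma max_sep (V : Finset ℕ) (θ : ℕ → ℝ) (d : ℝ) (hd : 0 < d) : ∃ S ⊆ V, (∀ i ∈ S, ∀ j ∈ S, i ≠ j → d ≤ dn (θ i - θ j)) ∧ ∀ i ∈ V, ∃ j ∈ S, dn (θ i - θ j) < d := by
  classical
  obtain ⟨S, hS, hmax⟩ := exists_max_image (V.powerset.filter fun S => ∀ i ∈ S, ∀ j ∈ S, i ≠ j → d ≤ dn (θ i - θ j)) card ⟨∅, by simp⟩
  simp only [mem_filter, mem_powerset] at hS hmax
  refine ⟨S, hS.1, hS.2, fun i hi => ?_⟩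
  by_contra! h
  have hiS : i ∉ S := fun hh => by have := h i hh; simp [(dn_zero_iff 0).2 ⟨0, by simp⟩] at this; linarith
  have := hmax (insert i S) ⟨insert_subset hi hS.1, by
    intro x hx y hy hxy
    rw [mem_insert] at hx hy
    rcases hx with rfl | hx <;> rcases hy with rfl | hy
    · exact absurd rfl hxy
    · exact h y hy
    · rw [dn_sub_comm]; exact h x hx
    · exact hS.2 x hx y hy hxy⟩
  rw [card_insert_of_notMem hiS] at this
  omega

lemma arcs (η : ℝ) (hη : 0 < η) : ∃ K M0 : ℕ, ∀ M ≥ M0, ∀ (S : Finset ℕ) (θ : ℕ → ℝ), (∀ i ∈ S, η * M ≤ ‖TT M (θ i)‖) →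
    (∀ i ∈ S, ∀ j ∈ S, i ≠ j → 1 / (M:ℝ) ≤ dn (θ i - θ j)) → #S ≤ K := by
  obtain ⟨C, hC, h⟩ := sieve_ls'
  obtain ⟨K, hK⟩ := exists_nat_ge ((8 * C / η^2)^2)
  have E : ∀ᶠ N : ℕ in Filter.atTop, 1 ≤ Real.log N ∧ Real.log N ^ 2 ≤ (η/4)^2 * N := by
    filter_upwards [(Real.tendsto_log_atTop.comp tendsto_natCast_atTop_atTop).eventually_ge_atTop 1, 
     tendsto_natCast_atTop_atTop.eventually (log_small 2 ((η/4)^2) (by positivity))] with N h1 h2 using ⟨h1, h2⟩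
  obtain ⟨N1, hN1⟩ := Filter.eventually_atTop.1 E
  refine ⟨K, N1 + 256, fun M hM S θ hS hsep => ?_⟩
  obtain ⟨l1, l2⟩ := hN1 M (by omega)
  have hM0 : (0:ℝ) < M := by norm_cast; omega
  set L := Real.log M
  set f : ℕ → ℂ := fun k => if M < k^4 then (lgp k : ℂ) else 0
  have hls := h ℕ inferInstance S θ M 1 0 (by omega) one_pos hsep f (by
    intro k _ hk
    by_cases h4 : M < k^4
    · simp only [f, if_pos h4] at hk
      simp only [one_mul, add_zero]
      refine ⟨?_, h4⟩
      by_contra hp; simp [lgp, hp] at hk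
    · simp [f, h4] at hk)
  have hf : ∀ k, ‖f k‖ ≤ lgp k := fun k => by
    simp only [f]; split_ifs
    · rw [Complex.norm_real, Real.norm_of_nonneg (lgp_nonneg k)]
    · simpa using lgp_nonneg k
  have hlogk : ∀ k ∈ range M, lgp k ≤ L := fun k hk => by
    rcases Nat.eq_zero_or_pos k with rfl | h0
    · simp [lgp]; linarith
    · exact (lgp_le k).trans (Real.log_le_log (by exact_mod_cast h0) (by exact_mod_cast (mem_range.1 hk).le))
  have h2 : ∑ k ∈ range M, ‖f k‖^2 ≤ L * (2 * M) := by
    refine le_trans ?_ (mul_le_mul_of_nonneg_left (lgp_sum' M) (by linarith))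
    rw [mul_sum]
    refine sum_le_sum fun k hk => ?_
    rw [sq]; exact mul_le_mul ((hf k).trans (hlogk k hk)) (hf k) (norm_nonneg _) (by linarith)
  have hlow : ∀ i ∈ S, η / 2 * M ≤ ‖∑ k ∈ range M, f k * ee (k * θ i)‖ := by
    intro i hi
    have e : TT M (θ i) = (∑ k ∈ range M, f k * ee (k * θ i)) + ∑ k ∈ (range M).filter (fun k => ¬ M < k^4), (lgp k : ℂ) * ee (k * θ i) := by
      rw [TT, sum_filter, ← sum_add_distrib]
      refine sum_congr rfl fun k _ => ?_
      by_cases h4 : M < k^4 <;> simp [f, h4]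
    have h3 : ‖∑ k ∈ (range M).filter (fun k => ¬ M < k^4), (lgp k : ℂ) * ee (k * θ i)‖ ≤ η / 2 * M := by
      have hc : #((range M).filter (fun k => ¬ M < k^4)) ≤ 2 * M.sqrt := by
        have h5 : 1 ≤ M.sqrt := Nat.le_sqrt.2 (by omega)
        calc _ ≤ #(range (M.sqrt + 1)) := card_le_card fun k hk => by
              simp only [mem_filter, mem_range, not_lt] at hk ⊢
              refine Nat.lt_succ_of_le (Nat.le_sqrt.2 (le_trans ?_ hk.2))
              rcases Nat.eq_zero_or_pos k with rfl | h0
              · simp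
              · rw [← sq]; exact Nat.pow_le_pow_right h0 (by norm_num)
          _ ≤ _ := by rw [card_range]; omega
      have hs : (M.sqrt:ℝ) ≤ Real.sqrt M := Real.nat_sqrt_le_real_sqrt
      have hs2 : L ≤ η / 4 * Real.sqrt M := by
        refine le_of_sq_le_sq ?_ (by positivity)
        rw [mul_pow, Real.sq_sqrt hM0.le]; exact l2
      calc _ ≤ ∑ k ∈ (range M).filter (fun k => ¬ M < k^4), L := norm_sum_le_of_le _ fun k hk => by
            rw [norm_mul, ee_norm, mul_one, Complex.norm_real, Real.norm_of_nonneg (lgp_nonneg k)]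
            exact hlogk k (mem_filter.1 hk).1
        _ = #((range M).filter (fun k => ¬ M < k^4)) * L := by rw [sum_const, nsmul_eq_mul]
        _ ≤ (2 * Real.sqrt M) * (η / 4 * Real.sqrt M) := by
            gcongr
            exact le_trans (by exact_mod_cast hc) (show (2 * M.sqrt : ℝ) ≤ _ by linarith)
        _ = η / 2 * (Real.sqrt M * Real.sqrt M) := by ring
        _ = _ := by rw [Real.mul_self_sqrt hM0.le]
    have h6 := hS i hi
    rw [e] at h6
    have := norm_add_le (∑ k ∈ range M, f k * ee (k * θ i)) (∑ k ∈ (range M).filter (fun k => ¬ M < k^4), (lgp k : ℂ) * ee (k * θ i))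
    linarith
  rcases S.eq_empty_or_nonempty with rfl | hne
  · simp
  have hc1 : (1:ℝ) ≤ #S := by exact_mod_cast card_pos.2 hne
  have hlow2 : #S * (η / 2 * M)^2 ≤ ∑ i ∈ S, ‖∑ k ∈ range M, f k * ee (k * θ i)‖^2 := by
    rw [← nsmul_eq_mul, ← sum_const]
    exact sum_le_sum fun i hi => pow_le_pow_left₀ (by positivity) (hlow i hi) 2
  have hr : (#S:ℝ)^(1/4:ℝ) ≤ Real.sqrt #S := by
    rw [Real.sqrt_eq_rpow]; exact Real.rpow_le_rpow_of_exponent_le hc1 (by norm_num)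
  simp only [Nat.totient_one, Nat.cast_one, div_one, one_mul] at hls
  have hfin : L * M^2 * (Real.sqrt #S * (Real.sqrt #S * η^2)) ≤ L * M^2 * (Real.sqrt #S * (8 * C)) := by
    have e := Real.mul_self_sqrt (show (0:ℝ) ≤ #S by positivity)
    calc L * M^2 * (Real.sqrt #S * (Real.sqrt #S * η^2)) = 4 * (L * (#S * (η / 2 * M)^2)) := by
          rw [← mul_assoc (√(#S:ℝ)), e]; ring
      _ ≤ 4 * (C * (#S:ℝ)^(1/4:ℝ) * M * (L * (2 * M))) := by
          refine mul_le_mul_of_nonneg_left (le_trans (mul_le_mul_of_nonneg_left hlow2 (by linarith)) (hls.trans ?_)) (by norm_num)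
          gcongr
      _ ≤ 4 * (C * Real.sqrt #S * M * (L * (2 * M))) := by gcongr
      _ = _ := by ring
  have h7 := le_of_mul_le_mul_left hfin (by positivity)
  have h8 := le_of_mul_le_mul_left h7 (Real.sqrt_pos.2 (by linarith))
  rw [← le_div_iff₀ (by positivity), Real.sqrt_le_left (by positivity)] at h8
  exact_mod_cast h8.trans hK

lemma block_bd (η ε : ℝ) (hη : 0 < η) (hε : 0 < ε) : ∃ Q N1 : ℕ, ∀ X N M : ℕ, N1 ≤ N → 32 * N ≤ M → X ≤ 2 * M * N → ∀ α : ℝ, Maj Q X α ∨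
    ∀ V : Finset ℕ, (∀ p ∈ V, p.Prime ∧ N ≤ p ∧ p ≤ 2 * N ∧ η * M ≤ ‖TT M (p * α)‖) → #V * Real.log N ≤ ε * N := by
  classical
  obtain ⟨K, M0, hA⟩ := arcs η hη
  obtain ⟨Q, N1, hO⟩ := occup (ε / (K+1)) (by positivity)
  refine ⟨Q, N1 + M0 + 1, fun X N M hN hM hX α => or_iff_not_imp_left.2 fun hMaj V hV => ?_⟩
  have hM0 : (0:ℝ) < M := by norm_cast; omega
  obtain ⟨S, hSV, hsep, hcov⟩ := max_sep V (fun p => p * α) (1/M) (by positivity)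
  have hSK : (#S:ℝ) ≤ K := by exact_mod_cast hA M (by omega) S _ (fun i hi => (hV i (hSV hi)).2.2.2) hsep
  have hsub : V ⊆ S.biUnion fun j => V.filter fun p : ℕ => dn (p * α - j * α) < 1/M := fun p hp => by
    obtain ⟨j, hj, hd⟩ := hcov p hp
    exact mem_biUnion.2 ⟨j, hj, mem_filter.2 ⟨hp, hd⟩⟩
  have hl : 0 ≤ Real.log N := Real.log_natCast_nonneg N
  calc #V * Real.log N ≤ (∑ j ∈ S, #(V.filter fun p : ℕ => dn (p * α - j * α) < 1/M) : ℕ) * Real.log N := by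
        gcongr; exact (card_le_card hsub).trans card_biUnion_le
    _ = ∑ j ∈ S, #(V.filter fun p : ℕ => dn (p * α - j * α) < 1/M) * Real.log N := by push_cast; rw [sum_mul]
    _ ≤ ∑ j ∈ S, ε / (K+1) * N := sum_le_sum fun j _ => (hO X N M (by omega) hM hX α (j*α)).resolve_left hMaj _ fun p hp => by
        obtain ⟨h1, h2⟩ := mem_filter.1 hp
        obtain ⟨h3, h4, h5, -⟩ := hV p h1
        exact ⟨h3, h4, h5, h2⟩
    _ = #S * (ε / (K+1) * N) := by rw [sum_const, nsmul_eq_mul]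
    _ ≤ (K+1) * (ε / (K+1) * N) := by gcongr; linarith
    _ = _ := by field_simp
end

section
open Finset

lemma TT_triv (M : ℕ) (θ : ℝ) : ‖TT (M+1) θ‖ ≤ 2 * M :=
  le_trans (norm_sum_le_of_le _ fun k _ => by
    rw [norm_mul, ee_norm, mul_one, Complex.norm_real, Real.norm_of_nonneg (lgp_nonneg k)]) (lgp_sum M)

lemma theta_pnt (δ : ℝ) (hδ : 0 < δ) : ∃ Y : ℕ, ∀ n ≥ Y, |∑ k ∈ range (n+1), lgp k - n| ≤ δ * n := by
  have h := psi_ap 1 1 isUnit_one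
  simp only [Nat.totient_one, Nat.cast_one, inv_one] at h
  have E : ∀ᶠ n : ℕ in Filter.atTop, |∑ k ∈ range (n+1), lgp k - n| ≤ δ * n := by
    filter_upwards [(Metric.tendsto_nhds.1 h (δ/2) (by positivity)), Filter.eventually_ge_atTop 1,
      tendsto_natCast_atTop_atTop.eventually (log_small 2 ((δ/4)^2) (by positivity))] with n h1 h2 h3
    have hn : (0:ℝ) < n := by exact_mod_cast h2
    have hn1 : (1:ℝ) ≤ n := by exact_mod_cast h2
    have e : ∑ k ∈ Icc 1 n, ArithmeticFunction.vonMangoldt.residueClass (1 : ZMod 1) k = Chebyshev.psi n := by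
      rw [Chebyshev.psi, Nat.floor_natCast]
      refine sum_congr rfl fun k _ => ?_
      rw [ArithmeticFunction.vonMangoldt.residueClass, Set.indicator_of_mem]
      exact Subsingleton.elim _ _
    rw [e, Real.dist_eq, div_sub_one hn.ne', abs_div, abs_of_pos hn, div_lt_iff₀ hn] at h1
    have h4 := Chebyshev.psi_sub_theta_le hn1
    have h5 := Chebyshev.theta_le_psi n
    rw [theta_eq']
    have h6 : Real.log n ≤ δ / 4 * Real.sqrt n := by
      refine le_of_sq_le_sq ?_ (by positivity)
      rw [mul_pow, Real.sq_sqrt hn.le]; exact h3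
    have h7 : Real.sqrt n * Real.log n ≤ δ / 4 * n := by
      calc _ ≤ Real.sqrt n * (δ / 4 * Real.sqrt n) := by gcongr
        _ = δ / 4 * (Real.sqrt n * Real.sqrt n) := by ring
        _ = _ := by rw [Real.mul_self_sqrt hn.le]
    rw [abs_lt] at h1; rw [abs_le]
    constructor <;> nlinarith [h1.1, h1.2]
  exact Filter.eventually_atTop.1 E

lemma TT_diff (δ : ℝ) (hδ : 0 < δ) : ∃ Y : ℕ, ∀ u v : ℕ, Y ≤ u → u ≤ v → ∀ θ : ℝ, ‖TT (u+1) θ‖ ≤ ‖TT (v+1) θ‖ + (v - u) + 2 * δ * v := by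
  obtain ⟨Y, hY⟩ := theta_pnt δ hδ
  refine ⟨Y, fun u v hu huv θ => ?_⟩
  have e : ∀ f : ℕ → ℂ, ∑ k ∈ range (v+1), f k = ∑ k ∈ range (u+1), f k + ∑ k ∈ Ico (u+1) (v+1), f k := fun f => (sum_range_add_sum_Ico _ (by omega)).symm
  have e' : ∑ k ∈ range (v+1), lgp k = ∑ k ∈ range (u+1), lgp k + ∑ k ∈ Ico (u+1) (v+1), lgp k := (sum_range_add_sum_Ico _ (by omega)).symm
  have h1 : ‖∑ k ∈ Ico (u+1) (v+1), (lgp k : ℂ) * ee (k * θ)‖ ≤ ∑ k ∈ Ico (u+1) (v+1), lgp k := norm_sum_le_of_le _ fun k _ => by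
    rw [norm_mul, ee_norm, mul_one, Complex.norm_real, Real.norm_of_nonneg (lgp_nonneg k)]
  have h2 := abs_le.1 (hY u hu)
  have h3 := abs_le.1 (hY v (by omega))
  have huv' : (u:ℝ) ≤ v := by exact_mod_cast huv
  have h4 : ‖TT (u+1) θ‖ ≤ ‖TT (v+1) θ‖ + ‖∑ k ∈ Ico (u+1) (v+1), (lgp k : ℂ) * ee (k * θ)‖ := by
    have : TT (u+1) θ = TT (v+1) θ - ∑ k ∈ Ico (u+1) (v+1), (lgp k : ℂ) * ee (k * θ) := by rw [TT, TT, e]; ring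
    rw [this]; exact norm_sub_le _ _
  nlinarith [h2.1, h3.2]

noncomputable def nb (δ : ℝ) (j : ℕ) : ℕ := ⌊Real.exp (δ * j)⌋₊
noncomputable def jb (δ : ℝ) (m : ℕ) : ℕ := ⌊Real.log m / δ⌋₊

lemma nb_bd (δ : ℝ) (hδ : 0 < δ) (hδ4 : δ ≤ 1/4) (m : ℕ) (hm : 4 / δ ≤ m) :
    nb δ (jb δ m) ≤ m ∧ (m:ℝ) ≤ (1 + 4 * δ) * nb δ (jb δ m) := by
  have h4 : 4 ≤ 1/δ := by rw [le_div_iff₀ hδ]; linarith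
  have e4 : 4 / δ = 4 * (1/δ) := by ring
  have hm0 : (0:ℝ) < m := by linarith
  have hm1 : (1:ℝ) ≤ m := by linarith
  have hl := Real.log_nonneg hm1
  have h1 := Nat.floor_le (div_nonneg hl hδ.le)
  have h2 := Nat.lt_floor_add_one (Real.log m / δ)
  rw [le_div_iff₀ hδ] at h1
  rw [div_lt_iff₀ hδ] at h2
  set y := Real.exp (δ * jb δ m)
  have hy0 : 0 < y := Real.exp_pos _
  have hy : y ≤ m := by
    rw [← Real.exp_log hm0]; exact Real.exp_le_exp.2 (by rw [mul_comm]; exact h1)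
  have he : Real.exp δ ≤ 1 + 2 * δ := by
    have h5 := Real.add_one_le_exp (-δ)
    have h6 : Real.exp δ * Real.exp (-δ) = 1 := by rw [← Real.exp_add]; simp
    nlinarith [Real.exp_pos δ]
  have hy2 : m ≤ (1 + 2 * δ) * y := by
    calc (m:ℝ) = Real.exp (Real.log m) := (Real.exp_log hm0).symm
      _ ≤ Real.exp (δ + δ * jb δ m) := Real.exp_le_exp.2 (by unfold jb; linarith)
      _ ≤ _ := by rw [Real.exp_add]; gcongr
  have hN := Nat.lt_floor_add_one y
  have hN' := Nat.floor_le hy0.le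
  change y < (nb δ (jb δ m) : ℝ) + 1 at hN
  change (nb δ (jb δ m) : ℝ) ≤ y at hN'
  refine ⟨by exact_mod_cast hN'.trans hy, ?_⟩
  have h7 : 1 / δ ≤ nb δ (jb δ m) := by nlinarith
  rw [div_le_iff₀ hδ] at h7
  nlinarith

set_option maxHeartbeats 1600000 in
lemma type2a (ε : ℝ) (hε : 0 < ε) : ∃ Q X0 : ℕ, ∀ X ≥ X0, ∀ α : ℝ, Maj Q X α ∨
    ∑ m ∈ Ioc 0 (X.sqrt / 8), lgp m * ‖TT (X / m + 1) (m * α)‖ ≤ ε * X * Real.log X := by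
  classical
  set δ := min (ε/100) (1/4) with hδd
  have hδ : 0 < δ := by positivity
  have hδ4 : δ ≤ 1/4 := min_le_right _ _
  have hδε : δ ≤ ε/100 := min_le_left _ _
  obtain ⟨Q, N1, hB⟩ := block_bd (ε/100) (ε*δ/100) (by positivity) (by positivity)
  obtain ⟨Y0, hY0⟩ := TT_diff δ hδ
  obtain ⟨B1, hB1⟩ := exists_nat_ge (4/δ)
  set B0 := B1 + 2 * N1 + 4 with hB0
  have E : ∀ᶠ X : ℕ in Filter.atTop, 6 ≤ Real.log X ∧ 2 * (Real.log B0 + 6) ≤ ε / 2 * Real.log X := by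
    have hl : Filter.Tendsto (fun n : ℕ => Real.log n) Filter.atTop Filter.atTop := Real.tendsto_log_atTop.comp tendsto_natCast_atTop_atTop
    filter_upwards [hl.eventually_ge_atTop 6, hl.eventually_ge_atTop (2 * (Real.log B0 + 6) / (ε/2))] with X h1 h2
    rw [div_le_iff₀ (by positivity)] at h2
    exact ⟨h1, by linarith⟩
  obtain ⟨X1, hX1⟩ := Filter.eventually_atTop.1 E
  refine ⟨Q, X1 + (Y0 + B1 + 1)^2, fun X hX α => or_iff_not_imp_left.2 fun hMaj => ?_⟩
  obtain ⟨l1, l2⟩ := hX1 X (by omega)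
  set L := Real.log X
  set Y := X.sqrt / 8 with hYd
  have hsq : Y0 + B1 + 1 ≤ X.sqrt := Nat.le_sqrt.2 (by rw [← sq]; omega)
  have hsX : X.sqrt * X.sqrt ≤ X := Nat.sqrt_le _
  have hsX2 : X.sqrt ≤ X := Nat.sqrt_le_self X
  have hXp : (0:ℝ) < X := by norm_cast; omega
  have hYs : 8 * Y ≤ X.sqrt := by omega
  have hum : ∀ m ∈ Ioc 0 Y, X.sqrt ≤ X / m ∧ (8 * (X.sqrt:ℝ)) ≤ X / m := by
    intro m hm
    rw [mem_Ioc] at hm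
    have h1 : 8 * X.sqrt * m ≤ X := by
      calc 8 * X.sqrt * m = X.sqrt * (8 * m) := by ring
        _ ≤ X.sqrt * X.sqrt := Nat.mul_le_mul_left _ (by omega)
        _ ≤ X := hsX
    refine ⟨(Nat.le_div_iff_mul_le hm.1).2 (by linarith [Nat.zero_le (X.sqrt * m)]), ?_⟩
    rw [le_div_iff₀ (by exact_mod_cast hm.1)]; exact_mod_cast h1
  have hX1d : ∀ m ∈ Ioc 0 Y, 1 ≤ δ * (X / m) := by
    intro m hm
    have h1 := (hum m hm).2
    have h2 : (B1:ℝ) ≤ X.sqrt := by norm_cast; omega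
    have h3 : 4/δ ≤ X / m := by linarith
    rw [div_le_iff₀ hδ] at h3; linarith
  have hNb : ∀ m, B0 < m → nb δ (jb δ m) ≤ m ∧ (m:ℝ) ≤ (1 + 4 * δ) * nb δ (jb δ m) ∧ m ≤ 2 * nb δ (jb δ m) := by
    intro m hm
    have : 4/δ ≤ m := hB1.trans (by norm_cast; omega)
    obtain ⟨h1, h2⟩ := nb_bd δ hδ hδ4 m this
    refine ⟨h1, h2, ?_⟩
    have : (m:ℝ) ≤ 2 * nb δ (jb δ m) := h2.trans (by gcongr; linarith)
    exact_mod_cast this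
  set bad : Finset ℕ := (Ioc 0 Y).filter fun m => m.Prime ∧ B0 < m ∧ ε/100 * ((X / nb δ (jb δ m) + 1 : ℕ):ℝ) ≤ ‖TT (X / nb δ (jb δ m) + 1) (m * α)‖ with hbad
  have hpt : ∀ m ∈ Ioc 0 Y, lgp m * ‖TT (X / m + 1) (m * α)‖ ≤ (lgp m / m) * (X * (12 * (ε/100))) + (if m ≤ B0 then lgp m / m * (2 * X) else 0)
      + (if m ∈ bad then lgp m / m * (2 * X) else 0) := by
    intro m hm
    have hm0 : (0:ℝ) < m := by exact_mod_cast (mem_Ioc.1 hm).1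
    have hg := lgp_nonneg m
    have htr : lgp m * ‖TT (X / m + 1) (m * α)‖ ≤ lgp m / m * (2 * X) := by
      calc _ ≤ lgp m * (2 * (X / m : ℕ)) := by gcongr; exact TT_triv _ _
        _ ≤ lgp m * (2 * (X / m)) := by gcongr; exact Nat.cast_div_le
        _ = _ := by ring
    have h0 : 0 ≤ (lgp m / m) * (X * (12 * (ε/100))) := by positivity
    have h0' : 0 ≤ lgp m / m * (2 * X) := by positivity
    by_cases hb : m ∈ bad
    · rw [if_pos hb]; split_ifs <;> linarith
    by_cases hs : m ≤ B0
    · rw [if_pos hs, if_neg hb]; linarith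
    by_cases hp : m.Prime
    swap
    · simp [lgp, hp]
    rw [if_neg hs, if_neg hb, add_zero, add_zero]
    push Not at hs
    obtain ⟨hN, hN2, hN3⟩ := hNb m hs
    set N := nb δ (jb δ m) with hNd
    have hlt : ‖TT (X / N + 1) (m * α)‖ < ε/100 * ((X / N + 1 : ℕ):ℝ) := by
      by_contra hge
      push Not at hge
      exact hb (mem_filter.2 ⟨hm, hp, hs, hge⟩)
    have hN0 : (0:ℝ) < N := by norm_cast; omega
    have hd := hY0 (X/m) (X/N) (by have := (hum m hm).1; omega) (Nat.div_le_div_left hN (by omega)) (m * α)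
    have hv : ((X/N:ℕ):ℝ) ≤ (1 + 4 * δ) * (X / m) := by
      refine Nat.cast_div_le.trans ?_
      rw [div_le_iff₀ hN0, mul_assoc, div_mul_eq_mul_div, mul_div_assoc', le_div_iff₀ hm0]
      linarith [mul_le_mul_of_nonneg_left hN2 hXp.le]
    have hu : (X:ℝ) / m < (X/m:ℕ) + 1 := by
      rw [div_lt_iff₀ hm0]; norm_cast
      have := Nat.lt_div_mul_add (a := X) (mem_Ioc.1 hm).1
      linarith
    have hx := hX1d m hm
    set xm := (X:ℝ)/m
    have hxm : 0 < xm := by positivity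
    have hfin : ‖TT (X / m + 1) (m * α)‖ ≤ xm * (12 * (ε/100)) := by
      push_cast at hlt
      have h1 : ((X/N:ℕ):ℝ) ≤ 2 * xm := hv.trans (by gcongr; linarith)
      have h2 : 1 ≤ xm := by linarith [mul_le_mul_of_nonneg_right hδ4 hxm.le]
      have h3 : ε / 100 * ((X/N:ℕ) + 1) ≤ ε/100 * (3 * xm) := by gcongr; linarith
      have h4 : 2 * δ * (X/N:ℕ) ≤ 2 * δ * (2 * xm) := by gcongr
      have h5 : δ * xm ≤ ε/100 * xm := by gcongr
      linarith
    calc _ ≤ lgp m * (xm * (12 * (ε/100))) := by gcongr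
      _ = _ := by simp only [xm]; ring
  have hbd : ∑ m ∈ bad, lgp m / m * (2 * X) ≤ (2 * L / δ) * (4 * (ε*δ/100) * X) := by
    have hmaps : ∀ m ∈ bad, jb δ m ∈ range (⌊L/δ⌋₊ + 1) := by
      intro m hm
      obtain ⟨h1, -⟩ := mem_filter.1 hm
      rw [mem_Ioc] at h1
      refine mem_range.2 (Nat.lt_succ_of_le (Nat.floor_le_floor ?_))
      have : m ≤ X := by omega
      exact div_le_div_of_nonneg_right (Real.log_le_log (by exact_mod_cast h1.1) (by exact_mod_cast this)) hδ.le
    rw [← sum_fiberwise_of_maps_to hmaps]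
    have hj : ∀ j ∈ range (⌊L/δ⌋₊ + 1), ∑ m ∈ bad.filter (fun m => jb δ m = j), lgp m / m * (2 * X) ≤ 4 * (ε*δ/100) * X := by
      intro j _
      rcases (bad.filter (fun m => jb δ m = j)).eq_empty_or_nonempty with he | ⟨m0, hm0⟩
      · rw [he, sum_empty]; positivity
      set N := nb δ j with hNd
      have hall : ∀ m ∈ bad.filter (fun m => jb δ m = j), m ∈ Ioc 0 Y ∧ m.Prime ∧ B0 < m ∧ N ≤ m ∧ m ≤ 2 * N ∧ ε/100 * ((X / N + 1 : ℕ):ℝ) ≤ ‖TT (X / N + 1) (m * α)‖ := by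
        intro m hm
        obtain ⟨hm1, rfl⟩ := mem_filter.1 hm
        obtain ⟨hm2, hm3, hm4, hm5⟩ := mem_filter.1 hm1
        obtain ⟨h1, -, h2⟩ := hNb m hm4
        exact ⟨hm2, hm3, hm4, h1, h2, hm5⟩
      obtain ⟨a1, -, a3, a4, a5, -⟩ := hall m0 hm0
      rw [mem_Ioc] at a1
      have hN2 : 2 ≤ N := by omega
      have hN0 : (0:ℝ) < N := by norm_cast; omega
      have hNY : N * (64 * N) ≤ X := by
        have : 8 * N ≤ X.sqrt := by omega
        have := Nat.mul_le_mul this this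
        linarith
      have hc := (hB X N (X/N+1) (by omega) (by
        have := (Nat.le_div_iff_mul_le (show 0 < N by omega)).2 (show 64 * N * N ≤ X by linarith)
        omega) (by have := Nat.lt_div_mul_add (a := X) (show 0 < N by omega); linarith [Nat.zero_le (X/N*N)]) α).resolve_left hMaj
          (bad.filter (fun m => jb δ m = j)) (fun m hm => by
            obtain ⟨-, b2, -, b4, b5, b6⟩ := hall m hm
            exact ⟨b2, b4, b5, b6⟩)
      have hl0 : 0 ≤ Real.log N := Real.log_natCast_nonneg N
      calc _ ≤ ∑ m ∈ bad.filter (fun m => jb δ m = j), (2 * Real.log N) / N * (2 * X) := by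
            refine sum_le_sum fun m hm => ?_
            obtain ⟨-, -, b3, b4, b5, -⟩ := hall m hm
            have : lgp m ≤ 2 * Real.log N := by
              refine (lgp_le m).trans ?_
              calc Real.log m ≤ Real.log ((N:ℝ)^2) := Real.log_le_log (by norm_cast; omega) (by norm_cast; nlinarith)
                _ = _ := by rw [Real.log_pow]; norm_num
            gcongr
        _ = (#(bad.filter (fun m => jb δ m = j)) * Real.log N) * (4 * X / N) := by rw [sum_const, nsmul_eq_mul]; ring
        _ ≤ (ε*δ/100 * N) * (4 * X / N) := by gcongr
        _ = _ := by field_simp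
    refine (sum_le_sum hj).trans ?_
    rw [sum_const, nsmul_eq_mul, card_range]
    gcongr
    have h1 := Nat.floor_le (show 0 ≤ L/δ by positivity)
    have h2 : 1 ≤ L / δ := by rw [le_div_iff₀ hδ]; linarith
    push_cast
    rw [mul_div_assoc]; linarith
  have hmert : ∀ n : ℕ, 1 ≤ n → ∀ S : Finset ℕ, S ⊆ Ioc 0 n → ∑ m ∈ S, lgp m / m ≤ Real.log n + 6 := fun n hn S hS => by
    refine le_trans (le_trans (sum_le_sum fun m _ => div_le_div_of_nonneg_right (lgp_le_vm m) (by positivity)) (sum_le_sum_of_subset_of_nonneg hS fun m _ _ => div_nonneg ArithmeticFunction.vonMangoldt_nonneg (by positivity))) (mertens n hn)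
  have hYX : Y ≤ X := by omega
  have hX1' : 1 ≤ X := by omega
  refine (sum_le_sum hpt).trans ?_
  rw [sum_add_distrib, sum_add_distrib, ← sum_filter, ← sum_filter, filter_mem_eq_inter, inter_eq_right.2 (filter_subset _ _), ← sum_mul, ← sum_mul]
  have m1 := hmert X hX1' (Ioc 0 Y) (Ioc_subset_Ioc_right hYX)
  have m2 := hmert B0 (by omega) ((Ioc 0 Y).filter (· ≤ B0)) (fun x hx => by simp only [mem_filter, mem_Ioc] at hx ⊢; omega)
  have e3 : (2 * L / δ) * (4 * (ε*δ/100) * X) = 8 * ε / 100 * X * L := by field_simp; ring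
  rw [e3] at hbd
  have n1 := mul_le_mul_of_nonneg_right (m1.trans (show L + 6 ≤ 2 * L by linarith)) (show 0 ≤ X * (12 * (ε/100)) by positivity)
  have n2 := mul_le_mul_of_nonneg_right m2 (show (0:ℝ) ≤ 2 * X by positivity)
  have n3 := mul_le_mul_of_nonneg_right l2 hXp.le
  have n4 : 0 ≤ ε * X * L := by positivity
  linarith
end

section
open Finset

lemma hyp_swap {R : Type*} [AddCommMonoid R] (X : ℕ) (F : ℕ → ℕ → R) :
    ∑ k ∈ Ioc 0 X, ∑ m ∈ Ioc 0 (X / k), F k m = ∑ m ∈ Ioc 0 X, ∑ k ∈ Ioc 0 (X / m), F k m := by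
  refine sum_comm' fun k m => ?_
  simp only [mem_Ioc]
  constructor
  · rintro ⟨⟨h1, h2⟩, h3, h4⟩
    rw [Nat.le_div_iff_mul_le h1] at h4
    exact ⟨⟨h1, (Nat.le_div_iff_mul_le h3).2 (by linarith)⟩, h3, by nlinarith⟩
  · rintro ⟨⟨h1, h2⟩, h3, h4⟩
    rw [Nat.le_div_iff_mul_le h3] at h2
    exact ⟨⟨h1, by nlinarith⟩, h3, (Nat.le_div_iff_mul_le h1).2 (by linarith)⟩

lemma vv_sum (X : ℕ) (α : ℝ) : ∑ n ∈ Ioc 0 X, ((ArithmeticFunction.vonMangoldt * ArithmeticFunction.vonMangoldt) n : ℝ) * ee (n * α) =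
    ∑ k ∈ Ioc 0 X, ∑ m ∈ Ioc 0 (X / k), ((ArithmeticFunction.vonMangoldt k * ArithmeticFunction.vonMangoldt m : ℝ) : ℂ) * ee (m * (k * α)) := by
  have h := dsum_swap (fun k n => ((ArithmeticFunction.vonMangoldt k * ArithmeticFunction.vonMangoldt (n / k) : ℝ) : ℂ) * ee (n * α)) X
  simp only [← sum_mul, ← Complex.ofReal_sum] at h
  simp only [ArithmeticFunction.mul_apply, Nat.sum_divisorsAntidiagonal (fun i j => ArithmeticFunction.vonMangoldt i * ArithmeticFunction.vonMangoldt j)]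
  rw [← h]
  refine sum_congr rfl fun k hk => sum_congr rfl fun m _ => ?_
  rw [Nat.mul_div_cancel_left _ (mem_Ioc.1 hk).1]
  congr 2; push_cast; ring

lemma lgp_D (n : ℕ) : ArithmeticFunction.vonMangoldt n - lgp n = if n.Prime then 0 else ArithmeticFunction.vonMangoldt n := by
  unfold lgp; split_ifs with h
  · rw [ArithmeticFunction.vonMangoldt_apply_prime h, sub_self]
  · simp

lemma D_sum : ∃ C : ℝ, 0 < C ∧ ∀ X : ℕ, ∑ k ∈ Ioc 0 X, (ArithmeticFunction.vonMangoldt k - lgp k) / k ≤ C := by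
  have h := ArithmeticFunction.vonMangoldt.summable_residueClass_non_primes_div (1 : ZMod 1)
  have e : ∀ n : ℕ, (if n.Prime then 0 else ArithmeticFunction.vonMangoldt.residueClass (1 : ZMod 1) n) / n = (ArithmeticFunction.vonMangoldt n - lgp n) / n := fun n => by
    rw [lgp_D, ArithmeticFunction.vonMangoldt.residueClass, Set.indicator_of_mem]
    exact Subsingleton.elim _ _
  simp only [e] at h
  have h0 : ∀ n : ℕ, 0 ≤ (ArithmeticFunction.vonMangoldt n - lgp n) / n := fun n => div_nonneg (sub_nonneg.2 (lgp_le_vm n)) (by positivity)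
  exact ⟨(∑' n : ℕ, (ArithmeticFunction.vonMangoldt n - lgp n) / n) + 1, add_pos_of_nonneg_of_pos (tsum_nonneg h0) one_pos, fun X => (h.sum_le_tsum _ fun i _ => h0 i).trans (by linarith)⟩

lemma vv_lgp : ∃ C : ℝ, 0 < C ∧ ∀ (X : ℕ) (α : ℝ), ‖∑ n ∈ Ioc 0 X, ((ArithmeticFunction.vonMangoldt * ArithmeticFunction.vonMangoldt) n : ℝ) * ee (n * α) -
    ∑ k ∈ Ioc 0 X, ∑ m ∈ Ioc 0 (X / k), ((lgp k * lgp m : ℝ) : ℂ) * ee (m * (k * α))‖ ≤ C * X := by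
  obtain ⟨C, hC, hD⟩ := D_sum
  refine ⟨20 * C, by positivity, fun X α => ?_⟩
  rw [vv_sum, ← sum_sub_distrib]
  simp only [← sum_sub_distrib, ← sub_mul, ← Complex.ofReal_sub]
  have h0 : ∀ n : ℕ, 0 ≤ ArithmeticFunction.vonMangoldt n - lgp n := fun n => sub_nonneg.2 (lgp_le_vm n)
  have hm : ∑ k ∈ Ioc 0 X, ∑ m ∈ Ioc 0 (X / k), (ArithmeticFunction.vonMangoldt k - lgp k) * ArithmeticFunction.vonMangoldt m ≤ 10 * C * X := by
    calc _ ≤ ∑ k ∈ Ioc 0 X, ((ArithmeticFunction.vonMangoldt k - lgp k) / k) * (10 * X) := sum_le_sum fun k _ => by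
          rw [← mul_sum]
          have h1 := Chebyshev.psi_le_const_mul_self (x := (X/k:ℕ)) (by positivity)
          rw [Chebyshev.psi, Nat.floor_natCast] at h1
          have h2 : Real.log 4 + 4 ≤ 10 := by have := Real.log_le_sub_one_of_pos (show (0:ℝ) < 4 by norm_num); linarith
          have h3 : ((X/k:ℕ):ℝ) ≤ X / k := Nat.cast_div_le
          calc _ ≤ (ArithmeticFunction.vonMangoldt k - lgp k) * (10 * (X / k)) := mul_le_mul_of_nonneg_left (h1.trans (by gcongr)) (h0 k)
            _ = _ := by ring
      _ ≤ C * (10 * X) := by rw [← sum_mul]; gcongr; exact hD X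
      _ = _ := by ring
  calc _ ≤ ∑ k ∈ Ioc 0 X, ∑ m ∈ Ioc 0 (X / k), ((ArithmeticFunction.vonMangoldt k - lgp k) * ArithmeticFunction.vonMangoldt m + (ArithmeticFunction.vonMangoldt m - lgp m) * ArithmeticFunction.vonMangoldt k) := by
        refine norm_sum_le_of_le _ fun k _ => norm_sum_le_of_le _ fun m _ => ?_
        rw [norm_mul, ee_norm, mul_one, Complex.norm_real, Real.norm_eq_abs]
        have a := h0 k; have b := h0 m; have c := lgp_nonneg k; have d := lgp_nonneg m
        rw [abs_le]; constructor <;> nlinarith [mul_nonneg a b, mul_nonneg a d, mul_nonneg c b]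
    _ ≤ _ := by
        simp only [sum_add_distrib]
        have := hyp_swap X fun k m => (ArithmeticFunction.vonMangoldt m - lgp m) * ArithmeticFunction.vonMangoldt k
        rw [this]; linarith

lemma inner_TT (X k : ℕ) (α : ℝ) : ∑ m ∈ Ioc 0 (X / k), ((lgp k * lgp m : ℝ) : ℂ) * ee (m * (k * α)) = lgp k * TT (X / k + 1) (k * α) := by
  rw [TT, range_eq_Ico, sum_eq_sum_Ico_succ_bot (Nat.succ_pos _)]
  simp only [lgp, Nat.not_prime_zero, if_false, Complex.ofReal_zero, zero_mul, zero_add]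
  rw [mul_sum]
  exact sum_congr (by ext; simp; omega) fun m _ => by push_cast; ring

lemma type2 (ε : ℝ) (hε : 0 < ε) : ∃ Q X0 : ℕ, ∀ X ≥ X0, ∀ α : ℝ, Maj Q X α ∨
    ‖∑ n ∈ Ioc 0 X, ((ArithmeticFunction.vonMangoldt * ArithmeticFunction.vonMangoldt) n : ℝ) * ee (n * α)‖ ≤ ε * X * Real.log X := by
  obtain ⟨C, hC, hV⟩ := vv_lgp
  obtain ⟨Q, X1, hA⟩ := type2a (ε/4) (by positivity)
  have hl : Filter.Tendsto (fun n : ℕ => Real.log n) Filter.atTop Filter.atTop := Real.tendsto_log_atTop.comp tendsto_natCast_atTop_atTop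
  obtain ⟨X2, hX2⟩ := Filter.eventually_atTop.1 (hl.eventually_ge_atTop ((C + 2000) / (ε/2)))
  refine ⟨Q, X1 + X2 + 10000, fun X hX α => or_iff_not_imp_left.2 fun hMaj => ?_⟩
  have hB := (hA X (by omega) α).resolve_left hMaj
  have hl2 := hX2 X (by omega)
  rw [div_le_iff₀ (by positivity)] at hl2
  have h1 := hV X α
  set Y := X.sqrt / 8 with hY
  have hs1 : X.sqrt * X.sqrt ≤ X := Nat.sqrt_le _
  have hs2 : X < (X.sqrt + 1) * (X.sqrt + 1) := Nat.lt_succ_sqrt X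
  have hs3 : 100 ≤ X.sqrt := Nat.le_sqrt.2 (by omega)
  have hY0 : 0 < Y := by omega
  have hYX : Y ≤ X := by have := Nat.sqrt_le_self X; omega
  have hY8 : 8 * Y ≤ X.sqrt := by omega
  have hYY : Y * Y ≤ X := by nlinarith
  have hY9 : X ≤ 100 * (Y * Y) := by
    have : X.sqrt + 1 ≤ 10 * Y := by omega
    nlinarith
  have hXp : (0:ℝ) < X := by norm_cast; omega
  have hYp : (0:ℝ) < Y := by exact_mod_cast hY0
  set g : ℕ → ℕ → ℂ := fun k m => ((lgp k * lgp m : ℝ) : ℂ) * ee (m * (k * α)) with hg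
  have hgn : ∀ k m, ‖g k m‖ = lgp k * lgp m := fun k m => by
    rw [hg]; simp only []; rw [norm_mul, ee_norm, mul_one, Complex.norm_real, Real.norm_of_nonneg (mul_nonneg (lgp_nonneg k) (lgp_nonneg m))]
  have hgs : ∀ k m, g k m = g m k := fun k m => by simp only [hg]; congr 2 <;> ring
  have hlI : ∀ M : ℕ, ∑ k ∈ Ioc 0 M, lgp k ≤ 2 * M := fun M =>
    le_trans (sum_le_sum_of_subset_of_nonneg (fun x hx => by simp only [mem_Ioc, mem_range] at *; omega) fun i _ _ => lgp_nonneg i) (lgp_sum M)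
  have hin : ∀ k, ‖∑ m ∈ Ioc 0 (X / k), g k m‖ = lgp k * ‖TT (X / k + 1) (k * α)‖ := fun k => by
    rw [hg, inner_TT, norm_mul, Complex.norm_real, Real.norm_of_nonneg (lgp_nonneg k)]
  -- first part
  have p1 : ‖∑ k ∈ Ioc 0 Y, ∑ m ∈ Ioc 0 (X / k), g k m‖ ≤ ε / 4 * X * Real.log X :=
    le_trans (norm_sum_le_of_le _ fun k _ => (hin k).le) hB
  have e1 : ∑ k ∈ Ioc 0 X, ∑ m ∈ Ioc 0 (X / k), g k m = ∑ k ∈ Ioc 0 Y, ∑ m ∈ Ioc 0 (X / k), g k m + ∑ k ∈ Ioc Y X, ∑ m ∈ Ioc 0 (X / k), g k m := by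
    rw [sum_Ioc_consecutive _ (Nat.zero_le _) hYX]
  have e2 : ∑ k ∈ Ioc Y X, ∑ m ∈ Ioc 0 (X / k), g k m = ∑ m ∈ Ioc 0 X, ∑ k ∈ (Ioc 0 (X / m)).filter (Y < ·), g m k := by
    have h := hyp_swap X fun k m => if Y < k then g m k else 0
    simp only [← sum_filter] at h
    rw [← h]
    have : Ioc Y X = (Ioc 0 X).filter (Y < ·) := by ext; simp; omega
    rw [this, sum_filter]
    refine sum_congr rfl fun k _ => ?_
    split_ifs with hk
    · simp [hk]; exact sum_congr rfl fun m _ => hgs _ _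
    · simp [hk]
  have p2 : ‖∑ m ∈ Ioc 0 Y, ∑ k ∈ (Ioc 0 (X / m)).filter (Y < ·), g m k‖ ≤ ε / 4 * X * Real.log X + 4 * X := by
    have hm : ∀ m ∈ Ioc 0 Y, ‖∑ k ∈ (Ioc 0 (X / m)).filter (Y < ·), g m k‖ ≤ lgp m * ‖TT (X / m + 1) (m * α)‖ + lgp m * (2 * Y) := by
      intro m _
      have := sum_filter_add_sum_filter_not (Ioc 0 (X / m)) (Y < ·) (g m)
      rw [← eq_sub_iff_add_eq] at this
      rw [this, ← hin]
      refine (norm_sub_le _ _).trans (by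
        gcongr
        refine (norm_sum_le_of_le _ fun k _ => (hgn m k).le).trans ?_
        rw [← mul_sum]
        refine mul_le_mul_of_nonneg_left (le_trans (sum_le_sum_of_subset_of_nonneg (fun k hk => ?_) fun i _ _ => lgp_nonneg i) (hlI Y)) (lgp_nonneg m)
        simp only [mem_filter, mem_Ioc] at hk ⊢; omega)
    refine (norm_sum_le_of_le _ hm).trans ?_
    rw [sum_add_distrib, ← sum_mul]
    have h2 : (∑ m ∈ Ioc 0 Y, lgp m) * (2 * Y) ≤ 2 * Y * (2 * Y) := by gcongr; exact hlI Y
    have h3 : (Y:ℝ) * Y ≤ X := by exact_mod_cast hYY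
    linarith
  have p3 : ‖∑ m ∈ Ioc Y X, ∑ k ∈ (Ioc 0 (X / m)).filter (Y < ·), g m k‖ ≤ 400 * X := by
    have hm : ∀ m ∈ Ioc Y X, ‖∑ k ∈ (Ioc 0 (X / m)).filter (Y < ·), g m k‖ ≤ if m ≤ X / Y then lgp m * (2 * (X / Y : ℕ)) else 0 := by
      intro m hm
      rw [mem_Ioc] at hm
      split_ifs with h
      · refine (norm_sum_le_of_le _ fun k _ => (hgn m k).le).trans ?_
        rw [← mul_sum]
        refine mul_le_mul_of_nonneg_left (le_trans (sum_le_sum_of_subset_of_nonneg (fun k hk => ?_) fun i _ _ => lgp_nonneg i) (hlI (X/Y))) (lgp_nonneg m)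
        simp only [mem_filter, mem_Ioc] at hk ⊢
        exact ⟨hk.1.1, hk.1.2.trans (Nat.div_le_div_left hm.1.le hY0)⟩
      · rw [filter_false_of_mem, sum_empty, norm_zero]
        intro k hk hk2
        rw [mem_Ioc, Nat.le_div_iff_mul_le (by omega)] at hk
        rw [Nat.le_div_iff_mul_le hY0] at h
        nlinarith
    refine (norm_sum_le_of_le _ hm).trans ?_
    rw [← sum_filter, ← sum_mul]
    have h2 : ∑ m ∈ (Ioc Y X).filter (· ≤ X / Y), lgp m ≤ 2 * (X/Y:ℕ) :=
      le_trans (sum_le_sum_of_subset_of_nonneg (fun x hx => by simp only [mem_Ioc, mem_filter] at *; omega) fun i _ _ => lgp_nonneg i) (hlI _)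
    have h3 : ((X/Y:ℕ):ℝ) * Y ≤ X := by exact_mod_cast Nat.div_mul_le_self X Y
    have h9 : (X:ℝ) ≤ 100 * (Y * Y) := by exact_mod_cast hY9
    have h4 : ((X/Y:ℕ):ℝ) ≤ 100 * Y := by
      refine le_of_mul_le_mul_right (h3.trans (h9.trans (le_of_eq ?_))) hYp; ring
    calc _ ≤ (2 * ((X/Y:ℕ):ℝ)) * (2 * (X/Y:ℕ)) := by gcongr
      _ ≤ (2 * ((X/Y:ℕ):ℝ)) * (2 * (100 * Y)) := by gcongr
      _ = 400 * ((X/Y:ℕ) * Y) := by ring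
      _ ≤ _ := by gcongr
  have e3 : ∑ m ∈ Ioc 0 X, ∑ k ∈ (Ioc 0 (X / m)).filter (Y < ·), g m k = ∑ m ∈ Ioc 0 Y, ∑ k ∈ (Ioc 0 (X / m)).filter (Y < ·), g m k + ∑ m ∈ Ioc Y X, ∑ k ∈ (Ioc 0 (X / m)).filter (Y < ·), g m k := by
    rw [sum_Ioc_consecutive _ (Nat.zero_le _) hYX]
  rw [e1, e2, e3] at h1
  set a := ∑ n ∈ Ioc 0 X, ((ArithmeticFunction.vonMangoldt * ArithmeticFunction.vonMangoldt) n : ℝ) * ee (n * α)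
  set b1 := ∑ k ∈ Ioc 0 Y, ∑ m ∈ Ioc 0 (X / k), g k m
  set b2 := ∑ m ∈ Ioc 0 Y, ∑ k ∈ (Ioc 0 (X / m)).filter (Y < ·), g m k
  set b3 := ∑ m ∈ Ioc Y X, ∑ k ∈ (Ioc 0 (X / m)).filter (Y < ·), g m k
  have h5 : ‖a‖ ≤ ‖a - (b1 + (b2 + b3))‖ + (‖b1‖ + (‖b2‖ + ‖b3‖)) := by
    calc ‖a‖ = ‖(a - (b1 + (b2 + b3))) + (b1 + (b2 + b3))‖ := by rw [sub_add_cancel]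
      _ ≤ _ := (norm_add_le _ _).trans (by gcongr; exact (norm_add_le _ _).trans (by gcongr; exact norm_add_le _ _))
  have h6 := mul_le_mul_of_nonneg_right hl2 hXp.le
  linarith

lemma sum_inv_sqrt (N : ℕ) : ∑ n ∈ Ioc 0 N, 1 / Real.sqrt n ≤ 2 * Real.sqrt N := by
  induction N with
  | zero => simp
  | succ n ih =>
    rw [sum_Ioc_succ_top (by omega)]
    have h1 : Real.sqrt n ≤ Real.sqrt (n+1:ℕ) := Real.sqrt_le_sqrt (by push_cast; linarith)
    have h2 : 0 < Real.sqrt (n+1:ℕ) := Real.sqrt_pos.2 (by positivity)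
    have h3 := Real.mul_self_sqrt (show (0:ℝ) ≤ (n+1:ℕ) by positivity)
    have h4 := Real.mul_self_sqrt (show (0:ℝ) ≤ n by positivity)
    have : 1 / Real.sqrt (n+1:ℕ) ≤ 2 * Real.sqrt (n+1:ℕ) - 2 * Real.sqrt n := by
      rw [div_le_iff₀ h2]; push_cast at h3 ⊢; nlinarith [sq_nonneg (Real.sqrt (n+1:ℕ) - Real.sqrt n)]
    linarith

noncomputable def PP (X : ℕ) (α : ℝ) : ℂ := ∑ p ∈ (Ioc 0 X).filter Nat.Prime, ee (p * α)

lemma minor (ε : ℝ) (hε : 0 < ε) : ∃ Q X0 : ℕ, ∀ X ≥ X0, ∀ α : ℝ, Maj Q X α ∨ ‖PP X α‖ * Real.log X ≤ ε * X := by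
  obtain ⟨Q1, X1, h1⟩ := type1_min (ε/5) (by positivity)
  obtain ⟨Q2, X2, h2⟩ := type2 (ε/5) (by positivity)
  have hl : Filter.Tendsto (fun n : ℕ => Real.log n) Filter.atTop Filter.atTop := Real.tendsto_log_atTop.comp tendsto_natCast_atTop_atTop
  obtain ⟨X3, h3⟩ := Filter.eventually_atTop.1 ((hl.eventually_ge_atTop (32 / (ε/5) + 1)).and ((tendsto_natCast_atTop_atTop.eventually (log_small 1 (ε/5) (by positivity))).and
    (tendsto_natCast_atTop_atTop.eventually (log_small 2 ((ε/20)^2) (by positivity)))))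
  refine ⟨Q1 + Q2, X1 + X2 + X3 + 1, fun X hX α => or_iff_not_imp_left.2 fun hM => ?_⟩
  have t1 := (h1 X (by omega) α).resolve_left fun h => hM (h.mono (by omega))
  have t2 := (h2 X (by omega) α).resolve_left fun h => hM (h.mono (by omega))
  obtain ⟨l1, l2, l3⟩ := h3 X (by omega)
  have hS := selberg_ex X (by omega) α
  set L := Real.log X
  have hX1 : (1:ℝ) ≤ X := by norm_cast; omega
  have hX0 : (0:ℝ) < X := by linarith
  have hL1 : 1 ≤ L := by have : 0 < 32 / (ε/5) := by positivity
                         linarith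
  have hL32 : 32 ≤ ε/5 * L := by
    have : 32 / (ε/5) ≤ L := by linarith
    rw [div_le_iff₀ (by positivity)] at this; linarith
  have hlog : ∀ n ∈ Ioc 0 X, 0 ≤ Real.log n ∧ Real.log n ≤ L := fun n hn => by
    rw [mem_Ioc] at hn
    exact ⟨Real.log_natCast_nonneg n, Real.log_le_log (by exact_mod_cast hn.1) (by exact_mod_cast hn.2)⟩
  set d1 := ∑ n ∈ Ioc 0 X, (((ArithmeticFunction.vonMangoldt n - lgp n) * (2 * L - Real.log n) : ℝ) : ℂ) * ee (n * α)
  set d2 := ∑ n ∈ Ioc 0 X, ((if n.Prime then (L - Real.log n)^2 else 0 : ℝ) : ℂ) * ee (n * α)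
  have key : (L:ℂ)^2 * PP X α = tyI X α - L^2 * ee α - ∑ n ∈ Ioc 0 X, ((ArithmeticFunction.vonMangoldt * ArithmeticFunction.vonMangoldt) n : ℝ) * ee (n * α) - d1 + d2 := by
    rw [hS, PP, sum_filter, mul_sum]
    have : ∑ n ∈ Ioc 0 X, (L:ℂ)^2 * (if n.Prime then ee (n * α) else 0) = ∑ n ∈ Ioc 0 X, (ArithmeticFunction.vonMangoldt n * (2 * L - Real.log n) : ℝ) * ee (n * α) - d1 + d2 := by
      rw [← sum_sub_distrib, ← sum_add_distrib]
      refine sum_congr rfl fun n _ => ?_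
      rw [lgp_D]
      split_ifs with hp
      · rw [ArithmeticFunction.vonMangoldt_apply_prime hp]; push_cast; ring
      · push_cast; ring
    rw [this]; ring
  have b1 : ‖d1‖ ≤ ε/5 * X * L := by
    have h4 : ‖d1‖ ≤ ∑ n ∈ Ioc 0 X, (ArithmeticFunction.vonMangoldt n - lgp n) * (2 * L) := norm_sum_le_of_le _ fun n hn => by
      obtain ⟨a, b⟩ := hlog n hn
      have := sub_nonneg.2 (lgp_le_vm n)
      rw [norm_mul, ee_norm, mul_one, Complex.norm_real, Real.norm_of_nonneg (mul_nonneg this (by linarith))]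
      gcongr; linarith
    rw [← sum_mul, sum_sub_distrib] at h4
    have h5 := Chebyshev.psi_sub_theta_le hX1
    rw [← theta_eq', Chebyshev.psi, Nat.floor_natCast, range_eq_Ico, sum_eq_sum_Ico_succ_bot (by omega)] at h5
    have e0 : lgp 0 = 0 := by simp [lgp]
    rw [e0, zero_add, show Ico (0+1) (X+1) = Ioc 0 X by ext; simp; omega] at h5
    have h6 : L ≤ ε / 20 * Real.sqrt X := by
      refine le_of_sq_le_sq ?_ (by positivity)
      rw [mul_pow, Real.sq_sqrt hX0.le]; exact l3
    have h7 : Real.sqrt X * L ≤ ε / 20 * X := by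
      calc _ ≤ Real.sqrt X * (ε / 20 * Real.sqrt X) := by gcongr
        _ = ε / 20 * (Real.sqrt X * Real.sqrt X) := by ring
        _ = _ := by rw [Real.mul_self_sqrt hX0.le]
    refine h4.trans ?_
    calc _ ≤ (2 * √X * L) * (2 * L) := by gcongr
      _ = 4 * (√X * L) * L := by ring
      _ ≤ 4 * (ε / 20 * X) * L := by gcongr
      _ = _ := by ring
  have b2 : ‖d2‖ ≤ ε/5 * X * L := by
    have h4 : ‖d2‖ ≤ ∑ n ∈ Ioc 0 X, 16 * √X * (1 / √n) := norm_sum_le_of_le _ fun n hn => by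
      rw [norm_mul, ee_norm, mul_one, Complex.norm_real]
      split_ifs
      swap
      · rw [norm_zero]; positivity
      have hn0 : (0:ℝ) < n := by exact_mod_cast (mem_Ioc.1 hn).1
      rw [Real.norm_of_nonneg (sq_nonneg _), ← Real.log_div hX0.ne' hn0.ne', mul_one_div, mul_div_assoc, ← Real.sqrt_div hX0.le]
      have h1y : (1:ℝ) ≤ X / n := by rw [le_div_iff₀ hn0, one_mul]; exact_mod_cast (mem_Ioc.1 hn).2
      set y := (X:ℝ)/n
      have h8 := Real.log_le_rpow_div (x := y) (by linarith) (show (0:ℝ) < 1/4 by norm_num)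
      calc Real.log y ^ 2 ≤ (y^(1/4:ℝ) / (1/4))^2 := pow_le_pow_left₀ (Real.log_nonneg h1y) h8 2
        _ = 16 * (y^(1/4:ℝ))^2 := by ring
        _ = _ := by rw [← Real.rpow_natCast, ← Real.rpow_mul (by linarith), Real.sqrt_eq_rpow]; norm_num
    rw [← mul_sum] at h4
    refine h4.trans ?_
    calc _ ≤ 16 * √X * (2 * √X) := by gcongr; exact sum_inv_sqrt X
      _ = 32 * (√X * √X) := by ring
      _ = 32 * X := by rw [Real.mul_self_sqrt hX0.le]
      _ ≤ ε/5 * L * X := by gcongr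
      _ = _ := by ring
  have b3 : ‖(L:ℂ)^2 * ee α‖ ≤ ε/5 * X * L := by
    rw [norm_mul, ee_norm, mul_one, norm_pow, Complex.norm_real, Real.norm_of_nonneg (by linarith), sq]
    gcongr; linarith
  have hn : L * (‖PP X α‖ * L) ≤ L * (ε * X) := by
    have e : L * (‖PP X α‖ * L) = ‖(L:ℂ)^2 * PP X α‖ := by
      rw [norm_mul, norm_pow, Complex.norm_real, Real.norm_of_nonneg (by linarith)]; ring
    rw [e, key]
    refine (norm_add_le _ _).trans ((add_le_add (norm_sub_le _ _) le_rfl).trans ?_)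
    have := norm_sub_le (tyI X α - L^2 * ee α) (∑ n ∈ Ioc 0 X, ((ArithmeticFunction.vonMangoldt * ArithmeticFunction.vonMangoldt) n : ℝ) * ee (n * α))
    have := norm_sub_le (tyI X α) (L^2 * ee α)
    linarith
  exact le_of_mul_le_mul_left hn (by linarith)
end

section
open Finset

lemma shift_sum (q d : ℕ) (F : ℕ → ℂ) (hF : ∀ s, F (s + q) = F s) :
    ∑ s ∈ range q, F (s + d) = ∑ s ∈ range q, F s := by
  induction d with
  | zero => simp
  | succ d ih =>
    rw [← ih]
    have h1 := sum_range_succ (fun s => F (s + d)) q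
    have h2 := sum_range_succ' (fun s => F (s + d)) q
    rw [h1] at h2
    have h3 : F (q + d) = F (0 + d) := by rw [add_comm, hF, zero_add]
    rw [h3] at h2
    have := add_right_cancel h2
    rw [this]
    exact sum_congr rfl fun s _ => by congr 1; omega

lemma cstar (W b q : ℕ) (hq : 0 < q) (hb : b.Coprime W) (c : ℤ) (hc : IsCoprime c q) :
    ‖∑ s ∈ range q, (if (W * s + b).Coprime q then ee (s * (c / q)) else 0)‖ ≤ if q.Coprime W then 1 else 0 := by
  have hq' : (q:ℝ) ≠ 0 := by positivity
  have h1 : ∑ s ∈ range q, (if (W * s + b).Coprime q then ee (s * (c / q)) else 0) =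
      ∑ d ∈ q.divisors, (ArithmeticFunction.moebius d : ℂ) * ∑ s ∈ range q, if d ∣ W * s + b then ee (s * (c / q)) else 0 := by
    simp_rw [mul_sum]
    rw [sum_comm]
    refine sum_congr rfl fun s _ => ?_
    have h := congrArg (fun z : ℤ => (z : ℂ) * ee (s * (c / q))) (mu_coprime (W * s + b) q hq)
    push_cast at h
    rw [sum_mul] at h
    rw [show (if (W * s + b).Coprime q then ee (s * (c / q)) else 0) = (if (W * s + b).Coprime q then (1:ℂ) else 0) * ee (s * (c / q)) by split_ifs <;> simp, h]
    exact sum_congr rfl fun d _ => by split_ifs <;> simp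
  have h2 : ∀ d ∈ q.divisors, d ≠ q → ∑ s ∈ range q, (if d ∣ W * s + b then ee (s * (c / q)) else 0) = 0 := by
    intro d hd hdq
    obtain ⟨e, he⟩ := (Nat.mem_divisors.1 hd).1
    have hd0 : 0 < d := by rcases Nat.eq_zero_or_pos d with h | h; · simp [h] at he; omega
                           · exact h
    have he0 : 0 < e := by rcases Nat.eq_zero_or_pos e with h | h; · simp [h] at he; omega
                           · exact h
    have hs := shift_sum q d (fun s => if d ∣ W * s + b then ee (s * (c / q)) else 0) (fun s => by
      have : d ∣ W * (s + q) + b ↔ d ∣ W * s + b := by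
        rw [show W * (s + q) + b = W * s + b + d * (W * e) by rw [he]; ring]
        exact (Nat.dvd_add_left (Dvd.intro _ rfl))
      simp only [this]
      congr 1
      push_cast
      rw [show ((s:ℝ) + q) * (c / q) = s * (c/q) + (c:ℤ) by field_simp, ee_add_int])
    have h3 : ∀ s : ℕ, (if d ∣ W * (s + d) + b then ee (((s + d : ℕ) : ℝ) * (c / q)) else 0) = ee (c / e) * (if d ∣ W * s + b then ee (s * (c / q)) else 0) := fun s => by
      have : d ∣ W * (s + d) + b ↔ d ∣ W * s + b := by
        rw [show W * (s + d) + b = W * s + b + d * W by ring]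
        exact (Nat.dvd_add_left (Dvd.intro _ rfl))
      simp only [this]
      split_ifs
      · rw [← ee_add]; congr 1
        have hd1 : (d:ℝ) ≠ 0 := by positivity
        have he1 : (e:ℝ) ≠ 0 := by positivity
        rw [he]; push_cast; field_simp
        ring
      · simp
    simp only [h3, ← mul_sum] at hs
    set T := ∑ s ∈ range q, (if d ∣ W * s + b then ee (s * (c / q)) else 0)
    have h4 : (ee (c / e) - 1) * T = 0 := by rw [sub_mul, hs]; ring
    rcases mul_eq_zero.1 h4 with h | h
    · exfalso
      have h5 := ee_sub_one ((c:ℝ) / e)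
      rw [h, norm_zero] at h5
      have h6 : ¬ (e:ℤ) ∣ c := fun hec => by
        have : IsUnit (e:ℤ) := hc.isUnit_of_dvd' hec (by rw [he]; push_cast; exact Dvd.intro_left _ rfl)
        have := Int.natAbs_of_isUnit this
        simp at this
        rw [this] at he; omega
      have h7 := dn_frac c e he0 h6
      have h8 : (0:ℝ) < 1 / e := by positivity
      linarith
    · exact h
  rw [h1, sum_eq_single q (fun d hd hdq => by rw [h2 d hd hdq, mul_zero]) (fun h => absurd (Nat.mem_divisors_self q hq.ne') h), norm_mul]
  have h3 : ‖(ArithmeticFunction.moebius q : ℂ)‖ ≤ 1 := by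
    rw [Complex.norm_intCast]; exact_mod_cast ArithmeticFunction.abs_moebius_le_one
  refine (mul_le_mul_of_nonneg_right h3 (norm_nonneg _)).trans ?_
  rw [one_mul, ← sum_filter]
  have h4 : ((range q).filter (q ∣ W * · + b)).card ≤ if q.Coprime W then 1 else 0 := by
    split_ifs with h
    · rw [card_le_one]
      intro s hs t ht
      rw [mem_filter, mem_range] at hs ht
      have h5 : W * s + b ≡ W * t + b [MOD q] := ((Nat.modEq_zero_iff_dvd.2 hs.2).trans (Nat.modEq_zero_iff_dvd.2 ht.2).symm)
      have h6 := Nat.ModEq.cancel_left_of_coprime (by simpa [Nat.Coprime] using h) (Nat.ModEq.add_right_cancel' b h5)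
      exact Nat.ModEq.eq_of_lt_of_lt h6 hs.1 ht.1
    · rw [Nat.le_zero, card_eq_zero, filter_eq_empty_iff]
      intro s _ hs
      apply h
      have h5 : Nat.gcd q W ∣ b := (Nat.dvd_add_right ((Nat.gcd_dvd_right q W).mul_right s)).1 ((Nat.gcd_dvd_left q W).trans hs)
      have := Nat.dvd_gcd h5 (Nat.gcd_dvd_right q W)
      rw [hb] at this
      exact Nat.dvd_one.1 this
  refine (norm_sum_le_of_le _ fun s _ => (ee_norm _).le).trans ?_
  rw [sum_const, nsmul_eq_mul, mul_one]
  exact_mod_cast h4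

/-- partial summation -/
lemma abel_bd (N : ℕ) (a : ℕ → ℂ) (k : ℂ) (E β : ℝ) (h : ∀ x ≤ N, ‖∑ m ∈ range x, a m - x * k‖ ≤ E) :
    ‖∑ m ∈ range N, a m * ee (m * β)‖ ≤ ‖k‖ * ‖∑ m ∈ range N, ee (m * β)‖ + E * (1 + 7 * |β| * N) := by
  have hE : 0 ≤ E := (norm_nonneg _).trans (h 0 (Nat.zero_le _))
  set A : ℕ → ℂ := fun x => ∑ m ∈ range x, a m - x * k with hA
  have key : ∀ x, ∑ m ∈ range x, a m * ee (m * β) = k * ∑ m ∈ range x, ee (m * β) + A x * ee (x * β) - ∑ m ∈ range x, A (m + 1) * (ee ((m+1:ℕ) * β) - ee (m * β)) := by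
    intro x
    induction x with
    | zero => simp [hA]
    | succ x ih =>
      rw [sum_range_succ, ih, sum_range_succ (fun m : ℕ => ee (m * β)), sum_range_succ (fun m => A (m + 1) * (ee ((m+1:ℕ) * β) - ee (m * β)))]
      have : A (x+1) = A x + a x - k := by simp only [hA]; rw [sum_range_succ]; push_cast; ring
      rw [this]; ring
  rw [key]
  refine (norm_sub_le _ _).trans ?_
  have h1 : ‖A N * ee (N * β)‖ ≤ E := by rw [norm_mul, ee_norm, mul_one]; exact h N le_rfl
  have h2 : ‖∑ m ∈ range N, A (m + 1) * (ee ((m+1:ℕ) * β) - ee (m * β))‖ ≤ ∑ m ∈ range N, E * (7 * |β|) := by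
    refine norm_sum_le_of_le _ fun m hm => ?_
    rw [mem_range] at hm
    rw [norm_mul]
    have := ee_dist ((m+1:ℕ) * β) (m * β)
    rw [show ((m+1:ℕ):ℝ) * β - m * β = β by push_cast; ring] at this
    exact mul_le_mul (h _ hm) this (norm_nonneg _) hE
  rw [sum_const, card_range, nsmul_eq_mul] at h2
  have h3 := norm_add_le (k * ∑ m ∈ range N, ee (m * β)) (A N * ee (N * β))
  rw [norm_mul] at h3
  nlinarith

lemma pc_mono (q a : ℕ) {x y : ℕ} (h : x ≤ y) : pc q a x ≤ pc q a y :=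
  card_le_card (filter_subset_filter _ (Ioc_subset_Ioc_right h))

lemma pc_unif (q a : ℕ) (hq : 0 < q) (ha : a.Coprime q) (ε : ℝ) (hε : 0 < ε) : ∃ P0 : ℕ, ∀ p ≥ P0, ∀ x ≤ p,
    |(pc q a x : ℝ) * Real.log p - x / q.totient| ≤ ε * p := by
  wlog h1 : ε ≤ 1 generalizing ε
  · obtain ⟨P0, h⟩ := this 1 one_pos le_rfl
    exact ⟨P0, fun p hp x hx => (h p hp x hx).trans (by gcongr; linarith)⟩
  have hφ : (1:ℝ) ≤ q.totient := by exact_mod_cast Nat.totient_pos.2 hq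
  have hφ' : (q.totient:ℝ)⁻¹ ≤ 1 := inv_le_one_of_one_le₀ hφ
  obtain ⟨Y, hY⟩ := Filter.eventually_atTop.1 (Metric.tendsto_nhds.1 (pnt_ap q a hq ha) (ε/8) (by positivity))
  have hY' : ∀ x ≥ Y + 1, |(pc q a x : ℝ) * Real.log x - x / q.totient| ≤ ε / 8 * x := fun x hx => by
    have := (hY x (by omega)).le
    have hx0 : (0:ℝ) < x := by norm_cast; omega
    rw [Real.dist_eq] at this
    have e : (pc q a x : ℝ) * Real.log x - x / q.totient = ((pc q a x : ℝ) * Real.log x / x - (q.totient:ℝ)⁻¹) * x := by field_simp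
    rw [e, abs_mul, abs_of_pos hx0]; gcongr
  set K := Real.log (8/ε)
  have hK : 0 ≤ K := Real.log_nonneg (by rw [le_div_iff₀ hε]; linarith)
  have hl : Filter.Tendsto (fun n : ℕ => Real.log n) Filter.atTop Filter.atTop := Real.tendsto_log_atTop.comp tendsto_natCast_atTop_atTop
  obtain ⟨Z, hZ⟩ := Filter.eventually_atTop.1 (hl.eventually_ge_atTop (2 * K / (ε/8) + 1))
  -- key for x ≥ ε/8 p
  have key : ∀ p x : ℕ, Y + Z + 1 ≤ x → x ≤ p → ε / 8 * p ≤ x → |(pc q a x : ℝ) * Real.log p - x / q.totient| ≤ ε / 4 * p := by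
    intro p x h2 h3 h4
    have a1 := hY' x (by omega)
    have a2 := hZ x (by omega)
    have hx0 : (0:ℝ) < x := by norm_cast; omega
    have hxp : (x:ℝ) ≤ p := by exact_mod_cast h3
    have hp0 : (0:ℝ) < p := by linarith
    have hlx : 0 < Real.log x := by have : 0 ≤ 2 * K / (ε/8) := by positivity
                                    linarith
    have hlp : Real.log x ≤ Real.log p := Real.log_le_log hx0 hxp
    have hd : Real.log p - Real.log x ≤ K := by
      rw [← Real.log_div hp0.ne' hx0.ne']
      refine Real.log_le_log (by positivity) ?_
      rw [div_le_div_iff₀ hx0 hε]; linarith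
    have hpc : (pc q a x:ℝ) * Real.log x ≤ 2 * x := by
      have := (abs_le.1 a1).2
      have : (x:ℝ) / q.totient ≤ x := by rw [div_eq_mul_inv]; exact mul_le_of_le_one_right hx0.le hφ'
      have : ε / 8 * x ≤ 1 * x := by gcongr; linarith
      linarith
    have hKl : 2 * K ≤ ε / 8 * Real.log x := by
      have : 2 * K / (ε/8) ≤ Real.log x := by linarith
      rw [div_le_iff₀ (by positivity)] at this; linarith
    have h5 : (pc q a x:ℝ) * (Real.log p - Real.log x) ≤ ε / 8 * x := by
      refine le_of_mul_le_mul_right ?_ hlx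
      calc _ = ((pc q a x:ℝ) * Real.log x) * (Real.log p - Real.log x) := by ring
        _ ≤ 2 * x * K := by gcongr
        _ = x * (2 * K) := by ring
        _ ≤ x * (ε / 8 * Real.log x) := by gcongr
        _ = _ := by ring
    have h6 : 0 ≤ (pc q a x:ℝ) * (Real.log p - Real.log x) := mul_nonneg (by positivity) (by linarith)
    have h7 : ε / 8 * x ≤ ε / 8 * p := by gcongr
    rw [abs_le] at a1 ⊢
    constructor <;> linarith [a1.1, a1.2]
  obtain ⟨Z2, hZ2⟩ := exists_nat_gt ((Y + Z + 1) * 8 / ε)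
  refine ⟨Z2 + Y + Z + 1, fun p hp x hx => ?_⟩
  have hp0 : (0:ℝ) < p := by norm_cast; omega
  have hbig : ((Y:ℝ) + Z + 1) ≤ ε / 8 * p := by
    have : ((Y:ℝ) + Z + 1) * 8 / ε ≤ p := hZ2.le.trans (by norm_cast; omega)
    rw [div_le_iff₀ hε] at this; linarith
  by_cases h : ε / 8 * p ≤ x
  · refine (key p x ?_ hx h).trans (by gcongr; linarith)
    have : ((Y + Z + 1 : ℕ):ℝ) ≤ x := by push_cast; linarith
    exact_mod_cast this
  · push Not at h
    set y := ⌈ε / 8 * p⌉₊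
    have hy1 : ε / 8 * p ≤ y := Nat.le_ceil _
    have hy2 : (y:ℝ) < ε / 8 * p + 1 := Nat.ceil_lt_add_one (by positivity)
    have hyY : Y + Z + 1 ≤ y := by
      have : ((Y + Z + 1 : ℕ):ℝ) ≤ y := by push_cast; linarith
      exact_mod_cast this
    have hY0 : (0:ℝ) ≤ Y := by positivity
    have hZ0 : (0:ℝ) ≤ Z := by positivity
    have hyp : y ≤ p := Nat.ceil_le.2 (by have : ε / 8 * p ≤ 1 * p := by gcongr; linarith
                                          linarith)
    have hxy : x ≤ y := by have : (x:ℝ) ≤ y := by linarith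
                           exact_mod_cast this
    have h2 := (abs_le.1 (key p y hyY hyp hy1)).2
    have h3 : (pc q a x:ℝ) * Real.log p ≤ pc q a y * Real.log p := by
      gcongr
      exact pc_mono q a hxy
    have h4 : (y:ℝ) / q.totient ≤ y := by rw [div_eq_mul_inv]; exact mul_le_of_le_one_right (by positivity) hφ'
    have h5 : (x:ℝ) / q.totient ≤ x := by rw [div_eq_mul_inv]; exact mul_le_of_le_one_right (by positivity) hφ'
    have h6 : 0 ≤ (pc q a x:ℝ) * Real.log p := mul_nonneg (by positivity) (Real.log_natCast_nonneg p)
    have h7 : 0 ≤ (x:ℝ) / q.totient := by positivity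
    rw [abs_le]; constructor <;> linarith
end

section
open Finset

lemma cnt (W b q s x : ℕ) (hb : b < W) (hq : 0 < q) :
    ((range x).filter fun m => m % q = s % q ∧ (W * m + b).Prime).card = pc (W * q) (W * s + b) (W * x - 1) := by
  have hW : 0 < W := by omega
  have e1 : ∀ m, (W * m + b) / W = m := fun m => by rw [Nat.mul_add_div hW, Nat.div_eq_of_lt hb, add_zero]
  have e2 : ∀ m, (W * m + b) % W = b := fun m => by rw [Nat.mul_add_mod, Nat.mod_eq_of_lt hb]
  refine card_bij (fun m _ => W * m + b) (fun m hm => ?_) (fun m _ m' _ h => by simpa [hW.ne'] using h) fun n hn => ?_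
  · rw [mem_filter, mem_range] at hm
    rw [mem_filter, mem_Ioc]
    have h1 : W * (m + 1) ≤ W * x := Nat.mul_le_mul_left _ hm.1
    rw [mul_add, mul_one] at h1
    refine ⟨⟨hm.2.2.pos, by omega⟩, hm.2.2, ?_⟩
    rw [Nat.mod_mul, Nat.mod_mul, e1, e1, e2, e2, hm.2.1]
  · rw [mem_filter, mem_Ioc, Nat.mod_mul, Nat.mod_mul, e1, e2] at hn
    obtain ⟨⟨h1, h2⟩, h3, h4⟩ := hn
    have h5 : n % W = b := by
      have := congrArg (· % W) h4
      simpa [Nat.add_mul_mod_self_left, Nat.mod_eq_of_lt hb] using this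
    have h6 : W * (n / W) + b = n := by rw [← h5]; exact Nat.div_add_mod n W
    refine ⟨n / W, ?_, h6⟩
    rw [mem_filter, mem_range, h6]
    refine ⟨(Nat.div_lt_iff_lt_mul hW).2 (by rw [mul_comm]; omega), ?_, h3⟩
    rw [h5] at h4
    exact Nat.eq_of_mul_eq_mul_left hW (by omega)

lemma pc_mod (q a x : ℕ) : pc q (a % q) x = pc q a x := by simp [pc]

lemma pc_non (q a x : ℕ) (hq : 0 < q) (h : ¬ a.Coprime q) : pc q a x ≤ q := by
  refine (card_le_card (t := Ioc 0 q) fun n hn => ?_).trans (by simp)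
  rw [mem_filter, mem_Ioc] at hn
  obtain ⟨⟨h1, _⟩, hp, hm⟩ := hn
  rw [mem_Ioc]
  refine ⟨h1, ?_⟩
  by_contra hlt
  have h2 : n.Coprime q := (Nat.Prime.coprime_iff_not_dvd hp).2 fun hd => hlt (Nat.le_of_dvd hq hd)
  apply h
  rw [Nat.Coprime, ← Nat.ModEq.gcd_eq (show n ≡ a [MOD q] from hm)]
  exact h2

lemma pc_all (D : ℕ) (hD : 0 < D) (ε : ℝ) (hε : 0 < ε) : ∃ P0 : ℕ, ∀ p ≥ P0, ∀ x ≤ p, ∀ a : ℕ,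
    |(pc D a x : ℝ) * Real.log p - if a.Coprime D then (x:ℝ) / D.totient else 0| ≤ ε * p := by
  have h : ∀ a : ℕ, ∃ P0 : ℕ, ∀ p ≥ P0, ∀ x ≤ p, |(pc D a x : ℝ) * Real.log p - if a.Coprime D then (x:ℝ) / D.totient else 0| ≤ ε * p := by
    intro a
    by_cases ha : a.Coprime D
    · exact (pc_unif D a hD ha ε hε).imp fun P h p hp x hx => by rw [if_pos ha]; exact h p hp x hx
    · obtain ⟨P0, hP⟩ := Filter.eventually_atTop.1 (tendsto_natCast_atTop_atTop.eventually (log_small 1 (ε/D) (by positivity)))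
      refine ⟨P0, fun p hp x _ => ?_⟩
      have h1 := hP p hp
      have h2 : (pc D a x : ℝ) ≤ D := by exact_mod_cast pc_non D a x hD ha
      have hl := Real.log_natCast_nonneg p
      rw [if_neg ha, sub_zero, abs_of_nonneg (by positivity)]
      calc _ ≤ (D:ℝ) * (ε / D * p) := by gcongr; rwa [pow_one] at h1
        _ = _ := by field_simp
  choose P hP using h
  refine ⟨(range D).sup P, fun p hp x hx a => ?_⟩
  have h1 := hP (a % D) p (le_trans (le_sup (f := P) (mem_range.2 (Nat.mod_lt a hD))) hp) x hx
  have h2 : (a % D).Coprime D ↔ a.Coprime D := by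
    rw [Nat.Coprime, Nat.Coprime, Nat.ModEq.gcd_eq (Nat.mod_modEq a D)]
  rw [pc_mod] at h1
  simpa only [h2] using h1

noncomputable def SP (W b p : ℕ) (θ : ℝ) : ℂ := ∑ m ∈ (range p).filter (fun m => (W * m + b).Prime), ee (m * θ)

lemma major (W Q : ℕ) (hW : 0 < W) (ε : ℝ) (hε : 0 < ε) : ∃ P0 : ℕ, ∀ p ≥ P0, ∀ b < W, b.Coprime W → ∀ q ≤ Q, 0 < q →
    ∀ c : ℤ, IsCoprime c q → ∀ β : ℝ, |β| * p ≤ 2 * Q →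
    Real.log (W * p : ℕ) * ‖SP W b p (c / q + β)‖ ≤ (if q.Coprime W then (W:ℝ) / (W * q).totient else 0) * ‖∑ m ∈ range p, ee (m * β)‖ + ε * p := by
  set ε' := ε / (2 * W * (Q + 1) * (1 + 14 * Q)) with hε'
  have hW' : (0:ℝ) < W := by exact_mod_cast hW
  have hp' : 0 < ε' := by positivity
  choose P hP using fun q : ℕ => pc_all (W * (q + 1)) (by positivity) ε' hp'
  obtain ⟨Z, hZ⟩ := exists_nat_gt (2 * Q * (1 + 14 * Q) / ε)
  refine ⟨(range (Q+1)).sup P + Z + 1, fun p hp b hb hbW q hqQ hq c hc β hβ => ?_⟩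
  have hp0 : (0:ℝ) < p := by norm_cast; omega
  have hq' : (0:ℝ) < q := by exact_mod_cast hq
  have hqQ' : (q:ℝ) ≤ Q := by exact_mod_cast hqQ
  set L := Real.log (W * p : ℕ)
  have hL : 0 ≤ L := Real.log_natCast_nonneg _
  have hU : ∀ x ≤ W * p, ∀ a : ℕ, |(pc (W * q) a x : ℝ) * L - if a.Coprime (W * q) then (x:ℝ) / (W * q).totient else 0| ≤ ε' * (W * p) := by
    intro x hx a
    have h1 : (range (Q+1)).sup P ≤ W * p := le_trans (by omega) (Nat.le_mul_of_pos_left p hW)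
    have := hP (q - 1) (W * p) (le_trans (le_sup (f := P) (mem_range.2 (by omega))) h1) x hx a
    rw [Nat.sub_add_cancel hq] at this
    rw [Nat.cast_mul (α := ℝ) W p] at this
    rw [show L = Real.log ((W:ℝ) * p) by simp only [L]; push_cast; rfl]
    exact this
  set Φ : ℝ := ((W * q).totient : ℝ) with hΦ
  have hΦ1 : 1 ≤ Φ := by rw [hΦ]; exact_mod_cast Nat.totient_pos.2 (by positivity)
  set cs := ∑ s ∈ range q, (if (W * s + b).Coprime q then ee (s * (c / q)) else 0)
  set k : ℂ := (W / Φ : ℝ) * cs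
  have hcs := cstar W b q hq hbW c hc
  have hk : ‖k‖ ≤ if q.Coprime W then (W:ℝ) / Φ else 0 := by
    rw [norm_mul, Complex.norm_real, Real.norm_of_nonneg (by positivity)]
    calc _ ≤ W / Φ * (if q.Coprime W then (1:ℝ) else 0) := by gcongr
      _ = _ := by split_ifs <;> simp
  set a : ℕ → ℂ := fun m => if (W * m + b).Prime then (L:ℂ) * ee (m * (c / q)) else 0 with ha
  have hE : ∀ x ≤ p, ‖∑ m ∈ range x, a m - x * k‖ ≤ q * (ε' * (W * p) + 1) := by
    intro x hx
    have h1 : ∑ m ∈ range x, a m = ∑ s ∈ range q, (((pc (W * q) (W * s + b) (W * x - 1) : ℝ) * L : ℝ) : ℂ) * ee (s * (c / q)) := by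
      rw [← sum_fiberwise_of_maps_to (g := fun m => m % q) (t := range q) fun m _ => mem_range.2 (Nat.mod_lt m hq)]
      refine sum_congr rfl fun s hs => ?_
      rw [← cnt W b q s x hb hq, ha, ← sum_filter, filter_filter]
      rw [sum_congr rfl (g := fun _ => (L:ℂ) * ee (s * (c / q)))]
      · rw [sum_const, nsmul_eq_mul, Nat.mod_eq_of_lt (mem_range.1 hs)]; push_cast; ring
      · intro m hm
        rw [mem_filter] at hm
        congr 1
        have h2 : (m:ℝ) = q * (m / q : ℕ) + s := by
          have := Nat.div_add_mod m q
          rw [hm.2.1] at this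
          exact_mod_cast this.symm
        rw [h2]
        generalize m / q = t
        rw [show ((q:ℝ) * t + s) * (c / q) = s * (c / q) + ((t : ℤ) * c : ℤ) by push_cast; field_simp; ring, ee_add_int]
    have h2 : x * k = ∑ s ∈ range q, ((if (W * s + b).Coprime (W * q) then (W * x : ℝ) / Φ else 0 : ℝ) : ℂ) * ee (s * (c / q)) := by
      simp only [k, cs]
      rw [mul_sum, mul_sum]
      refine sum_congr rfl fun s _ => ?_
      have : (W * s + b).Coprime (W * q) ↔ (W * s + b).Coprime q := by
        rw [Nat.coprime_mul_iff_right]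
        refine and_iff_right ?_
        rw [add_comm]; simpa using hbW
      simp only [this]
      split_ifs <;> push_cast <;> ring
    rw [h1, h2, ← sum_sub_distrib]
    simp only [← sub_mul, ← Complex.ofReal_sub]
    refine (norm_sum_le_of_le (n := fun _ => ε' * (W * p) + 1) _ fun s _ => ?_).trans (by rw [sum_const, card_range, nsmul_eq_mul])
    rw [norm_mul, ee_norm, mul_one, Complex.norm_real, Real.norm_eq_abs]
    have h3 := hU (W * x - 1) (le_trans (Nat.sub_le _ _) (Nat.mul_le_mul_left _ hx)) (W * s + b)
    have h4 : |(if (W * s + b).Coprime (W * q) then (((W * x - 1 : ℕ) : ℝ)) / Φ else 0) - (if (W * s + b).Coprime (W * q) then (W * x : ℝ) / Φ else 0)| ≤ 1 := by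
      split_ifs
      · rw [← sub_div, abs_div, abs_of_pos (show 0 < Φ by linarith), div_le_one (by linarith)]
        refine le_trans ?_ hΦ1
        have : (W * x - 1 : ℕ) + 1 ≥ W * x ∧ (W * x - 1 : ℕ) ≤ W * x := by omega
        have t1 : ((W * x - 1 : ℕ):ℝ) + 1 ≥ W * x := by exact_mod_cast this.1
        have t2 : ((W * x - 1 : ℕ):ℝ) ≤ W * x := by exact_mod_cast this.2
        rw [abs_le]; constructor <;> linarith
      · simp
    exact (abs_sub_le _ _ _).trans (add_le_add h3 h4)
  have hab := abel_bd p a k _ β hE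
  have e1 : ∑ m ∈ range p, a m * ee (m * β) = L * SP W b p (c / q + β) := by
    rw [SP, mul_sum, sum_filter]
    refine sum_congr rfl fun m _ => ?_
    simp only [ha]
    split_ifs
    · rw [mul_assoc, ← ee_add]; congr 2; ring
    · simp
  rw [e1, norm_mul, Complex.norm_real, Real.norm_of_nonneg hL] at hab
  refine hab.trans (add_le_add (mul_le_mul_of_nonneg_right hk (norm_nonneg _)) ?_)
  have z1 : 2 * Q * (1 + 14 * Q) ≤ ε * p := by
    have : 2 * Q * (1 + 14 * Q) / ε ≤ (p:ℝ) := hZ.le.trans (by norm_cast; omega)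
    rw [div_le_iff₀ hε] at this; linarith
  have z2 : 1 + 7 * |β| * p ≤ 1 + 14 * (Q:ℝ) := by linarith
  calc (q:ℝ) * (ε' * (W * p) + 1) * (1 + 7 * |β| * p) ≤ Q * (ε' * (W * p) + 1) * (1 + 14 * Q) := by gcongr
    _ = ε' * (2 * W * Q * (1 + 14 * Q)) * p / 2 + (2 * Q * (1 + 14 * Q)) / 2 := by ring
    _ ≤ ε' * (2 * W * (Q + 1) * (1 + 14 * Q)) * p / 2 + ε * p / 2 := by gcongr; linarith
    _ = ε * p := by rw [hε', div_mul_cancel₀ _ (by positivity)]; ring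
end

section
open Finset

lemma SP_zero (W : ℕ) (hW : 0 < W) (ε : ℝ) (hε : 0 < ε) : ∃ P0 : ℕ, ∀ p ≥ P0, ∀ b < W, b.Coprime W →
    (W.totient:ℝ) / W * Real.log p * ((range p).filter fun m => (W * m + b).Prime).card ≤ (1 + ε) * p := by
  obtain ⟨P0, hP⟩ := pc_all W hW (ε / W) (by positivity)
  refine ⟨P0 + 1, fun p hp b hb hbW => ?_⟩
  have hp0 : (0:ℝ) < p := by norm_cast; omega
  have hW' : (0:ℝ) < W := by exact_mod_cast hW
  have hW1 : (1:ℝ) ≤ W := by exact_mod_cast hW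
  have h1 := (abs_le.1 (hP (W * p) (le_trans (by omega) (Nat.le_mul_of_pos_left p hW)) (W * p - 1) (Nat.sub_le _ _) b)).2
  rw [if_pos hbW] at h1
  have h2 := cnt W b 1 0 p hb one_pos
  simp only [Nat.mod_one, true_and, mul_zero, zero_add, mul_one] at h2
  rw [h2]
  have hφ : (0:ℝ) < W.totient := by exact_mod_cast Nat.totient_pos.2 hW
  have hφ' : (W.totient:ℝ) ≤ W := by exact_mod_cast Nat.totient_le W
  have h3 : ((W * p - 1 : ℕ):ℝ) ≤ W * p := by exact_mod_cast Nat.sub_le _ _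
  have h4 : ((W * p - 1 : ℕ):ℝ) / W.totient ≤ W * p / W.totient := by gcongr
  have h5 : Real.log p ≤ Real.log (W * p : ℕ) := Real.log_le_log hp0 (by push_cast; nlinarith)
  push_cast at h1 h5
  calc _ = (W.totient:ℝ) / W * (pc W b (W * p - 1) * Real.log p) := by ring
    _ ≤ (W.totient:ℝ) / W * (pc W b (W * p - 1) * Real.log (W * p)) := by gcongr
    _ ≤ (W.totient:ℝ) / W * (W * p / W.totient + ε / W * (W * p)) := by gcongr; linarith
    _ = p + (W.totient:ℝ) / W * (ε * p) := by field_simp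
    _ ≤ p + 1 * (ε * p) := by gcongr; rw [div_le_one hW']; exact hφ'
    _ = _ := by ring

lemma SP_four (W b p : ℕ) (hb : b < W) (θ : ℝ) :
    (W:ℂ) * SP W b p θ = ∑ l ∈ range W, ee (-(b * ((θ + l) / W))) * PP (W * p - 1) ((θ + l) / W) := by
  have hW : 0 < W := by omega
  have hW' : (W:ℝ) ≠ 0 := by positivity
  have h1 : ∀ n : ℕ, ∑ l ∈ range W, ee (-(b * ((θ + l) / W))) * ee (n * ((θ + l) / W)) = if n % W = b then (W:ℂ) * ee ((n / W : ℕ) * θ) else 0 := by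
    intro n
    have h2 : ∀ l : ℕ, ee (-(b * ((θ + l) / W))) * ee (n * ((θ + l) / W)) = ee (((n:ℝ) - b) / W * θ) * ee (l * (((n - b : ℤ) : ℝ) / W)) := fun l => by
      rw [← ee_add, ← ee_add]; congr 1; push_cast; field_simp; ring
    simp only [h2]
    rw [← mul_sum, sum_ee_frac W hW]
    have h3 : (W:ℤ) ∣ (n:ℤ) - b ↔ n % W = b := by
      rw [← Int.modEq_iff_dvd, Int.natCast_modEq_iff, Nat.ModEq, Nat.mod_eq_of_lt hb, eq_comm]
    simp only [h3]
    split_ifs with h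
    · have : ((n:ℝ) - b) / W = (n / W : ℕ) := by
        have h4 := Nat.div_add_mod n W
        rw [h] at h4
        have h5 : (n:ℝ) = W * (n / W : ℕ) + b := by exact_mod_cast h4.symm
        rw [eq_comm, eq_div_iff hW']; linarith
      rw [this, mul_comm]
    · simp
  simp only [PP, mul_sum]
  rw [sum_comm]
  simp only [h1]
  rw [SP, mul_sum, ← sum_filter, filter_filter]
  have e1 : ∀ m, (W * m + b) / W = m := fun m => by rw [Nat.mul_add_div hW, Nat.div_eq_of_lt hb, add_zero]
  refine sum_bij (fun m _ => W * m + b) (fun m hm => ?_) (fun m _ m' _ h => by simpa [hW.ne'] using h) (fun n hn => ?_) (fun m hm => by rw [e1])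
  · rw [mem_filter, mem_range] at hm
    rw [mem_filter, mem_Ioc]
    have h1 : W * (m + 1) ≤ W * p := Nat.mul_le_mul_left _ hm.1
    rw [mul_add, mul_one] at h1
    exact ⟨⟨hm.2.pos, by omega⟩, hm.2, by rw [Nat.mul_add_mod, Nat.mod_eq_of_lt hb]⟩
  · rw [mem_filter, mem_Ioc] at hn
    obtain ⟨⟨h1, h2⟩, h3, h5⟩ := hn
    have h6 : W * (n / W) + b = n := by rw [← h5]; exact Nat.div_add_mod n W
    refine ⟨n / W, ?_, h6⟩
    rw [mem_filter, mem_range, h6]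
    exact ⟨(Nat.div_lt_iff_lt_mul hW).2 (by rw [mul_comm]; omega), h3⟩

lemma maj_red (W Q p l : ℕ) (hW : 0 < W) (hp : 2 ≤ p) (θ : ℝ) (h : Maj Q (W * p - 1) ((θ + l) / W)) :
    ∃ q : ℕ, 0 < q ∧ q ≤ Q ∧ ∃ c : ℤ, IsCoprime c q ∧ |θ - c / q| * p ≤ 2 * Q := by
  obtain ⟨q, hq, hqQ, hd⟩ := h
  obtain ⟨a, ha⟩ := dn_exists (q * ((θ + l) / W))
  rw [← ha] at hd
  set c : ℤ := W * a - q * l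
  have hW' : (0:ℝ) < W := by exact_mod_cast hW
  have hq' : (0:ℝ) < q := by exact_mod_cast hq
  have hq1 : (1:ℝ) ≤ q := by exact_mod_cast hq
  have hX : (W:ℝ) * p ≤ 2 * (W * p - 1 : ℕ) := by
    have : 2 ≤ W * p := le_trans hp (Nat.le_mul_of_pos_left p hW)
    have h3 : W * p ≤ 2 * (W * p - 1) := by omega
    exact_mod_cast h3
  have h1 : |θ - c / q| * p ≤ 2 * Q := by
    have e : θ - c / q = (q * ((θ + l) / W) - a) * (W / q) := by simp only [c]; push_cast; field_simp; ring
    rw [e, abs_mul, abs_of_pos (show (0:ℝ) < W / q by positivity)]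
    calc _ = |q * ((θ + l) / W) - a| * (W * p) * (1 / q) := by ring
      _ ≤ |q * ((θ + l) / W) - a| * (2 * (W * p - 1 : ℕ)) * 1 := by gcongr; rw [div_le_one hq']; exact hq1
      _ ≤ _ := by linarith
  set t : ℚ := (c:ℚ) / q with ht
  have e : ((c:ℝ) / q) = (t.num : ℝ) / (t.den : ℝ) := by
    rw [← Rat.cast_def, ht]; push_cast; rfl
  refine ⟨t.den, t.den_pos, le_trans (Nat.le_of_dvd hq ?_) hqQ, t.num, ?_, by rw [← e]; exact h1⟩
  · have := Rat.den_dvd c q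
    rw [Rat.divInt_eq_div] at this
    rw [ht]; exact_mod_cast this
  · rw [Int.isCoprime_iff_gcd_eq_one]; exact t.reduced

theorem pseudo (ε : ℝ) (hε : 0 < ε) : ∃ w : ℕ, ∀ W : ℕ, 1 < W → (∀ l ≤ w, l.Prime → l ∣ W) → ∃ P0 : ℕ, ∀ p ≥ P0, ∀ b < W, b.Coprime W →
    ∀ r : ℤ, ¬ (p:ℤ) ∣ r → (W.totient:ℝ) / W * Real.log p * ‖SP W b p (r / p)‖ ≤ ε * p := by
  obtain ⟨w, hw⟩ := exists_nat_gt (8 / ε^2)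
  refine ⟨w, fun W hW2 hwW => ?_⟩
  have hW : 0 < W := by omega
  have hW' : (0:ℝ) < W := by exact_mod_cast hW
  obtain ⟨Q, X0, hm⟩ := minor (ε / W) (by positivity)
  obtain ⟨P0, hM⟩ := major W Q hW (ε/2) (by positivity)
  refine ⟨P0 + X0 + 2, fun p hp b hb hbW r hr => ?_⟩
  have hp0 : (0:ℝ) < p := by norm_cast; omega
  have hW1 : (1:ℝ) ≤ W := by exact_mod_cast hW
  have hφ : (0:ℝ) < W.totient := by exact_mod_cast Nat.totient_pos.2 hW
  have hφ' : (W.totient:ℝ) ≤ W := by exact_mod_cast Nat.totient_le W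
  have hφ1 : (W.totient:ℝ) / W ≤ 1 := by rw [div_le_one hW']; exact hφ'
  have hpW : p ≤ W * p := Nat.le_mul_of_pos_left p hW
  have hlp : 0 ≤ Real.log p := Real.log_natCast_nonneg p
  by_cases hmaj : ∃ l : ℕ, Maj Q (W * p - 1) ((r / p + l) / W)
  · obtain ⟨l, hl⟩ := hmaj
    obtain ⟨q, hq, hqQ, c, hc, hβ⟩ := maj_red W Q p l hW (by omega) _ hl
    have h1 := hM p (by omega) b hb hbW q hqQ hq c hc (r / p - c / q) hβ
    rw [add_sub_cancel] at h1
    have h2 : Real.log p ≤ Real.log (W * p : ℕ) := Real.log_le_log hp0 (by exact_mod_cast hpW)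
    have h3 : (W.totient:ℝ) / W * ((if q.Coprime W then (W:ℝ) / (W * q).totient else 0) * ‖∑ m ∈ range p, ee (m * (r / p - c / q))‖) ≤ ε / 2 * p := by
      rcases Nat.lt_or_ge 1 q with h | h
      · split_ifs with hqW
        swap
        · simp; positivity
        have h4 : ‖∑ m ∈ range p, ee (m * (r / p - c / q))‖ ≤ p :=
          (norm_sum_le_of_le _ fun m _ => (ee_norm _).le).trans (by simp)
        have h5 : w < q := by
          by_contra hlt
          have h6 := Nat.minFac_prime (show q ≠ 1 by omega)
          have h7 := hwW q.minFac (le_trans (Nat.minFac_le hq) (by omega)) h6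
          exact Nat.not_coprime_of_dvd_of_dvd h6.one_lt (Nat.minFac_dvd q) h7 hqW
        have h8 := phi_fin q hq
        have hφq : (0:ℝ) < q.totient := by exact_mod_cast Nat.totient_pos.2 hq
        have h9 : (2:ℝ) / ε ≤ q.totient := by
          refine le_of_sq_le_sq ?_ hφq.le
          have t1 : (q:ℝ) ≤ 2 * q.totient ^ 2 := by exact_mod_cast h8
          have t2 : (w:ℝ) ≤ q := by exact_mod_cast h5.le
          rw [div_pow]
          have : (8:ℝ) / ε^2 = 2 * (2^2 / ε^2) := by ring
          linarith
        rw [Nat.totient_mul hqW.symm]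
        push_cast
        rw [div_le_iff₀ hε] at h9
        calc _ ≤ (W.totient:ℝ) / W * ((W:ℝ) / (W.totient * q.totient) * p) := by gcongr
          _ = 1 / q.totient * p := by field_simp
          _ ≤ _ := by
            refine mul_le_mul_of_nonneg_right ?_ hp0.le
            rw [div_le_iff₀ hφq]; linarith
      · have hq1 : q = 1 := by omega
        subst hq1
        have h4 : ∑ m ∈ range p, ee (m * (r / p - c / (1:ℕ))) = 0 := by
          have h5 : ∀ m : ℕ, ee (m * (r / p - c / (1:ℕ))) = ee (m * (r / p)) := fun m => by
            rw [← ee_add_int (m * (r / p - c / (1:ℕ))) (m * c)]; congr 1; push_cast; ring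
          simp only [h5]
          rw [sum_ee_frac p (by omega), if_neg hr]
        rw [h4]; simp; positivity
    calc _ = (W.totient:ℝ) / W * (Real.log p * ‖SP W b p (r / p)‖) := by ring
      _ ≤ (W.totient:ℝ) / W * (Real.log (W * p : ℕ) * ‖SP W b p (r / p)‖) := by gcongr
      _ ≤ (W.totient:ℝ) / W * ((if q.Coprime W then (W:ℝ) / (W * q).totient else 0) * ‖∑ m ∈ range p, ee (m * (r / p - c / q))‖ + ε / 2 * p) := by gcongr
      _ ≤ ε / 2 * p + 1 * (ε / 2 * p) := by rw [mul_add]; gcongr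
      _ = _ := by ring
  · push Not at hmaj

    have hX : p ≤ W * p - 1 := by
      have : 2 * p ≤ W * p := Nat.mul_le_mul_right p hW2
      omega
    have h1 : ∀ l ∈ range W, ‖ee (-(b * (((r:ℝ) / p + l) / W))) * PP (W * p - 1) ((r / p + l) / W)‖ ≤ ε / W * (W * p) / Real.log (W * p - 1 : ℕ) := fun l _ => by
      have h2 := (hm (W * p - 1) (by omega) ((r / p + l) / W)).resolve_left (hmaj l)
      rw [norm_mul, ee_norm, one_mul, le_div_iff₀ (Real.log_pos (by norm_cast; omega))]
      refine h2.trans ?_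
      gcongr
      exact_mod_cast Nat.sub_le _ _
    have h2 := norm_sum_le_of_le _ h1
    rw [← SP_four W b p hb, norm_mul, sum_const, card_range, nsmul_eq_mul, Complex.norm_natCast] at h2
    have h3 := le_of_mul_le_mul_left h2 hW'
    rw [le_div_iff₀ (Real.log_pos (by norm_cast; omega)), show ε / W * (W * p) = ε * p by field_simp] at h3
    have h4 : Real.log p ≤ Real.log (W * p - 1 : ℕ) := Real.log_le_log hp0 (by exact_mod_cast hX)
    calc _ ≤ 1 * Real.log (W * p - 1 : ℕ) * ‖SP W b p (r / p)‖ := by gcongr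
      _ ≤ _ := by linarith
end

section
open Finset

lemma rest_abs (C : ℝ) (hC : 0 < C) : ∃ C' : ℝ, 0 < C' ∧ ∀ (ι : Type) (_ : DecidableEq ι) (s : Finset ι) (a : ι → ℝ), (∀ i, 0 ≤ a i) →
    (∀ R ⊆ s, ∑ i ∈ R, a i ^ 2 ≤ C * (R.card : ℝ) ^ (1/4:ℝ)) → ∑ i ∈ s, a i ^ (17/6:ℝ) ≤ C' := by
  have hs : Summable (fun n : ℕ => ((n + 1 : ℕ) : ℝ) ^ (-(17/16):ℝ)) :=
    (summable_nat_add_iff 1).2 (Real.summable_nat_rpow.2 (by norm_num))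
  have hnn : ∀ n : ℕ, 0 ≤ ((n + 1 : ℕ) : ℝ) ^ (-(17/16):ℝ) := fun n => by positivity
  have key : ∀ (n : ℕ) (ι : Type) (_ : DecidableEq ι) (s : Finset ι) (a : ι → ℝ), (∀ i, 0 ≤ a i) →
      (∀ R ⊆ s, ∑ i ∈ R, a i ^ 2 ≤ C * (R.card : ℝ) ^ (1/4:ℝ)) → s.card = n →
      ∑ i ∈ s, a i ^ (17/6:ℝ) ≤ C ^ (17/12:ℝ) * ∑ k ∈ range n, ((k + 1 : ℕ) : ℝ) ^ (-(17/16):ℝ) := by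
    intro n
    induction n with
    | zero => intro ι _ s a _ _ h; rw [card_eq_zero] at h; simp [h]
    | succ n ih =>
      intro ι _ s a ha hR hn
      have hne : s.Nonempty := card_pos.1 (by omega)
      obtain ⟨i, hi, hmin⟩ := exists_min_image s a hne
      rw [← add_sum_erase s _ hi, sum_range_succ, mul_add, add_comm]
      refine add_le_add (ih ι inferInstance (s.erase i) a ha (fun R h => hR R (h.trans (erase_subset _ _))) (by rw [card_erase_of_mem hi]; omega)) ?_
      have h1 := hR s (Subset.refl _)
      have h2 : s.card * a i ^ 2 ≤ ∑ j ∈ s, a j ^ 2 := by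
        rw [← nsmul_eq_mul]; exact card_nsmul_le_sum _ _ _ fun j hj => pow_le_pow_left₀ (ha i) (hmin j hj) 2
      rw [hn] at h1 h2
      set K : ℝ := ((n + 1 : ℕ) : ℝ) with hK
      have hK0 : 0 < K := by positivity
      have h3 : a i ^ 2 ≤ C * K ^ (-(3/4):ℝ) := by
        refine le_of_mul_le_mul_left ?_ hK0
        calc _ ≤ C * K ^ (1/4:ℝ) := h2.trans h1
          _ = C * (K ^ (1:ℝ) * K ^ (-(3/4):ℝ)) := by rw [← Real.rpow_add hK0]; norm_num
          _ = _ := by rw [Real.rpow_one]; ring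
      calc a i ^ (17/6:ℝ) = (a i ^ 2) ^ (17/12:ℝ) := by
            rw [← Real.rpow_natCast, ← Real.rpow_mul (ha i)]; norm_num
        _ ≤ (C * K ^ (-(3/4):ℝ)) ^ (17/12:ℝ) := Real.rpow_le_rpow (by positivity) h3 (by norm_num)
        _ = _ := by rw [Real.mul_rpow hC.le (by positivity), ← Real.rpow_mul hK0.le]; norm_num
  refine ⟨C ^ (17/12:ℝ) * ((∑' n : ℕ, ((n + 1 : ℕ) : ℝ) ^ (-(17/16):ℝ)) + 1), mul_pos (by positivity) (add_pos_of_nonneg_of_pos (tsum_nonneg hnn) one_pos), fun ι _ s a ha hR => (key _ ι inferInstance s a ha hR rfl).trans ?_⟩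
  gcongr
  exact (hs.sum_le_tsum _ fun n _ => hnn n).trans (by linarith)

noncomputable def ps {p : ℕ} [NeZero p] (x : ZMod p) : ℂ := ZMod.stdAddChar x

lemma ps_nat {p : ℕ} [NeZero p] (r : ZMod p) (k : ℕ) : ps (r * (k : ZMod p)) = ee (k * (((r.val : ℤ) : ℝ) / p)) := by
  have : r * (k : ZMod p) = ((r.val * k : ℤ) : ZMod p) := by push_cast; simp
  rw [ps, this, ZMod.stdAddChar_coe, ee]
  congr 1; push_cast; ring

lemma ps_val {p : ℕ} [NeZero p] (r x : ZMod p) : ps (r * x) = ee (x.val * (((r.val : ℤ) : ℝ) / p)) := by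
  rw [← ps_nat]; simp

lemma ps_norm {p : ℕ} [NeZero p] (x : ZMod p) : ‖ps x‖ = 1 := by
  have := ps_val 1 x
  rw [one_mul] at this; rw [this, ee_norm]

lemma ps_add {p : ℕ} [NeZero p] (x y : ZMod p) : ps (x + y) = ps x * ps y := AddChar.map_add_eq_mul _ _ _

lemma ps_sum {p : ℕ} [NeZero p] (x : ZMod p) : ∑ r : ZMod p, ps (r * x) = if x = 0 then (p:ℂ) else 0 := by
  have := AddChar.sum_mulShift x (ZMod.isPrimitive_stdAddChar p)
  rw [ZMod.card] at this; exact_mod_cast this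

noncomputable def FT {p : ℕ} [NeZero p] (F : ZMod p → ℝ) (r : ZMod p) : ℂ := (p:ℂ)⁻¹ * ∑ x, (F x : ℂ) * ps (r * x)

lemma sum_zmod {p : ℕ} [NeZero p] {R : Type*} [AddCommMonoid R] (G : ZMod p → R) : ∑ x, G x = ∑ k ∈ range p, G (k : ZMod p) :=
  sum_nbij' (fun x : ZMod p => x.val) (fun k => (k : ZMod p)) (fun x _ => mem_range.2 (ZMod.val_lt x)) (fun _ _ => mem_univ _)
    (fun x _ => by simp) (fun k hk => ZMod.val_cast_of_lt (mem_range.1 hk)) (fun x _ => by simp)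

lemma sep_zmod {p : ℕ} [NeZero p] (i j : ZMod p) (h : i ≠ j) : 1 / (p:ℝ) ≤ dn (((i.val : ℤ) : ℝ) / p - ((j.val : ℤ) : ℝ) / p) := by
  have := dn_frac ((i.val : ℤ) - j.val) p (NeZero.pos p) fun hd => h (by
    rw [← ZMod.intCast_zmod_eq_zero_iff_dvd] at hd
    push_cast at hd
    simpa [sub_eq_zero] using hd)
  rw [← sub_div]; push_cast at this ⊢; exact this

theorem restr : ∃ C' : ℝ, 0 < C' ∧ ∀ W : ℕ, 0 < W → ∃ P0 : ℕ, ∀ p ≥ P0, ∀ [NeZero p], ∀ b < W, b.Coprime W → ∀ F : ZMod p → ℝ,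
    (∀ x, 0 ≤ F x ∧ F x ≤ (W.totient:ℝ) / W * Real.log p) → (∀ x, F x ≠ 0 → (W * x.val + b).Prime ∧ p < (W * x.val + b) ^ 4) →
    ∑ r, ‖FT F r‖ ^ (17/6:ℝ) ≤ C' := by
  obtain ⟨C, hC, hsv⟩ := sieve_ls'
  obtain ⟨C', hC', hab⟩ := rest_abs (2 * C) (by positivity)
  refine ⟨C', hC', fun W hW => ?_⟩
  obtain ⟨P0, hP⟩ := SP_zero W hW 1 one_pos
  refine ⟨P0 + 256, fun p hp _ b hb hbW F hF hFp => hab (ZMod p) inferInstance univ _ (fun r => norm_nonneg _) fun R _ => ?_⟩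
  have h1 := hsv (ZMod p) inferInstance R (fun r => ((r.val : ℤ) : ℝ) / p) p W b (by omega) hW (fun i _ j _ hij => sep_zmod i j hij)
    (fun k => (F (k : ZMod p) : ℂ)) (fun k hk hne => by
      have := hFp k (by exact_mod_cast hne)
      rwa [ZMod.val_cast_of_lt hk] at this)
  have hp0 : (0:ℝ) < p := by norm_cast; omega
  have hW' : (0:ℝ) < W := by exact_mod_cast hW
  have hφ : (0:ℝ) < W.totient := by exact_mod_cast Nat.totient_pos.2 hW
  set V := (W.totient:ℝ) / W * Real.log p with hV
  have hV0 : 0 < V := mul_pos (by positivity) (Real.log_pos (by norm_cast; omega))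
  have h2 : ∑ k ∈ range p, ‖(F (k : ZMod p) : ℂ)‖ ^ 2 ≤ V * (2 * p) := by
    have h3 := hP p (by omega) b hb hbW
    calc _ ≤ ∑ k ∈ range p, if (W * k + b).Prime then V * V else 0 := sum_le_sum fun k hk => by
          rw [Complex.norm_real, Real.norm_eq_abs, sq_abs, sq]
          obtain ⟨a1, a2⟩ := hF (k : ZMod p)
          split_ifs with hpr
          · exact mul_le_mul a2 a2 a1 hV0.le
          · have : F (k : ZMod p) = 0 := by
              by_contra hne
              have := (hFp k hne).1
              rw [ZMod.val_cast_of_lt (mem_range.1 hk)] at this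
              exact hpr this
            rw [this, mul_zero]
      _ = V * (V * ((range p).filter fun m => (W * m + b).Prime).card) := by
          rw [← sum_filter, sum_const, nsmul_eq_mul]; ring
      _ ≤ V * ((1 + 1) * p) := by gcongr
      _ = _ := by ring
  have h4 : ∀ r : ZMod p, ‖FT F r‖ ^ 2 = (1 / p^2) * ‖∑ k ∈ range p, (F (k : ZMod p) : ℂ) * ee (k * (((r.val : ℤ) : ℝ) / p))‖ ^ 2 := fun r => by
    rw [FT, sum_zmod]; simp only [ps_nat]
    rw [norm_mul, mul_pow, norm_inv, Complex.norm_natCast]; congr 1; rw [inv_pow, one_div]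
  simp only [h4]
  rw [← mul_sum]
  refine le_of_mul_le_mul_left ?_ hV0
  calc _ = 1 / (p:ℝ)^2 * (V * ∑ i ∈ R, ‖∑ k ∈ range p, (F (k : ZMod p) : ℂ) * ee (k * (((i.val : ℤ) : ℝ) / p))‖ ^ 2) := by ring
    _ ≤ 1 / (p:ℝ)^2 * (C * (R.card:ℝ) ^ (1/4:ℝ) * p * (V * (2 * p))) :=
        mul_le_mul_of_nonneg_left (h1.trans (mul_le_mul_of_nonneg_left h2 (by positivity))) (by positivity)
    _ = _ := by field_simp
end

section
open Finset

section
variable {p : ℕ} [NeZero p]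

lemma ps_zero : ps (0 : ZMod p) = 1 := AddChar.map_zero_eq_one _

lemma ps_neg (x : ZMod p) : ps (-x) * ps x = 1 := by rw [← ps_add, neg_add_cancel, ps_zero]

lemma ps_conj (x : ZMod p) : (starRingEnd ℂ) (ps x) = ps (-x) := by
  have h := ps_neg x
  have h0 : ps x ≠ 0 := fun h => by have := ps_norm x; rw [h, norm_zero] at this; exact zero_ne_one this
  have h1 : (starRingEnd ℂ) (ps x) * ps x = 1 := by
    rw [mul_comm, Complex.mul_conj, Complex.normSq_eq_norm_sq, ps_norm]; simp
  exact mul_right_cancel₀ h0 (h1.trans h.symm)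

lemma ps_self (x : ZMod p) : ps x = ee (x.val / p) := by
  have : (x.val : ℤ) = x.val := rfl
  have e : x = ((x.val : ℤ) : ZMod p) := by simp
  rw [ps]
  conv_lhs => rw [e]
  rw [ZMod.stdAddChar_coe, ee]
  congr 1; push_cast; ring

lemma pp0 : (p:ℂ) ≠ 0 := by exact_mod_cast NeZero.ne p

lemma FT_inv (G : ZMod p → ℝ) (x : ZMod p) : ∑ r, FT G r * ps (-(r * x)) = G x := by
  have : ∀ r : ZMod p, FT G r * ps (-(r * x)) = ∑ y, (p:ℂ)⁻¹ * (G y * ps (r * (y - x))) := fun r => by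
    rw [FT, mul_assoc, sum_mul, mul_sum]
    refine sum_congr rfl fun y _ => ?_
    rw [mul_assoc, ← ps_add]; congr 3; ring
  simp only [this]
  rw [sum_comm]
  simp only [← mul_sum, ps_sum]
  simp only [sub_eq_zero, mul_ite, mul_zero, sum_ite_eq', mem_univ, if_true]
  rw [mul_comm, mul_assoc, mul_inv_cancel₀ pp0, mul_one]

lemma FT_count (F G H : ZMod p → ℝ) (n : ZMod p) : ((∑ x, ∑ y, F x * G y * H (n - x - y) : ℝ) : ℂ) =
    p^2 * ∑ r, FT F r * FT G r * FT H r * ps (-(r * n)) := by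
  have h1 : ∀ x y : ZMod p, ((F x * G y * H (n - x - y) : ℝ) : ℂ) = ∑ r, F x * G y * (FT H r * ps (-(r * (n - x - y)))) := fun x y => by
    rw [← mul_sum, FT_inv]; push_cast; ring
  push_cast at h1 ⊢
  simp only [h1]
  have h2 : ∀ r : ZMod p, (p:ℂ)^2 * (FT F r * FT G r * FT H r * ps (-(r * n))) = ∑ x, ∑ y, F x * G y * (FT H r * ps (-(r * (n - x - y)))) := fun r => by
    have : (p:ℂ)^2 * (FT F r * FT G r * FT H r * ps (-(r * n))) = (∑ x, (F x : ℂ) * ps (r * x)) * (∑ y, (G y : ℂ) * ps (r * y)) * (FT H r * ps (-(r * n))) := by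
      rw [FT, FT]
      have := pp0 (p := p)
      field_simp
    rw [this, sum_mul_sum, sum_mul]
    refine sum_congr rfl fun x _ => ?_
    rw [sum_mul]
    refine sum_congr rfl fun y _ => ?_
    rw [show -(r * (n - x - y)) = r * x + (r * y + -(r * n)) by ring, ps_add, ps_add]; ring
  rw [mul_sum]
  simp only [h2]
  rw [sum_comm' (t' := univ) (s' := fun _ => univ) (by simp)]
  conv_rhs => rw [sum_comm]
  rw [sum_comm]
  refine sum_congr rfl fun x _ => ?_
  rw [sum_comm]

noncomputable def mB (B : Finset (ZMod p)) (r : ZMod p) : ℂ := (B.card : ℂ)⁻¹ * ∑ y ∈ B, ps (r * y)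

noncomputable def cv (B : Finset (ZMod p)) (F : ZMod p → ℝ) (x : ZMod p) : ℝ :=
  ((B.card : ℝ)⁻¹)^2 * ∑ y ∈ B, ∑ z ∈ B, F (x - y - z)

lemma FT_cv (B : Finset (ZMod p)) (F : ZMod p → ℝ) (r : ZMod p) : FT (cv B F) r = FT F r * mB B r ^ 2 := by
  have h1 : ∀ y z : ZMod p, ∑ x, (F (x - y - z) : ℂ) * ps (r * x) = (∑ x, (F x : ℂ) * ps (r * x)) * (ps (r * y) * ps (r * z)) := fun y z => by
    rw [sum_mul, ← Equiv.sum_comp (Equiv.addRight (y + z)) (fun x => (F (x - y - z) : ℂ) * ps (r * x))]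
    refine sum_congr rfl fun x _ => ?_
    simp only [Equiv.coe_addRight]
    rw [show x + (y + z) - y - z = x by ring, mul_add, mul_add, ps_add, ps_add]; ring
  have h2 : ∑ x, (cv B F x : ℂ) * ps (r * x) = ((B.card : ℂ)⁻¹)^2 * ∑ y ∈ B, ∑ z ∈ B, ∑ x, (F (x - y - z) : ℂ) * ps (r * x) := by
    simp only [cv]; push_cast
    simp only [mul_assoc, sum_mul]
    rw [← mul_sum]; congr 1
    rw [sum_comm]
    exact sum_congr rfl fun y _ => sum_comm
  rw [FT, h2]
  simp only [h1]
  simp only [← mul_sum, ← sum_mul]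
  rw [FT, mB]; ring

lemma mB_zero (B : Finset (ZMod p)) (hB : B.Nonempty) : mB B 0 = 1 := by
  have : (B.card : ℂ) ≠ 0 := by exact_mod_cast hB.card_pos.ne'
  simp [mB, ps_zero, this]

lemma mB_norm (B : Finset (ZMod p)) (r : ZMod p) : ‖mB B r‖ ≤ 1 := by
  rw [mB, norm_mul, norm_inv, Complex.norm_natCast]
  have h : ‖∑ y ∈ B, ps (r * y)‖ ≤ B.card := (norm_sum_le_of_le _ fun y _ => (ps_norm _).le).trans (by simp)
  exact (mul_le_mul_of_nonneg_left h (by positivity)).trans inv_mul_le_one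

lemma mB_near (B : Finset (ZMod p)) (hB : B.Nonempty) (r : ZMod p) (η : ℝ) (h : ∀ y ∈ B, ‖ps (r * y) - 1‖ ≤ η) : ‖mB B r - 1‖ ≤ η := by
  have hc : (B.card : ℂ) ≠ 0 := by exact_mod_cast hB.card_pos.ne'
  have hc' : (0:ℝ) < B.card := by exact_mod_cast hB.card_pos
  have : mB B r - 1 = (B.card : ℂ)⁻¹ * ∑ y ∈ B, (ps (r * y) - 1) := by
    rw [sum_sub_distrib, mul_sub, mB]; simp [hc]
  rw [this, norm_mul, norm_inv, Complex.norm_natCast]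
  have h2 := norm_sum_le_of_le _ h
  rw [sum_const, nsmul_eq_mul] at h2
  calc _ ≤ (B.card:ℝ)⁻¹ * (B.card * η) := by gcongr
    _ = η := by field_simp

lemma mB_sq (B : Finset (ZMod p)) (hB : B.Nonempty) : ∑ r, ‖mB B r‖^2 = p / B.card := by
  have hc : (B.card : ℂ) ≠ 0 := by exact_mod_cast hB.card_pos.ne'
  have h1 : ∀ r : ZMod p, ((‖mB B r‖^2 : ℝ) : ℂ) = ((B.card : ℂ)⁻¹)^2 * ∑ y ∈ B, ∑ z ∈ B, ps (r * (y - z)) := fun r => by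
    rw [← Complex.normSq_eq_norm_sq, ← Complex.mul_conj, mB, map_mul, map_sum]
    simp only [ps_conj, map_inv₀, Complex.conj_natCast]
    rw [show ∀ a b c : ℂ, a * b * (a * c) = a^2 * (b * c) by intros; ring, sum_mul_sum]
    congr 1
    refine sum_congr rfl fun y _ => sum_congr rfl fun z _ => ?_
    rw [← ps_add]; congr 1; ring
  have h2 : ((∑ r, ‖mB B r‖^2 : ℝ) : ℂ) = ((p / B.card : ℝ) : ℂ) := by
    rw [Complex.ofReal_sum]
    simp only [h1]
    rw [← mul_sum, sum_comm]
    have : ∀ y ∈ B, ∑ r : ZMod p, ∑ z ∈ B, ps (r * (y - z)) = p := fun y hy => by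
      rw [sum_comm]; simp only [ps_sum, sub_eq_zero]
      rw [sum_ite_eq, if_pos hy]
    rw [sum_congr rfl this]
    simp; field_simp
  exact_mod_cast h2

lemma bohr (S : Finset (ZMod p)) (L : ℕ) (hL : 0 < L) : ∃ B : Finset (ZMod p), B.Nonempty ∧ (p:ℝ) ≤ (L:ℝ)^S.card * B.card ∧
    ∀ r ∈ S, ∀ y ∈ B, ‖ps (r * y) - 1‖ ≤ 7 / L := by
  have hp : 0 < p := NeZero.pos p
  let f : ZMod p → (S → Fin L) := fun x r => ⟨L * ((r : ZMod p) * x).val / p, (Nat.div_lt_iff_lt_mul hp).2 ((Nat.mul_lt_mul_left hL).2 (ZMod.val_lt _))⟩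
  haveI : Nonempty (Fin L) := ⟨⟨0, hL⟩⟩
  obtain ⟨k, _, hk⟩ := exists_le_card_fiber_of_nsmul_le_card_of_maps_to (s := (univ : Finset (ZMod p))) (t := (univ : Finset (S → Fin L))) (f := f) (b := (p:ℝ) / L^S.card) (fun _ _ => mem_univ _) univ_nonempty (by
    simp only [card_univ, Fintype.card_fun, Fintype.card_fin, Fintype.card_coe, ZMod.card, nsmul_eq_mul]
    push_cast
    rw [mul_div_cancel₀ _ (by positivity)])
  set T := univ.filter fun x => f x = k
  have hT : T.Nonempty := by
    rw [← card_pos]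
    have : (0:ℝ) < T.card := lt_of_lt_of_le (by positivity) hk
    exact_mod_cast this
  obtain ⟨x0, hx0⟩ := hT
  refine ⟨T.image (· - x0), ⟨_, mem_image_of_mem _ hx0⟩, ?_, ?_⟩
  · rw [card_image_of_injective _ sub_left_injective]
    rw [div_le_iff₀ (by positivity)] at hk; linarith
  · intro r hr y hy
    obtain ⟨x, hx, rfl⟩ := mem_image.1 hy
    have h1 : f x = f x0 := ((mem_filter.1 hx).2).trans (mem_filter.1 hx0).2.symm
    have h2 := congrArg (fun g => ((g ⟨r, hr⟩ : Fin L) : ℕ)) h1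
    simp only [f] at h2
    set u := (r * x).val
    set v := (r * x0).val
    have a1 := Nat.div_mul_le_self (L * u) p
    have a2 := Nat.lt_div_mul_add (a := L * u) hp
    have a3 := Nat.div_mul_le_self (L * v) p
    have a4 := Nat.lt_div_mul_add (a := L * v) hp
    rw [h2] at a1 a2
    have hu : (L:ℝ) * u ≤ L * v + p := by norm_cast; omega
    have hv : (L:ℝ) * v ≤ L * u + p := by norm_cast; omega
    have e : ‖ps (r * (x - x0)) - 1‖ = ‖ps (r * x) - ps (r * x0)‖ := by
      have : ps (r * x) - ps (r * x0) = (ps (r * (x - x0)) - 1) * ps (r * x0) := by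
        rw [sub_mul, ← ps_add, one_mul]; congr 2; ring
      rw [this, norm_mul, ps_norm, mul_one]
    rw [e, ps_self, ps_self]
    refine (ee_dist _ _).trans ?_
    rw [← sub_div, abs_div, abs_of_pos (show (0:ℝ) < p by exact_mod_cast hp), div_eq_mul_one_div (7:ℝ)]
    have hLr : (0:ℝ) < L := by exact_mod_cast hL
    have hpr : (0:ℝ) < p := by exact_mod_cast hp
    refine mul_le_mul_of_nonneg_left ?_ (by norm_num)
    have hab : |(u:ℝ) - v| * L = |((u:ℝ) - v) * L| := by rw [abs_mul, abs_of_pos hLr]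
    rw [div_le_div_iff₀ hpr hLr, hab, abs_le]
    constructor <;> linarith

end
end

section
open Finset

section
variable {p : ℕ} [NeZero p]

lemma cv_sum (B : Finset (ZMod p)) (hB : B.Nonempty) (F : ZMod p → ℝ) : ∑ x, cv B F x = ∑ x, F x := by
  have h := FT_cv B F 0
  rw [mB_zero B hB, one_pow, mul_one, FT, FT] at h
  have h2 := mul_left_cancel₀ (inv_ne_zero pp0) h
  simp only [zero_mul, ps_zero, mul_one] at h2
  exact_mod_cast h2

lemma cv_mono (B : Finset (ZMod p)) (F G : ZMod p → ℝ) (h : ∀ x, F x ≤ G x) (x : ZMod p) : cv B F x ≤ cv B G x := by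
  unfold cv; gcongr; exact h _

lemma cv_nonneg (B : Finset (ZMod p)) (F : ZMod p → ℝ) (h : ∀ x, 0 ≤ F x) (x : ZMod p) : 0 ≤ cv B F x :=
  mul_nonneg (by positivity) (sum_nonneg fun _ _ => sum_nonneg fun _ _ => h _)

lemma cv_bd (B : Finset (ZMod p)) (hB : B.Nonempty) (ν : ZMod p → ℝ) (ε : ℝ) (hε : 0 ≤ ε) (h0 : ‖FT ν 0‖ ≤ 1 + ε)
    (h1 : ∀ r ≠ 0, ‖FT ν r‖ ≤ ε) (x : ZMod p) : cv B ν x ≤ 1 + ε + ε * (p / B.card) := by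
  have h := FT_inv (cv B ν) x
  have hn : cv B ν x ≤ ‖((cv B ν x : ℝ) : ℂ)‖ := by rw [Complex.norm_real]; exact Real.le_norm_self _
  refine hn.trans ?_
  rw [← h, ← add_sum_erase _ _ (mem_univ 0)]
  refine (norm_add_le _ _).trans (add_le_add ?_ ?_)
  · rw [norm_mul, ps_norm, mul_one, FT_cv, mB_zero B hB, one_pow, mul_one]; exact h0
  · rw [← mB_sq B hB, mul_sum]

    refine (norm_sum_le_of_le (n := fun r => ε * ‖mB B r‖^2) _ fun r hr => ?_).trans (sum_le_sum_of_subset_of_nonneg (subset_univ _) fun _ _ _ => by positivity)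
    rw [norm_mul, ps_norm, mul_one, FT_cv, norm_mul, norm_pow]
    gcongr
    exact h1 r (ne_of_mem_erase hr)

lemma pow6 (z : ℂ) (h : ‖z‖ ≤ 1) : ‖1 - z^6‖ ≤ 6 * ‖z - 1‖ ∧ ‖1 - z^6‖ ≤ 2 := by
  constructor
  · have : 1 - z^6 = -((z - 1) * (1 + z + z^2 + z^3 + z^4 + z^5)) := by ring
    rw [this, norm_neg, norm_mul, mul_comm]
    gcongr
    have hz : ∀ n : ℕ, ‖z^n‖ ≤ 1 := fun n => by rw [norm_pow]; exact pow_le_one₀ (norm_nonneg _) h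
    have := norm_add_le (1 + z + z^2 + z^3 + z^4) (z^5)
    have := norm_add_le (1 + z + z^2 + z^3) (z^4)
    have := norm_add_le (1 + z + z^2) (z^3)
    have := norm_add_le (1 + z) (z^2)
    have := norm_add_le 1 z
    have h1 : ‖(1:ℂ)‖ = 1 := norm_one
    linarith [hz 2, hz 3, hz 4, hz 5]
  · refine (norm_sub_le _ _).trans ?_
    rw [norm_one, norm_pow]
    linarith [pow_le_one₀ (norm_nonneg _) h (n := 6)]

lemma amgm3 (a b c : ℝ) (ha : 0 ≤ a) (hb : 0 ≤ b) (hc : 0 ≤ c) : a * b * c ≤ a^3 + b^3 + c^3 := by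
  nlinarith [mul_nonneg ha hb, mul_nonneg hb hc, mul_nonneg ha hc, mul_nonneg (add_nonneg (add_nonneg ha hb) hc) (add_nonneg (add_nonneg (sq_nonneg (a-b)) (sq_nonneg (b-c))) (sq_nonneg (a-c))), pow_nonneg ha 3, pow_nonneg hb 3, pow_nonneg hc 3, mul_nonneg (mul_nonneg ha hb) hc]

lemma cube_le (a K : ℝ) (ha : 0 ≤ a) (h : a ^ (1/6:ℝ) ≤ K) : a^3 ≤ K * a^(17/6:ℝ) := by
  rcases ha.eq_or_lt with rfl | h0
  · rw [Real.zero_rpow (by norm_num)]; norm_num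
  · have : a^3 = a^(1/6:ℝ) * a^(17/6:ℝ) := by rw [← Real.rpow_add h0, ← Real.rpow_natCast]; norm_num
    rw [this]; gcongr

lemma tri (F : Fin 3 → ZMod p → ℝ) (C δ : ℝ) (hδ : 0 < δ) (hC : ∀ i, ∑ r, ‖FT (F i) r‖ ^ (17/6:ℝ) ≤ C)
    (B : Finset (ZMod p)) (hB : B.Nonempty) (L : ℝ) (hL : 0 < L) (n : ZMod p)
    (hS : ∀ r, (∃ i, δ ≤ ‖FT (F i) r‖) → ∀ y ∈ B, ‖ps (r * y) - 1‖ ≤ 7 / L) :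
    |∑ x, ∑ y, F 0 x * F 1 y * F 2 (n - x - y) - ∑ x, ∑ y, cv B (F 0) x * cv B (F 1) y * cv B (F 2) (n - x - y)| ≤
      p^2 * (3 * C * (42 / L * (1 + C) + 2 * δ^(1/6:ℝ))) := by
  have hC0 : 0 ≤ C := (sum_nonneg fun r _ => by positivity).trans (hC 0)
  rw [← Real.norm_eq_abs, ← Complex.norm_real, Complex.ofReal_sub, FT_count, FT_count, ← mul_sub, norm_mul, norm_pow, Complex.norm_natCast, ← sum_sub_distrib]
  gcongr
  set K := 42 / L * (1 + C) + 2 * δ^(1/6:ℝ)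
  have hpt : ∀ r : ZMod p, ‖FT (F 0) r * FT (F 1) r * FT (F 2) r * ps (-(r * n)) - FT (cv B (F 0)) r * FT (cv B (F 1)) r * FT (cv B (F 2)) r * ps (-(r * n))‖
      ≤ K * (‖FT (F 0) r‖ ^ (17/6:ℝ) + ‖FT (F 1) r‖ ^ (17/6:ℝ) + ‖FT (F 2) r‖ ^ (17/6:ℝ)) := by
    intro r
    have e : FT (F 0) r * FT (F 1) r * FT (F 2) r * ps (-(r * n)) - FT (cv B (F 0)) r * FT (cv B (F 1)) r * FT (cv B (F 2)) r * ps (-(r * n))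
        = FT (F 0) r * FT (F 1) r * FT (F 2) r * (1 - mB B r ^ 6) * ps (-(r * n)) := by
      rw [FT_cv, FT_cv, FT_cv]; ring
    rw [e, norm_mul, ps_norm, mul_one, norm_mul, norm_mul, norm_mul]
    have ham := amgm3 ‖FT (F 0) r‖ ‖FT (F 1) r‖ ‖FT (F 2) r‖ (norm_nonneg _) (norm_nonneg _) (norm_nonneg _)
    obtain ⟨h6, h7⟩ := pow6 (mB B r) (mB_norm B r)
    have hδ6 : 0 < δ^(1/6:ℝ) := by positivity
    have hL' : 0 < 42 / L * (1 + C) := by positivity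
    -- uniform statement
    have hred : ∀ K1 K2 : ℝ, 0 ≤ K1 → (∀ i, ‖FT (F i) r‖^(1/6:ℝ) ≤ K1) → ‖1 - mB B r ^ 6‖ ≤ K2 → K1 * K2 ≤ K →
        ‖FT (F 0) r‖ * ‖FT (F 1) r‖ * ‖FT (F 2) r‖ * ‖1 - mB B r ^ 6‖ ≤ K * (‖FT (F 0) r‖ ^ (17/6:ℝ) + ‖FT (F 1) r‖ ^ (17/6:ℝ) + ‖FT (F 2) r‖ ^ (17/6:ℝ)) := by
      intro K1 K2 hK1 ha hm hK
      have c0 := cube_le _ K1 (norm_nonneg (FT (F 0) r)) (ha 0)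
      have c1 := cube_le _ K1 (norm_nonneg (FT (F 1) r)) (ha 1)
      have c2 := cube_le _ K1 (norm_nonneg (FT (F 2) r)) (ha 2)
      set s := ‖FT (F 0) r‖ ^ (17/6:ℝ) + ‖FT (F 1) r‖ ^ (17/6:ℝ) + ‖FT (F 2) r‖ ^ (17/6:ℝ) with hs
      have hs0 : 0 ≤ s := by positivity
      calc _ ≤ (K1 * s) * K2 := mul_le_mul (by rw [hs]; linarith) hm (norm_nonneg _) (by positivity)
        _ = (K1 * K2) * s := by ring
        _ ≤ _ := by gcongr
    by_cases hr : ∃ i, δ ≤ ‖FT (F i) r‖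
    · refine hred (1 + C) (42 / L) (by linarith) (fun i => ?_) (h6.trans ?_) (by simp only [K]; linarith)
      · have h1 : ‖FT (F i) r‖^(17/6:ℝ) ≤ C := (single_le_sum (f := fun r => ‖FT (F i) r‖^(17/6:ℝ)) (fun _ _ => by positivity) (mem_univ r)).trans (hC i)
        rcases le_total 1 ‖FT (F i) r‖ with h | h
        · exact (Real.rpow_le_rpow_of_exponent_le h (by norm_num)).trans (h1.trans (by linarith))
        · exact (Real.rpow_le_one (norm_nonneg _) h (by norm_num)).trans (by linarith)
      · have := mB_near B hB r _ (hS r hr)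
        calc _ ≤ 6 * (7 / L) := by gcongr
          _ = _ := by ring
    · push Not at hr
      exact hred (δ^(1/6:ℝ)) 2 hδ6.le (fun i => Real.rpow_le_rpow (norm_nonneg _) (hr i).le (by norm_num)) h7 (by simp only [K]; linarith)
  have hK0 : 0 ≤ K := by positivity
  refine (norm_sum_le_of_le _ fun r _ => hpt r).trans ?_
  rw [← mul_sum, sum_add_distrib, sum_add_distrib]
  calc _ ≤ K * (C + C + C) := by gcongr <;> exact hC _
    _ = _ := by ring

end
end

section
open Finset

section
variable {p : ℕ} [Fact p.Prime]

lemma poll_lower (g : Fin 3 → ZMod p → ℝ) (hg : ∀ i x, 0 ≤ g i x) (c0 : ℝ) (hc0 : 0 ≤ c0) (n : ZMod p) (t : ℕ)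
    (ht : ∀ i, t ≤ #(univ.filter fun x => c0 ≤ g i x))
    (hs : p + 2 * t ≤ #(univ.filter fun x => c0 ≤ g 0 x) + #(univ.filter fun x => c0 ≤ g 1 x) + #(univ.filter fun x => c0 ≤ g 2 x)) :
    c0^3 * t^2 ≤ ∑ x, ∑ y, g 0 x * g 1 y * g 2 (n - x - y) := by
  have h := pollard3 _ _ _ n t (ht 0) (ht 1) (ht 2) hs
  have h' : (t:ℝ)^2 ≤ ∑ s : ZMod p, ∑ y : ZMod p, if c0 ≤ g 2 (n - s) ∧ c0 ≤ g 1 y ∧ c0 ≤ g 0 (s - y) then (1:ℝ) else 0 := by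
    have : ((t * t : ℕ):ℝ) ≤ _ := Nat.cast_le.2 h
    rw [Nat.cast_mul, ← sq, Nat.cast_sum] at this
    refine this.trans (sum_le_sum fun s _ => ?_)
    simp only [mem_filter, mem_univ, true_and]
    split_ifs with hh
    · simp only [hh, true_and, rp, filter_filter, mem_filter, mem_univ]
      rw [Finset.card_filter]; push_cast
      exact le_of_eq (sum_congr rfl fun y _ => by simp)
    · simp only [hh, false_and, if_false]; simp
  calc c0^3 * t^2 ≤ _ := mul_le_mul_of_nonneg_left h' (by positivity)
    _ ≤ ∑ s : ZMod p, ∑ y : ZMod p, g 0 (s - y) * g 1 y * g 2 (n - s) := by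
      rw [mul_sum]
      refine sum_le_sum fun s _ => ?_
      rw [mul_sum]
      refine sum_le_sum fun y _ => ?_
      split_ifs with hh
      · obtain ⟨h1, h2, h3⟩ := hh
        calc c0^3 * 1 = c0 * c0 * c0 := by ring
          _ ≤ _ := by gcongr <;> first | exact hg _ _ | exact mul_nonneg (hg _ _) (hg _ _) | skip
      · rw [mul_zero]; exact mul_nonneg (mul_nonneg (hg _ _) (hg _ _)) (hg _ _)
    _ = _ := by
      rw [sum_comm]; conv_rhs => rw [sum_comm]
      refine sum_congr rfl fun y _ => ?_
      rw [← Equiv.sum_comp (Equiv.subRight y) (fun x => g 0 x * g 1 y * g 2 (n - x - y))]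
      refine sum_congr rfl fun s _ => ?_
      simp only [Equiv.subRight_apply]
      congr 2; ring

lemma spec_card (F : Fin 3 → ZMod p → ℝ) (C δ : ℝ) (hδ : 0 < δ) (hC : ∀ i, ∑ r, ‖FT (F i) r‖ ^ (17/6:ℝ) ≤ C) :
    (#(univ.filter fun r => ∃ i, δ ≤ ‖FT (F i) r‖) : ℝ) ≤ 3 * C / δ^(17/6:ℝ) := by
  rw [le_div_iff₀ (by positivity)]
  calc _ = ∑ r ∈ univ.filter (fun r => ∃ i, δ ≤ ‖FT (F i) r‖), δ^(17/6:ℝ) := by rw [sum_const, nsmul_eq_mul]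
    _ ≤ ∑ r ∈ univ.filter (fun r => ∃ i, δ ≤ ‖FT (F i) r‖), ∑ i, ‖FT (F i) r‖ ^ (17/6:ℝ) := by
      refine sum_le_sum fun r hr => ?_
      obtain ⟨i, hi⟩ := (mem_filter.1 hr).2
      exact (Real.rpow_le_rpow hδ.le hi (by norm_num)).trans (single_le_sum (f := fun i => ‖FT (F i) r‖ ^ (17/6:ℝ)) (fun _ _ => by positivity) (mem_univ i))
    _ ≤ ∑ r, ∑ i, ‖FT (F i) r‖ ^ (17/6:ℝ) := sum_le_sum_of_subset_of_nonneg (subset_univ _) fun _ _ _ => by positivity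
    _ ≤ ∑ i : Fin 3, C := by rw [sum_comm]; exact sum_le_sum fun i _ => hC i
    _ = 3 * C := by simp

end

lemma card_lev {p : ℕ} [NeZero p] (g : ZMod p → ℝ) (κ c0 : ℝ) (hk : 0 ≤ κ) (hc : 0 ≤ c0) (h : ∀ x, g x ≤ 1 + κ) :
    ∑ x, g x ≤ (1 + κ) * #(univ.filter fun x => c0 ≤ g x) + c0 * p := by
  calc ∑ x, g x ≤ ∑ x, ((if c0 ≤ g x then (1 + κ) else 0) + c0) := sum_le_sum fun x _ => by
        split_ifs with h1
        · linarith [h x]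
        · linarith
    _ = _ := by
      rw [sum_add_distrib, ← sum_filter, sum_const, sum_const, card_univ, ZMod.card, nsmul_eq_mul, nsmul_eq_mul]; ring

lemma transf (c C : ℝ) (hc : 0 < c) (hc1 : c ≤ 1) (hC : 0 < C) : ∃ ε > 0, ∃ P0 : ℕ, ∀ p ≥ P0, ∀ [Fact p.Prime],
    ∀ F ν : Fin 3 → ZMod p → ℝ, (∀ i x, 0 ≤ F i x ∧ F i x ≤ ν i x) → (∀ i, ∑ r, ‖FT (F i) r‖ ^ (17/6:ℝ) ≤ C) →
    (∀ i, ∀ r ≠ 0, ‖FT (ν i) r‖ ≤ ε) → (∀ i, ‖FT (ν i) 0‖ ≤ 1 + ε) → (∀ i, c * p ≤ ∑ x, F i x) →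
    ((1 + c) * p ≤ ∑ i, ∑ x, F i x) → ∀ n : ZMod p, ∃ x y z, x + y + z = n ∧ F 0 x ≠ 0 ∧ F 1 y ≠ 0 ∧ F 2 z ≠ 0 := by
  obtain ⟨η, hη⟩ : ∃ η, η = (c/8)^3 * (c/16)^2 / 2 := ⟨_, rfl⟩
  have hη0 : 0 < η := by rw [hη]; positivity
  obtain ⟨δ, hδ⟩ : ∃ δ, δ = (η / (12 * C))^6 := ⟨_, rfl⟩
  have hδ0 : 0 < δ := by rw [hδ]; positivity
  have hδ6 : δ^(1/6:ℝ) = η / (12 * C) := by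
    rw [hδ, ← Real.rpow_natCast, ← Real.rpow_mul (by positivity)]; norm_num
  obtain ⟨L, hL⟩ := exists_nat_ge (252 * C * (1 + C) / η + 1)
  have hL1 : (1:ℝ) ≤ L := le_trans (by have : 0 ≤ 252 * C * (1 + C) / η := by positivity
                                       linarith) hL
  have hL0 : (0:ℝ) < L := by linarith
  set K := ⌈3 * C / δ^(17/6:ℝ)⌉₊
  refine ⟨c / 8 / (1 + (L:ℝ)^K), by positivity, ⌈16 / c⌉₊, fun p hp _ F ν hF hFC hν hν0 hd hds n => ?_⟩
  set ε := c / 8 / (1 + (L:ℝ)^K)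
  have hε : 0 ≤ ε := by positivity
  have hp16 : 16 ≤ c * p := by
    have := (Nat.le_ceil (16 / c)).trans (Nat.cast_le.2 hp)
    rw [div_le_iff₀ hc] at this; linarith
  have hp0 : (0:ℝ) < p := by by_contra h; nlinarith
  obtain ⟨B, hB, hBp, hBS⟩ := bohr (univ.filter fun r => ∃ i, δ ≤ ‖FT (F i) r‖) L (by exact_mod_cast hL0)
  have hB0 : (0:ℝ) < B.card := by exact_mod_cast hB.card_pos
  have hpB : (p:ℝ) / B.card ≤ (L:ℝ)^K := by
    rw [div_le_iff₀ hB0]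
    refine hBp.trans ?_
    refine mul_le_mul_of_nonneg_right (pow_le_pow_right₀ hL1 ?_) hB0.le
    exact Nat.cast_le.1 ((spec_card F C δ hδ0 hFC).trans (Nat.le_ceil _))
  have hg1 : ∀ i x, cv B (F i) x ≤ 1 + c/8 := fun i x => by
    refine (cv_mono B _ _ (fun x => (hF i x).2) x).trans ((cv_bd B hB (ν i) ε hε (hν0 i) (hν i) x).trans ?_)
    have : ε * (1 + (L:ℝ)^K) = c / 8 := div_mul_cancel₀ _ (by positivity)
    nlinarith [mul_le_mul_of_nonneg_left hpB hε]
  have hg0 : ∀ i x, 0 ≤ cv B (F i) x := fun i x => cv_nonneg B _ (fun x => (hF i x).1) x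
  have hA : ∀ i, ∑ x, F i x ≤ (1 + c/8) * #(univ.filter fun x => c/8 ≤ cv B (F i) x) + c/8 * p := fun i => by
    rw [← cv_sum B hB]; exact card_lev _ _ _ (by positivity) (by positivity) (hg1 i)
  have ht1 : (⌊c * p / 8⌋₊ : ℝ) ≤ c * p / 8 := Nat.floor_le (by positivity)
  have ht2 : c * p / 16 ≤ (⌊c * p / 8⌋₊ : ℝ) := by
    have := Nat.lt_floor_add_one (c * p / 8); linarith
  have hlow := poll_lower (fun i => cv B (F i)) hg0 (c/8) (by positivity) n ⌊c * p / 8⌋₊ (fun i => by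
    rw [← Nat.cast_le (α := ℝ)]
    have := hA i
    have := hd i
    have hcp : c * (c * p) ≤ c * p := by nlinarith [mul_pos hc hp0]
    by_contra hh
    push Not at hh
    have : (1 + c/8) * (#(univ.filter fun x => c/8 ≤ cv B (F i) x) : ℝ) ≤ (1 + c/8) * (c * p / 8) := by
      gcongr; linarith
    nlinarith) (by
    rw [← Nat.cast_le (α := ℝ)]
    push_cast
    have h0 := hA 0
    have h1 := hA 1
    have h2 := hA 2
    rw [Fin.sum_univ_three] at hds
    set a0 := (#(univ.filter fun x => c/8 ≤ cv B (F 0) x) : ℝ)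
    set a1 := (#(univ.filter fun x => c/8 ≤ cv B (F 1) x) : ℝ)
    set a2 := (#(univ.filter fun x => c/8 ≤ cv B (F 2) x) : ℝ)
    have : (1 + 5 * c / 8) * p ≤ (1 + c/8) * (a0 + a1 + a2) := by linarith
    have h4 : (1 + c/8) * ((1 + c/4) * p) ≤ (1 + 5 * c / 8) * p := by
      have : (1 + c/8) * (1 + c/4) ≤ (1 + 5 * c / 8) := by nlinarith
      nlinarith
    have h5 := le_of_mul_le_mul_left (h4.trans this) (by positivity)
    linarith)
  have htri := tri F C δ hδ0 hFC B hB L hL0 n (fun r hr y hy => hBS r (mem_filter.2 ⟨mem_univ _, hr⟩) y hy)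
  have herr : 3 * C * (42 / L * (1 + C) + 2 * δ^(1/6:ℝ)) ≤ η := by
    rw [hδ6]
    have h1 : 3 * C * (2 * (η / (12 * C))) = η / 2 := by field_simp; norm_num
    have h2 : 3 * C * (42 / L * (1 + C)) ≤ η / 2 := by
      have : 252 * C * (1 + C) / η ≤ L := by linarith
      rw [div_le_iff₀ hη0] at this
      rw [show 3 * C * (42 / L * (1 + C)) = 126 * C * (1 + C) / L by ring, div_le_iff₀ hL0]; linarith
    linarith
  have hpos : 0 < ∑ x, ∑ y, F 0 x * F 1 y * F 2 (n - x - y) := by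
    have h1 := (abs_le.1 htri).1
    have h2 : (p:ℝ)^2 * (3 * C * (42 / L * (1 + C) + 2 * δ^(1/6:ℝ))) ≤ p^2 * η := by gcongr
    have h3 : (c/8)^3 * (c * p / 16)^2 ≤ (c/8)^3 * (⌊c * p / 8⌋₊ : ℝ)^2 := by gcongr
    have h4 : (c/8)^3 * (c * p / 16)^2 = 2 * (p^2 * η) := by rw [hη]; ring
    have h5 : 0 < (p:ℝ)^2 * η := by positivity
    linarith
  obtain ⟨x, _, hx⟩ := exists_ne_zero_of_sum_ne_zero hpos.ne'
  obtain ⟨y, _, hy⟩ := exists_ne_zero_of_sum_ne_zero hx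
  exact ⟨x, y, n - x - y, by ring, fun h => hy (by simp [h]), fun h => hy (by simp [h]), fun h => hy (by simp [h])⟩
end

section
open Finset

lemma FT_nu (W b p : ℕ) [NeZero p] (V : ℝ) (r : ZMod p) :
    FT (fun x : ZMod p => if (W * x.val + b).Prime then V else 0) r = (p:ℂ)⁻¹ * (V * SP W b p (((r.val:ℤ):ℝ) / p)) := by
  rw [FT, sum_zmod, SP, sum_filter, mul_sum _ _ (V:ℂ)]
  refine congrArg ((p:ℂ)⁻¹ * ·) (sum_congr rfl fun k hk => ?_)
  rw [ZMod.val_cast_of_lt (mem_range.1 hk), ps_nat]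
  split_ifs <;> simp

lemma concrete (c : ℝ) (hc : 0 < c) (hc1 : c ≤ 1) : ∃ w : ℕ, ∀ W : ℕ, 1 < W → (∀ l ≤ w, l.Prime → l ∣ W) → ∃ P0 : ℕ, ∀ p ≥ P0, p.Prime →
    ∀ b : Fin 3 → ℕ, (∀ i, b i < W ∧ (b i).Coprime W) → ∀ S : Fin 3 → Finset ℕ,
    (∀ i, ∀ m ∈ S i, m < p ∧ (W * m + b i).Prime ∧ p < (W * m + b i)^4) →
    (∀ i, c * p ≤ (W.totient:ℝ) / W * Real.log p * #(S i)) → ((1 + c) * p ≤ ∑ i, (W.totient:ℝ) / W * Real.log p * #(S i)) →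
    ∀ n : ℕ, ∃ m : Fin 3 → ℕ, (∀ i, m i ∈ S i) ∧ m 0 + m 1 + m 2 ≡ n [MOD p] := by
  obtain ⟨C, hC, hR⟩ := restr
  obtain ⟨ε, hε, P1, hT⟩ := transf c C hc hc1 hC
  obtain ⟨w, hw⟩ := pseudo ε hε
  refine ⟨w, fun W hW hWl => ?_⟩
  obtain ⟨P2, h2⟩ := hR W (by omega)
  obtain ⟨P3, h3⟩ := hw W hW hWl
  obtain ⟨P4, h4⟩ := SP_zero W (by omega) ε hε
  refine ⟨P1 + P2 + P3 + P4, fun p hp hpp b hb S hS hd hds n => ?_⟩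
  haveI : Fact p.Prime := ⟨hpp⟩
  have hp0 : (0:ℝ) < p := by exact_mod_cast hpp.pos
  obtain ⟨V, hV⟩ : ∃ V, V = (W.totient:ℝ) / W * Real.log p := ⟨_, rfl⟩
  have hlog : 0 < Real.log p := Real.log_pos (by exact_mod_cast hpp.one_lt)
  have hV0 : 0 < V := by
    have : 0 < W.totient := Nat.totient_pos.2 (by omega)
    have : 0 < W := by omega
    rw [hV]; positivity
  simp only [← hV] at hd hds h2 h3 h4
  let F : Fin 3 → ZMod p → ℝ := fun i x => if x.val ∈ S i then V else 0
  let ν : Fin 3 → ZMod p → ℝ := fun i x => if (W * x.val + b i).Prime then V else 0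
  have hF0 : ∀ i x, F i x ≠ 0 → x.val ∈ S i := fun i x h => by
    by_contra hh; exact h (if_neg hh)
  have hsum : ∀ i, ∑ x, F i x = V * #(S i) := fun i => by
    rw [sum_zmod, mul_comm, ← nsmul_eq_mul, ← sum_const]
    simp only [F]
    rw [← sum_filter]
    refine sum_congr (ext fun k => ?_) fun _ _ => rfl
    rw [mem_filter, mem_range]
    constructor
    · rintro ⟨h1, h2⟩; rwa [ZMod.val_cast_of_lt h1] at h2
    · intro h
      have := (hS i k h).1
      rw [ZMod.val_cast_of_lt this]; exact ⟨this, h⟩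
  have hnorm : ∀ i r, ‖FT (ν i) r‖ = (V * ‖SP W (b i) p (((r.val:ℤ):ℝ) / p)‖) / p := fun i r => by
    simp only [ν]
    rw [FT_nu, norm_mul, norm_mul, norm_inv, Complex.norm_natCast, Complex.norm_real, Real.norm_of_nonneg hV0.le]
    ring
  suffices key : ∃ x y z, x + y + z = (n : ZMod p) ∧ F 0 x ≠ 0 ∧ F 1 y ≠ 0 ∧ F 2 z ≠ 0 by
    obtain ⟨x, y, z, hn, hx, hy, hz⟩ := key
    refine ⟨![x.val, y.val, z.val], fun i => ?_, ?_⟩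
    · fin_cases i
      · exact hF0 0 x hx
      · exact hF0 1 y hy
      · exact hF0 2 z hz
    · rw [← ZMod.natCast_eq_natCast_iff]
      simpa using hn
  refine hT p (by omega) F ν (fun i x => ?_) (fun i => ?_) (fun i r hr => ?_) (fun i => ?_) (fun i => ?_) ?_ (n : ZMod p)
  · constructor
    · simp only [F]; split_ifs <;> linarith
    · simp only [F, ν]
      split_ifs with h1 h2 h2
      · exact le_rfl
      · exact absurd (hS i _ h1).2.1 h2
      · exact hV0.le
      · exact le_rfl
  · refine h2 p (by omega) (b i) (hb i).1 (hb i).2 (F i) (fun x => ?_) fun x hx => (hS i _ (hF0 i x hx)).2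
    simp only [F]; split_ifs
    · exact ⟨hV0.le, hV.le⟩
    · exact ⟨le_rfl, hV ▸ hV0.le⟩
  · rw [hnorm, div_le_iff₀ hp0]
    refine hV ▸ h3 p (by omega) (b i) (hb i).1 (hb i).2 _ fun hdvd => hr ?_
    have := Int.natCast_dvd_natCast.1 hdvd
    have h5 := Nat.eq_zero_of_dvd_of_lt this (ZMod.val_lt r)
    exact (ZMod.val_eq_zero r).1 h5
  · rw [hnorm, div_le_iff₀ hp0]
    have := h4 p (by omega) (b i) (hb i).1 (hb i).2
    rw [← hV] at this
    refine le_trans (mul_le_mul_of_nonneg_left ?_ hV0.le) this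
    rw [SP]
    refine (norm_sum_le _ _).trans ?_
    simp [ee]
  · rw [hsum]; exact hd i
  · simp only [hsum]; exact hds
end

section
open Finset

open Classical in
noncomputable def AX (A : Set ℕ) (x : ℕ) : Finset ℕ := (Icc 1 x).filter fun a => a ∈ A

lemma mem_AX (A : Set ℕ) (x a : ℕ) : a ∈ AX A x ↔ (1 ≤ a ∧ a ≤ x) ∧ a ∈ A := by
  simp [AX]

lemma AX_card (A : Set ℕ) (x : ℕ) : (A ∩ Set.Icc 1 x).ncard = #(AX A x) := by
  rw [← Set.ncard_coe_finset]; congr 1; ext a; simp [AX]; tauto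

lemma prime_card (x : ℕ) : ({p : ℕ | p.Prime} ∩ Set.Icc 1 x).ncard = pc 1 0 x := by
  rw [pc, ← Set.ncard_coe_finset]; congr 1; ext a; simp [Nat.mod_one, Nat.succ_le_iff]; tauto

lemma dens_ev (A : Set ℕ) (η : ℝ) (hη : 0 < η) : ∀ᶠ x : ℕ in Filter.atTop,
    (lowerDensityInPrimes A - η) * pc 1 0 x ≤ #(AX A x) := by
  have hl : lowerDensityInPrimes A - η < Filter.liminf
    (fun N : ℕ => ((A ∩ Set.Icc 1 N).ncard : ℝ) / (({p : ℕ | p.Prime} ∩ Set.Icc 1 N).ncard : ℝ)) Filter.atTop := by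
    rw [← lowerDensityInPrimes]; linarith
  have h := Filter.eventually_lt_of_lt_liminf hl ⟨0, Filter.eventually_map.2 (Filter.Eventually.of_forall fun x => div_nonneg (Nat.cast_nonneg _) (Nat.cast_nonneg _))⟩
  filter_upwards [h] with x hx
  rw [AX_card, prime_card] at hx
  rcases Nat.eq_zero_or_pos (pc 1 0 x) with h0 | h0
  · rw [h0]; simp
  · rw [lt_div_iff₀ (by exact_mod_cast h0)] at hx; exact hx.le

lemma dens (A : Fin 3 → Set ℕ) (h : 2 < ∑ i, lowerDensityInPrimes (A i)) : ∃ c : ℝ, 0 < c ∧ c ≤ 1 ∧ ∀ᶠ x : ℕ in Filter.atTop,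
    (2 + 2 * c) * x ≤ (∑ i, (#(AX (A i) x) : ℝ)) * Real.log x := by
  obtain ⟨s, hs0, hs1, hs⟩ : ∃ s : ℝ, 0 < s ∧ s ≤ 1 ∧ 2 + s ≤ ∑ i, lowerDensityInPrimes (A i) :=
    ⟨min 1 (∑ i, lowerDensityInPrimes (A i) - 2), lt_min one_pos (by linarith), min_le_left _ _, by linarith [min_le_right 1 (∑ i, lowerDensityInPrimes (A i) - 2)]⟩
  refine ⟨s / 8, by positivity, by linarith, ?_⟩
  have hp := pnt_ap 1 0 one_pos (by simp)
  simp only [Nat.totient_one, Nat.cast_one, inv_one] at hp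
  filter_upwards [Filter.eventually_all.2 fun i => dens_ev (A i) (s/6) (by positivity), hp.eventually (lt_mem_nhds (show 1 - s/100 < 1 by linarith)), Filter.eventually_ge_atTop 1] with x h1 h2 h3
  have hx : (0:ℝ) < x := by exact_mod_cast h3
  have hlog := Real.log_natCast_nonneg x
  rw [lt_div_iff₀ hx] at h2
  have h4 := sum_le_sum fun i (_ : i ∈ univ) => h1 i
  rw [← sum_mul, sum_sub_distrib] at h4
  simp only [sum_const, card_univ, Fintype.card_fin, nsmul_eq_mul] at h4
  have h5 : (2 + s/2) * (pc 1 0 x : ℝ) ≤ ∑ i, (#(AX (A i) x) : ℝ) := le_trans (by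
    refine mul_le_mul_of_nonneg_right ?_ (Nat.cast_nonneg _); push_cast; linarith) h4
  calc (2 + 2 * (s/8)) * x ≤ (2 + s/2) * ((1 - s/100) * x) := by
        rw [← mul_assoc]; gcongr; nlinarith
    _ ≤ (2 + s/2) * (pc 1 0 x * Real.log x) := by gcongr
    _ = ((2 + s/2) * pc 1 0 x) * Real.log x := by ring
    _ ≤ _ := by gcongr

def TW (T : Finset ℕ) (N W b : ℕ) : Finset ℕ := T.filter fun a => N < a^4 ∧ a % W = b

lemma TW_sum (A : Set ℕ) (hA : ∀ a ∈ A, a.Prime) (N W X : ℕ) [NeZero W] :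
    #(AX A X) ≤ (∑ u : (ZMod W)ˣ, #(TW (AX A X) N W (u : ZMod W).val)) + (W + Nat.sqrt N + 2) := by
  have hsub : AX A X ⊆ (univ.biUnion fun u : (ZMod W)ˣ => TW (AX A X) N W (u : ZMod W).val) ∪ (range (W+1) ∪ range (Nat.sqrt N + 1)) := by
    intro a ha
    by_cases h1 : a < W + 1
    · exact mem_union_right _ (mem_union_left _ (mem_range.2 h1))
    by_cases h2 : a < Nat.sqrt N + 1
    · exact mem_union_right _ (mem_union_right _ (mem_range.2 h2))
    refine mem_union_left _ (mem_biUnion.2 ?_)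
    have ha' := ha
    rw [mem_AX] at ha'
    have hap : a.Prime := hA a ha'.2
    have hco : a.Coprime W := (Nat.Prime.coprime_iff_not_dvd hap).2 fun hd => h1 (by have := Nat.le_of_dvd (NeZero.pos W) hd; omega)
    refine ⟨ZMod.unitOfCoprime a hco, mem_univ _, mem_filter.2 ⟨ha, ?_, ?_⟩⟩
    · have h3 := Nat.lt_succ_sqrt N
      have h4 : Nat.sqrt N + 1 ≤ a := by omega
      calc N < (Nat.sqrt N + 1) * (Nat.sqrt N + 1) := h3
        _ ≤ a * a := Nat.mul_le_mul h4 h4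
        _ = a^2 := by ring
        _ ≤ a^4 := Nat.pow_le_pow_right hap.pos (by norm_num)
    · rw [ZMod.coe_unitOfCoprime, ZMod.val_natCast]
  refine (card_le_card hsub).trans ((card_union_le _ _).trans (add_le_add card_biUnion_le ((card_union_le _ _).trans ?_)))
  simp; omega

lemma TW_pc (A : Set ℕ) (hA : ∀ a ∈ A, a.Prime) (N W X b : ℕ) (hb : b < W) : #(TW (AX A X) N W b) ≤ pc W b X := by
  refine card_le_card fun a ha => ?_
  obtain ⟨h1, h2, h3⟩ := mem_filter.1 ha
  rw [mem_AX] at h1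
  obtain ⟨h4, h5⟩ := h1
  exact mem_filter.2 ⟨mem_Ioc.2 ⟨by omega, h4.2⟩, hA a h5, by rw [h3, Nat.mod_eq_of_lt hb]⟩

lemma local_main' (W M : ℕ) (hW : W = 3 * M) [NeZero W] [NeZero M] (hM : Nat.Coprime 3 M) (n : ℕ) (hg : LGood (ZMod M) (n : ZMod M))
    (f : Fin 3 → ZMod W → ℝ) (c : ℝ) (hc : 0 < c) (hf : ∀ i x, f i x ≤ 1 + c / 10)
    (hs : (2 + c) * W.totient ≤ ∑ i, ∑ u : (ZMod W)ˣ, f i u) :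
    ∃ x : Fin 3 → (ZMod W)ˣ, (x 0 + x 1 + x 2 : ZMod W) = n ∧ 5/3 ≤ ∑ i, f i (x i) ∧ ∀ i, c / 10 ≤ f i (x i) := by
  subst hW
  exact local_main M hM n hg f c hc hf hs

lemma local_step (A : Fin 3 → Set ℕ) (hA : ∀ i, ∀ a ∈ A i, a.Prime) (c : ℝ) (hc : 0 < c)
    (hd : ∀ᶠ x : ℕ in Filter.atTop, (2 + 2 * c) * x ≤ (∑ i, (#(AX (A i) x) : ℝ)) * Real.log x)
    (W M : ℕ) (hW : W = 3 * M) (hM0 : 0 < M) (hM : Nat.Coprime 3 M) (hg : ∀ n : ℕ, n % 2 = 1 → ∀ [Fintype (ZMod M)ˣ], LGood (ZMod M) (n : ZMod M)) :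
    ∀ᶠ X : ℕ in Filter.atTop, ∀ N : ℕ, N ≤ 2 * X → N % 2 = 1 → ∃ b : Fin 3 → ℕ, (∀ i, b i < W ∧ (b i).Coprime W) ∧
      b 0 + b 1 + b 2 ≡ N [MOD W] ∧
      5 / 3 * (X:ℝ) ≤ ∑ i, (W.totient : ℝ) * #(TW (AX (A i) X) N W (b i)) * Real.log X ∧
      ∀ i, c / 10 * X ≤ (W.totient : ℝ) * #(TW (AX (A i) X) N W (b i)) * Real.log X := by
  have hW0 : 0 < W := by omega
  have : NeZero W := ⟨hW0.ne'⟩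
  have : NeZero M := ⟨hM0.ne'⟩
  have hφ : 0 < W.totient := Nat.totient_pos.2 hW0
  have hφr : (0:ℝ) < W.totient := by exact_mod_cast hφ
  obtain ⟨P0, hP⟩ := pc_all W hW0 (c / (10 * W.totient)) (by positivity)
  filter_upwards [hd, Filter.eventually_ge_atTop P0, Filter.eventually_ge_atTop 1,
    tendsto_natCast_atTop_atTop.eventually (log_small 2 ((c/12)^2) (by positivity)),
    tendsto_natCast_atTop_atTop.eventually (log_small 1 (c / (6 * (W + 2))) (by positivity))] with X h1 h2 h3 h4 h5 N hN hodd
  have hX : (0:ℝ) < X := by exact_mod_cast h3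
  have hlog := Real.log_natCast_nonneg X
  let f : Fin 3 → ZMod W → ℝ := fun i x => (W.totient:ℝ) * #(TW (AX (A i) X) N W x.val) * Real.log X / X
  obtain ⟨x, hx1, hx2, hx3⟩ := local_main' W M hW hM N (hg N hodd) f c hc (fun i x => by
      simp only [f]
      rw [div_le_iff₀ hX]
      have hxW : x.val < W := ZMod.val_lt x
      have a1 := (abs_le.1 (hP X h2 X le_rfl x.val)).2
      have a2 : (if x.val.Coprime W then (X:ℝ) / W.totient else 0) ≤ X / W.totient := by split_ifs <;> first | exact le_rfl | positivity
      have a3 : (#(TW (AX (A i) X) N W x.val) : ℝ) ≤ pc W x.val X := by exact_mod_cast TW_pc (A i) (hA i) N W X _ hxW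
      calc _ ≤ (W.totient:ℝ) * pc W x.val X * Real.log X := by gcongr
        _ = W.totient * (pc W x.val X * Real.log X) := by ring
        _ ≤ W.totient * (X / W.totient + c / (10 * W.totient) * X) := by gcongr; linarith
        _ = _ := by field_simp) (by
      simp only [f]
      have b1 : ∀ i, (#(AX (A i) X) : ℝ) ≤ (∑ u : (ZMod W)ˣ, (#(TW (AX (A i) X) N W (u : ZMod W).val) : ℝ)) + (W + Nat.sqrt N + 2) := fun i => by
        have := TW_sum (A i) (hA i) N W X
        exact_mod_cast this
      have b2 := sum_le_sum fun i (_ : i ∈ univ) => b1 i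
      rw [sum_add_distrib] at b2
      simp only [sum_const, card_univ, Fintype.card_fin, nsmul_eq_mul] at b2
      simp only [← sum_div, ← sum_mul, ← mul_sum]
      rw [le_div_iff₀ hX]
      have sq : Real.log X ≤ c / 12 * Real.sqrt X := by
        refine (pow_le_pow_iff_left₀ hlog (by positivity) two_ne_zero).1 ?_
        rw [mul_pow, Real.sq_sqrt hX.le]; exact h4
      have sN : (Nat.sqrt N : ℝ) ≤ 2 * Real.sqrt X := by
        refine (pow_le_pow_iff_left₀ (by positivity) (by positivity) two_ne_zero).1 ?_
        rw [mul_pow, Real.sq_sqrt hX.le]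
        have := Nat.sqrt_le' N
        have h6 : (Nat.sqrt N)^2 ≤ 2 * X := by omega
        have h7 : (Nat.sqrt N : ℝ)^2 ≤ 2 * X := by exact_mod_cast h6
        linarith
      have b3 : (Nat.sqrt N : ℝ) * Real.log X ≤ c / 6 * X := by
        calc _ ≤ (2 * Real.sqrt X) * (c / 12 * Real.sqrt X) := by gcongr
          _ = c / 6 * (Real.sqrt X)^2 := by ring
          _ = _ := by rw [Real.sq_sqrt hX.le]
      have b4 : ((W:ℝ) + 2) * Real.log X ≤ c / 6 * X := by
        rw [pow_one] at h5
        calc _ ≤ ((W:ℝ) + 2) * (c / (6 * (W + 2)) * X) := by gcongr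
          _ = _ := by field_simp
      set Q := ∑ i : Fin 3, ∑ u : (ZMod W)ˣ, (#(TW (AX (A i) X) N W (u : ZMod W).val) : ℝ)
      have b5 : (2 + c) * X ≤ Q * Real.log X := by
        have := mul_le_mul_of_nonneg_right b2 hlog
        push_cast at this
        nlinarith
      calc (2 + c) * W.totient * X = W.totient * ((2 + c) * X) := by ring
        _ ≤ W.totient * (Q * Real.log X) := by gcongr
        _ = _ := by ring)
  refine ⟨fun i => (x i : ZMod W).val, fun i => ⟨ZMod.val_lt _, ZMod.val_coe_unit_coprime _⟩, ?_, ?_, fun i => ?_⟩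
  · rw [← ZMod.natCast_eq_natCast_iff]; push_cast; simpa using hx1
  · simp only [f] at hx2
    rw [← sum_div, le_div_iff₀ hX] at hx2; exact hx2
  · have := hx3 i
    simp only [f] at this
    rwa [le_div_iff₀ hX] at this
end

section
open Finset

lemma prime_gap : ∃ Y : ℕ, ∀ n ≥ Y, ∃ p, p.Prime ∧ n < p ∧ p ≤ n + n / 200 := by
  obtain ⟨Y, hY⟩ := theta_pnt (1/1000) (by norm_num)
  refine ⟨Y + 1000, fun n hn => ?_⟩
  by_contra hne
  push Not at hne
  have h1 := hY n (by omega)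
  have h2 := hY (n + n / 200) (by omega)
  have e : ∑ k ∈ range (n + n / 200 + 1), lgp k = ∑ k ∈ range (n + 1), lgp k := by
    refine (sum_subset (range_subset_range.2 (by omega)) fun k hk hk' => ?_).symm
    rw [mem_range] at hk hk'
    rw [lgp, if_neg fun hp => ?_]
    have := hne k hp (by omega)
    omega
  rw [e] at h2
  have h3 := (abs_le.1 h1).2
  have h4 := (abs_le.1 h2).1
  have h5 : n ≤ 200 * (n / 200) + 199 := by omega
  have h6 : (n:ℝ) ≤ 200 * ((n / 200 : ℕ):ℝ) + 199 := by exact_mod_cast h5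
  have h7 : (1000:ℝ) ≤ n := by norm_cast; omega
  push_cast at h4
  set m : ℝ := ((n / 200 : ℕ):ℝ)
  linarith

lemma final (A : Fin 3 → Set ℕ) (hA : ∀ i, ∀ a ∈ A i, a.Prime) (h : 2 < ∑ i, lowerDensityInPrimes (A i)) :
    ∃ N₀ : ℕ, ∀ N ≥ N₀, N % 2 = 1 → ∃ a : Fin 3 → ℕ, (∀ i, a i ∈ A i) ∧ N = a 0 + a 1 + a 2 := by
  obtain ⟨c, hc, hc1, hd⟩ := dens A h
  obtain ⟨w, hw⟩ := concrete (c / 20) (by positivity) (by linarith)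
  let s := (range (w + 3)).filter fun l => l.Prime ∧ l ≠ 3
  have hs : ∀ l ∈ s, l.Prime ∧ l ≠ 3 := fun l hl => (mem_filter.1 hl).2
  obtain ⟨M, hM⟩ : ∃ M, M = ∏ l ∈ s, l := ⟨_, rfl⟩
  have hM0 : 0 < M := hM ▸ prod_pos fun l hl => (hs l hl).1.pos
  have hM3 : Nat.Coprime 3 M := hM ▸ Nat.Coprime.prod_right fun l hl => (Nat.coprime_primes Nat.prime_three (hs l hl).1).2 (hs l hl).2.symm
  obtain ⟨W, hW⟩ : ∃ W, W = 3 * M := ⟨_, rfl⟩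
  have hW1 : 1 < W := by omega
  have hWr : (0:ℝ) < W := by norm_cast; omega
  obtain ⟨P0, hP⟩ := hw W hW1 (fun l hl hlp => by
    rw [hW]
    by_cases h3 : l = 3
    · rw [h3]; exact dvd_mul_right _ _
    · refine dvd_mul_of_dvd_right ?_ _
      rw [hM]; exact dvd_prod_of_mem _ (mem_filter.2 ⟨mem_range.2 (by omega), hlp, h3⟩))
  obtain ⟨X0, hX0⟩ := Filter.eventually_atTop.1 (local_step A hA c hc hd W M hW hM0 hM3 (fun n hn _ => by subst hM; exact LGood_set s hs n hn))
  obtain ⟨Y, hY⟩ := prime_gap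
  obtain ⟨N2, hN2⟩ := Filter.eventually_atTop.1 ((Real.tendsto_log_atTop.comp tendsto_natCast_atTop_atTop).eventually_ge_atTop (100 * Real.log W))
  refine ⟨2 * X0 + N2 + W * (P0 + Y) + 10000 * W + 10000, fun N hN hodd => ?_⟩
  obtain ⟨X, hX⟩ : ∃ X, X = 2 * N / 3 := ⟨_, rfl⟩
  obtain ⟨b, hb, hbN, hv, hvi⟩ := hX0 X (by omega) N (by omega) hodd
  have hNW : P0 + Y + 1000 ≤ N / W := (Nat.le_div_iff_mul_le (by omega)).2 (by nlinarith)
  obtain ⟨p, hpp, hp1, hp2⟩ := hY (N / W + 3) (by omega)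
  have hdm := Nat.div_add_mod N W
  have hml := Nat.mod_lt N (show 0 < W by omega)
  have hpW1 : N + 3 * W < p * W := by nlinarith
  have hpW2 : (p:ℝ) * W ≤ 1.01 * N := by
    have a1 : 200 * p ≤ 201 * (N / W + 3) := by omega
    have a2 : W * (N / W) ≤ N := by omega
    have a3 : 200 * (p * W) ≤ 201 * (N + 3 * W) := by nlinarith
    have a4 : (200:ℝ) * (p * W) ≤ 201 * (N + 3 * W) := by exact_mod_cast a3
    have a5 : (10000:ℝ) * W ≤ N := by norm_cast; omega
    linarith
  have hpN : p ≤ N := by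
    have : (p:ℝ) ≤ N := by
      have h2 : (2:ℝ) ≤ W := by exact_mod_cast hW1
      have hp0 : (0:ℝ) ≤ p := Nat.cast_nonneg _
      have hN0 : (0:ℝ) ≤ N := Nat.cast_nonneg _
      nlinarith
    exact_mod_cast this
  have hp0 : (0:ℝ) < p := by exact_mod_cast hpp.pos
  have hXN : (0.666:ℝ) * N ≤ X := by
    have a1 : 2 * N ≤ 3 * X + 2 := by omega
    have a2 : (2:ℝ) * N ≤ 3 * X + 2 := by exact_mod_cast a1
    have a5 : (10000:ℝ) ≤ N := by norm_cast; omega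
    linarith
  have hNr : (1:ℝ) < N := by norm_cast; omega
  have hXr : (1:ℝ) < X := by norm_cast; omega
  have hlX : 0 < Real.log X := Real.log_pos hXr
  have hlogs : 0.99 * Real.log X ≤ Real.log p := by
    have a1 : Real.log X ≤ Real.log N := Real.log_le_log (by linarith) (by norm_cast; omega)
    have a2 : Real.log N ≤ Real.log p + Real.log W := by
      rw [← Real.log_mul hp0.ne' hWr.ne']
      refine Real.log_le_log (by linarith) ?_
      have : N ≤ p * W := by omega
      exact_mod_cast this
    have a3 : 100 * Real.log W ≤ Real.log N := hN2 N (by omega)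
    linarith
  have hnum : 0.65 * p * (W * Real.log X) ≤ X * Real.log p := by
    calc 0.65 * p * (W * Real.log X) = 0.65 * (p * W) * Real.log X := by ring
      _ ≤ 0.65 * (1.01 * N) * Real.log X := by gcongr
      _ ≤ (0.666 * N) * (0.99 * Real.log X) := by nlinarith [mul_pos (show (0:ℝ) < N by linarith) hlX]
      _ ≤ X * Real.log p := by gcongr
  let T : Fin 3 → Finset ℕ := fun i => TW (AX (A i) X) N W (b i)
  have hT : ∀ i, ∀ a ∈ T i, a ∈ A i ∧ a ≤ X ∧ N < a^4 ∧ W * (a / W) + b i = a := fun i a ha => by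
    obtain ⟨h1, h2, h3⟩ := mem_filter.1 ha
    rw [mem_AX] at h1
    exact ⟨h1.2, h1.1.2, h2, by rw [← h3]; exact Nat.div_add_mod a W⟩
  let S : Fin 3 → Finset ℕ := fun i => (T i).image (· / W)
  have hScard : ∀ i, #(S i) = #(T i) := fun i => card_image_of_injOn fun a ha a' ha' he => by
    rw [← (hT i a ha).2.2.2, ← (hT i a' ha').2.2.2]; rw [show a / W = a' / W from he]
  have hS : ∀ i, ∀ m ∈ S i, m < p ∧ W * m + b i ∈ A i ∧ W * m + b i ≤ X ∧ N < (W * m + b i)^4 := fun i m hm => by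
    obtain ⟨a, ha, rfl⟩ := mem_image.1 hm
    obtain ⟨h1, h2, h3, h4⟩ := hT i a ha
    simp only [h4]
    refine ⟨?_, h1, h2, h3⟩
    have := Nat.div_le_div_right (c := W) (show a ≤ N by omega)
    omega
  have hdi : ∀ i, (W.totient:ℝ) / W * Real.log p * #(S i) = ((W.totient:ℝ) * #(T i) * Real.log X) * (Real.log p / (W * Real.log X)) := fun i => by
    rw [hScard]; field_simp
  have hρ : 0.65 * p ≤ X * (Real.log p / (W * Real.log X)) := by
    rw [← mul_div_assoc, le_div_iff₀ (by positivity)]; exact hnum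
  have hρ0 : 0 ≤ Real.log p / (W * Real.log X) := div_nonneg (Real.log_natCast_nonneg p) (by positivity)
  have hsb : b 0 + b 1 + b 2 ≤ N := by
    have := (hb 0).1; have := (hb 1).1; have := (hb 2).1; omega
  obtain ⟨n, hn⟩ := (Nat.modEq_iff_dvd' hsb).1 hbN
  obtain ⟨m, hm, hmn⟩ := hP p (by omega) hpp b hb S (fun i k hk => by
      obtain ⟨h1, h2, h3, h4⟩ := hS i k hk
      exact ⟨h1, hA i _ h2, by omega⟩) (fun i => by
      rw [hdi]
      calc c / 20 * p ≤ c / 10 * (0.65 * p) := by nlinarith [mul_pos hc hp0]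
        _ ≤ c / 10 * (X * (Real.log p / (W * Real.log X))) := by gcongr
        _ = (c / 10 * X) * (Real.log p / (W * Real.log X)) := by ring
        _ ≤ _ := mul_le_mul_of_nonneg_right (hvi i) hρ0) (by
      simp only [hdi]
      rw [← sum_mul]
      calc (1 + c / 20) * p ≤ 5 / 3 * (0.65 * p) := by nlinarith [mul_pos hc hp0]
        _ ≤ 5 / 3 * (X * (Real.log p / (W * Real.log X))) := by gcongr
        _ = (5 / 3 * X) * (Real.log p / (W * Real.log X)) := by ring
        _ ≤ _ := mul_le_mul_of_nonneg_right hv hρ0) n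
  refine ⟨fun i => W * m i + b i, fun i => (hS i _ (hm i)).2.1, ?_⟩
  have q0 := (hS 0 _ (hm 0)).2.2.1
  have q1 := (hS 1 _ (hm 1)).2.2.1
  have q2 := (hS 2 _ (hm 2)).2.2.1
  have hNn : W * n + (b 0 + b 1 + b 2) = N := by omega
  have heq : m 0 + m 1 + m 2 = n := by
    have hW0 : 0 < W := by omega
    have r1 : n < p := by
      refine lt_of_mul_lt_mul_left (a := W) ?_ (Nat.zero_le _)
      rw [mul_comm W p]; omega
    have r2 : m 0 + m 1 + m 2 < n + p := by
      refine lt_of_mul_lt_mul_left (a := W) ?_ (Nat.zero_le _)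
      have := (hb 0).1; have := (hb 1).1; have := (hb 2).1
      have e : W * (n + p) = W * n + p * W := by ring
      have e' : W * (m 0 + m 1 + m 2) = W * m 0 + W * m 1 + W * m 2 := by ring
      rw [e, e']; omega
    have hdv := (Nat.modEq_iff_dvd).1 hmn
    have := Int.eq_zero_of_abs_lt_dvd hdv (abs_lt.2 ⟨by push_cast; omega, by push_cast; omega⟩)
    push_cast at this; omega
  simp only
  have e' : W * (m 0 + m 1 + m 2) = W * m 0 + W * m 1 + W * m 2 := by ring
  rw [heq] at e'
  omega
end

/-- Li–Pan: if `A₁, A₂, A₃` are sets of primes whose lower densities in the primes sum to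
more than `2`, then every sufficiently large odd positive integer `N` can be written as
`N = a₁ + a₂ + a₃` with `aᵢ ∈ Aᵢ`. -/
theorem stmt2 (A₁ A₂ A₃ : Set ℕ)
    (h₁ : A₁ ⊆ {p : ℕ | p.Prime}) (h₂ : A₂ ⊆ {p : ℕ | p.Prime}) (h₃ : A₃ ⊆ {p : ℕ | p.Prime})
    (hd : lowerDensityInPrimes A₁ + lowerDensityInPrimes A₂ + lowerDensityInPrimes A₃ > 2) :
    ∃ N₀ : ℕ, ∀ N : ℕ, N₀ ≤ N → Odd N →
      ∃ a₁ ∈ A₁, ∃ a₂ ∈ A₂, ∃ a₃ ∈ A₃, N = a₁ + a₂ + a₃ := by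
  obtain ⟨N₀, h⟩ := final ![A₁, A₂, A₃] (fun i a ha => by
    fin_cases i
    · exact h₁ ha
    · exact h₂ ha
    · exact h₃ ha) (by rw [Fin.sum_univ_three]; exact hd)
  refine ⟨N₀, fun N hN ho => ?_⟩
  obtain ⟨a, ha, e⟩ := h N hN (Nat.odd_iff.1 ho)
  exact ⟨a 0, ha 0, a 1, ha 1, a 2, ha 2, e⟩
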